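/- Let n ≥ 2, α = 1, 0 < γ < 1, and let f : ℝⁿ → ℂ be a Schwartz function. For each ε ∈ (0,1] let u^ε be a solution of (H) with datum f. Then for every fixed t with π/2 < t ≤ π and for A^ε equal to any of the operators Id, J^ε, or H^ε: sup_{t ≤ τ ≤ π} ‖ A^ε(τ)( u^ε(τ,x) − e^{−inπ/2} (cos τ)^{−n/2} f(x/cos τ) exp( −i|x|² tan τ/(2ε) + i g(τ, x/cos τ) ) ) ‖_{L²_x} → 0 as ε → 0 (here cos τ < 0 and (cos τ)^{−n/2} is interpreted as e^{−inπ/2}|cos τ|^{−n/2} being already factored out, i.e. the profile is e^{−inπ/2}|cos τ|^{−n/2} f(x/cos τ)). -/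

import Mathlib

open MeasureTheory Real Filter Topology
open scoped ENNReal NNReal ComplexConjugate

noncomputable section

/-- Euclidean space ℝⁿ. -/
abbrev Rn (n : ℕ) := EuclideanSpace ℝ (Fin n)

/-- The gradient of a complex-valued function on ℝⁿ, as a ℂⁿ-valued function. -/
def grad {n : ℕ} (φ : Rn n → ℂ) (x : Rn n) : Fin n → ℂ :=
  fun j => fderiv ℝ φ x (EuclideanSpace.single j 1)

/-- The gradient, valued in the Euclidean space ℂⁿ (so that its pointwise norm is the
Euclidean norm). -/
def gradE {n : ℕ} (φ : Rn n → ℂ) (x : Rn n) : EuclideanSpace ℂ (Fin n) :=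
  (WithLp.equiv 2 (Fin n → ℂ)).symm (grad φ x)

/-- The Laplacian of a complex-valued function on ℝⁿ. -/
def lap {n : ℕ} (φ : Rn n → ℂ) (x : Rn n) : ℂ :=
  ∑ j, fderiv ℝ (fun y => fderiv ℝ φ y (EuclideanSpace.single j 1)) x (EuclideanSpace.single j 1)

/-- The operator J^ε(t) = (x/ε) sin t − i cos t ∇ₓ. -/
def Jop {n : ℕ} (ε t : ℝ) (φ : Rn n → ℂ) (x : Rn n) : Fin n → ℂ :=
  fun j => ((x j / ε : ℝ) : ℂ) * ((Real.sin t : ℝ) : ℂ) * φ x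
    - Complex.I * ((Real.cos t : ℝ) : ℂ) * grad φ x j

/-- The operator H^ε(t) = x cos t + iε sin t ∇ₓ. -/
def Hop {n : ℕ} (ε t : ℝ) (φ : Rn n → ℂ) (x : Rn n) : Fin n → ℂ :=
  fun j => ((x j : ℝ) : ℂ) * ((Real.cos t : ℝ) : ℂ) * φ x
    + Complex.I * (ε : ℂ) * ((Real.sin t : ℝ) : ℂ) * grad φ x j

/-- J^ε(t)φ viewed as valued in Euclidean ℂⁿ. -/
def JopE {n : ℕ} (ε t : ℝ) (φ : Rn n → ℂ) (x : Rn n) : EuclideanSpace ℂ (Fin n) :=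
  (WithLp.equiv 2 (Fin n → ℂ)).symm (Jop ε t φ x)

/-- H^ε(t)φ viewed as valued in Euclidean ℂⁿ. -/
def HopE {n : ℕ} (ε t : ℝ) (φ : Rn n → ℂ) (x : Rn n) : EuclideanSpace ℂ (Fin n) :=
  (WithLp.equiv 2 (Fin n → ℂ)).symm (Hop ε t φ x)

/-- Convolution (|x|^{−γ} ∗ ψ)(x) of a real-valued ψ with the kernel |x|^{−γ}. -/
def conv {n : ℕ} (γ : ℝ) (ψ : Rn n → ℝ) (x : Rn n) : ℝ :=
  ∫ y : Rn n, ‖x - y‖ ^ (-γ) * ψ y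

/-- Convolution (|x|^{−γ} ∗ ψ)(x) of a complex-valued ψ with the kernel |x|^{−γ}. -/
def convC {n : ℕ} (γ : ℝ) (ψ : Rn n → ℂ) (x : Rn n) : ℂ :=
  ∫ y : Rn n, ((‖x - y‖ ^ (-γ) : ℝ) : ℂ) * ψ y

/-- The Hartree potential |x|^{−γ} ∗ |u|². -/
def hartree {n : ℕ} (γ : ℝ) (u : Rn n → ℂ) (x : Rn n) : ℝ :=
  conv γ (fun y => Complex.normSq (u y)) x

/-- `u` is a (smooth, Schwartz-in-x) solution of the semiclassical Hartree equation with
harmonic potential: iε∂ₜu + (ε²/2)Δu = (|x|²/2)u + ε^α(|x|^{−γ}∗|u|²)u, u(0) = f. -/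
structure IsSolutionH (n : ℕ) (α γ ε : ℝ) (f : Rn n → ℂ) (u : ℝ → Rn n → ℂ) : Prop where
  smooth : ContDiff ℝ (⊤ : ℕ∞) (fun p : ℝ × Rn n => u p.1 p.2)
  schwartz : ∀ t, ∃ φ : SchwartzMap (Rn n) ℂ, u t = ⇑φ
  init : u 0 = f
  eq : ∀ t x, Complex.I * (ε : ℂ) * deriv (fun s => u s x) t
      + ((ε ^ 2 / 2 : ℝ) : ℂ) * lap (u t) x
    = ((‖x‖ ^ 2 / 2 : ℝ) : ℂ) * u t x
      + ((ε ^ α : ℝ) : ℂ) * ((hartree γ (u t) x : ℝ) : ℂ) * u t x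

/-- `u` is a (smooth, Schwartz-in-x) solution of the linear equation
iε∂ₜu + (ε²/2)Δu = (|x|²/2)u. -/
structure IsLinSol (n : ℕ) (ε : ℝ) (u : ℝ → Rn n → ℂ) : Prop where
  smooth : ContDiff ℝ (⊤ : ℕ∞) (fun p : ℝ × Rn n => u p.1 p.2)
  schwartz : ∀ t, ∃ φ : SchwartzMap (Rn n) ℂ, u t = ⇑φ
  eq : ∀ t x, Complex.I * (ε : ℂ) * deriv (fun s => u s x) t
      + ((ε ^ 2 / 2 : ℝ) : ℂ) * lap (u t) x
    = ((‖x‖ ^ 2 / 2 : ℝ) : ℂ) * u t x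

/-- The semiclassical harmonic-oscillator propagator U^ε(t), via Mehler's formula
(for 0 < t < π). -/
def Uprop (n : ℕ) (ε t : ℝ) (φ : Rn n → ℂ) (x : Rn n) : ℂ :=
  Complex.exp (-Complex.I * (n : ℂ) * (π : ℂ) / 4) *
    ((2 * π * ε * Real.sin t : ℝ) : ℂ) ^ (-(n : ℂ) / 2) *
    ∫ y : Rn n, Complex.exp ((Complex.I / ((ε * Real.sin t : ℝ) : ℂ)) *
      (((‖x‖ ^ 2 + ‖y‖ ^ 2) / 2 * Real.cos t - ∑ j, x j * y j : ℝ) : ℂ)) * φ y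

/-- The WKB approximation operator V^ε(t) (for t ∈ (0,π/2) ∪ (π/2,π)). -/
def Vprop (n : ℕ) (ε t : ℝ) (φ : Rn n → ℂ) (x : Rn n) : ℂ :=
  if t < π / 2 then
    ((Real.cos t ^ (-(n : ℝ) / 2) : ℝ) : ℂ) * φ ((Real.cos t)⁻¹ • x) *
      Complex.exp (-Complex.I * ((‖x‖ ^ 2 * Real.tan t / (2 * ε) : ℝ) : ℂ))
  else
    Complex.exp (-Complex.I * (n : ℂ) * ((π / 2 : ℝ) : ℂ)) *
      ((|Real.cos t| ^ (-(n : ℝ) / 2) : ℝ) : ℂ) * φ ((Real.cos t)⁻¹ • x) *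
      Complex.exp (-Complex.I * ((‖x‖ ^ 2 * Real.tan t / (2 * ε) : ℝ) : ℂ))

/-- The Σ-norm ‖φ‖_Σ = ‖φ‖_{L²} + ‖|x|φ‖_{L²} + ‖∇φ‖_{L²}, with values in ℝ≥0∞. -/
def SigmaNorm {n : ℕ} (φ : Rn n → ℂ) : ℝ≥0∞ :=
  eLpNorm φ 2 volume + eLpNorm (fun x => (‖x‖ : ℂ) * φ x) 2 volume
    + eLpNorm (gradE φ) 2 volume

/-- The H¹-norm (‖φ‖_{L²}² + ‖∇φ‖_{L²}²)^{1/2}, with values in ℝ≥0∞. -/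
def H1norm {n : ℕ} (φ : Rn n → ℂ) : ℝ≥0∞ :=
  (eLpNorm φ 2 volume ^ (2 : ℝ) + eLpNorm (gradE φ) 2 volume ^ (2 : ℝ)) ^ ((1 : ℝ) / 2)

/-- The nonlinear WKB phase g(t,x) = −(|x|^{−γ}∗|f|²)(x) ∫₀ᵗ |cos τ|^{−γ} dτ. -/
def gphase {n : ℕ} (γ : ℝ) (f : Rn n → ℂ) (t : ℝ) (x : Rn n) : ℝ :=
  -(conv γ (fun y => Complex.normSq (f y)) x) * ∫ τ in (0 : ℝ)..t, |Real.cos τ| ^ (-γ)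

/-- The Fourier transform Fφ(ξ) = (2π)^{−n/2} ∫ e^{−ix·ξ} φ(x) dx. -/
def FT {n : ℕ} (φ : Rn n → ℂ) (ξ : Rn n) : ℂ :=
  (((2 * π : ℝ) ^ (-(n : ℝ) / 2) : ℝ) : ℂ) *
    ∫ x : Rn n, Complex.exp (-Complex.I * ((∑ j, x j * ξ j : ℝ) : ℂ)) * φ x

/-- The inverse Fourier transform. -/
def FTinv {n : ℕ} (φ : Rn n → ℂ) (ξ : Rn n) : ℂ :=
  (((2 * π : ℝ) ^ (-(n : ℝ) / 2) : ℝ) : ℂ) *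
    ∫ x : Rn n, Complex.exp (Complex.I * ((∑ j, x j * ξ j : ℝ) : ℂ)) * φ x

/-- The nonlinear WKB profile after the focus:
e^{−inπ/2} |cos τ|^{−n/2} f(x/cos τ) e^{−i|x|²tan τ/(2ε) + i g(τ, x/cos τ)}. -/
def wkbProfileAfter (n : ℕ) (γ : ℝ) (f : Rn n → ℂ) (ε τ : ℝ) (x : Rn n) : ℂ :=
  Complex.exp (-Complex.I * (n : ℂ) * ((π / 2 : ℝ) : ℂ)) *
    ((|Real.cos τ| ^ (-(n : ℝ) / 2) : ℝ) : ℂ) * f ((Real.cos τ)⁻¹ • x) *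
    Complex.exp (Complex.I *
      ((-(‖x‖ ^ 2 * Real.tan τ / (2 * ε)) + gphase γ f τ ((Real.cos τ)⁻¹ • x) : ℝ) : ℂ))

noncomputable section
namespace HW
variable {n : ℕ}

/-- partial derivative -/
def pd (j : Fin n) (φ : Rn n → ℂ) (x : Rn n) : ℂ := fderiv ℝ φ x (EuclideanSpace.single j 1)

/-- being a Schwartz function -/
def IsS (φ : Rn n → ℂ) : Prop := ∃ s : SchwartzMap (Rn n) ℂ, φ = ⇑s

theorem lap_eq (φ : Rn n → ℂ) (x : Rn n) : lap φ x = ∑ j, pd j (pd j φ) x := rfl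

theorem IsS.zero : IsS (fun _ : Rn n => (0 : ℂ)) := ⟨0, by ext; simp⟩

theorem IsS.add {φ ψ : Rn n → ℂ} (h : IsS φ) (k : IsS ψ) : IsS (fun x => φ x + ψ x) := by
  obtain ⟨s, rfl⟩ := h; obtain ⟨r, rfl⟩ := k
  exact ⟨s + r, by ext; simp⟩

theorem IsS.sub {φ ψ : Rn n → ℂ} (h : IsS φ) (k : IsS ψ) : IsS (fun x => φ x - ψ x) := by
  obtain ⟨s, rfl⟩ := h; obtain ⟨r, rfl⟩ := k
  exact ⟨s - r, by ext; simp⟩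

theorem IsS.neg {φ : Rn n → ℂ} (h : IsS φ) : IsS (fun x => - φ x) := by
  obtain ⟨s, rfl⟩ := h
  exact ⟨-s, by ext; simp⟩

theorem IsS.cmul {φ : Rn n → ℂ} (h : IsS φ) (c : ℂ) : IsS (fun x => c * φ x) := by
  obtain ⟨s, rfl⟩ := h
  exact ⟨c • s, by ext; simp⟩

theorem IsS.sum {ι : Type*} (s : Finset ι) {φ : ι → Rn n → ℂ} (h : ∀ i ∈ s, IsS (φ i)) :
    IsS (fun x => ∑ i ∈ s, φ i x) := by
  classical
  induction s using Finset.induction_on with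
  | empty => simpa using IsS.zero
  | insert a s ha ih =>
    simp only [Finset.sum_insert ha]
    exact (h a (by simp)).add (ih fun i hi => h i (by simp [hi]))

theorem IsS.tmul {φ g : Rn n → ℂ} (hg : g.HasTemperateGrowth) (h : IsS φ) :
    IsS (fun x => g x * φ x) := by
  obtain ⟨s, rfl⟩ := h
  refine ⟨SchwartzMap.smulLeftCLM ℂ g s, ?_⟩
  ext x
  rw [SchwartzMap.smulLeftCLM_apply_apply hg]; rfl

theorem IsS.temp {φ : Rn n → ℂ} (h : IsS φ) : φ.HasTemperateGrowth := by
  obtain ⟨s, rfl⟩ := h; exact s.hasTemperateGrowth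

theorem IsS.mul {φ ψ : Rn n → ℂ} (h : IsS φ) (k : IsS ψ) : IsS (fun x => φ x * ψ x) :=
  IsS.tmul h.temp k

theorem temp_coord (j : Fin n) : (fun x : Rn n => ((x j : ℝ) : ℂ)).HasTemperateGrowth := by
  have := (Complex.ofRealCLM.comp (EuclideanSpace.proj j : Rn n →L[ℝ] ℝ)).hasTemperateGrowth
  exact this

theorem temp_normsq : (fun x : Rn n => ((‖x‖ ^ 2 : ℝ) : ℂ)).HasTemperateGrowth :=
  Function.Complex.hasTemperateGrowth_ofReal.comp (Function.hasTemperateGrowth_norm_sq (H := Rn n))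

theorem IsS.coord {φ : Rn n → ℂ} (h : IsS φ) (j : Fin n) :
    IsS (fun x => ((x j : ℝ) : ℂ) * φ x) := IsS.tmul (temp_coord j) h

theorem IsS.pd {φ : Rn n → ℂ} (h : IsS φ) (j : Fin n) : IsS (pd j φ) := by
  obtain ⟨s, rfl⟩ := h
  exact ⟨LineDeriv.lineDerivOp (EuclideanSpace.single j (1 : ℝ)) s, by
    ext x; rw [SchwartzMap.lineDerivOp_apply_eq_fderiv]; rfl⟩

theorem IsS.lap {φ : Rn n → ℂ} (h : IsS φ) : IsS (lap φ) := by
  have := IsS.sum Finset.univ (φ := fun j => HW.pd j (HW.pd j φ)) (fun j _ => (h.pd j).pd j)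
  exact this

theorem IsS.conj {φ : Rn n → ℂ} (h : IsS φ) : IsS (fun x => conj (φ x)) := by
  obtain ⟨s, rfl⟩ := h
  exact ⟨SchwartzMap.postcompCLM (𝕜 := ℝ) (Complex.conjCLE : ℂ →L[ℝ] ℂ) s, by ext; simp⟩

theorem IsS.contDiff {φ : Rn n → ℂ} (h : IsS φ) (m : ℕ∞) : ContDiff ℝ m φ := by
  obtain ⟨s, rfl⟩ := h; exact s.smooth m

theorem IsS.diff {φ : Rn n → ℂ} (h : IsS φ) : Differentiable ℝ φ := by
  obtain ⟨s, rfl⟩ := h; exact s.differentiable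

theorem IsS.cont {φ : Rn n → ℂ} (h : IsS φ) : Continuous φ := by
  obtain ⟨s, rfl⟩ := h; exact s.continuous

theorem IsS.int {φ : Rn n → ℂ} (h : IsS φ) : Integrable φ := by
  obtain ⟨s, rfl⟩ := h; exact s.integrable

theorem IsS.memLp {φ : Rn n → ℂ} (h : IsS φ) : MemLp φ 2 volume := by
  obtain ⟨s, rfl⟩ := h; exact s.memLp 2

theorem IsS.bdd {φ : Rn n → ℂ} (h : IsS φ) : ∃ C, ∀ x, ‖φ x‖ ≤ C := by
  obtain ⟨s, rfl⟩ := h; exact ⟨_, fun x => SchwartzMap.norm_le_seminorm ℝ s x⟩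

/-! pd rules -/
theorem pd_add {φ ψ : Rn n → ℂ} (h : Differentiable ℝ φ) (k : Differentiable ℝ ψ) (j : Fin n)
    (x : Rn n) : pd j (fun x => φ x + ψ x) x = pd j φ x + pd j ψ x := by
  unfold pd; rw [fderiv_fun_add (h x) (k x)]; rfl

theorem pd_sub {φ ψ : Rn n → ℂ} (h : Differentiable ℝ φ) (k : Differentiable ℝ ψ) (j : Fin n)
    (x : Rn n) : pd j (fun x => φ x - ψ x) x = pd j φ x - pd j ψ x := by
  unfold pd; rw [fderiv_fun_sub (h x) (k x)]; rfl

theorem pd_cmul {φ : Rn n → ℂ} (h : Differentiable ℝ φ) (c : ℂ) (j : Fin n)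
    (x : Rn n) : pd j (fun x => c * φ x) x = c * pd j φ x := by
  unfold pd; rw [fderiv_const_mul (h x) c]; rfl

theorem pd_mul {φ ψ : Rn n → ℂ} (h : Differentiable ℝ φ) (k : Differentiable ℝ ψ) (j : Fin n)
    (x : Rn n) : pd j (fun x => φ x * ψ x) x = φ x * pd j ψ x + pd j φ x * ψ x := by
  unfold pd; rw [fderiv_fun_mul (h x) (k x)]
  simp; ring

theorem pd_conj {φ : Rn n → ℂ} (h : Differentiable ℝ φ) (j : Fin n) (x : Rn n) :
    pd j (fun x => conj (φ x)) x = conj (pd j φ x) := by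
  unfold pd
  have := ((Complex.conjCLE : ℂ →L[ℝ] ℂ).hasFDerivAt (x := φ x)).comp x (h x).hasFDerivAt
  have h2 : fderiv ℝ (fun x => conj (φ x)) x = _ := this.fderiv
  rw [h2]; simp

theorem pd_coord (i j : Fin n) (x : Rn n) :
    pd j (fun x => ((x i : ℝ) : ℂ)) x = if i = j then 1 else 0 := by
  have h2 : fderiv ℝ (fun x : Rn n => ((x i : ℝ) : ℂ)) x
    = Complex.ofRealCLM.comp (EuclideanSpace.proj i : Rn n →L[ℝ] ℝ) :=
    (Complex.ofRealCLM.comp (EuclideanSpace.proj i : Rn n →L[ℝ] ℝ)).hasFDerivAt.fderiv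
  unfold pd
  rw [h2]; simp; split_ifs <;> simp

theorem diff_coord (i : Fin n) : Differentiable ℝ (fun x : Rn n => ((x i : ℝ) : ℂ)) :=
  (Complex.ofRealCLM.comp (EuclideanSpace.proj i : Rn n →L[ℝ] ℝ)).differentiable

/-! integration by parts -/
theorem ibp {φ ψ : Rn n → ℂ} (h : IsS φ) (k : IsS ψ) (j : Fin n) :
    ∫ x, φ x * pd j ψ x = - ∫ x, pd j φ x * ψ x := by
  obtain ⟨s, rfl⟩ := h; obtain ⟨r, rfl⟩ := k
  have := SchwartzMap.integral_mul_lineDerivOp_right_eq_neg_left s r (EuclideanSpace.single j (1:ℝ))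
    (μ := volume)
  simpa [SchwartzMap.lineDerivOp_apply_eq_fderiv, pd] using this

theorem ibp2 {φ ψ : Rn n → ℂ} (h : IsS φ) (k : IsS ψ) :
    ∫ x, φ x * lap ψ x = ∫ x, lap φ x * ψ x := by
  simp only [lap_eq, Finset.mul_sum, Finset.sum_mul]
  rw [integral_finsetSum _ fun j _ => (h.mul ((k.pd j).pd j)).int,
    integral_finsetSum _ fun j _ => (((h.pd j).pd j).mul k).int]
  refine Finset.sum_congr rfl fun j _ => ?_
  rw [ibp h (k.pd j), ibp (h.pd j) k, neg_neg]

/-! L2 norm -/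
/-- real valued L2 norm -/
def l2 (φ : Rn n → ℂ) : ℝ := (eLpNorm φ 2 volume).toReal

theorem l2_nonneg (φ : Rn n → ℂ) : 0 ≤ l2 φ := ENNReal.toReal_nonneg

theorem l2_add {φ ψ : Rn n → ℂ} (h : MemLp φ 2 volume) (k : MemLp ψ 2 volume) :
    l2 (fun x => φ x + ψ x) ≤ l2 φ + l2 ψ := by
  unfold l2
  rw [← ENNReal.toReal_add h.2.ne k.2.ne]
  exact ENNReal.toReal_mono (ENNReal.add_ne_top.2 ⟨h.2.ne, k.2.ne⟩)
    (eLpNorm_add_le h.1 k.1 (by norm_num))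

theorem l2_neg (φ : Rn n → ℂ) : l2 (fun x => - φ x) = l2 φ := by
  unfold l2; congr 1; exact eLpNorm_neg φ 2 volume

theorem l2_sub {φ ψ : Rn n → ℂ} (h : MemLp φ 2 volume) (k : MemLp ψ 2 volume) :
    l2 (fun x => φ x - ψ x) ≤ l2 φ + l2 ψ := by
  simp only [sub_eq_add_neg]
  exact (l2_add h k.neg).trans_eq (by rw [← l2_neg ψ]; rfl)

theorem l2_cmul (c : ℂ) (φ : Rn n → ℂ) : l2 (fun x => c * φ x) = ‖c‖ * l2 φ := by
  unfold l2
  have : eLpNorm (fun x => c * φ x) 2 volume = _ := eLpNorm_const_smul c φ 2 volume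
  rw [this]; simp

theorem l2_sum {ι : Type*} (s : Finset ι) {φ : ι → Rn n → ℂ}
    (h : ∀ i ∈ s, MemLp (φ i) 2 volume) :
    l2 (fun x => ∑ i ∈ s, φ i x) ≤ ∑ i ∈ s, l2 (φ i) := by
  classical
  induction s using Finset.induction_on with
  | empty => simp [l2]
  | insert a s ha ih =>
    simp only [Finset.sum_insert ha]
    refine (l2_add (h a (by simp)) (memLp_finsetSum s fun i hi => h i (by simp [hi]))).trans ?_
    gcongr
    exact ih fun i hi => h i (by simp [hi])

theorem l2_mono {φ ψ : Rn n → ℂ} (k : MemLp ψ 2 volume) (h : ∀ x, ‖φ x‖ ≤ ‖ψ x‖) :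
    l2 φ ≤ l2 ψ :=
  ENNReal.toReal_mono k.2.ne (eLpNorm_mono h)

theorem l2_mul_le {φ g : Rn n → ℂ} {C : ℝ} (hC : 0 ≤ C) (k : MemLp φ 2 volume)
    (h : ∀ x, ‖g x‖ ≤ C) : l2 (fun x => g x * φ x) ≤ C * l2 φ := by
  have := l2_cmul (C : ℂ) φ
  rw [Complex.norm_real, Real.norm_of_nonneg hC] at this
  rw [← this]
  refine l2_mono (k.const_mul _) fun x => ?_
  rw [norm_mul, norm_mul, Complex.norm_real, Real.norm_of_nonneg hC]
  gcongr; exact h x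

theorem l2_eq {φ : Rn n → ℂ} (h : MemLp φ 2 volume) :
    l2 φ = (∫ x, ‖φ x‖ ^ 2) ^ ((1 : ℝ) / 2) := by
  unfold l2
  rw [h.eLpNorm_eq_integral_rpow_norm (by norm_num) (by norm_num)]
  simp only [ENNReal.toReal_ofNat, one_div]
  rw [ENNReal.toReal_ofReal (by positivity)]
  norm_cast

theorem l2_sq {φ : Rn n → ℂ} (h : MemLp φ 2 volume) : l2 φ ^ 2 = ∫ x, ‖φ x‖ ^ 2 := by
  rw [l2_eq h, ← Real.sqrt_eq_rpow, Real.sq_sqrt (by positivity)]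

theorem int_mul {φ ψ : Rn n → ℂ} (h : MemLp φ 2 volume) (k : MemLp ψ 2 volume) :
    Integrable (fun x => φ x * ψ x) := h.integrable_mul k

theorem memLp_conj {φ : Rn n → ℂ} (h : MemLp φ 2 volume) : MemLp (fun x => conj (φ x)) 2 volume :=
  MemLp.of_le h (Complex.continuous_conj.comp_aestronglyMeasurable h.1) (by simp)

theorem l2_conj (φ : Rn n → ℂ) : l2 (fun x => conj (φ x)) = l2 φ := by
  unfold l2; congr 1; exact eLpNorm_congr_norm_ae (by simp)

theorem cs_norm {φ ψ : Rn n → ℂ} (h : MemLp φ 2 volume) (k : MemLp ψ 2 volume) :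
    ∫ x, ‖φ x‖ * ‖ψ x‖ ≤ l2 φ * l2 ψ := by
  rw [l2_eq h, l2_eq k]
  have := integral_mul_norm_le_Lp_mul_Lq (μ := volume) (p := 2) (q := 2) (f := φ) (g := ψ)
    Real.HolderConjugate.two_two (by simpa using h) (by simpa using k)
  norm_cast at this ⊢

theorem cs {φ ψ : Rn n → ℂ} (h : MemLp φ 2 volume) (k : MemLp ψ 2 volume) :
    ‖∫ x, φ x * ψ x‖ ≤ l2 φ * l2 ψ := by
  refine (norm_integral_le_integral_norm _).trans ?_
  simp only [norm_mul]
  exact cs_norm h k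

/-- pairing -/
def dot (φ ψ : Rn n → ℂ) : ℂ := ∫ x, φ x * conj (ψ x)

theorem dot_le {φ ψ : Rn n → ℂ} (h : MemLp φ 2 volume) (k : MemLp ψ 2 volume) :
    ‖dot φ ψ‖ ≤ l2 φ * l2 ψ := by
  have := cs h (memLp_conj k); rwa [l2_conj] at this

theorem dot_self {φ : Rn n → ℂ} (h : MemLp φ 2 volume) : dot φ φ = ((l2 φ ^ 2 : ℝ) : ℂ) := by
  rw [l2_sq h, ← integral_complex_ofReal]
  unfold dot; congr 1; ext x
  rw [Complex.mul_conj, Complex.normSq_eq_norm_sq]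

theorem dot_sub_left {φ ψ θ : Rn n → ℂ} (h : MemLp φ 2 volume) (k : MemLp ψ 2 volume)
    (l : MemLp θ 2 volume) : dot (fun x => φ x - ψ x) θ = dot φ θ - dot ψ θ := by
  unfold dot
  rw [← integral_sub (int_mul h (memLp_conj l)) (int_mul k (memLp_conj l))]
  congr 1; ext x; ring

theorem dot_sub_right {φ ψ θ : Rn n → ℂ} (h : MemLp φ 2 volume) (k : MemLp ψ 2 volume)
    (l : MemLp θ 2 volume) : dot θ (fun x => φ x - ψ x) = dot θ φ - dot θ ψ := by
  unfold dot
  rw [← integral_sub (int_mul l (memLp_conj h)) (int_mul l (memLp_conj k))]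
  congr 1; ext x; simp; ring

/-! first order operators -/
/-- α x_j - iβ ∂_j -/
def Aop (α β : ℝ) (j : Fin n) (φ : Rn n → ℂ) (x : Rn n) : ℂ :=
  (α : ℂ) * (((x j : ℝ) : ℂ) * φ x) - (Complex.I * (β : ℂ)) * pd j φ x

theorem IsS.Aop {φ : Rn n → ℂ} (h : IsS φ) (α β : ℝ) (j : Fin n) : IsS (Aop α β j φ) :=
  ((h.coord j).cmul _).sub ((h.pd j).cmul _)

theorem Aop_sub {φ ψ : Rn n → ℂ} (h : Differentiable ℝ φ) (k : Differentiable ℝ ψ) (α β : ℝ)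
    (j : Fin n) (x : Rn n) :
    Aop α β j (fun x => φ x - ψ x) x = Aop α β j φ x - Aop α β j ψ x := by
  unfold Aop; rw [pd_sub h k]; ring

theorem Aop_add {φ ψ : Rn n → ℂ} (h : Differentiable ℝ φ) (k : Differentiable ℝ ψ) (α β : ℝ)
    (j : Fin n) (x : Rn n) :
    Aop α β j (fun x => φ x + ψ x) x = Aop α β j φ x + Aop α β j ψ x := by
  unfold Aop; rw [pd_add h k]; ring

theorem Aop_cmul {φ : Rn n → ℂ} (h : Differentiable ℝ φ) (c : ℂ) (α β : ℝ)
    (j : Fin n) (x : Rn n) :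
    Aop α β j (fun x => c * φ x) x = c * Aop α β j φ x := by
  unfold Aop; rw [pd_cmul h]; ring

theorem Aop_symm {φ ψ : Rn n → ℂ} (h : IsS φ) (k : IsS ψ) (α β : ℝ) (j : Fin n) :
    dot (Aop α β j φ) ψ = dot φ (Aop α β j ψ) := by
  have e := ibp h k.conj j
  have i1 : Integrable (fun x => (α : ℂ) * (((x j : ℝ) : ℂ) * φ x) * conj (ψ x)) :=
    (((h.coord j).cmul α).mul k.conj).int
  have i2 : Integrable (fun x => pd j φ x * conj (ψ x)) := ((h.pd j).mul k.conj).int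
  have i3 : Integrable (fun x => φ x * pd j (fun x => conj (ψ x)) x) :=
    (h.mul (k.conj.pd j)).int
  have a1 : dot (Aop α β j φ) ψ = (∫ x, (α : ℂ) * (((x j : ℝ) : ℂ) * φ x) * conj (ψ x))
     - (Complex.I * (β : ℂ)) * ∫ x, pd j φ x * conj (ψ x) := by
    rw [← integral_const_mul, ← integral_sub i1 (i2.const_mul _)]
    unfold dot Aop; congr 1; ext x; ring
  have a2 : dot φ (Aop α β j ψ) = (∫ x, (α : ℂ) * (((x j : ℝ) : ℂ) * φ x) * conj (ψ x))
     + (Complex.I * (β : ℂ)) * ∫ x, φ x * pd j (fun x => conj (ψ x)) x := by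
    rw [← integral_const_mul, ← integral_add i1 (i3.const_mul _)]
    unfold dot Aop; congr 1; ext x
    rw [pd_conj k.diff]; simp; ring
  rw [a1, a2, e]; ring

end HW
end

noncomputable section
namespace HW
variable {n : ℕ}

theorem meas_om (γ : ℝ) : Measurable (fun z : Rn n => ‖z‖ ^ (-γ)) :=
  measurable_norm.pow_const _

theorem int_ball_om {γ : ℝ} (hn : 1 ≤ n) (h1 : γ < n) :
    IntegrableOn (fun z : Rn n => ‖z‖ ^ (-γ)) (Metric.ball 0 1) := by
  refine integrableOn_ball_of_norm_le_rpow (C := 1) (α := γ) (by simpa using hn) (by simpa using h1)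
    ?_ (meas_om γ).aestronglyMeasurable
  refine Eventually.of_forall fun x => ?_
  rw [Real.norm_of_nonneg (by positivity), one_mul]

theorem int_om {γ : ℝ} (hn : 1 ≤ n) (h0 : 0 ≤ γ) (h1 : γ < n) :
    Integrable (fun z : Rn n => ‖z‖ ^ (-γ) * (1 + ‖z‖) ^ (-((n + 1 : ℕ) : ℝ))) := by
  have i1 := (integrable_indicator_iff Metric.isOpen_ball.measurableSet).2 (int_ball_om hn h1)
  have i2 : Integrable (fun z : Rn n => (1 + ‖z‖) ^ (-((n + 1 : ℕ) : ℝ))) :=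
    integrable_one_add_norm (by simp)
  refine (i1.add i2).mono' ?_ (Eventually.of_forall fun z => ?_)
  · exact ((meas_om γ).mul ((measurable_const.add measurable_norm).pow_const _)).aestronglyMeasurable
  · rw [Real.norm_of_nonneg (by positivity)]
    have hz : (1 : ℝ) ≤ 1 + ‖z‖ := by linarith [norm_nonneg z]
    have h2 : (1 + ‖z‖) ^ (-((n + 1 : ℕ) : ℝ)) ≤ 1 :=
      Real.rpow_le_one_of_one_le_of_nonpos hz (by simp only [Left.neg_nonpos_iff]; positivity)
    have h3 : 0 ≤ (1 + ‖z‖) ^ (-((n + 1 : ℕ) : ℝ)) := by positivity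
    have h4 : 0 ≤ ‖z‖ ^ (-γ) := by positivity
    by_cases hb : z ∈ Metric.ball (0 : Rn n) 1
    · simp only [Pi.add_apply, Set.indicator_of_mem hb]
      nlinarith
    · simp only [Pi.add_apply, Set.indicator_of_notMem hb, zero_add]
      have : ‖z‖ ^ (-γ) ≤ 1 := by
        apply Real.rpow_le_one_of_one_le_of_nonpos
        · simpa using hb
        · linarith
      nlinarith

section conv
variable {F : Type} [NormedAddCommGroup F] [NormedSpace ℝ F]

theorem schw_dec (ρ : SchwartzMap (Rn n) F) : ∃ C : ℝ, 0 ≤ C ∧ ∀ x z : Rn n,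
    ‖ρ (x - z)‖ ≤ C * (1 + ‖x‖) ^ (n + 1) * (1 + ‖z‖) ^ (-((n + 1 : ℕ) : ℝ)) := by
  obtain ⟨C, hC⟩ : ∃ C : ℝ, ∀ y, (1 + ‖y‖) ^ (n + 1) * ‖ρ y‖ ≤ C := by
    have := fun y => SchwartzMap.one_add_le_sup_seminorm_apply (𝕜 := ℝ) (m := (n + 1, 0))
      (k := n + 1) (n := 0) le_rfl le_rfl ρ y
    simp only [norm_iteratedFDeriv_zero] at this
    exact ⟨_, this⟩
  have hC0 : 0 ≤ C := le_trans (by positivity) (hC 0)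
  refine ⟨C, hC0, fun x z => ?_⟩
  rw [Real.rpow_neg (by positivity), Real.rpow_natCast, ← div_eq_mul_inv, le_div_iff₀ (by positivity)]
  have h1 : 1 + ‖z‖ ≤ (1 + ‖x - z‖) * (1 + ‖x‖) := by
    have : ‖z‖ ≤ ‖x‖ + ‖x - z‖ := by
      calc ‖z‖ = ‖x - (x - z)‖ := by congr 1; abel
        _ ≤ _ := norm_sub_le _ _
    nlinarith [norm_nonneg x, norm_nonneg (x - z)]
  calc ‖ρ (x - z)‖ * (1 + ‖z‖) ^ (n + 1)
      ≤ ‖ρ (x - z)‖ * ((1 + ‖x - z‖) * (1 + ‖x‖)) ^ (n + 1) := by gcongr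
    _ = ((1 + ‖x - z‖) ^ (n + 1) * ‖ρ (x - z)‖) * (1 + ‖x‖) ^ (n + 1) := by rw [mul_pow]; ring
    _ ≤ C * (1 + ‖x‖) ^ (n + 1) := by gcongr; exact hC _

/-- vector valued convolution -/
def cv (γ : ℝ) (ρ : Rn n → F) (x : Rn n) : F := ∫ z : Rn n, ‖z‖ ^ (-γ) • ρ (x - z)

theorem meas_cv (γ : ℝ) (ρ : SchwartzMap (Rn n) F) (x : Rn n) :
    AEStronglyMeasurable (fun z : Rn n => ‖z‖ ^ (-γ) • ρ (x - z)) volume :=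
  (meas_om γ).aestronglyMeasurable.smul
    (ρ.continuous.comp (continuous_const.sub continuous_id)).aestronglyMeasurable

theorem int_cv {γ : ℝ} (hn : 1 ≤ n) (h0 : 0 ≤ γ) (h1 : γ < n) (ρ : SchwartzMap (Rn n) F)
    (x : Rn n) : Integrable (fun z : Rn n => ‖z‖ ^ (-γ) • ρ (x - z)) := by
  obtain ⟨C, hC0, hC⟩ := schw_dec ρ
  refine ((int_om hn h0 h1).const_mul (C * (1 + ‖x‖) ^ (n + 1))).mono' (meas_cv γ ρ x)
    (Eventually.of_forall fun z => ?_)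
  rw [norm_smul, Real.norm_of_nonneg (by positivity)]
  calc ‖z‖ ^ (-γ) * ‖ρ (x - z)‖ ≤ ‖z‖ ^ (-γ) *
          (C * (1 + ‖x‖) ^ (n + 1) * (1 + ‖z‖) ^ (-((n + 1 : ℕ) : ℝ))) :=
        mul_le_mul_of_nonneg_left (hC x z) (by positivity)
    _ = _ := by ring

theorem cv_bd {γ : ℝ} (hn : 1 ≤ n) (h0 : 0 ≤ γ) (h1 : γ < n) (ρ : SchwartzMap (Rn n) F) :
    ∃ C : ℝ, ∀ x, ‖cv γ ρ x‖ ≤ C * (1 + ‖x‖) ^ (n + 1) := by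
  obtain ⟨C, hC0, hC⟩ := schw_dec ρ
  refine ⟨C * ∫ z : Rn n, ‖z‖ ^ (-γ) * (1 + ‖z‖) ^ (-((n + 1 : ℕ) : ℝ)), fun x => ?_⟩
  have := norm_integral_le_of_norm_le ((int_om hn h0 h1).const_mul (C * (1 + ‖x‖) ^ (n + 1)))
    (f := fun z : Rn n => ‖z‖ ^ (-γ) • ρ (x - z)) (Eventually.of_forall fun z => by
      rw [norm_smul, Real.norm_of_nonneg (by positivity)]
      calc ‖z‖ ^ (-γ) * ‖ρ (x - z)‖ ≤ ‖z‖ ^ (-γ) *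
          (C * (1 + ‖x‖) ^ (n + 1) * (1 + ‖z‖) ^ (-((n + 1 : ℕ) : ℝ))) :=
        mul_le_mul_of_nonneg_left (hC x z) (by positivity)
        _ = _ := by ring)
  refine this.trans_eq ?_
  rw [integral_const_mul]; ring

theorem cv_hasFDerivAt {γ : ℝ} (hn : 1 ≤ n) (h0 : 0 ≤ γ) (h1 : γ < n) (ρ : SchwartzMap (Rn n) F)
    (x : Rn n) : HasFDerivAt (cv γ ρ) (cv γ (SchwartzMap.fderivCLM ℝ (Rn n) F ρ) x) x := by
  obtain ⟨C, hC0, hC⟩ := schw_dec (SchwartzMap.fderivCLM ℝ (Rn n) F ρ)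
  refine hasFDerivAt_integral_of_dominated_of_fderiv_le (𝕜 := ℝ) (s := Metric.ball x 1)
    (bound := fun z => C * (2 + ‖x‖) ^ (n + 1) * (‖z‖ ^ (-γ) * (1 + ‖z‖) ^ (-((n + 1 : ℕ) : ℝ))))
    (F' := fun x z => ‖z‖ ^ (-γ) • (SchwartzMap.fderivCLM ℝ (Rn n) F ρ) (x - z))
    (Metric.ball_mem_nhds x one_pos) (Eventually.of_forall fun y => meas_cv γ ρ y)
    (int_cv hn h0 h1 ρ x) (meas_cv γ _ x) (Eventually.of_forall fun z y hy => ?_)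
    ((int_om hn h0 h1).const_mul _) (Eventually.of_forall fun z y _ => ?_)
  · rw [norm_smul, Real.norm_of_nonneg (by positivity)]
    have hy' : ‖y‖ ≤ 1 + ‖x‖ := by
      have : ‖y - x‖ < 1 := by simpa [dist_eq_norm] using hy
      have := norm_le_norm_add_norm_sub' y x
      linarith
    calc ‖z‖ ^ (-γ) * ‖(SchwartzMap.fderivCLM ℝ (Rn n) F ρ) (y - z)‖
        ≤ ‖z‖ ^ (-γ) * (C * (1 + ‖y‖) ^ (n + 1) * (1 + ‖z‖) ^ (-((n + 1 : ℕ) : ℝ))) := by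
          gcongr; exact hC y z
      _ ≤ ‖z‖ ^ (-γ) * (C * (2 + ‖x‖) ^ (n + 1) * (1 + ‖z‖) ^ (-((n + 1 : ℕ) : ℝ))) := by
          have : 1 + ‖y‖ ≤ 2 + ‖x‖ := by linarith
          gcongr
      _ = _ := by ring
  · have := (ρ.hasFDerivAt (y - z)).comp y ((hasFDerivAt_id y).sub_const z)
    simp only [ContinuousLinearMap.comp_id] at this
    exact this.const_smul _

theorem fderiv_cv {γ : ℝ} (hn : 1 ≤ n) (h0 : 0 ≤ γ) (h1 : γ < n) (ρ : SchwartzMap (Rn n) F) :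
    fderiv ℝ (cv γ ρ) = cv γ (SchwartzMap.fderivCLM ℝ (Rn n) F ρ) :=
  funext fun x => (cv_hasFDerivAt hn h0 h1 ρ x).fderiv

end conv

theorem cv_temp_aux {γ : ℝ} (hn : 1 ≤ n) (h0 : 0 ≤ γ) (h1 : γ < n) (m : ℕ) :
    ∀ (F : Type) [NormedAddCommGroup F] [NormedSpace ℝ F] (ρ : SchwartzMap (Rn n) F),
    ContDiff ℝ m (cv γ ρ) ∧
    ∃ (k : ℕ) (C : ℝ), ∀ x, ‖iteratedFDeriv ℝ m (cv γ ρ) x‖ ≤ C * (1 + ‖x‖) ^ k := by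
  induction m with
  | zero =>
    intro F _ _ ρ
    refine ⟨?_, ?_⟩
    · simp only [Nat.cast_zero, contDiff_zero]
      exact continuous_iff_continuousAt.2 fun x => (cv_hasFDerivAt hn h0 h1 ρ x).continuousAt
    · obtain ⟨C, hC⟩ := cv_bd hn h0 h1 ρ
      exact ⟨n + 1, C, by simpa using hC⟩
  | succ m ih =>
    intro F _ _ ρ
    obtain ⟨c, k, C, hC⟩ := ih _ (SchwartzMap.fderivCLM ℝ (Rn n) F ρ)
    rw [← fderiv_cv hn h0 h1] at c hC
    refine ⟨?_, k, C, fun x => ?_⟩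
    · push_cast
      rw [contDiff_succ_iff_fderiv]
      exact ⟨fun x => (cv_hasFDerivAt hn h0 h1 ρ x).differentiableAt, by simp, c⟩
    · rw [← norm_iteratedFDeriv_fderiv]; exact hC x

theorem cv_temp {γ : ℝ} (hn : 1 ≤ n) (h0 : 0 ≤ γ) (h1 : γ < n) {F : Type} [NormedAddCommGroup F]
    [NormedSpace ℝ F] (ρ : SchwartzMap (Rn n) F) : (cv γ ρ).HasTemperateGrowth :=
  ⟨contDiff_infty.2 fun m => (cv_temp_aux hn h0 h1 m F ρ).1,
    fun m => (cv_temp_aux hn h0 h1 m F ρ).2⟩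

theorem convC_eq (γ : ℝ) (ρ : Rn n → ℂ) : convC γ ρ = cv γ ρ := by
  ext x
  unfold convC cv
  rw [← integral_sub_left_eq_self _ _ x]
  simp

theorem convC_temp {γ : ℝ} (hn : 1 ≤ n) (h0 : 0 ≤ γ) (h1 : γ < n) {ρ : Rn n → ℂ} (h : IsS ρ) :
    (convC γ ρ).HasTemperateGrowth := by
  obtain ⟨s, rfl⟩ := h
  rw [convC_eq]; exact cv_temp hn h0 h1 s

theorem convC_int {γ : ℝ} (hn : 1 ≤ n) (h0 : 0 ≤ γ) (h1 : γ < n) {ρ : Rn n → ℂ} (h : IsS ρ)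
    (x : Rn n) : Integrable (fun y : Rn n => ((‖x - y‖ ^ (-γ) : ℝ) : ℂ) * ρ y) := by
  obtain ⟨s, rfl⟩ := h
  have := int_cv hn h0 h1 s x
  have := this.comp_sub_left x
  simpa using this

theorem temp_diff {F : Type} [NormedAddCommGroup F] [NormedSpace ℝ F] {g : Rn n → F}
    (h : g.HasTemperateGrowth) : Differentiable ℝ g :=
  h.1.differentiable (by simp)

theorem pd_convC {γ : ℝ} (hn : 1 ≤ n) (h0 : 0 ≤ γ) (h1 : γ < n) {ρ : Rn n → ℂ} (h : IsS ρ)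
    (j : Fin n) (x : Rn n) : pd j (convC γ ρ) x = convC γ (pd j ρ) x := by
  obtain ⟨s, rfl⟩ := h
  unfold pd
  rw [convC_eq, convC_eq, fderiv_cv hn h0 h1, cv, cv,
    ContinuousLinearMap.integral_apply (int_cv hn h0 h1 _ x)]
  rfl

theorem convC_add {γ : ℝ} (hn : 1 ≤ n) (h0 : 0 ≤ γ) (h1 : γ < n) {ρ σ : Rn n → ℂ} (h : IsS ρ)
    (k : IsS σ) (x : Rn n) : convC γ (fun x => ρ x + σ x) x = convC γ ρ x + convC γ σ x := by
  unfold convC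
  rw [← integral_add (convC_int hn h0 h1 h x) (convC_int hn h0 h1 k x)]
  congr 1; ext y; ring

theorem convC_cmul {γ : ℝ} (c : ℂ) (ρ : Rn n → ℂ)
    (x : Rn n) : convC γ (fun x => c * ρ x) x = c * convC γ ρ x := by
  unfold convC
  rw [← integral_const_mul]
  congr 1; ext y; ring

theorem convC_sub {γ : ℝ} (hn : 1 ≤ n) (h0 : 0 ≤ γ) (h1 : γ < n) {ρ σ : Rn n → ℂ} (h : IsS ρ)
    (k : IsS σ) (x : Rn n) : convC γ (fun x => ρ x - σ x) x = convC γ ρ x - convC γ σ x := by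
  unfold convC
  rw [← integral_sub (convC_int hn h0 h1 h x) (convC_int hn h0 h1 k x)]
  congr 1; ext y; ring

/-- the trilinear Hartree term -/
def T (γ : ℝ) (a b c : Rn n → ℂ) (x : Rn n) : ℂ := convC γ (fun y => a y * conj (b y)) x * c x

theorem T_isS {γ : ℝ} (hn : 1 ≤ n) (h0 : 0 ≤ γ) (h1 : γ < n) {a b c : Rn n → ℂ} (ha : IsS a)
    (hb : IsS b) (hc : IsS c) : IsS (T γ a b c) :=
  IsS.tmul (convC_temp hn h0 h1 (ha.mul hb.conj)) hc

theorem hartree_eq (γ : ℝ) (a : Rn n → ℂ) (x : Rn n) :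
    ((hartree γ a x : ℝ) : ℂ) = convC γ (fun y => a y * conj (a y)) x := by
  unfold hartree conv convC
  rw [← integral_complex_ofReal]
  congr 1; ext y
  beta_reduce
  rw [Complex.mul_conj]; simp

theorem T_leib {γ : ℝ} (hn : 1 ≤ n) (h0 : 0 ≤ γ) (h1 : γ < n) {a b c : Rn n → ℂ} (ha : IsS a)
    (hb : IsS b) (hc : IsS c) (α β : ℝ) (j : Fin n) (x : Rn n) :
    Aop α β j (T γ a b c) x = T γ (Aop α β j a) b c x - T γ a (Aop α β j b) c x
      + T γ a b (Aop α β j c) x := by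
  have hab := ha.mul hb.conj
  have hd := temp_diff (convC_temp hn h0 h1 hab)
  have e1 : pd j (T γ a b c) x = convC γ (fun y => a y * conj (b y)) x * pd j c x
      + pd j (convC γ (fun y => a y * conj (b y))) x * c x := pd_mul hd hc.diff j x
  have e2 : pd j (convC γ (fun y => a y * conj (b y))) x
      = convC γ (fun y => a y * conj (pd j b y)) x + convC γ (fun y => pd j a y * conj (b y)) x := by
    rw [pd_convC hn h0 h1 hab, ← convC_add hn h0 h1 (ha.mul (hb.pd j).conj) ((ha.pd j).mul hb.conj)]
    congr 1; ext y
    rw [pd_mul ha.diff hb.conj.diff, pd_conj hb.diff]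
  have e3 : convC γ (fun y => Aop α β j a y * conj (b y)) x =
      convC γ (fun y => α * ((y j : ℂ) * (a y * conj (b y)))) x
      - (Complex.I * β) * convC γ (fun y => pd j a y * conj (b y)) x := by
    rw [← convC_cmul, ← convC_sub hn h0 h1 ((hab.coord j).cmul α)
      (((ha.pd j).mul hb.conj).cmul (Complex.I * β))]
    congr 1; ext y; unfold Aop; ring
  have e4 : convC γ (fun y => a y * conj (Aop α β j b y)) x =
      convC γ (fun y => α * ((y j : ℂ) * (a y * conj (b y)))) x
      + (Complex.I * β) * convC γ (fun y => a y * conj (pd j b y)) x := by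
    rw [← convC_cmul, ← convC_add hn h0 h1 ((hab.coord j).cmul α)
      ((ha.mul (hb.pd j).conj).cmul (Complex.I * β))]
    congr 1; ext y; unfold Aop; simp; ring
  unfold Aop at *
  rw [e1, e2]
  unfold T
  rw [e3, e4]; ring

theorem T_split {γ : ℝ} (hn : 1 ≤ n) (h0 : 0 ≤ γ) (h1 : γ < n) {a b : Rn n → ℂ} (ha : IsS a)
    (hb : IsS b) (x : Rn n) :
    T γ a a a x - T γ b b b x = T γ (fun x => a x - b x) a a x + T γ b (fun x => a x - b x) a x
      + T γ b b (fun x => a x - b x) x := by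
  unfold T
  have e1 : convC γ (fun y => (a y - b y) * conj (a y)) x = convC γ (fun y => a y * conj (a y)) x
      - convC γ (fun y => b y * conj (a y)) x := by
    rw [← convC_sub hn h0 h1 (ha.mul ha.conj) (hb.mul ha.conj)]
    congr 1; ext y; ring
  have e2 : convC γ (fun y => b y * conj (a y - b y)) x = convC γ (fun y => b y * conj (a y)) x
      - convC γ (fun y => b y * conj (b y)) x := by
    rw [← convC_sub hn h0 h1 (hb.mul ha.conj) (hb.mul hb.conj)]
    congr 1; ext y; simp; ring
  rw [e1, e2]; ring

/-! oscillating exponentials have temperate growth -/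
theorem temp_cis : (fun s : ℝ => Complex.exp (Complex.I * s)).HasTemperateGrowth := by
  have hd : ∀ s : ℝ, HasDerivAt (fun s : ℝ => Complex.exp (Complex.I * s))
      (Complex.I * Complex.exp (Complex.I * s)) s := by
    intro s
    have h1 : HasDerivAt (fun s : ℝ => Complex.I * (s : ℂ)) (Complex.I * 1) s :=
      (Complex.ofRealCLM.hasDerivAt (x := s)).const_mul Complex.I
    have := h1.cexp
    convert this using 1; ring
  refine ⟨?_, fun m => ⟨0, 1, fun x => ?_⟩⟩
  · have : ContDiff ℝ (⊤ : ℕ∞) (fun s : ℝ => Complex.I * (s : ℂ)) :=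
      contDiff_const.mul Complex.ofRealCLM.contDiff
    exact this.cexp
  · have key : ∀ m : ℕ, iteratedDeriv m (fun s : ℝ => Complex.exp (Complex.I * s))
        = fun s : ℝ => Complex.I ^ m * Complex.exp (Complex.I * s) := by
      intro m
      induction m with
      | zero => simp
      | succ m ih =>
        rw [iteratedDeriv_succ, ih]
        ext s
        rw [((hd s).const_mul _).deriv]; ring
    rw [norm_iteratedFDeriv_eq_norm_iteratedDeriv, key]
    simp [Complex.norm_exp]

theorem temp_cis_comp {g : Rn n → ℝ} (hg : g.HasTemperateGrowth) :
    (fun x => Complex.exp (Complex.I * (g x : ℝ))).HasTemperateGrowth :=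
  temp_cis.comp hg

end HW
end

noncomputable section
namespace HW
variable {n : ℕ}

/-- regularised radius -/
def wreg (s δ : ℝ) (x y : Rn n) : ℝ := ‖y - x‖ ^ 2 / s ^ 2 + δ

theorem wreg_pos {s δ : ℝ} (hδ : 0 < δ) (x y : Rn n) : 0 < wreg s δ x y := by
  unfold wreg; positivity

theorem wreg_le {s δ : ℝ} (x y : Rn n) : δ ≤ wreg s δ x y := by
  unfold wreg; have : 0 ≤ ‖y - x‖ ^ 2 / s ^ 2 := by positivity
  linarith

theorem wreg_fd {s δ : ℝ} (x y : Rn n) :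
    HasFDerivAt (wreg s δ x) ((2 / s ^ 2) • innerSL ℝ (y - x)) y := by
  have h := ((hasFDerivAt_id y).sub_const x).norm_sq
  have := (h.mul_const (1 / s ^ 2)).add_const δ
  refine (this.congr_fderiv ?_).congr_of_eventuallyEq (Eventually.of_forall fun z => ?_)
  · ext v; simp; ring
  · unfold wreg; simp; ring

/-- the vector field -/
def Xf (s δ b : ℝ) (x : Rn n) (j : Fin n) (y : Rn n) : ℝ := (y j - x j) * wreg s δ x y ^ (-b)

theorem Xf_fd {s δ b : ℝ} (hδ : 0 < δ) (x y : Rn n) (j : Fin n) :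
    HasFDerivAt (Xf s δ b x j) ((y j - x j) • (((-b) * wreg s δ x y ^ (-b - 1)) •
      ((2 / s ^ 2) • innerSL ℝ (y - x))) + wreg s δ x y ^ (-b) • (EuclideanSpace.proj j : Rn n →L[ℝ] ℝ)) y := by
  have h1 : HasFDerivAt (fun y : Rn n => y j - x j) (EuclideanSpace.proj j : Rn n →L[ℝ] ℝ) y :=
    (EuclideanSpace.proj j : Rn n →L[ℝ] ℝ).hasFDerivAt.sub_const (x j)
  have h2 := (wreg_fd (s := s) (δ := δ) x y).rpow_const (p := -b) (Or.inl (wreg_pos hδ x y).ne')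
  exact h1.mul h2

theorem Xf_div {s δ b : ℝ} (hδ : 0 < δ) (x y : Rn n) (j : Fin n) :
    fderiv ℝ (Xf s δ b x j) y (EuclideanSpace.single j 1) =
      wreg s δ x y ^ (-b) - 2 * b * ((y j - x j) ^ 2 / s ^ 2) * wreg s δ x y ^ (-b - 1) := by
  rw [(Xf_fd hδ x y j).fderiv]
  simp [EuclideanSpace.inner_single_right]
  ring

theorem sq_coord_le (y : Rn n) (j : Fin n) : y j ^ 2 ≤ ‖y‖ ^ 2 := by
  rw [EuclideanSpace.norm_sq_eq]
  have := Finset.single_le_sum (f := fun i => ‖y i‖ ^ 2) (fun i _ => by positivity) (Finset.mem_univ j)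
  simpa using this

theorem rpow_b1 {b w : ℝ} (hb : 1/2 ≤ b) (hb1 : b ≤ 1) (hw : 0 < w) : w ^ (1 / 2 - b) ≤ 1 + w ^ (-b / 2) := by
  have h0 : 0 ≤ w ^ (-b/2) := by positivity
  rcases le_total 1 w with h | h
  · have := Real.rpow_le_one_of_one_le_of_nonpos h (by linarith : 1 / 2 - b ≤ 0)
    linarith
  · have := Real.rpow_le_rpow_of_exponent_ge hw h (by linarith : -b/2 ≤ 1/2 - b)
    linarith

theorem Xf_le {s δ b : ℝ} (hs : 0 < s) (hδ : 0 < δ) (hb : 1/2 ≤ b) (hb1 : b ≤ 1) (x y : Rn n)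
    (j : Fin n) : |Xf s δ b x j y| ≤ s * (1 + wreg s δ x y ^ (-b / 2)) := by
  have hw := wreg_pos (s := s) hδ x y
  have h1 : |y j - x j| ≤ s * wreg s δ x y ^ ((1:ℝ)/2) := by
    rw [← Real.sqrt_eq_rpow]
    have hq : s * √(wreg s δ x y) = √(s ^ 2 * wreg s δ x y) := by
      rw [Real.sqrt_mul (by positivity), Real.sqrt_sq hs.le]
    rw [hq]
    apply Real.abs_le_sqrt
    · have := sq_coord_le (y - x) j
      simp at this
      refine this.trans ?_
      unfold wreg
      rw [mul_add, mul_div_cancel₀ _ (by positivity)]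
      have : 0 ≤ s ^ 2 * δ := by positivity
      linarith
  unfold Xf
  rw [abs_mul, abs_of_nonneg (by positivity : 0 ≤ wreg s δ x y ^ (-b))]
  calc _ ≤ s * wreg s δ x y ^ ((1:ℝ)/2) * wreg s δ x y ^ (-b) := by gcongr
    _ = s * wreg s δ x y ^ (1 / 2 - b) := by rw [mul_assoc, ← Real.rpow_add hw]; ring_nf
    _ ≤ _ := by gcongr; exact rpow_b1 hb hb1 hw

theorem wr_le {s δ b : ℝ} (hδ : 0 < δ) (hb : 0 ≤ b) (x y : Rn n) :
    wreg s δ x y ^ (-b) ≤ δ ^ (-b) :=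
  Real.rpow_le_rpow_of_nonpos hδ (wreg_le x y) (by linarith)

theorem wr_cont {s δ b : ℝ} (hδ : 0 < δ) (x : Rn n) :
    Continuous (fun y => wreg s δ x y ^ b) := by
  refine Continuous.rpow_const ?_ fun y => Or.inl (wreg_pos hδ x y).ne'
  unfold wreg; fun_prop

theorem pd_normsq {z : Rn n → ℂ} (hz : IsS z) (y v : Rn n) :
    fderiv ℝ (fun y => ‖z y‖ ^ 2) y v = 2 * (conj (z y) * fderiv ℝ z y v).re := by
  rw [((hz.diff y).hasFDerivAt.norm_sq).fderiv]
  simp [Complex.inner]; ring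

theorem pd_normsq_A {z : Rn n → ℂ} (hz : IsS z) {α β : ℝ} (hβ : β ≠ 0) (j : Fin n) (y : Rn n) :
    |fderiv ℝ (fun y => ‖z y‖ ^ 2) y (EuclideanSpace.single j 1)|
      ≤ 2 / |β| * (‖z y‖ * ‖Aop α β j z y‖) := by
  have e : fderiv ℝ (fun y => ‖z y‖ ^ 2) y (EuclideanSpace.single j 1)
      = - (2 / β) * (conj (z y) * Aop α β j z y).im := by
    rw [pd_normsq hz]
    have : fderiv ℝ z y (EuclideanSpace.single j 1) = pd j z y := rfl
    rw [this]
    unfold Aop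
    simp only [Complex.mul_im, Complex.mul_re, Complex.sub_re, Complex.sub_im, Complex.ofReal_re,
      Complex.ofReal_im, Complex.I_re, Complex.I_im, Complex.conj_re, Complex.conj_im]
    field_simp
    ring
  rw [e, abs_mul, abs_neg, abs_div, abs_two]
  gcongr
  refine (Complex.abs_im_le_norm _).trans ?_
  simp

theorem hardy_reg {s δ b : ℝ} (hn : 2 ≤ n) (hδ : 0 < δ) (hb : 1/2 ≤ b) (hb1 : b < 1) {α β : ℝ}
    (hs : s = |β|) (hβ : β ≠ 0) {z : Rn n → ℂ} (hz : IsS z) (x : Rn n) :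
    (n - 2 * b) * ∫ y, wreg s δ x y ^ (-b) * ‖z y‖ ^ 2 ≤
      2 * (l2 z + √(∫ y, wreg s δ x y ^ (-b) * ‖z y‖ ^ 2)) * ∑ j, l2 (Aop α β j z) := by
  have hs0 : 0 < s := hs ▸ abs_pos.2 hβ
  have hzc := hz.cont
  have iz : Integrable (fun y => ‖z y‖ ^ 2) := hz.memLp.integrable_norm_pow (by norm_num)
  have bd : ∀ (g : Rn n → ℝ) (C : ℝ), Continuous g → (∀ y, |g y| ≤ C) →
      Integrable (fun y => g y * ‖z y‖ ^ 2) := fun g C hg h =>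
    iz.bdd_mul hg.aestronglyMeasurable (Eventually.of_forall fun y => h y)
  have iw : Integrable (fun y => wreg s δ x y ^ (-b) * ‖z y‖ ^ 2) :=
    bd _ (δ ^ (-b)) (wr_cont hδ x) fun y => by
      have := wreg_pos (s := s) hδ x y
      rw [abs_of_nonneg (by positivity)]
      exact wr_le hδ (by linarith) x y
  -- the weighted function
  set g : Rn n → ℂ := fun y => ((wreg s δ x y ^ (-b / 2) : ℝ) : ℂ) * z y with hg
  have gm : MemLp g 2 volume := by
    refine (hz.memLp.const_mul ((δ ^ (-b/2) : ℝ) : ℂ)).mono ?_ (Eventually.of_forall fun y => ?_)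
    · exact ((Complex.continuous_ofReal.comp (wr_cont hδ x)).mul hzc).aestronglyMeasurable
    · have := wreg_pos (s := s) hδ x y
      rw [hg, norm_mul, norm_mul, Complex.norm_real, Complex.norm_real,
        Real.norm_of_nonneg (by positivity), Real.norm_of_nonneg (by positivity)]
      have := wr_le (s := s) hδ (by linarith : 0 ≤ b/2) x y
      rw [← neg_div] at this
      gcongr ?_ * _
  have gl : l2 g = √(∫ y, wreg s δ x y ^ (-b) * ‖z y‖ ^ 2) := by
    rw [l2_eq gm, Real.sqrt_eq_rpow]
    congr 2; ext y
    have := wreg_pos (s := s) hδ x y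
    rw [hg, norm_mul, Complex.norm_real, Real.norm_of_nonneg (by positivity), mul_pow, sq (_ ^ (-b/2)),
      ← Real.rpow_add this]
    ring_nf
  rw [← gl]
  -- per coordinate
  have key : ∀ j, Integrable (fun y => fderiv ℝ (Xf s δ b x j) y (EuclideanSpace.single j 1) * ‖z y‖ ^ 2)
     ∧ ∫ y, fderiv ℝ (Xf s δ b x j) y (EuclideanSpace.single j 1) * ‖z y‖ ^ 2 ≤
      2 * (l2 z + l2 g) * l2 (Aop α β j z) := by
    intro j
    have hA := hz.Aop α β j
    have Xc : Continuous (Xf s δ b x j) :=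
      continuous_iff_continuousAt.2 fun y => (Xf_fd hδ x y j).continuousAt
    have i1 : Integrable (fun y => fderiv ℝ (Xf s δ b x j) y (EuclideanSpace.single j 1) * ‖z y‖ ^ 2) := by
      refine bd _ (δ ^ (-b) + 2 * b * δ ^ (-b)) ?_ fun y => ?_
      · simp_rw [Xf_div hδ]
        refine (wr_cont hδ x).sub (Continuous.mul ?_ (wr_cont hδ x))
        fun_prop
      · rw [Xf_div hδ]
        have hw := wreg_pos (s := s) hδ x y
        have h1 := wr_le (s := s) hδ (by linarith : 0 ≤ b) x y
        have h2 : (y j - x j) ^ 2 / s ^ 2 * wreg s δ x y ^ (-b - 1) ≤ wreg s δ x y ^ (-b) := by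
          rw [Real.rpow_sub_one hw.ne', ← mul_div_assoc, div_le_iff₀ hw, mul_comm]
          gcongr
          have := sq_coord_le (y - x) j
          simp at this
          unfold wreg
          have : (y j - x j) ^ 2 / s ^ 2 ≤ ‖y - x‖ ^ 2 / s ^ 2 := by gcongr
          linarith
        have h3 : 0 ≤ (y j - x j) ^ 2 / s ^ 2 * wreg s δ x y ^ (-b - 1) := by positivity
        have h4 : 0 ≤ wreg s δ x y ^ (-b) := by positivity
        rw [abs_le]; constructor <;> nlinarith
    have iA : Integrable (fun y => 2 * (‖z y‖ * ‖Aop α β j z y‖ + ‖g y‖ * ‖Aop α β j z y‖)) := by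
      have a1 := (int_mul hz.memLp hA.memLp).norm
      have a2 := (int_mul gm hA.memLp).norm
      simp only [norm_mul] at a1 a2
      exact (a1.add a2).const_mul 2
    have bb : ∀ y, ‖Xf s δ b x j y * fderiv ℝ (fun y => ‖z y‖ ^ 2) y (EuclideanSpace.single j 1)‖ ≤
        2 * (‖z y‖ * ‖Aop α β j z y‖ + ‖g y‖ * ‖Aop α β j z y‖) := by
      intro y
      have hw := wreg_pos (s := s) hδ x y
      have gn : ‖g y‖ = wreg s δ x y ^ (-b/2) * ‖z y‖ := by
        rw [hg, norm_mul, Complex.norm_real, Real.norm_of_nonneg (by positivity)]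
      rw [norm_mul, Real.norm_eq_abs, Real.norm_eq_abs, gn]
      calc _ ≤ (s * (1 + wreg s δ x y ^ (-b / 2))) * (2 / |β| * (‖z y‖ * ‖Aop α β j z y‖)) := by
            gcongr
            · exact Xf_le hs0 hδ hb hb1.le x y j
            · exact pd_normsq_A hz hβ j y
        _ = _ := by rw [← hs]; field_simp
    have zc : ContDiff ℝ 1 (fun y => ‖z y‖ ^ 2) := (hz.contDiff 1).norm_sq ℝ
    have i2 : Integrable (fun y => Xf s δ b x j y * fderiv ℝ (fun y => ‖z y‖ ^ 2) y (EuclideanSpace.single j 1)) := by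
      refine iA.mono' ?_ (Eventually.of_forall bb)
      exact (Xc.mul ((zc.continuous_fderiv (by simp)).clm_apply continuous_const)).aestronglyMeasurable
    have i3 : Integrable (fun y => Xf s δ b x j y * ‖z y‖ ^ 2) := by
      refine bd _ (s * (1 + δ ^ (-b/2))) Xc fun y => (Xf_le hs0 hδ hb hb1.le x y j).trans ?_
      have := wr_le (s := s) hδ (by linarith : 0 ≤ b/2) x y
      rw [← neg_div] at this
      gcongr _ * (1 + ?_)
    refine ⟨i1, ?_⟩
    have e := integral_mul_fderiv_eq_neg_fderiv_mul_of_integrable i1 i2 i3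
      (fun y _ => (Xf_fd hδ x y j).differentiableAt) (fun y _ => zc.differentiable (by simp) y)
    have e2 : ∫ y, fderiv ℝ (Xf s δ b x j) y (EuclideanSpace.single j 1) * ‖z y‖ ^ 2
      = - ∫ y, Xf s δ b x j y * fderiv ℝ (fun y => ‖z y‖ ^ 2) y (EuclideanSpace.single j 1) := by
      rw [e, neg_neg]
    rw [e2]
    refine (neg_le_abs _).trans ?_
    refine (norm_integral_le_of_norm_le iA (Eventually.of_forall bb)).trans ?_
    have a1 := (int_mul hz.memLp hA.memLp).norm
    have a2 := (int_mul gm hA.memLp).norm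
    simp only [norm_mul] at a1 a2
    rw [integral_const_mul, integral_add a1 a2]
    have := cs_norm hz.memLp hA.memLp
    have := cs_norm gm hA.memLp
    linarith
  rw [Finset.mul_sum]
  refine le_trans ?_ (Finset.sum_le_sum fun j _ => (key j).2)
  rw [← integral_finsetSum _ fun j _ => (key j).1, ← integral_const_mul]
  refine integral_mono (iw.const_mul _) (integrable_finsetSum _ fun j _ => (key j).1) fun y => ?_
  beta_reduce
  rw [← Finset.sum_mul, ← mul_assoc]
  refine mul_le_mul_of_nonneg_right ?_ (by positivity)
  simp_rw [Xf_div hδ]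
  have hw := wreg_pos (s := s) hδ x y
  rw [Finset.sum_sub_distrib, ← Finset.sum_mul, ← Finset.mul_sum, ← Finset.sum_div]
  have : ∑ j, (y j - x j) ^ 2 = ‖y - x‖ ^ 2 := by
    rw [EuclideanSpace.norm_sq_eq]; simp
  rw [this, Real.rpow_sub_one hw.ne']
  simp only [Finset.sum_const, Finset.card_univ, Fintype.card_fin, nsmul_eq_mul]
  have h4 : 0 ≤ wreg s δ x y ^ (-b) := by positivity
  have h5 : ‖y - x‖ ^ 2 / s ^ 2 * (wreg s δ x y ^ (-b) / wreg s δ x y) ≤ wreg s δ x y ^ (-b) := by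
    rw [← mul_div_assoc, div_le_iff₀ hw, mul_comm]
    gcongr
    unfold wreg; linarith
  nlinarith

end HW
end

noncomputable section
namespace HW
variable {n : ℕ}

theorem int_sing {p : ℝ} (hn : 1 ≤ n) (h0 : 0 ≤ p) (h1 : p < n) {z : Rn n → ℂ} (hz : IsS z)
    (x : Rn n) : Integrable (fun y => ‖x - y‖ ^ (-p) * ‖z y‖ ^ 2) := by
  have := (convC_int hn h0 h1 (hz.mul hz.conj) x).norm
  refine this.congr (Eventually.of_forall fun y => ?_)
  simp only [norm_mul, Complex.norm_real, RCLike.norm_conj]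
  rw [Real.norm_of_nonneg (by positivity)]; ring

theorem quad_aux {c I N : ℝ} (hc : 0 < c) (hI : 0 ≤ I) (hN : 0 ≤ N)
    (h : c * I ≤ 2 * (N + √I) * N) : I ≤ 2 / c * (2 + 2 / c) * N ^ 2 := by
  set q := √I
  have hq : q ^ 2 = I := Real.sq_sqrt hI
  rw [← hq] at h ⊢
  have h2 : 2 * q * N ≤ c / 2 * q ^ 2 + 2 / c * N ^ 2 := by
    have : 0 ≤ c / 2 * (q - 2 / c * N) ^ 2 := by positivity
    have e : c / 2 * (q - 2 / c * N) ^ 2 = c / 2 * q ^ 2 - 2 * q * N + 2 / c * N ^ 2 := by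
      field_simp; ring
    linarith
  have h3 : c / 2 * q ^ 2 ≤ (2 + 2 / c) * N ^ 2 := by nlinarith
  calc q ^ 2 = 2 / c * (c / 2 * q ^ 2) := by field_simp
    _ ≤ 2 / c * ((2 + 2 / c) * N ^ 2) := by gcongr
    _ = _ := by ring

/-- the norm attached to A -/
def nA (α β : ℝ) (z : Rn n → ℂ) : ℝ := l2 z + ∑ j, l2 (Aop α β j z)

theorem l2_le_nA (α β : ℝ) (z : Rn n → ℂ) : l2 z ≤ nA α β z := by
  unfold nA
  have : 0 ≤ ∑ j, l2 (Aop α β j z) := Finset.sum_nonneg fun j _ => l2_nonneg _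
  linarith

theorem nA_nonneg (α β : ℝ) (z : Rn n → ℂ) : 0 ≤ nA α β z := (l2_nonneg z).trans (l2_le_nA α β z)

theorem hardy0 {b : ℝ} (hn : 2 ≤ n) (hb : 1/2 ≤ b) (hb1 : b < 1) {α β : ℝ}
    (hβ : β ≠ 0) {z : Rn n → ℂ} (hz : IsS z) (x : Rn n) :
    ∫ y, (‖x - y‖ / |β|) ^ (-(2 * b)) * ‖z y‖ ^ 2 ≤
      2 / (n - 2 * b) * (2 + 2 / (n - 2 * b)) * nA α β z ^ 2 := by
  have hs0 : 0 < |β| := abs_pos.2 hβ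
  have hn' : (2 : ℝ) ≤ n := by exact_mod_cast hn
  have hc : (0 : ℝ) < n - 2 * b := by linarith
  have step : ∀ δ : ℝ, 0 < δ → ∫ y, wreg |β| δ x y ^ (-b) * ‖z y‖ ^ 2 ≤
      2 / (n - 2 * b) * (2 + 2 / (n - 2 * b)) * nA α β z ^ 2 := by
    intro δ hδ
    have h := hardy_reg hn hδ hb hb1 (α := α) rfl hβ hz x
    have hI : 0 ≤ ∫ y, wreg |β| δ x y ^ (-b) * ‖z y‖ ^ 2 :=
      integral_nonneg fun y => by have := wreg_pos (s := |β|) hδ x y; positivity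
    refine quad_aux hc hI (nA_nonneg α β z) (h.trans ?_)
    have h1 := l2_le_nA α β z
    have h2 : ∑ j, l2 (Aop α β j z) ≤ nA α β z := by
      unfold nA; linarith [l2_nonneg z]
    have h3 : 0 ≤ ∑ j, l2 (Aop α β j z) := Finset.sum_nonneg fun j _ => l2_nonneg _
    have h4 := nA_nonneg α β z
    exact mul_le_mul (mul_le_mul_of_nonneg_left (by linarith) (by norm_num)) h2 h3
      (by have := Real.sqrt_nonneg (∫ y, wreg |β| δ x y ^ (-b) * ‖z y‖ ^ 2); positivity)
  have lim : Tendsto (fun δ : ℝ => ∫ y, wreg |β| δ x y ^ (-b) * ‖z y‖ ^ 2) (𝓝[>] 0)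
      (𝓝 (∫ y, (‖x - y‖ / |β|) ^ (-(2 * b)) * ‖z y‖ ^ 2)) := by
    have int0 : Integrable (fun y => (‖x - y‖ / |β|) ^ (-(2 * b)) * ‖z y‖ ^ 2) := by
      have := (int_sing (p := 2 * b) (by omega) (by linarith) (by linarith) hz x).const_mul
        ((|β|⁻¹) ^ (-(2*b)))
      refine this.congr (Eventually.of_forall fun y => ?_)
      simp only
      rw [div_eq_mul_inv, Real.mul_rpow (by positivity) (by positivity)]; ring
    have hpt : ∀ y, y ≠ x → 0 < ‖x - y‖ / |β| := fun y hy => by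
      have : 0 < ‖x - y‖ := norm_pos_iff.2 (sub_ne_zero.2 hy.symm)
      positivity
    have hae : ∀ᵐ y ∂(volume : Measure (Rn n)), y ≠ x := by
      have : Nontrivial (Rn n) := by
        haveI : Nonempty (Fin n) := ⟨⟨0, by omega⟩⟩
        infer_instance
      exact Measure.ae_ne volume x
    have hq : ∀ y, wreg |β| 0 x y = (‖x - y‖ / |β|) ^ (2:ℝ) := fun y => by
      unfold wreg; rw [norm_sub_rev, add_zero, ← div_pow]; norm_cast
    have hq2 : ∀ y, (‖x - y‖ / |β|) ^ (-(2 * b)) = wreg |β| 0 x y ^ (-b) := fun y => by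
      rw [hq, ← Real.rpow_mul (by positivity)]; ring_nf
    refine tendsto_integral_filter_of_dominated_convergence _ ?_ ?_ int0 ?_
    · filter_upwards [self_mem_nhdsWithin] with δ hδ
      exact ((wr_cont hδ x).mul (hz.cont.norm.pow 2)).aestronglyMeasurable
    · filter_upwards [self_mem_nhdsWithin] with δ hδ
      filter_upwards [hae] with y hy
      have hw := wreg_pos (s := |β|) hδ x y
      rw [Real.norm_of_nonneg (by positivity), hq2]
      refine mul_le_mul_of_nonneg_right ?_ (by positivity)
      apply Real.rpow_le_rpow_of_nonpos
      · rw [hq]; exact Real.rpow_pos_of_pos (hpt y hy) _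
      · unfold wreg; simp only [add_zero]; linarith [Set.mem_Ioi.1 hδ]
      · linarith
    · filter_upwards [hae] with y hy
      refine Tendsto.mul_const _ ?_
      rw [hq2]
      refine Tendsto.mono_left ?_ nhdsWithin_le_nhds
      refine Tendsto.rpow_const ?_ (Or.inl ?_)
      · unfold wreg
        exact Continuous.tendsto (by fun_prop) (0:ℝ)
      · rw [hq]; exact (Real.rpow_pos_of_pos (hpt y hy) _).ne'
  exact le_of_tendsto lim (by filter_upwards [self_mem_nhdsWithin] with δ hδ using step δ hδ)

theorem hardy {γ : ℝ} (hn : 2 ≤ n) (h0 : 0 < γ) (h1 : γ < 1) : ∃ C : ℝ, 0 < C ∧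
    ∀ (α β : ℝ), β ≠ 0 → ∀ (z : Rn n → ℂ), IsS z → ∀ x : Rn n,
    ∫ y, ‖x - y‖ ^ (-(2 * γ)) * ‖z y‖ ^ 2 ≤ (C * |β| ^ (-γ) * nA α β z) ^ 2 := by
  set b := (1 + γ) / 2 with hb
  have hn' : (2 : ℝ) ≤ n := by exact_mod_cast hn
  set K := 2 / (n - 2 * b) * (2 + 2 / (n - 2 * b)) with hK
  have hc : (0 : ℝ) < n - 2 * b := by rw [hb]; linarith
  have hK0 : 0 < K := by positivity
  refine ⟨√(1 + K), by positivity, fun α β hβ z hz x => ?_⟩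
  have hs0 : 0 < |β| := abs_pos.2 hβ
  have i1 : Integrable (fun y => ‖z y‖ ^ 2) := hz.memLp.integrable_norm_pow (by norm_num)
  have i2 : Integrable (fun y => (‖x - y‖ / |β|) ^ (-(2 * b)) * ‖z y‖ ^ 2) := by
    have := (int_sing (p := 2 * b) (by omega) (by linarith) (by linarith) hz x).const_mul
      ((|β|⁻¹) ^ (-(2*b)))
    refine this.congr (Eventually.of_forall fun y => ?_)
    simp only
    rw [div_eq_mul_inv, Real.mul_rpow (by positivity) (by positivity)]; ring
  have i3 := int_sing (p := 2 * γ) (by omega) (by linarith) (by linarith) hz x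
  have pt : ∀ y, ‖x - y‖ ^ (-(2 * γ)) * ‖z y‖ ^ 2 ≤
      |β| ^ (-(2 * γ)) * (‖z y‖ ^ 2 + (‖x - y‖ / |β|) ^ (-(2 * b)) * ‖z y‖ ^ 2) := by
    intro y
    set r := ‖x - y‖ / |β| with hr
    have hr0 : 0 ≤ r := by positivity
    have e : ‖x - y‖ ^ (-(2 * γ)) = |β| ^ (-(2 * γ)) * r ^ (-(2 * γ)) := by
      rw [← Real.mul_rpow (by positivity) hr0, hr, mul_div_cancel₀ _ hs0.ne']
    have h : r ^ (-(2 * γ)) ≤ 1 + r ^ (-(2 * b)) := by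
      have hp : 0 ≤ r ^ (-(2 * b)) := by positivity
      rcases hr0.eq_or_lt with hr1 | hr1
      · rw [← hr1, Real.zero_rpow (by linarith), Real.zero_rpow (by linarith)]; norm_num
      rcases le_total 1 r with h | h
      · have := Real.rpow_le_one_of_one_le_of_nonpos h (by linarith : -(2 * γ) ≤ 0)
        linarith
      · have := Real.rpow_le_rpow_of_exponent_ge hr1 h (by linarith : -(2 * b) ≤ -(2 * γ))
        linarith
    rw [e, mul_assoc]
    gcongr
    nlinarith [sq_nonneg ‖z y‖]
  refine (integral_mono i3 ((i1.add i2).const_mul _) pt).trans ?_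
  rw [integral_const_mul]
  have ea : ∫ y, (‖z y‖ ^ 2 + (‖x - y‖ / |β|) ^ (-(2 * b)) * ‖z y‖ ^ 2) = _ := integral_add i1 i2
  simp only [Pi.add_apply]
  rw [ea, ← l2_sq hz.memLp]
  have hh := hardy0 hn (b := b) (by linarith) (by linarith) (α := α) hβ hz x
  rw [mul_pow, mul_pow, Real.sq_sqrt (by positivity)]
  have e2 : |β| ^ (-(2 * γ)) = (|β| ^ (-γ)) ^ 2 := by
    rw [sq, ← Real.rpow_add hs0]; ring_nf
  rw [e2, mul_comm (1 + K), mul_assoc]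
  gcongr
  have : l2 z ^ 2 ≤ nA α β z ^ 2 := pow_le_pow_left₀ (l2_nonneg z) (l2_le_nA α β z) 2
  rw [← hK] at hh
  linarith

theorem convC_bd {γ : ℝ} (hn : 2 ≤ n) (h0 : 0 < γ) (h1 : γ < 1) : ∃ C : ℝ, 0 < C ∧
    ∀ (α β : ℝ), β ≠ 0 → ∀ (a b : Rn n → ℂ), IsS a → IsS b → ∀ x : Rn n,
    ‖convC γ (fun y => a y * conj (b y)) x‖ ≤ C * |β| ^ (-γ) * nA α β a * l2 b ∧
    ‖convC γ (fun y => b y * conj (a y)) x‖ ≤ C * |β| ^ (-γ) * nA α β a * l2 b := by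
  obtain ⟨C, hC, H⟩ := hardy (n := n) hn h0 h1
  have hn' : (2 : ℝ) ≤ n := by exact_mod_cast hn
  refine ⟨C, hC, fun α β hβ a b ha hb x => ?_⟩
  have hs0 : 0 < |β| := abs_pos.2 hβ
  set g : Rn n → ℂ := fun y => ((‖x - y‖ ^ (-γ) : ℝ) : ℂ) * a y with hg
  have gsq : ∀ y, ‖g y‖ ^ 2 = ‖x - y‖ ^ (-(2 * γ)) * ‖a y‖ ^ 2 := fun y => by
    rw [hg, norm_mul, Complex.norm_real, Real.norm_of_nonneg (by positivity), mul_pow]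
    congr 1
    rw [← Real.rpow_natCast, ← Real.rpow_mul (by positivity)]; ring_nf
  have mo : Measurable (fun y : Rn n => ((‖x - y‖ ^ (-γ) : ℝ) : ℂ)) :=
    Complex.measurable_ofReal.comp ((measurable_norm.comp (measurable_const.sub measurable_id)).pow_const _)
  have gm : MemLp g 2 volume := by
    have gmm : AEStronglyMeasurable g volume := (mo.mul ha.cont.measurable).aestronglyMeasurable
    rw [memLp_two_iff_integrable_sq_norm gmm]
    simp_rw [gsq]
    exact int_sing (by omega) (by linarith) (by linarith) ha x
  have gl : l2 g ≤ C * |β| ^ (-γ) * nA α β a := by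
    have hp : 0 ≤ C * |β| ^ (-γ) * nA α β a := by have := nA_nonneg α β a; positivity
    refine le_of_sq_le_sq ?_ hp
    rw [l2_sq gm]; simp_rw [gsq]
    exact H α β hβ a ha x
  have main : ∫ y, ‖g y‖ * ‖b y‖ ≤ C * |β| ^ (-γ) * nA α β a * l2 b :=
    (cs_norm gm hb.memLp).trans (mul_le_mul_of_nonneg_right gl (l2_nonneg b))
  constructor
  · refine (norm_integral_le_integral_norm _).trans (le_of_eq_of_le ?_ main)
    congr 1; ext y; simp [hg, mul_assoc]
  · refine (norm_integral_le_integral_norm _).trans (le_of_eq_of_le ?_ main)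
    congr 1; ext y; simp [hg]; ring

end HW
end

noncomputable section
namespace HW
variable {n : ℕ}

/-- coefficient of x -/
def gA (ε t : ℝ) (b : Bool) : ℝ := if b then Real.sin t / ε else Real.cos t
/-- coefficient of the derivative -/
def gB (ε t : ℝ) (b : Bool) : ℝ := if b then Real.cos t else -(ε * Real.sin t)

/-- the family of operators -/
def gop (k : Option (Bool × Fin n)) (ε t : ℝ) (φ : Rn n → ℂ) : Rn n → ℂ :=
  match k with
  | none => φ
  | some p => Aop (gA ε t p.1) (gB ε t p.1) p.2 φ

/-- total norm -/
def nn (ε t : ℝ) (φ : Rn n → ℂ) : ℝ := ∑ k, l2 (gop k ε t φ)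

theorem IsS.gop {φ : Rn n → ℂ} (h : IsS φ) (k : Option (Bool × Fin n)) (ε t : ℝ) :
    IsS (gop k ε t φ) := by
  cases k with
  | none => exact h
  | some p => exact h.Aop _ _ _

theorem gop_sub {φ ψ : Rn n → ℂ} (h : Differentiable ℝ φ) (k : Differentiable ℝ ψ)
    (i : Option (Bool × Fin n)) (ε t : ℝ) :
    gop i ε t (fun x => φ x - ψ x) = fun x => gop i ε t φ x - gop i ε t ψ x := by
  cases i with
  | none => rfl
  | some p => ext x; exact Aop_sub h k _ _ _ x

theorem gop_add {φ ψ : Rn n → ℂ} (h : Differentiable ℝ φ) (k : Differentiable ℝ ψ)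
    (i : Option (Bool × Fin n)) (ε t : ℝ) :
    gop i ε t (fun x => φ x + ψ x) = fun x => gop i ε t φ x + gop i ε t ψ x := by
  cases i with
  | none => rfl
  | some p => ext x; exact Aop_add h k _ _ _ x

theorem gop_cmul {φ : Rn n → ℂ} (h : Differentiable ℝ φ) (c : ℂ)
    (i : Option (Bool × Fin n)) (ε t : ℝ) :
    gop i ε t (fun x => c * φ x) = fun x => c * gop i ε t φ x := by
  cases i with
  | none => rfl
  | some p => ext x; exact Aop_cmul h c _ _ _ x

theorem gop_symm {φ ψ : Rn n → ℂ} (h : IsS φ) (k : IsS ψ)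
    (i : Option (Bool × Fin n)) (ε t : ℝ) :
    dot (gop i ε t φ) ψ = dot φ (gop i ε t ψ) := by
  cases i with
  | none => rfl
  | some p => exact Aop_symm h k _ _ _

theorem l2_gop_le_nn (k : Option (Bool × Fin n)) (ε t : ℝ) (φ : Rn n → ℂ) :
    l2 (gop k ε t φ) ≤ nn ε t φ :=
  Finset.single_le_sum (f := fun k => l2 (gop k ε t φ)) (fun _ _ => l2_nonneg _) (Finset.mem_univ k)

theorem l2_le_nn (ε t : ℝ) (φ : Rn n → ℂ) : l2 φ ≤ nn ε t φ := l2_gop_le_nn none ε t φ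

theorem nn_nonneg (ε t : ℝ) (φ : Rn n → ℂ) : 0 ≤ nn ε t φ :=
  Finset.sum_nonneg fun _ _ => l2_nonneg _

theorem nn_add {φ ψ : Rn n → ℂ} (h : IsS φ) (k : IsS ψ) (ε t : ℝ) :
    nn ε t (fun x => φ x + ψ x) ≤ nn ε t φ + nn ε t ψ := by
  unfold nn
  rw [← Finset.sum_add_distrib]
  refine Finset.sum_le_sum fun i _ => ?_
  rw [gop_add h.diff k.diff]
  exact l2_add (h.gop i ε t).memLp (k.gop i ε t).memLp

theorem nn_sub {φ ψ : Rn n → ℂ} (h : IsS φ) (k : IsS ψ) (ε t : ℝ) :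
    nn ε t (fun x => φ x - ψ x) ≤ nn ε t φ + nn ε t ψ := by
  unfold nn
  rw [← Finset.sum_add_distrib]
  refine Finset.sum_le_sum fun i _ => ?_
  rw [gop_sub h.diff k.diff]
  exact l2_sub (h.gop i ε t).memLp (k.gop i ε t).memLp

theorem nn_cmul {φ : Rn n → ℂ} (h : IsS φ) (c : ℂ) (ε t : ℝ) :
    nn ε t (fun x => c * φ x) = ‖c‖ * nn ε t φ := by
  unfold nn
  rw [Finset.mul_sum]
  refine Finset.sum_congr rfl fun i _ => ?_
  rw [gop_cmul h.diff, l2_cmul]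

theorem nA_le_nn (ε t : ℝ) (b : Bool) (φ : Rn n → ℂ) : nA (gA ε t b) (gB ε t b) φ ≤ nn ε t φ := by
  unfold nA nn
  rw [Fintype.sum_option, Fintype.sum_prod_type, Fintype.sum_bool]
  have h : ∀ b, 0 ≤ ∑ j, l2 (Aop (gA ε t b) (gB ε t b) j φ) := fun b =>
    Finset.sum_nonneg fun _ _ => l2_nonneg _
  have h1 := h true
  have h2 := h false
  cases b <;> simp only [gop] <;> linarith

theorem T_l2 {γ : ℝ} (hn : 2 ≤ n) (h0 : 0 < γ) (h1 : γ < 1) : ∃ C : ℝ, 0 < C ∧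
    ∀ (α β : ℝ), β ≠ 0 → ∀ (a b c : Rn n → ℂ), IsS a → IsS b → IsS c →
    l2 (T γ a b c) ≤ C * |β| ^ (-γ) * nA α β a * l2 b * l2 c ∧
    l2 (T γ a b c) ≤ C * |β| ^ (-γ) * l2 a * nA α β b * l2 c := by
  obtain ⟨C, hC, H⟩ := convC_bd (n := n) hn h0 h1
  refine ⟨C, hC, fun α β hβ a b c ha hb hc => ⟨?_, ?_⟩⟩
  · refine l2_mul_le ?_ hc.memLp fun x => (H α β hβ a b ha hb x).1
    have := nA_nonneg α β a; have := l2_nonneg b; positivity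
  · have : C * |β| ^ (-γ) * l2 a * nA α β b * l2 c = C * |β| ^ (-γ) * nA α β b * l2 a * l2 c := by ring
    rw [this]
    refine l2_mul_le ?_ hc.memLp fun x => (H α β hβ b a hb ha x).2
    have := nA_nonneg α β b; have := l2_nonneg a; positivity

theorem T_bd {γ : ℝ} (hn : 2 ≤ n) (h0 : 0 < γ) (h1 : γ < 1) : ∃ C : ℝ, 0 < C ∧
    ∀ (ε t : ℝ) (b0 : Bool), gB ε t b0 ≠ 0 → ∀ (a b c : Rn n → ℂ), IsS a → IsS b → IsS c →
    nn ε t (T γ a b c) ≤ C * |gB ε t b0| ^ (-γ) * nn ε t a * nn ε t b * nn ε t c := by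
  obtain ⟨C, hC, H⟩ := T_l2 (n := n) hn h0 h1
  have hn' : (2 : ℝ) ≤ n := by exact_mod_cast hn
  refine ⟨(∑ _k : Option (Bool × Fin n), 3) * C, ?_, fun ε t b0 hb0 a b c ha hb hc => ?_⟩
  · refine mul_pos ?_ hC
    exact Finset.sum_pos (fun _ _ => by norm_num) Finset.univ_nonempty
  set M := C * |gB ε t b0| ^ (-γ) with hM
  have hM0 : 0 ≤ M := by positivity
  have na := nn_nonneg ε t a; have nb := nn_nonneg ε t b; have nc := nn_nonneg ε t c
  have step : ∀ k, l2 (gop k ε t (T γ a b c)) ≤ 3 * (M * nn ε t a * nn ε t b * nn ε t c) := by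
    intro k
    cases k with
    | none =>
      have := (H (gA ε t b0) _ hb0 a b c ha hb hc).1
      have h2 : l2 (T γ a b c) ≤ M * nn ε t a * nn ε t b * nn ε t c := by
        refine this.trans ?_
        have := nA_le_nn ε t b0 a; have := l2_le_nn ε t b; have := l2_le_nn ε t c
        have := l2_nonneg b; have := l2_nonneg c
        gcongr
      have : 0 ≤ M * nn ε t a * nn ε t b * nn ε t c := by positivity
      simp only [gop]; linarith
    | some p =>
      have e : gop (some p) ε t (T γ a b c) = fun x => (T γ (gop (some p) ε t a) b c x
          - T γ a (gop (some p) ε t b) c x) + T γ a b (gop (some p) ε t c) x := by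
        ext x
        exact T_leib (by omega) h0.le (by linarith) ha hb hc _ _ _ x
      have sa := ha.gop (some p) ε t
      have sb := hb.gop (some p) ε t
      have sc := hc.gop (some p) ε t
      have t1 := T_isS (γ := γ) (by omega) h0.le (by linarith) sa hb hc
      have t2 := T_isS (γ := γ) (by omega) h0.le (by linarith) ha sb hc
      have t3 := T_isS (γ := γ) (by omega) h0.le (by linarith) ha hb sc
      rw [e]
      refine (l2_add (t1.sub t2).memLp t3.memLp).trans ?_
      have q0 := l2_sub t1.memLp t2.memLp
      have q1 := (H (gA ε t b0) _ hb0 _ b c sa hb hc).2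
      have q2 := (H (gA ε t b0) _ hb0 a _ c ha sb hc).1
      have q3 := (H (gA ε t b0) _ hb0 a b _ ha hb sc).1
      have ea := l2_gop_le_nn (some p) ε t a
      have eb := l2_gop_le_nn (some p) ε t b
      have ec := l2_gop_le_nn (some p) ε t c
      have fa := nA_le_nn ε t b0 a
      have fb := nA_le_nn ε t b0 b
      have ga := l2_le_nn ε t a; have gb := l2_le_nn ε t b; have gc := l2_le_nn ε t c
      have pa := l2_nonneg a; have pb := l2_nonneg b; have pc := l2_nonneg c
      have ra := l2_nonneg (gop (some p) ε t a)
      have rb := l2_nonneg (gop (some p) ε t b)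
      have rc := l2_nonneg (gop (some p) ε t c)
      have ma := nA_nonneg (gA ε t b0) (gB ε t b0) a
      have mb := nA_nonneg (gA ε t b0) (gB ε t b0) b
      have w1 : M * l2 (gop (some p) ε t a) * nA (gA ε t b0) (gB ε t b0) b * l2 c
        ≤ M * nn ε t a * nn ε t b * nn ε t c := by gcongr
      have w2 : M * nA (gA ε t b0) (gB ε t b0) a * l2 (gop (some p) ε t b) * l2 c
        ≤ M * nn ε t a * nn ε t b * nn ε t c := by gcongr
      have w3 : M * nA (gA ε t b0) (gB ε t b0) a * l2 b * l2 (gop (some p) ε t c)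
        ≤ M * nn ε t a * nn ε t b * nn ε t c := by gcongr
      linarith
  refine (Finset.sum_le_sum fun k _ => step k).trans ?_
  rw [← Finset.sum_mul]
  refine le_of_eq ?_
  rw [hM]; ring

theorem gB_big {ε : ℝ} (h0 : 0 < ε) (h1 : ε ≤ 1) (t : ℝ) : ∃ b, ε / 2 ≤ |gB ε t b| := by
  have h := Real.sin_sq_add_cos_sq t
  by_contra! hc
  have a := hc true
  have b := hc false
  simp only [gB, if_true] at a
  simp only [gB, Bool.false_eq_true, if_false, abs_neg, abs_mul, abs_of_pos h0] at b
  have b' : |Real.sin t| < 1 / 2 := by nlinarith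
  have a' : |Real.cos t| < 1 / 2 := by linarith
  have := sq_lt_sq' (by linarith [abs_nonneg (Real.sin t)]) b'
  have := sq_lt_sq' (by linarith [abs_nonneg (Real.cos t)]) a'
  simp only [sq_abs] at *
  linarith

theorem T_bd_eps {γ : ℝ} (hn : 2 ≤ n) (h0 : 0 < γ) (h1 : γ < 1) {ε : ℝ} (he : 0 < ε) (he1 : ε ≤ 1) :
    ∃ C : ℝ, 0 < C ∧ ∀ (t : ℝ), ∀ (a b c : Rn n → ℂ), IsS a → IsS b → IsS c →
    nn ε t (T γ a b c) ≤ C * nn ε t a * nn ε t b * nn ε t c := by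
  obtain ⟨C, hC, H⟩ := T_bd (n := n) hn h0 h1
  refine ⟨C * (ε / 2) ^ (-γ), by positivity, fun t a b c ha hb hc => ?_⟩
  obtain ⟨b0, hb0⟩ := gB_big he he1 t
  have hp : 0 < |gB ε t b0| := lt_of_lt_of_le (by positivity) hb0
  refine (H ε t b0 (abs_pos.1 hp) a b c ha hb hc).trans ?_
  have na := nn_nonneg ε t a; have nb := nn_nonneg ε t b; have nc := nn_nonneg ε t c
  have : |gB ε t b0| ^ (-γ) ≤ (ε / 2) ^ (-γ) :=
    Real.rpow_le_rpow_of_nonpos (by positivity) hb0 (by linarith)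
  gcongr C * ?_ * _ * _ * _

theorem T_diff_bd {γ : ℝ} (hn : 2 ≤ n) (h0 : 0 < γ) (h1 : γ < 1) : ∃ C : ℝ, 0 < C ∧
    ∀ (ε t : ℝ), Real.cos t ≠ 0 → ∀ (a b : Rn n → ℂ), IsS a → IsS b →
    nn ε t (fun x => T γ a a a x - T γ b b b x) ≤
      C * |Real.cos t| ^ (-γ) * nn ε t (fun x => a x - b x) * (nn ε t a + nn ε t b) ^ 2 := by
  obtain ⟨C, hC, H⟩ := T_bd (n := n) hn h0 h1
  have hn' : (2 : ℝ) ≤ n := by exact_mod_cast hn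
  refine ⟨C, hC, fun ε t ht a b ha hb => ?_⟩
  have hab := ha.sub hb
  have e : (fun x => T γ a a a x - T γ b b b x) = fun x => (T γ (fun x => a x - b x) a a x
      + T γ b (fun x => a x - b x) a x) + T γ b b (fun x => a x - b x) x := by
    ext x; exact T_split (by omega) h0.le (by linarith) ha hb x
  rw [e]
  have t1 := T_isS (γ := γ) (by omega) h0.le (by linarith) hab ha ha
  have t2 := T_isS (γ := γ) (by omega) h0.le (by linarith) hb hab ha
  have t3 := T_isS (γ := γ) (by omega) h0.le (by linarith) hb hb hab
  have q1 := H ε t true ht _ a a hab ha ha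
  have q2 := H ε t true ht b _ a hb hab ha
  have q3 := H ε t true ht b b _ hb hb hab
  have r1 := nn_add (t1.add t2) t3 ε t
  have r2 := nn_add t1 t2 ε t
  simp only [gB, if_true] at q1 q2 q3
  have na := nn_nonneg ε t a; have nb := nn_nonneg ε t b
  have nc := nn_nonneg ε t (fun x => a x - b x)
  set M := C * |Real.cos t| ^ (-γ) * nn ε t (fun x => a x - b x) with hM
  have hM0 : 0 ≤ M := by positivity
  have : 0 ≤ M * (nn ε t a * nn ε t b) := by positivity
  calc _ ≤ M * nn ε t a * nn ε t a + M * nn ε t b * nn ε t a + M * nn ε t b * nn ε t b := by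
        rw [hM]; linarith
    _ ≤ _ := by nlinarith

end HW
end

noncomputable section
namespace HW
variable {n : ℕ}

theorem IsS.comp_smul {φ : Rn n → ℂ} (h : IsS φ) {c : ℝ} (hc : c ≠ 0) :
    IsS (fun x => φ (c • x)) := by
  obtain ⟨s, rfl⟩ := h
  exact ⟨SchwartzMap.compCLMOfContinuousLinearEquiv ℝ
    (ContinuousLinearEquiv.smulLeft (Units.mk0 c hc) : Rn n ≃L[ℝ] Rn n) s, by ext x; rfl⟩

theorem pd_comp_smul {φ : Rn n → ℂ} (h : Differentiable ℝ φ) (c : ℝ) (j : Fin n) (x : Rn n) :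
    pd j (fun x => φ (c • x)) x = c * pd j φ (c • x) := by
  unfold pd
  have h1 : HasFDerivAt (fun x : Rn n => c • x) (c • ContinuousLinearMap.id ℝ (Rn n)) x :=
    (hasFDerivAt_id x).const_smul c
  have := (h (c • x)).hasFDerivAt.comp x h1
  have h2 : fderiv ℝ (fun x => φ (c • x)) x = _ := this.fderiv
  rw [h2]; simp

theorem norm_le_sum (x : Rn n) : ‖x‖ ≤ ∑ j, |x j| := by
  refine le_of_sq_le_sq ?_ (Finset.sum_nonneg fun _ _ => abs_nonneg _)
  rw [EuclideanSpace.norm_sq_eq]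
  exact Finset.sum_sq_le_sq_sum_of_nonneg fun _ _ => abs_nonneg _

theorem cutoff (n : ℕ) : ∃ C : ℝ, 0 < C ∧ ∀ R : ℝ, 1 ≤ R → ∃ χ : Rn n → ℂ, IsS χ ∧
    (∃ k : Set (Rn n), IsCompact k ∧ ∀ x, x ∉ k → χ x = 0) ∧
    (∀ x, ‖1 - χ x‖ ≤ (∑ j, |x j|) / R) ∧ (∀ x, ‖χ x‖ ≤ 1) ∧ (∀ j x, ‖pd j χ x‖ ≤ C / R) ∧
    (∀ x, ‖lap χ x‖ ≤ C / R) := by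
  let f : ContDiffBump (0 : Rn n) := ⟨1, 2, by norm_num, by norm_num⟩
  set χ0 : Rn n → ℂ := fun x => ((f x : ℝ) : ℂ) with hχ0
  have hs : IsS χ0 := by
    have h1 : HasCompactSupport χ0 := f.hasCompactSupport.comp_left (g := fun r : ℝ => (r : ℂ)) (by simp)
    have h2 : ContDiff ℝ (⊤ : ℕ∞) χ0 := Complex.ofRealCLM.contDiff.comp f.contDiff
    exact ⟨h1.toSchwartzMap h2, by ext; simp⟩
  choose C hC using fun j => (hs.pd j).bdd
  obtain ⟨L, hL⟩ := hs.lap.bdd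
  refine ⟨(∑ j, |C j|) + |L| + 1, by positivity, fun R hR => ?_⟩
  have hR0 : 0 < R := by linarith
  refine ⟨fun x => χ0 (R⁻¹ • x), hs.comp_smul (by positivity), ⟨Metric.closedBall 0 (2 * R),
    isCompact_closedBall _ _, fun x hx => ?_⟩, fun x => ?_, fun x => ?_, fun j x => ?_, fun x => ?_⟩
  · simp only [Metric.mem_closedBall, dist_zero_right, not_le] at hx
    simp only [hχ0]
    rw [f.zero_of_le_dist]; · simp
    show 2 ≤ _
    rw [dist_zero_right, norm_smul, norm_inv, Real.norm_of_nonneg hR0.le, inv_mul_eq_div,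
      le_div_iff₀ hR0]
    exact hx.le
  · simp only [hχ0]
    rw [← Complex.ofReal_one, ← Complex.ofReal_sub, Complex.norm_real, Real.norm_eq_abs,
      abs_of_nonneg (by linarith [f.le_one (x := R⁻¹ • x)])]
    have hx := norm_le_sum x
    by_cases h : ‖x‖ ≤ R
    · rw [f.one_of_mem_closedBall]
      · simp; positivity
      · show R⁻¹ • x ∈ Metric.closedBall 0 1
        rw [mem_closedBall_zero_iff, norm_smul, norm_inv, Real.norm_of_nonneg hR0.le, inv_mul_eq_div,
          div_le_one hR0]
        exact h
    · rw [le_div_iff₀ hR0]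
      push Not at h
      nlinarith [f.nonneg (x := R⁻¹ • x)]
  · simp only [hχ0, Complex.norm_real, Real.norm_eq_abs]
    rw [abs_of_nonneg f.nonneg]; exact f.le_one
  · rw [pd_comp_smul hs.diff, norm_mul, Complex.norm_real, Real.norm_of_nonneg (by positivity),
      inv_mul_eq_div]
    gcongr
    refine (hC j _).trans ((le_abs_self _).trans ?_)
    have := Finset.single_le_sum (f := fun j => |C j|) (fun _ _ => abs_nonneg _) (Finset.mem_univ j)
    have := abs_nonneg L
    linarith
  · have e : lap (fun x => χ0 (R⁻¹ • x)) x = ((R⁻¹ : ℝ) : ℂ) * (((R⁻¹ : ℝ) : ℂ) * lap χ0 (R⁻¹ • x)) := by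
      rw [lap_eq, lap_eq, Finset.mul_sum, Finset.mul_sum]
      refine Finset.sum_congr rfl fun j _ => ?_
      have : pd j (fun x => χ0 (R⁻¹ • x)) = fun x => ((R⁻¹ : ℝ) : ℂ) * pd j χ0 (R⁻¹ • x) := by
        ext x; exact pd_comp_smul hs.diff _ _ _
      rw [this, pd_cmul ((hs.pd j).comp_smul (by positivity)).diff, pd_comp_smul (hs.pd j).diff]
    rw [e, norm_mul, norm_mul, Complex.norm_real, Real.norm_of_nonneg (by positivity), inv_mul_eq_div]
    gcongr
    have h1 : R⁻¹ ≤ 1 := inv_le_one_of_one_le₀ hR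
    have h2 := hL (R⁻¹ • x)
    have h3 := norm_nonneg (lap χ0 (R⁻¹ • x))
    have h4 : R⁻¹ * ‖lap χ0 (R⁻¹ • x)‖ ≤ ‖lap χ0 (R⁻¹ • x)‖ := mul_le_of_le_one_left h3 h1
    have : 0 ≤ ∑ j, |C j| := by positivity
    linarith [le_abs_self L]

theorem param_ftc {a b : ℝ} (hab : a ≤ b) {g gd : ℝ → Rn n → ℂ} {k : Set (Rn n)} (hk : IsCompact k)
    (hg : ContinuousOn g.uncurry (Set.Icc a b ×ˢ Set.univ))
    (hgd : ContinuousOn gd.uncurry (Set.Icc a b ×ˢ Set.univ))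
    (h0 : ∀ t x, t ∈ Set.Icc a b → x ∉ k → g t x = 0)
    (h0d : ∀ t x, t ∈ Set.Icc a b → x ∉ k → gd t x = 0)
    (hd : ∀ t ∈ Set.Ioo a b, ∀ x, HasDerivAt (fun s => g s x) (gd t x) t) :
    IntervalIntegrable (fun t => ∫ x, gd t x) volume a b ∧
    ∫ t in a..b, ∫ x, gd t x = (∫ x, g b x) - ∫ x, g a x := by
  have c1 := continuousOn_integral_of_compact_support (μ := volume) hk hg h0
  have c2 := continuousOn_integral_of_compact_support (μ := volume) hk hgd h0d
  have ii : IntervalIntegrable (fun t => ∫ x, gd t x) volume a b := c2.intervalIntegrable_of_Icc hab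
  refine ⟨ii, intervalIntegral.integral_eq_sub_of_hasDerivAt_of_le hab c1 (fun t ht => ?_) ii⟩
  have sl : ∀ h : ℝ → Rn n → ℂ, ContinuousOn h.uncurry (Set.Icc a b ×ˢ Set.univ) →
      ∀ t ∈ Set.Icc a b, Continuous (h t) := fun h hh t ht => by
    have : Continuous (fun x : Rn n => h.uncurry (t, x)) :=
      hh.comp_continuous (by fun_prop) (fun x => ⟨ht, trivial⟩)
    exact this
  obtain ⟨M, hM⟩ := ((isCompact_Icc (a := a) (b := b)).prod hk).exists_bound_of_continuousOn
    (hgd.mono (Set.prod_mono le_rfl (Set.subset_univ _)))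
  have key := hasDerivAt_integral_of_dominated_loc_of_deriv_le (μ := volume) (F := g) (F' := gd)
    (x₀ := t) (s := Set.Ioo a b) (bound := fun x => k.indicator (fun _ => M) x)
    (Ioo_mem_nhds ht.1 ht.2) ?_ ?_ ?_ ?_ ?_ ?_
  · exact key.2
  · filter_upwards [Ioo_mem_nhds ht.1 ht.2] with s hs
    exact (sl g hg s ⟨hs.1.le, hs.2.le⟩).aestronglyMeasurable
  · refine (sl g hg t ⟨ht.1.le, ht.2.le⟩).integrable_of_hasCompactSupport ?_
    exact HasCompactSupport.intro hk fun x hx => h0 t x ⟨ht.1.le, ht.2.le⟩ hx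
  · exact (sl gd hgd t ⟨ht.1.le, ht.2.le⟩).aestronglyMeasurable
  · refine Eventually.of_forall fun x s hs => ?_
    by_cases hx : x ∈ k
    · simp only [Set.indicator_of_mem hx]
      exact hM (s, x) ⟨⟨hs.1.le, hs.2.le⟩, hx⟩
    · simp only [Set.indicator_of_notMem hx]
      rw [h0d s x ⟨hs.1.le, hs.2.le⟩ hx]; simp
  · exact (integrable_indicator_iff hk.measurableSet).2 (integrableOn_const hk.measure_ne_top)
  · exact Eventually.of_forall fun x s hs => hd s hs x

/-- solution of the (forced) harmonic Schroedinger equation on a set of times -/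
structure Sol (ε : ℝ) (S : Set ℝ) (z zd F : ℝ → Rn n → ℂ) : Prop where
  isS : ∀ t ∈ S, IsS (z t)
  FS : ∀ t ∈ S, IsS (F t)
  der : ∀ t ∈ S, ∀ x, HasDerivAt (fun s => z s x) (zd t x) t
  cz : ContinuousOn z.uncurry (S ×ˢ Set.univ)
  czd : ContinuousOn zd.uncurry (S ×ˢ Set.univ)
  eq : ∀ t ∈ S, ∀ x, Complex.I * ε * zd t x = -((ε ^ 2 / 2 : ℝ) : ℂ) * lap (z t) x
    + ((‖x‖ ^ 2 / 2 : ℝ) : ℂ) * z t x + ε * F t x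

theorem Sol.mono {ε : ℝ} {S S' : Set ℝ} {z zd F : ℝ → Rn n → ℂ} (h : Sol ε S z zd F)
    (hS : S' ⊆ S) : Sol ε S' z zd F :=
  ⟨fun t ht => h.isS t (hS ht), fun t ht => h.FS t (hS ht), fun t ht => h.der t (hS ht),
    h.cz.mono (Set.prod_mono hS le_rfl), h.czd.mono (Set.prod_mono hS le_rfl),
    fun t ht => h.eq t (hS ht)⟩

theorem lap_sub {φ ψ : Rn n → ℂ} (h : IsS φ) (k : IsS ψ) (x : Rn n) :
    lap (fun x => φ x - ψ x) x = lap φ x - lap ψ x := by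
  rw [lap_eq, lap_eq, lap_eq, ← Finset.sum_sub_distrib]
  refine Finset.sum_congr rfl fun j _ => ?_
  have : pd j (fun x => φ x - ψ x) = fun x => pd j φ x - pd j ψ x := by
    ext x; exact pd_sub h.diff k.diff j x
  rw [this, pd_sub (h.pd j).diff (k.pd j).diff]

theorem lap_add {φ ψ : Rn n → ℂ} (h : IsS φ) (k : IsS ψ) (x : Rn n) :
    lap (fun x => φ x + ψ x) x = lap φ x + lap ψ x := by
  rw [lap_eq, lap_eq, lap_eq, ← Finset.sum_add_distrib]
  refine Finset.sum_congr rfl fun j _ => ?_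
  have : pd j (fun x => φ x + ψ x) = fun x => pd j φ x + pd j ψ x := by
    ext x; exact pd_add h.diff k.diff j x
  rw [this, pd_add (h.pd j).diff (k.pd j).diff]

theorem lap_cmul {φ : Rn n → ℂ} (h : IsS φ) (c : ℂ) (x : Rn n) :
    lap (fun x => c * φ x) x = c * lap φ x := by
  rw [lap_eq, lap_eq, Finset.mul_sum]
  refine Finset.sum_congr rfl fun j _ => ?_
  have : pd j (fun x => c * φ x) = fun x => c * pd j φ x := by
    ext x; exact pd_cmul h.diff c j x
  rw [this, pd_cmul (h.pd j).diff]

theorem lap_mul {φ ψ : Rn n → ℂ} (h : IsS φ) (k : IsS ψ) (x : Rn n) :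
    lap (fun x => φ x * ψ x) x = φ x * lap ψ x + 2 * ∑ j, pd j φ x * pd j ψ x + lap φ x * ψ x := by
  simp only [lap_eq]
  rw [Finset.mul_sum, Finset.mul_sum, Finset.sum_mul, ← Finset.sum_add_distrib, ← Finset.sum_add_distrib]
  refine Finset.sum_congr rfl fun j _ => ?_
  have : pd j (fun x => φ x * ψ x) = fun x => φ x * pd j ψ x + pd j φ x * ψ x := by
    ext x; exact pd_mul h.diff k.diff j x
  rw [this, pd_add (h.mul (k.pd j)).diff ((h.pd j).mul k).diff, pd_mul h.diff (k.pd j).diff,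
    pd_mul (h.pd j).diff k.diff]
  ring

theorem lap_conj {φ : Rn n → ℂ} (h : IsS φ) (x : Rn n) :
    lap (fun x => conj (φ x)) x = conj (lap φ x) := by
  rw [lap_eq, lap_eq, map_sum]
  refine Finset.sum_congr rfl fun j _ => ?_
  have : pd j (fun x => conj (φ x)) = fun x => conj (pd j φ x) := by
    ext x; exact pd_conj h.diff j x
  rw [this, pd_conj (h.pd j).diff]

theorem Sol.sub {ε : ℝ} {S : Set ℝ} {z zd F w wd G : ℝ → Rn n → ℂ} (h : Sol ε S z zd F)
    (k : Sol ε S w wd G) :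
    Sol ε S (fun t x => z t x - w t x) (fun t x => zd t x - wd t x) (fun t x => F t x - G t x) where
  isS t ht := (h.isS t ht).sub (k.isS t ht)
  FS t ht := (h.FS t ht).sub (k.FS t ht)
  der t ht x := (h.der t ht x).sub (k.der t ht x)
  cz := h.cz.sub k.cz
  czd := h.czd.sub k.czd
  eq t ht x := by
    rw [lap_sub (h.isS t ht) (k.isS t ht)]
    linear_combination h.eq t ht x - k.eq t ht x

theorem Sol.add {ε : ℝ} {S : Set ℝ} {z zd F w wd G : ℝ → Rn n → ℂ} (h : Sol ε S z zd F)
    (k : Sol ε S w wd G) :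
    Sol ε S (fun t x => z t x + w t x) (fun t x => zd t x + wd t x) (fun t x => F t x + G t x) where
  isS t ht := (h.isS t ht).add (k.isS t ht)
  FS t ht := (h.FS t ht).add (k.FS t ht)
  der t ht x := (h.der t ht x).add (k.der t ht x)
  cz := h.cz.add k.cz
  czd := h.czd.add k.czd
  eq t ht x := by
    rw [lap_add (h.isS t ht) (k.isS t ht)]
    linear_combination h.eq t ht x + k.eq t ht x

end HW
end

noncomputable section
namespace HW
variable {n : ℕ}

/-- uniform bounds on a test function -/
def TB (B : ℝ) (Θ : Rn n → ℂ) : Prop :=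
  l2 Θ ≤ B ∧ (∀ j, l2 (fun x => ((x j : ℝ) : ℂ) * Θ x) ≤ B) ∧ ∀ j, l2 (pd j Θ) ≤ B

theorem cut_tail {χ g Θ : Rn n → ℂ} {R B B' : ℝ} (hR : 0 < R) (hχ : IsS χ) (hg : MemLp g 2 volume)
    (hΘ : IsS Θ) (h1 : ∀ x, ‖1 - χ x‖ ≤ (∑ j, |x j|) / R) (hB : TB B Θ) (hg2 : l2 g ≤ B') :
    ‖(∫ x, χ x * g x * conj (Θ x)) - dot g Θ‖ ≤ B' * (n * B / R) := by
  have m : MemLp (fun x => (1 - χ x) * Θ x) 2 volume := by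
    have := (hΘ.sub (hχ.mul hΘ)).memLp
    refine this.congr_norm ?_ ?_
    · have hc := hχ.cont; have hd := hΘ.cont
      exact Continuous.aestronglyMeasurable (by fun_prop)
    · exact Eventually.of_forall fun x => by congr 1; ring
  have e : (∫ x, χ x * g x * conj (Θ x)) - dot g Θ = - ∫ x, g x * ((1 - χ x) * conj (Θ x)) := by
    have i1 : Integrable (fun x => χ x * g x * conj (Θ x)) := by
      have := int_mul hg (hχ.mul hΘ.conj).memLp
      refine this.congr (Eventually.of_forall fun x => ?_)
      simp only; ring
    have i2 := int_mul hg (memLp_conj hΘ.memLp)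
    unfold dot
    rw [← integral_sub i1 i2, ← integral_neg]
    congr 1; ext x; ring
  have hl : l2 (fun x => (1 - χ x) * Θ x) ≤ n * B / R := by
    have mj : ∀ j, MemLp (fun x => ((‖((x j : ℝ) : ℂ) * Θ x‖ : ℝ) : ℂ)) 2 volume := fun j =>
      (hΘ.coord j).memLp.norm.ofReal
    have lj : ∀ j, l2 (fun x => ((‖((x j : ℝ) : ℂ) * Θ x‖ : ℝ) : ℂ)) ≤ B := fun j => by
      refine le_trans (le_of_eq ?_) (hB.2.1 j)
      unfold l2; congr 1; exact eLpNorm_congr_norm_ae (by simp)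
    have : l2 (fun x => (1 - χ x) * Θ x) ≤ l2 (fun x => ((R⁻¹ : ℝ) : ℂ) *
        ∑ j, ((‖((x j : ℝ) : ℂ) * Θ x‖ : ℝ) : ℂ)) := by
      refine l2_mono ((memLp_finsetSum Finset.univ fun j _ => mj j).const_mul _) fun x => ?_
      rw [norm_mul, norm_mul, ← Complex.ofReal_sum, Complex.norm_real, Complex.norm_real,
        Real.norm_of_nonneg (by positivity), Real.norm_of_nonneg (by positivity)]
      simp only [norm_mul, Complex.norm_real, Real.norm_eq_abs]
      rw [← Finset.sum_mul, ← mul_assoc, inv_mul_eq_div]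
      exact mul_le_mul_of_nonneg_right (h1 x) (norm_nonneg _)
    refine this.trans ?_
    rw [l2_cmul, Complex.norm_real, Real.norm_of_nonneg (by positivity), inv_mul_eq_div]
    gcongr
    refine (l2_sum _ fun j _ => mj j).trans ((Finset.sum_le_sum fun j _ => lj j).trans ?_)
    simp
  have m2 : MemLp (fun x => (1 - χ x) * conj (Θ x)) 2 volume := by
    refine m.congr_norm ?_ (Eventually.of_forall fun x => by simp)
    have hc := hχ.cont; have hd := hΘ.conj.cont
    exact ((continuous_const.sub hc).mul hd).aestronglyMeasurable
  have l2e : l2 (fun x => (1 - χ x) * conj (Θ x)) = l2 (fun x => (1 - χ x) * Θ x) := by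
    unfold l2; congr 1; exact eLpNorm_congr_norm_ae (by simp)
  rw [e, norm_neg]
  refine (cs hg m2).trans ?_
  rw [l2e]
  exact mul_le_mul hg2 hl (l2_nonneg _) ((l2_nonneg _).trans hg2)

theorem core_pt {ε : ℝ} (he : 0 < ε) {z zd F Θ Θd χ G : Rn n → ℂ} (hz : IsS z) (hF : IsS F) (hG : IsS G)
    (hΘ : IsS Θ) (hχ : IsS χ)
    (eq1 : ∀ x, Complex.I * ε * zd x = -((ε ^ 2 / 2 : ℝ) : ℂ) * lap z x
      + ((‖x‖ ^ 2 / 2 : ℝ) : ℂ) * z x + ε * F x)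
    (eq2 : ∀ x, Complex.I * ε * Θd x = -((ε ^ 2 / 2 : ℝ) : ℂ) * lap Θ x
      + ((‖x‖ ^ 2 / 2 : ℝ) : ℂ) * Θ x + ε * G x)
    {R B C : ℝ} (hR : 0 < R) (hC : 0 < C) (h1 : ∀ x, ‖1 - χ x‖ ≤ (∑ j, |x j|) / R)
    (h2 : ∀ j x, ‖pd j χ x‖ ≤ C / R) (h3 : ∀ x, ‖lap χ x‖ ≤ C / R)
    (bz : l2 z ≤ B) (bF : l2 F ≤ B) (bΘ : TB B Θ) (bG : TB B G) (c : ℂ) :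
    ‖(∫ x, χ x * (zd x * conj (Θ x) + z x * conj (Θd x))) + Complex.I * c‖ ≤
      ‖dot F Θ - dot z G - c‖ + (ε / 2 * (B * ((2 * n + 1) * (C * B))) + 2 * (B * (n * B))) / R := by
  have hB : 0 ≤ B := (l2_nonneg _).trans bz
  set E : Rn n → ℂ := fun x => 2 * ∑ j, pd j χ x * conj (pd j Θ x) + lap χ x * conj (Θ x) with hE
  have ES : IsS E := ((IsS.sum _ fun j _ => (hχ.pd j).mul (hΘ.pd j).conj).cmul 2).add
    (hχ.lap.mul hΘ.conj)
  have i0 : Integrable (fun x => z x * E x) := (hz.mul ES).int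
  have i1 : Integrable (fun x => χ x * F x * conj (Θ x)) := ((hχ.mul hF).mul hΘ.conj).int
  have i5 : Integrable (fun x => χ x * z x * conj (G x)) := ((hχ.mul hz).mul hG.conj).int
  have ib := ibp2 (hχ.mul hΘ.conj) hz
  have i2 : Integrable (fun x => χ x * conj (Θ x) * lap z x) := ((hχ.mul hΘ.conj).mul hz.lap).int
  have i3 : Integrable (fun x => z x * χ x * conj (lap Θ x)) := ((hz.mul hχ).mul hΘ.lap.conj).int
  have i4 : Integrable (fun x => lap (fun x => χ x * conj (Θ x)) x * z x) :=
    ((hχ.mul hΘ.conj).lap.mul hz).int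
  have key : Complex.I * ε * ∫ x, χ x * (zd x * conj (Θ x) + z x * conj (Θd x)) =
      -((ε ^ 2 / 2 : ℝ) : ℂ) * (∫ x, z x * E x) + ε * ((∫ x, χ x * F x * conj (Θ x)) - ∫ x, χ x * z x * conj (G x)) := by
    have e1 : (∫ x, χ x * conj (Θ x) * lap z x) - ∫ x, z x * χ x * conj (lap Θ x)
        = ∫ x, z x * E x := by
      rw [ib, ← integral_sub i4 i3]
      congr 1; ext x
      rw [lap_mul hχ hΘ.conj, lap_conj hΘ]
      have : ∀ j, pd j (fun x => conj (Θ x)) x = conj (pd j Θ x) := fun j => pd_conj hΘ.diff j x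
      simp only [this, hE]; ring
    have i23 : Integrable (fun x => χ x * conj (Θ x) * lap z x - z x * χ x * conj (lap Θ x)) :=
      i2.sub i3
    have i15 : Integrable (fun x => χ x * F x * conj (Θ x) - χ x * z x * conj (G x)) := i1.sub i5
    rw [← e1, ← integral_sub i2 i3, ← integral_sub i1 i5, ← integral_const_mul, ← integral_const_mul, ← integral_const_mul,
      ← integral_add (i23.const_mul _) (i15.const_mul _)]
    congr 1; ext x
    have q1 := eq1 x
    have q2 := congrArg conj (eq2 x)
    simp only [map_mul, map_add, map_neg, Complex.conj_I, Complex.conj_ofReal] at q2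
    linear_combination (χ x * conj (Θ x)) * q1 - χ x * z x * q2
  have lE : l2 E ≤ (2 * n + 1) * (C * B) / R := by
    have s1 : IsS (fun x => ∑ j, pd j χ x * conj (pd j Θ x)) :=
      IsS.sum _ fun j _ => (hχ.pd j).mul (hΘ.pd j).conj
    have hCR : 0 ≤ C / R := by positivity
    refine (l2_add (s1.cmul 2).memLp (hχ.lap.mul hΘ.conj).memLp).trans ?_
    rw [l2_cmul]
    have a1 : l2 (fun x => ∑ j, pd j χ x * conj (pd j Θ x)) ≤ n * (C / R * B) := by
      refine (l2_sum _ fun j _ => ((hχ.pd j).mul (hΘ.pd j).conj).memLp).trans ?_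
      refine (Finset.sum_le_sum (g := fun _ => C / R * B) fun j _ => ?_).trans (by simp)
      refine (l2_mul_le hCR (hΘ.pd j).conj.memLp (h2 j)).trans ?_
      rw [l2_conj]
      exact mul_le_mul_of_nonneg_left (bΘ.2.2 j) hCR
    have a2 : l2 (fun x => lap χ x * conj (Θ x)) ≤ C / R * B := by
      refine (l2_mul_le hCR hΘ.conj.memLp h3).trans ?_
      rw [l2_conj]
      exact mul_le_mul_of_nonneg_left bΘ.1 hCR
    simp only [Complex.norm_ofNat]
    calc _ ≤ 2 * (n * (C / R * B)) + C / R * B := by linarith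
      _ = _ := by ring
  have b1 : ‖∫ x, z x * E x‖ ≤ B * ((2 * n + 1) * (C * B) / R) :=
    (cs hz.memLp ES.memLp).trans (mul_le_mul bz lE (l2_nonneg _) hB)
  have b2 : ‖(∫ x, χ x * F x * conj (Θ x)) - (∫ x, χ x * z x * conj (G x)) - c‖ ≤
      ‖dot F Θ - dot z G - c‖ + 2 * (B * (n * B / R)) := by
    have t1 := cut_tail hR hχ hF.memLp hΘ h1 bΘ bF
    have t2 := cut_tail hR hχ hz.memLp hG h1 bG bz
    have e : (∫ x, χ x * F x * conj (Θ x)) - (∫ x, χ x * z x * conj (G x)) - c = (dot F Θ - dot z G - c) +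
      ((∫ x, χ x * F x * conj (Θ x)) - dot F Θ) - ((∫ x, χ x * z x * conj (G x)) - dot z G) := by ring
    rw [e]
    have h := norm_sub_le ((dot F Θ - dot z G - c) + ((∫ x, χ x * F x * conj (Θ x)) - dot F Θ))
      ((∫ x, χ x * z x * conj (G x)) - dot z G)
    have h' := norm_add_le (dot F Θ - dot z G - c) ((∫ x, χ x * F x * conj (Θ x)) - dot F Θ)
    linarith
  have key2 : Complex.I * ε * ((∫ x, χ x * (zd x * conj (Θ x) + z x * conj (Θd x))) + Complex.I * c) =
      -((ε ^ 2 / 2 : ℝ) : ℂ) * (∫ x, z x * E x) + ε * ((∫ x, χ x * F x * conj (Θ x))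
        - (∫ x, χ x * z x * conj (G x)) - c) := by
    rw [mul_add, key]
    linear_combination (ε : ℂ) * c * Complex.I_sq
  have nk := congrArg norm key2
  rw [norm_mul, norm_mul, Complex.norm_I, Complex.norm_real, Real.norm_of_nonneg he.le, one_mul] at nk
  have nk2 := norm_add_le (-((ε ^ 2 / 2 : ℝ) : ℂ) * (∫ x, z x * E x)) (ε * ((∫ x, χ x * F x * conj (Θ x))
        - (∫ x, χ x * z x * conj (G x)) - c))
  rw [← nk, norm_mul, norm_mul, norm_neg, Complex.norm_real, Complex.norm_real,
    Real.norm_of_nonneg (by positivity), Real.norm_of_nonneg he.le] at nk2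
  have : ε * ‖(∫ x, χ x * (zd x * conj (Θ x) + z x * conj (Θd x))) + Complex.I * c‖ ≤ ε * (
      ‖dot F Θ - dot z G - c‖ + (ε / 2 * (B * ((2 * n + 1) * (C * B))) + 2 * (B * (n * B))) / R) := by
    refine nk2.trans ?_
    have c1 := mul_le_mul_of_nonneg_left b1 (by positivity : 0 ≤ ε ^ 2 / 2)
    have c2 := mul_le_mul_of_nonneg_left b2 he.le
    refine (add_le_add c1 c2).trans (le_of_eq ?_)
    field_simp
    ring
  exact le_of_mul_le_mul_left this he

theorem coreF {ε a b : ℝ} (he : 0 < ε) (hab : a ≤ b) {z zd F Θ Θd G : ℝ → Rn n → ℂ}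
    (hz : Sol ε (Set.Icc a b) z zd F) (hΘ : Sol ε (Set.Icc a b) Θ Θd G) {B : ℝ}
    (bz : ∀ t ∈ Set.Icc a b, l2 (z t) ≤ B) (bF : ∀ t ∈ Set.Icc a b, l2 (F t) ≤ B)
    (bΘ : ∀ t ∈ Set.Icc a b, TB B (Θ t)) (bG : ∀ t ∈ Set.Icc a b, TB B (G t)) (c : ℝ → ℂ) (ic : IntervalIntegrable c volume a b) {K : ℝ → ℝ} {p : ℝ}
    (hK : ∀ t ∈ Set.Icc a b, t ≠ p → ‖dot (F t) (Θ t) - dot (z t) (G t) - c t‖ ≤ K t)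
    (iK : IntervalIntegrable K volume a b) :
    ‖dot (z b) (Θ b) - dot (z a) (Θ a) + Complex.I * ∫ t in a..b, c t‖ ≤ ∫ t in a..b, K t := by
  obtain ⟨C, hC, H⟩ := cutoff n
  have hB : 0 ≤ B := (l2_nonneg _).trans (bz a ⟨le_rfl, hab⟩)
  set D : ℝ := ε / 2 * (B * ((2 * n + 1) * (C * B))) + 2 * (B * (n * B)) with hD
  have hD0 : 0 ≤ D := by positivity
  have main : ∀ R : ℝ, 1 ≤ R → ‖dot (z b) (Θ b) - dot (z a) (Θ a) + Complex.I * ∫ t in a..b, c t‖ ≤ (∫ t in a..b, K t) +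
      ((b - a) * D + 2 * (B * (n * B))) / R := by
    intro R hR
    have hR0 : 0 < R := by linarith
    obtain ⟨χ, hχ, ⟨k, hk, hk0⟩, h1, -, h2, h3⟩ := H R hR
    have hχc := hχ.cont
    have ft := param_ftc hab (g := fun t x => χ x * z t x * conj (Θ t x))
      (gd := fun t x => χ x * (zd t x * conj (Θ t x) + z t x * conj (Θd t x))) hk
      (by
        have c1 : ContinuousOn (fun q : ℝ × Rn n => χ q.2) (Set.Icc a b ×ˢ Set.univ) :=
          (hχc.comp continuous_snd).continuousOn
        exact (c1.mul hz.cz).mul (Complex.continuous_conj.comp_continuousOn hΘ.cz))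
      (by
        have c1 : ContinuousOn (fun q : ℝ × Rn n => χ q.2) (Set.Icc a b ×ˢ Set.univ) :=
          (hχc.comp continuous_snd).continuousOn
        exact c1.mul ((hz.czd.mul (Complex.continuous_conj.comp_continuousOn hΘ.cz)).add
          (hz.cz.mul (Complex.continuous_conj.comp_continuousOn hΘ.czd))))
      (by intro t x _ hx; simp [hk0 x hx]) (by intro t x _ hx; simp [hk0 x hx])
      (by
        intro t ht x
        have ht' : t ∈ Set.Icc a b := ⟨ht.1.le, ht.2.le⟩
        have d1 := hz.der t ht' x
        have d2 : HasDerivAt (fun s => conj (Θ s x)) (conj (Θd t x)) t :=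
          (Complex.conjCLE : ℂ →L[ℝ] ℂ).hasFDerivAt.comp_hasDerivAt t (hΘ.der t ht' x)
        have := (d1.mul d2).const_mul (χ x)
        simpa [mul_assoc] using this)
    obtain ⟨ii, fe⟩ := ft
    have pt : ∀ t ∈ Set.Icc a b, t ≠ p →
        ‖(∫ x, χ x * (zd t x * conj (Θ t x) + z t x * conj (Θd t x))) + Complex.I * c t‖ ≤ K t + D / R := by
      intro t ht htp
      have := core_pt he (hz.isS t ht) (hz.FS t ht) (hΘ.FS t ht) (hΘ.isS t ht) hχ (hz.eq t ht)
        (hΘ.eq t ht) hR0 hC h1 h2 h3 (bz t ht) (bF t ht) (bΘ t ht) (bG t ht) (c t)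
      have := hK t ht htp
      linarith
    have iK2 : IntervalIntegrable (fun t => K t + D / R) volume a b :=
      iK.add intervalIntegrable_const
    have step := intervalIntegral.norm_integral_le_of_norm_le hab (μ := volume)
      (f := fun t => (∫ x, χ x * (zd t x * conj (Θ t x) + z t x * conj (Θd t x))) + Complex.I * c t)
      (g := fun t => K t + D / R) (by
        filter_upwards [Measure.ae_ne volume p] with t htp ht
        exact pt t ⟨ht.1.le, ht.2⟩ htp) iK2
    rw [intervalIntegral.integral_add ii (ic.const_mul _), fe, intervalIntegral.integral_const_mul, intervalIntegral.integral_add iK intervalIntegrable_const] at step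
    simp only [intervalIntegral.integral_const, smul_eq_mul, Complex.real_smul] at step
    have ha : a ∈ Set.Icc a b := ⟨le_rfl, hab⟩
    have hb : b ∈ Set.Icc a b := ⟨hab, le_rfl⟩
    have ta := cut_tail hR0 hχ (hz.isS a ha).memLp (hΘ.isS a ha) h1 (bΘ a ha) (bz a ha)
    have tb := cut_tail hR0 hχ (hz.isS b hb).memLp (hΘ.isS b hb) h1 (bΘ b hb) (bz b hb)
    set X := ∫ x, χ x * z b x * conj (Θ b x)
    set Y := ∫ x, χ x * z a x * conj (Θ a x)
    have e : dot (z b) (Θ b) - dot (z a) (Θ a) + Complex.I * ∫ t in a..b, c t = (X - Y + Complex.I * ∫ t in a..b, c t) - (X - dot (z b) (Θ b))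
      + (Y - dot (z a) (Θ a)) := by ring
    rw [e]
    have n1 := norm_add_le ((X - Y + Complex.I * ∫ t in a..b, c t) - (X - dot (z b) (Θ b))) (Y - dot (z a) (Θ a))
    have n2 := norm_sub_le (X - Y + Complex.I * ∫ t in a..b, c t) (X - dot (z b) (Θ b))
    have e3 : ((b - a) * D + 2 * (B * (n * B))) / R = (b - a) * (D / R) + B * (n * B / R)
      + B * (n * B / R) := by field_simp; ring
    rw [e3]; linarith
  have lim : Tendsto (fun R : ℝ => (∫ t in a..b, K t) + ((b - a) * D + 2 * (B * (n * B))) / R) atTop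
      (𝓝 ((∫ t in a..b, K t) + 0)) :=
    tendsto_const_nhds.add (tendsto_const_nhds.div_atTop tendsto_id)
  rw [add_zero] at lim
  exact ge_of_tendsto lim (by filter_upwards [eventually_ge_atTop 1] with R hR using main R hR)

theorem coreG {ε a b : ℝ} (he : 0 < ε) (hab : a ≤ b) {z zd F Θ Θd G : ℝ → Rn n → ℂ}
    (hz : Sol ε (Set.Icc a b) z zd F) (hΘ : Sol ε (Set.Icc a b) Θ Θd G) {B : ℝ}
    (bz : ∀ t ∈ Set.Icc a b, l2 (z t) ≤ B) (bF : ∀ t ∈ Set.Icc a b, l2 (F t) ≤ B)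
    (bΘ : ∀ t ∈ Set.Icc a b, TB B (Θ t)) (bG : ∀ t ∈ Set.Icc a b, TB B (G t)) (c : ℂ) {K : ℝ → ℝ} {p : ℝ}
    (hK : ∀ t ∈ Set.Icc a b, t ≠ p → ‖dot (F t) (Θ t) - dot (z t) (G t) - c‖ ≤ K t)
    (iK : IntervalIntegrable K volume a b) :
    ‖dot (z b) (Θ b) - dot (z a) (Θ a) + Complex.I * c * ((b - a : ℝ) : ℂ)‖ ≤ ∫ t in a..b, K t := by
  have := coreF he hab hz hΘ bz bF bΘ bG (fun _ => c) intervalIntegrable_const hK iK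
  rw [intervalIntegral.integral_const, Complex.real_smul] at this
  rwa [mul_assoc, mul_comm c]

theorem TB_zero {B : ℝ} (hB : 0 ≤ B) : TB B (fun _ : Rn n => (0 : ℂ)) := by
  refine ⟨by simpa [l2] using hB, fun j => by simpa [l2] using hB, fun j => ?_⟩
  have : pd j (fun _ : Rn n => (0 : ℂ)) = fun _ => 0 := by ext x; simp [pd]
  rw [this]; simpa [l2] using hB

theorem core {ε a b : ℝ} (he : 0 < ε) (hab : a ≤ b) {z zd F Θ Θd : ℝ → Rn n → ℂ}
    (hz : Sol ε (Set.Icc a b) z zd F) (hΘ : Sol ε (Set.Icc a b) Θ Θd (fun _ _ => 0)) {B : ℝ}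
    (bz : ∀ t ∈ Set.Icc a b, l2 (z t) ≤ B) (bF : ∀ t ∈ Set.Icc a b, l2 (F t) ≤ B)
    (bΘ : ∀ t ∈ Set.Icc a b, TB B (Θ t)) {K : ℝ → ℝ} {p : ℝ}
    (hK : ∀ t ∈ Set.Icc a b, t ≠ p → ‖dot (F t) (Θ t)‖ ≤ K t)
    (iK : IntervalIntegrable K volume a b) :
    ‖dot (z b) (Θ b) - dot (z a) (Θ a)‖ ≤ ∫ t in a..b, K t := by
  have hB : 0 ≤ B := (l2_nonneg _).trans (bz a ⟨le_rfl, hab⟩)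
  have := coreG he hab hz hΘ bz bF bΘ (fun _ _ => TB_zero hB) 0 (p := p)
    (fun t ht hp => by simpa [dot] using hK t ht hp) iK
  simpa using this

end HW
end

noncomputable section
namespace HW
variable {n : ℕ}

theorem pow_exp_bd (m : ℕ) {a : ℝ} (ha : 0 < a) (R : ℝ) : ∃ M : ℝ, 0 < M ∧ ∀ r : ℝ, 0 ≤ r →
    (1 + r) ^ m * Real.exp (-a * r ^ 2 + R * r) ≤ M := by
  refine ⟨(m.factorial : ℝ) * Real.exp (1 + (R + 1) ^ 2 / (4 * a)), by positivity, fun r hr => ?_⟩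
  have h1 : (1 + r) ^ m ≤ m.factorial * Real.exp (1 + r) := by
    have := Real.pow_div_factorial_le_exp (1 + r) (by linarith) m
    rwa [div_le_iff₀ (by positivity), mul_comm] at this
  refine (mul_le_mul_of_nonneg_right h1 (by positivity)).trans ?_
  rw [mul_assoc, ← Real.exp_add]
  refine mul_le_mul_of_nonneg_left (Real.exp_le_exp.2 ?_) (by positivity)
  have : (R + 1) * r - a * r ^ 2 ≤ (R + 1) ^ 2 / (4 * a) := by
    rw [le_div_iff₀ (by positivity)]
    nlinarith [sq_nonneg (2 * a * r - (R + 1))]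
  linarith

theorem isS_exp {g : Rn n → ℝ} (hg : g.HasTemperateGrowth) {a R K : ℝ} (ha : 0 < a)
    (h : ∀ x, g x ≤ -a * ‖x‖ ^ 2 + R * ‖x‖ + K) : IsS (fun x => ((Real.exp (g x) : ℝ) : ℂ)) := by
  have hd : ContDiff ℝ (⊤ : ℕ∞) (fun x => Real.exp (g x)) := Real.contDiff_exp.comp hg.1
  have dec : ∀ k m : ℕ, ∃ C : ℝ, ∀ x, ‖x‖ ^ k * ‖iteratedFDeriv ℝ m (fun x => Real.exp (g x)) x‖ ≤ C := by
    intro k m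
    obtain ⟨p, C, hC, hb⟩ := hg.norm_iteratedFDeriv_le_uniform m
    obtain ⟨M, hM, hMb⟩ := pow_exp_bd (k + p * m) ha R
    refine ⟨m.factorial * (C + 1) ^ m * Real.exp K * M, fun x => ?_⟩
    have key := norm_iteratedFDeriv_comp_le (𝕜 := ℝ) (n := m) (N := (⊤ : ℕ∞)) Real.contDiff_exp hg.1
      (by exact_mod_cast le_top) x (C := Real.exp (g x)) (D := (C + 1) * (1 + ‖x‖) ^ p)
      (fun i _ => by
        rw [norm_iteratedFDeriv_eq_norm_iteratedDeriv, iteratedDeriv_eq_iterate, Real.iter_deriv_exp]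
        simp)
      (fun i hi him => by
        have h1 : 1 ≤ (1 + ‖x‖) ^ p := one_le_pow₀ (by linarith [norm_nonneg x])
        have h2 : 1 ≤ (C + 1) * (1 + ‖x‖) ^ p := by nlinarith
        refine (hb i him x).trans ?_
        calc C * (1 + ‖x‖) ^ p ≤ (C + 1) * (1 + ‖x‖) ^ p := by gcongr; linarith
          _ ≤ _ := le_self_pow₀ h2 (by omega))
    have e : (Real.exp ∘ g) = fun x => Real.exp (g x) := rfl
    rw [e] at key
    calc _ ≤ (1 + ‖x‖) ^ k * (m.factorial * Real.exp (g x) * ((C + 1) * (1 + ‖x‖) ^ p) ^ m) := by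
          refine mul_le_mul ?_ key (norm_nonneg _) (by positivity)
          gcongr; linarith [norm_nonneg x]
      _ = m.factorial * (C + 1) ^ m * ((1 + ‖x‖) ^ (k + p * m) * Real.exp (g x)) := by
          rw [mul_pow, ← pow_mul, pow_add]; ring
      _ ≤ m.factorial * (C + 1) ^ m * (Real.exp K * ((1 + ‖x‖) ^ (k + p * m)
            * Real.exp (-a * ‖x‖ ^ 2 + R * ‖x‖))) := by
          refine mul_le_mul_of_nonneg_left ?_ (by positivity)
          rw [mul_left_comm, ← Real.exp_add]
          refine mul_le_mul_of_nonneg_left (Real.exp_le_exp.2 ?_) (by positivity)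
          linarith [h x]
      _ ≤ m.factorial * (C + 1) ^ m * (Real.exp K * M) := by
          refine mul_le_mul_of_nonneg_left (mul_le_mul_of_nonneg_left (hMb _ (norm_nonneg x))
            (by positivity)) (by positivity)
      _ = _ := by ring
  have hr : Function.HasTemperateGrowth (fun x : ℝ => (x : ℂ)) :=
    Function.Complex.hasTemperateGrowth_ofReal
  refine ⟨⟨fun x => ((Real.exp (g x) : ℝ) : ℂ), Complex.ofRealCLM.contDiff.comp hd, fun k m => ?_⟩, rfl⟩
  obtain ⟨C, hC⟩ := dec k m
  refine ⟨C, fun x => ?_⟩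
  have : iteratedFDeriv ℝ m (fun x => ((Real.exp (g x) : ℝ) : ℂ)) x =
      Complex.ofRealCLM.compContinuousMultilinearMap (iteratedFDeriv ℝ m (fun x => Real.exp (g x)) x) :=
    ContinuousLinearMap.iteratedFDeriv_comp_left Complex.ofRealCLM (hd.contDiffAt) (by exact_mod_cast le_top)
  rw [this]
  refine le_trans (mul_le_mul_of_nonneg_left
    (ContinuousLinearMap.norm_compContinuousMultilinearMap_le _ _) (by positivity)) ?_
  rw [Complex.ofRealCLM_norm, one_mul]
  exact hC x

/-- reference Gaussian -/
def G0 (x : Rn n) : ℂ := ((Real.exp (-(1/4) * ‖x‖ ^ 2) : ℝ) : ℂ)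

theorem G0_isS : IsS (G0 : Rn n → ℂ) := by
  refine isS_exp (a := 1/4) (R := 0) (K := 0) ?_ (by norm_num) (fun x => by linarith)
  exact (Function.HasTemperateGrowth.const _).mul (Function.hasTemperateGrowth_norm_sq (H := Rn n))

theorem dom (m : ℕ) (R : ℝ) : ∃ M : ℝ, 0 < M ∧ ∀ x : Rn n,
    (1 + ‖x‖) ^ m * Real.exp (-(1/2) * ‖x‖ ^ 2 + R * ‖x‖) ≤ M * ‖G0 x‖ := by
  obtain ⟨M, hM, h⟩ := pow_exp_bd m (by norm_num : (0 : ℝ) < 1/4) R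
  refine ⟨M, hM, fun x => ?_⟩
  rw [G0, Complex.norm_real, Real.norm_of_nonneg (by positivity)]
  refine le_trans (le_of_eq ?_) (mul_le_mul_of_nonneg_right (h ‖x‖ (norm_nonneg x)) (by positivity))
  rw [mul_assoc, ← Real.exp_add]; congr 2; ring

/-- complex Gaussian -/
def gau (q : ℂ) (b : Fin n → ℂ) (c : ℂ) (x : Rn n) : ℂ :=
  Complex.exp (q * ((‖x‖ ^ 2 : ℝ) : ℂ) + ∑ j, b j * ((x j : ℝ) : ℂ) + c)

theorem lin_bd (b : Fin n → ℂ) (x : Rn n) : ‖∑ j, b j * ((x j : ℝ) : ℂ)‖ ≤ (∑ j, ‖b j‖) * ‖x‖ := by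
  rw [Finset.sum_mul]
  refine (norm_sum_le _ _).trans (Finset.sum_le_sum fun j _ => ?_)
  rw [norm_mul, Complex.norm_real, Real.norm_eq_abs]
  refine mul_le_mul_of_nonneg_left ?_ (norm_nonneg _)
  exact abs_le_of_sq_le_sq (sq_coord_le x j) (norm_nonneg _)

theorem gau_norm (q : ℂ) (b : Fin n → ℂ) (c : ℂ) (x : Rn n) :
    ‖gau q b c x‖ = Real.exp (q.re * ‖x‖ ^ 2 + (∑ j, b j * ((x j : ℝ) : ℂ)).re + c.re) := by
  rw [gau, Complex.norm_exp]; simp only [Complex.add_re, Complex.re_mul_ofReal]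

theorem gau_norm_le {q : ℂ} {R K : ℝ} (hq : q.re ≤ -(1/2)) {b : Fin n → ℂ} (hb : ∑ j, ‖b j‖ ≤ R) {c : ℂ}
    (hc : c.re ≤ K) (x : Rn n) :
    ‖gau q b c x‖ ≤ Real.exp K * Real.exp (-(1/2) * ‖x‖ ^ 2 + R * ‖x‖) := by
  rw [gau_norm, ← Real.exp_add]
  refine Real.exp_le_exp.2 ?_
  have h1 := (Complex.re_le_norm _).trans (lin_bd b x)
  have h2 := mul_le_mul_of_nonneg_right hb (norm_nonneg x)
  have h3 := mul_le_mul_of_nonneg_right hq (sq_nonneg ‖x‖)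
  linarith

theorem temp_quad (q : ℝ) (b : Fin n → ℝ) (c : ℝ) :
    (fun x : Rn n => q * ‖x‖ ^ 2 + ∑ j, b j * x j + c).HasTemperateGrowth := by
  refine Function.HasTemperateGrowth.add (Function.HasTemperateGrowth.add
    ((Function.HasTemperateGrowth.const _).mul (Function.hasTemperateGrowth_norm_sq (H := Rn n))) ?_)
    (Function.HasTemperateGrowth.const _)
  refine Function.HasTemperateGrowth.sum fun j _ => (Function.HasTemperateGrowth.const _).mul ?_
  exact (EuclideanSpace.proj j : Rn n →L[ℝ] ℝ).hasTemperateGrowth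

theorem gau_isS {q : ℂ} (hq : q.re < 0) (b : Fin n → ℂ) (c : ℂ) : IsS (gau q b c) := by
  have h1 := isS_exp (temp_quad (n := n) q.re (fun j => (b j).re) c.re) (a := -q.re) (R := ∑ j, ‖b j‖)
    (K := c.re) (by linarith) (fun x => by
      have h1 := (Complex.re_le_norm _).trans (lin_bd b x)
      simp only [Complex.re_sum, Complex.re_mul_ofReal] at h1
      linarith)
  have h2 := temp_cis_comp (temp_quad (n := n) q.im (fun j => (b j).im) c.im)
  have := h1.tmul h2
  convert this using 2 with x
  rw [Complex.ofReal_exp, ← Complex.exp_add, gau]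
  congr 1
  apply Complex.ext
  · simp [Complex.re_sum, Complex.im_sum, -Complex.ofReal_pow]
  · simp [Complex.re_sum, Complex.im_sum, -Complex.ofReal_pow]

theorem pd_gau (q : ℂ) (b : Fin n → ℂ) (c : ℂ) (j : Fin n) (x : Rn n) :
    pd j (gau q b c) x = (2 * q * ((x j : ℝ) : ℂ) + b j) * gau q b c x := by
  have h1 : HasFDerivAt (fun x : Rn n => ((‖x‖ ^ 2 : ℝ) : ℂ))
      (Complex.ofRealCLM.comp (2 • (innerSL ℝ x))) x :=
    Complex.ofRealCLM.hasFDerivAt.comp x (hasStrictFDerivAt_norm_sq x).hasFDerivAt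
  have h2 : ∀ i, HasFDerivAt (fun x : Rn n => ((x i : ℝ) : ℂ))
      (Complex.ofRealCLM.comp (EuclideanSpace.proj i : Rn n →L[ℝ] ℝ)) x := fun i =>
    (Complex.ofRealCLM.comp (EuclideanSpace.proj i : Rn n →L[ℝ] ℝ)).hasFDerivAt
  have h3 := (((h1.const_mul q).add (HasFDerivAt.fun_sum (u := Finset.univ)
    fun i _ => (h2 i).const_mul (b i))).add_const c).cexp
  unfold pd
  have e : gau q b c = fun x => Complex.exp (q * ((‖x‖ ^ 2 : ℝ) : ℂ) + ∑ j, b j * ((x j : ℝ) : ℂ) + c) := rfl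
  have h4 : fderiv ℝ (gau q b c) x = _ := h3.fderiv
  rw [h4]
  simp [EuclideanSpace.inner_single_right, Pi.single_apply]
  have es : ∑ i, b i * (((if i = j then 1 else 0 : ℝ)) : ℂ) = b j := by
    rw [Finset.sum_eq_single j (fun i _ hi => by simp [hi]) (by simp)]; simp
  rw [gau, es]; push_cast; ring

end HW
end

noncomputable section
namespace HW
variable {n : ℕ}

theorem lap_coord {φ : Rn n → ℂ} (h : IsS φ) (j : Fin n) (x : Rn n) :
    lap (fun x => ((x j : ℝ) : ℂ) * φ x) x = ((x j : ℝ) : ℂ) * lap φ x + 2 * pd j φ x := by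
  have e1 : ∀ i, pd i (fun x => ((x j : ℝ) : ℂ) * φ x) =
      fun x => (if j = i then 1 else 0 : ℂ) * φ x + ((x j : ℝ) : ℂ) * pd i φ x := fun i => by
    ext x
    rw [pd_mul (diff_coord j) h.diff]
    rw [show pd i (fun x : Rn n => ((x j : ℝ) : ℂ)) x = _ from pd_coord _ _ _]
    split_ifs <;> ring
  have e2 : ∀ i, pd i (pd i (fun x => ((x j : ℝ) : ℂ) * φ x)) x =
      ((x j : ℝ) : ℂ) * pd i (pd i φ) x + 2 * ((if j = i then 1 else 0 : ℂ) * pd i φ x) := fun i => by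
    rw [e1, pd_add ((h.cmul _).diff) ((h.pd i).coord j).diff, pd_cmul h.diff,
      pd_mul (diff_coord j) (h.pd i).diff]
    rw [show pd i (fun x : Rn n => ((x j : ℝ) : ℂ)) x = _ from pd_coord _ _ _]
    split_ifs <;> ring
  rw [lap_eq, Finset.sum_congr rfl fun i _ => e2 i, Finset.sum_add_distrib, ← Finset.mul_sum,
    ← Finset.mul_sum, lap_eq]
  simp

theorem normsq_c (x : Rn n) : ((‖x‖ ^ 2 : ℝ) : ℂ) = ∑ j, ((x j : ℝ) : ℂ) ^ 2 := by
  rw [EuclideanSpace.norm_sq_eq]; push_cast; 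
  refine Finset.sum_congr rfl fun j _ => ?_
  rw [Real.norm_eq_abs, ← Complex.ofReal_pow, sq_abs, Complex.ofReal_pow]

theorem lap_gau {q : ℂ} (hq : q.re < 0) (b : Fin n → ℂ) (c : ℂ) (x : Rn n) :
    lap (gau q b c) x = (4 * q ^ 2 * ((‖x‖ ^ 2 : ℝ) : ℂ) + 4 * q * (∑ j, b j * ((x j : ℝ) : ℂ))
      + ∑ j, b j ^ 2 + 2 * n * q) * gau q b c x := by
  have hS := gau_isS hq b c
  have e1 : ∀ i, pd i (gau q b c) = fun x => 2 * q * (((x i : ℝ) : ℂ) * gau q b c x) + b i * gau q b c x :=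
    fun i => by ext x; rw [pd_gau]; ring
  have e2 : ∀ i, pd i (pd i (gau q b c)) x = (4 * q ^ 2 * ((x i : ℝ) : ℂ) ^ 2
      + 4 * q * (b i * ((x i : ℝ) : ℂ)) + b i ^ 2 + 2 * q) * gau q b c x := fun i => by
    rw [e1, pd_add (((hS.coord i).cmul _).diff) (hS.cmul _).diff, pd_cmul (hS.coord i).diff,
      pd_cmul hS.diff, pd_mul (diff_coord i) hS.diff, pd_gau]
    rw [show pd i (fun x : Rn n => ((x i : ℝ) : ℂ)) x = _ from pd_coord _ _ _]
    simp; ring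
  rw [lap_eq, Finset.sum_congr rfl fun i _ => e2 i, ← Finset.sum_mul, normsq_c]
  simp only [Finset.sum_add_distrib, ← Finset.mul_sum, Finset.sum_const, Finset.card_univ,
    Fintype.card_fin, nsmul_eq_mul]
  ring

/-- first order polynomial times Gaussian -/
def mg (j : Fin n) (m0 m1 q : ℂ) (b : Fin n → ℂ) (c : ℂ) (x : Rn n) : ℂ :=
  m0 * gau q b c x + m1 * (((x j : ℝ) : ℂ) * gau q b c x)

theorem mg_isS (j : Fin n) (m0 m1 : ℂ) {q : ℂ} (hq : q.re < 0) (b : Fin n → ℂ) (c : ℂ) :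
    IsS (mg j m0 m1 q b c) :=
  ((gau_isS hq b c).cmul m0).add (((gau_isS hq b c).coord j).cmul m1)

theorem lap_mg (j : Fin n) (m0 m1 : ℂ) {q : ℂ} (hq : q.re < 0) (b : Fin n → ℂ) (c : ℂ) (x : Rn n) :
    lap (mg j m0 m1 q b c) x = ((m0 + m1 * ((x j : ℝ) : ℂ)) * (4 * q ^ 2 * ((‖x‖ ^ 2 : ℝ) : ℂ)
      + 4 * q * (∑ j, b j * ((x j : ℝ) : ℂ)) + ∑ j, b j ^ 2 + 2 * n * q)
      + 2 * m1 * (2 * q * ((x j : ℝ) : ℂ) + b j)) * gau q b c x := by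
  have hS := gau_isS hq b c
  have := lap_add (hS.cmul m0) ((hS.coord j).cmul m1) x
  have e : mg j m0 m1 q b c = fun x => m0 * gau q b c x + m1 * (((x j : ℝ) : ℂ) * gau q b c x) := rfl
  rw [e, this, lap_cmul hS, lap_cmul (hS.coord j), lap_coord hS, lap_gau hq, pd_gau]
  ring

theorem mg_sol {ε : ℝ} (he : 0 < ε) {S : Set ℝ} (j : Fin n) {m0 m1 q c : ℝ → ℂ} {b : ℝ → Fin n → ℂ}
    (hre : ∀ t ∈ S, (q t).re < 0)
    (hq : ∀ t ∈ S, HasDerivAt q (2 * Complex.I * ε * q t ^ 2 - Complex.I / (2 * ε)) t)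
    (hb : ∀ t ∈ S, ∀ i, HasDerivAt (fun t => b t i) (2 * Complex.I * ε * q t * b t i) t)
    (hc : ∀ t ∈ S, HasDerivAt c (Complex.I * ε / 2 * ∑ i, b t i ^ 2 + Complex.I * ε * n * q t) t)
    (hm1 : ∀ t ∈ S, HasDerivAt m1 (2 * Complex.I * ε * q t * m1 t) t)
    (hm0 : ∀ t ∈ S, HasDerivAt m0 (Complex.I * ε * m1 t * b t j) t) :
    ∃ zd, Sol ε S (fun t => mg j (m0 t) (m1 t) (q t) (b t) (c t)) zd (fun _ _ => 0) := by
  have cq : ContinuousOn (fun p : ℝ × Rn n => q p.1) (S ×ˢ Set.univ) :=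
    ContinuousOn.comp (t := S) (fun t ht => (hq t ht).continuousAt.continuousWithinAt)
      continuous_fst.continuousOn (fun p hp => hp.1)
  have cc : ContinuousOn (fun p : ℝ × Rn n => c p.1) (S ×ˢ Set.univ) :=
    ContinuousOn.comp (t := S) (fun t ht => (hc t ht).continuousAt.continuousWithinAt)
      continuous_fst.continuousOn (fun p hp => hp.1)
  have c0 : ContinuousOn (fun p : ℝ × Rn n => m0 p.1) (S ×ˢ Set.univ) :=
    ContinuousOn.comp (t := S) (fun t ht => (hm0 t ht).continuousAt.continuousWithinAt)
      continuous_fst.continuousOn (fun p hp => hp.1)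
  have c1 : ContinuousOn (fun p : ℝ × Rn n => m1 p.1) (S ×ˢ Set.univ) :=
    ContinuousOn.comp (t := S) (fun t ht => (hm1 t ht).continuousAt.continuousWithinAt)
      continuous_fst.continuousOn (fun p hp => hp.1)
  have cb : ∀ i, ContinuousOn (fun p : ℝ × Rn n => b p.1 i) (S ×ˢ Set.univ) := fun i =>
    ContinuousOn.comp (g := fun t => b t i) (t := S)
      (fun t ht => (hb t ht i).continuousAt.continuousWithinAt)
      continuous_fst.continuousOn (fun p hp => hp.1)
  have cx : ∀ i, ContinuousOn (fun p : ℝ × Rn n => ((p.2 i : ℝ) : ℂ)) (S ×ˢ Set.univ) := fun i =>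
    (by fun_prop : Continuous (fun p : ℝ × Rn n => ((p.2 i : ℝ) : ℂ))).continuousOn
  have cn : ContinuousOn (fun p : ℝ × Rn n => ((‖p.2‖ ^ 2 : ℝ) : ℂ)) (S ×ˢ Set.univ) :=
    (by fun_prop : Continuous (fun p : ℝ × Rn n => ((‖p.2‖ ^ 2 : ℝ) : ℂ))).continuousOn
  have cg : ContinuousOn (fun p : ℝ × Rn n => gau (q p.1) (b p.1) (c p.1) p.2) (S ×ˢ Set.univ) := by
    refine ContinuousOn.cexp (((cq.mul cn).add ?_).add cc)
    exact continuousOn_finsetSum _ fun i _ => (cb i).mul (cx i)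
  refine ⟨fun t x => ((Complex.I * ε * m1 t * b t j) + 2 * Complex.I * ε * q t * m1 t * ((x j : ℝ) : ℂ)
    + (m0 t + m1 t * ((x j : ℝ) : ℂ)) *
      ((2 * Complex.I * ε * q t ^ 2 - Complex.I / (2 * ε)) * ((‖x‖ ^ 2 : ℝ) : ℂ)
        + ∑ i, 2 * Complex.I * ε * q t * b t i * ((x i : ℝ) : ℂ)
        + (Complex.I * ε / 2 * ∑ i, b t i ^ 2 + Complex.I * ε * n * q t))) * gau (q t) (b t) (c t) x,
    ⟨fun t ht => mg_isS j _ _ (hre t ht) _ _, fun t ht => IsS.zero, fun t ht x => ?_,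
    (c0.mul cg).add (c1.mul ((cx j).mul cg)), ?_, fun t ht x => ?_⟩⟩
  · have d1 := ((((hq t ht).mul_const ((‖x‖ ^ 2 : ℝ) : ℂ)).add (HasDerivAt.fun_sum (u := Finset.univ)
      fun i _ => (hb t ht i).mul_const ((x i : ℝ) : ℂ))).add (hc t ht)).cexp
    have d2 := ((hm0 t ht).mul d1).add ((hm1 t ht).mul (d1.const_mul ((x j : ℝ) : ℂ)))
    have e : (fun s => mg j (m0 s) (m1 s) (q s) (b s) (c s) x) = fun s => m0 s *
      Complex.exp (q s * ((‖x‖ ^ 2 : ℝ) : ℂ) + ∑ i, b s i * ((x i : ℝ) : ℂ) + c s) + m1 s *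
      (((x j : ℝ) : ℂ) * Complex.exp (q s * ((‖x‖ ^ 2 : ℝ) : ℂ) + ∑ i, b s i * ((x i : ℝ) : ℂ) + c s)) := rfl
    rw [e]
    refine d2.congr_deriv ?_
    simp only [Pi.add_apply, gau]
    ring
  · refine ContinuousOn.mul (ContinuousOn.add (ContinuousOn.add ?_ ?_) (ContinuousOn.mul
      (c0.add (c1.mul (cx j))) (ContinuousOn.add (ContinuousOn.add (ContinuousOn.mul ?_ cn) ?_) ?_))) cg
    · exact (continuousOn_const.mul c1).mul (cb j)
    · exact ((continuousOn_const.mul cq).mul c1).mul (cx j)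
    · exact (continuousOn_const.mul (cq.pow 2)).sub continuousOn_const
    · exact continuousOn_finsetSum _ fun i _ => ((continuousOn_const.mul cq).mul (cb i)).mul (cx i)
    · exact (continuousOn_const.mul (continuousOn_finsetSum _ fun i _ => (cb i).pow 2)).add
        (continuousOn_const.mul cq)
  · have hε : (ε : ℂ) ≠ 0 := by exact_mod_cast he.ne'
    rw [lap_mg j _ _ (hre t ht)]
    have es : ∑ i, 2 * Complex.I * ε * q t * b t i * ((x i : ℝ) : ℂ) =
      2 * Complex.I * ε * q t * ∑ i, b t i * ((x i : ℝ) : ℂ) := by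
      rw [Finset.mul_sum]; exact Finset.sum_congr rfl fun i _ => by ring
    rw [es, mg]
    have hI := Complex.I_sq
    push_cast
    generalize (∑ i, b t i * ((x i : ℝ) : ℂ)) = X
    generalize (∑ i, b t i ^ 2) = Y
    generalize gau (q t) (b t) (c t) x = G
    field_simp
    ring_nf
    simp only [hI]
    ring

end HW
end

noncomputable section
namespace HW
variable {n : ℕ}

theorem l2_dom (m : ℕ) (R : ℝ) : ∃ M : ℝ, 0 < M ∧ ∀ (C : ℝ) (h : Rn n → ℂ), 0 ≤ C →
    (∀ x, ‖h x‖ ≤ C * ((1 + ‖x‖) ^ m * Real.exp (-(1/2) * ‖x‖ ^ 2 + R * ‖x‖))) → l2 h ≤ C * M := by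
  obtain ⟨M, hM, hb⟩ := dom (n := n) m R
  refine ⟨M * (l2 (G0 : Rn n → ℂ) + 1), by have := l2_nonneg (G0 : Rn n → ℂ); positivity, fun C h hC hh => ?_⟩
  have := l2_mono (φ := h) (ψ := fun x => ((C * M : ℝ) : ℂ) * G0 x) (G0_isS.cmul _).memLp (fun x => by
    rw [norm_mul, Complex.norm_real, Real.norm_of_nonneg (by positivity), mul_assoc]
    exact (hh x).trans (mul_le_mul_of_nonneg_left (hb x) hC))
  rw [l2_cmul, Complex.norm_real, Real.norm_of_nonneg (by positivity)] at this
  refine this.trans ?_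
  rw [mul_assoc]
  gcongr
  linarith

theorem abs_coord_le (x : Rn n) (j : Fin n) : ‖((x j : ℝ) : ℂ)‖ ≤ ‖x‖ := by
  rw [Complex.norm_real, Real.norm_eq_abs]
  exact abs_le_of_sq_le_sq (sq_coord_le x j) (norm_nonneg _)

theorem mg_TB (R K : ℝ) (hR : 0 ≤ R) : ∃ B : ℝ, ∀ (j : Fin n) (m0 m1 q c : ℂ) (b : Fin n → ℂ),
    ‖m0‖ ≤ R → ‖m1‖ ≤ R → ‖q‖ ≤ R → q.re ≤ -(1/2) → (∑ i, ‖b i‖) ≤ R → c.re ≤ K →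
    TB B (mg j m0 m1 q b c) := by
  obtain ⟨M, hM, hb⟩ := l2_dom (n := n) 2 R
  set C := (R + 3 * R ^ 2) * Real.exp K
  refine ⟨C * M, fun j m0 m1 q c b h0 h1 hq hqr hbb hc => ?_⟩
  have hC : 0 ≤ C := by positivity
  have hE := gau_norm_le hqr hbb hc
  have hm : ∀ x : Rn n, ‖m0 + m1 * ((x j : ℝ) : ℂ)‖ ≤ R * (1 + ‖x‖) := fun x => by
    refine (norm_add_le _ _).trans ?_
    rw [norm_mul]
    have := mul_le_mul h1 (abs_coord_le x j) (norm_nonneg _) hR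
    linarith
  have e : ∀ x, mg j m0 m1 q b c x = (m0 + m1 * ((x j : ℝ) : ℂ)) * gau q b c x := fun x => by
    rw [mg]; ring
  have red : ∀ (φ : Rn n → ℂ) (P : Rn n → ℂ), (∀ x, φ x = P x * gau q b c x) →
      (∀ x, ‖P x‖ ≤ (R + 3 * R ^ 2) * (1 + ‖x‖) ^ 2) → l2 φ ≤ C * M := by
    intro φ P h1 h2
    refine hb C φ hC fun x => ?_
    rw [h1, norm_mul]
    refine (mul_le_mul (h2 x) (hE x) (norm_nonneg _) (by positivity)).trans (le_of_eq ?_)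
    simp only [C]; ring
  refine ⟨red _ _ e fun x => (hm x).trans ?_, fun i => red _ (fun x => ((x i : ℝ) : ℂ) *
    (m0 + m1 * ((x j : ℝ) : ℂ))) (fun x => by rw [e]; ring) fun x => ?_, fun i => red _ (fun x =>
    m0 * (2 * q * ((x i : ℝ) : ℂ) + b i) + m1 * (((x j : ℝ) : ℂ) * (2 * q * ((x i : ℝ) : ℂ) + b i)
      + if j = i then 1 else 0)) (fun x => ?_) fun x => ?_⟩
  · have := norm_nonneg x
    nlinarith [mul_nonneg hR this, sq_nonneg R, mul_nonneg hR (sq_nonneg ‖x‖), mul_nonneg (sq_nonneg R) (sq_nonneg (1 + ‖x‖))]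
  · rw [norm_mul]
    refine (mul_le_mul (abs_coord_le x i) (hm x) (norm_nonneg _) (norm_nonneg _)).trans ?_
    have := norm_nonneg x
    nlinarith [mul_nonneg hR this, mul_nonneg hR (sq_nonneg ‖x‖), mul_nonneg (sq_nonneg R) (sq_nonneg (1 + ‖x‖))]
  · have hre : q.re < 0 := by linarith
    have hS := gau_isS hre b c
    have ee : mg j m0 m1 q b c = fun x => m0 * gau q b c x + m1 * (((x j : ℝ) : ℂ) * gau q b c x) := rfl
    rw [ee, pd_add (hS.cmul _).diff ((hS.coord j).cmul _).diff, pd_cmul hS.diff, pd_cmul (hS.coord j).diff,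
      pd_mul (diff_coord j) hS.diff, pd_gau]
    rw [show pd i (fun x : Rn n => ((x j : ℝ) : ℂ)) x = _ from pd_coord _ _ _]
    split_ifs <;> ring
  · have hbi : ‖b i‖ ≤ R := (Finset.single_le_sum (f := fun i => ‖b i‖) (fun _ _ => norm_nonneg _)
      (Finset.mem_univ i)).trans hbb
    have hx := norm_nonneg x
    have l1 : ‖2 * q * ((x i : ℝ) : ℂ) + b i‖ ≤ 2 * R * ‖x‖ + R := by
      refine (norm_add_le _ _).trans (add_le_add ?_ hbi)
      rw [norm_mul, norm_mul, Complex.norm_ofNat]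
      exact mul_le_mul (by linarith) (abs_coord_le x i) (norm_nonneg _) (by positivity)
    have l2 : ‖(if j = i then 1 else 0 : ℂ)‖ ≤ 1 := by split_ifs <;> simp
    have l3 : ‖m0 * (2 * q * ((x i : ℝ) : ℂ) + b i)‖ ≤ R * (2 * R * ‖x‖ + R) := by
      rw [norm_mul]; exact mul_le_mul h0 l1 (norm_nonneg _) hR
    have l4 : ‖((x j : ℝ) : ℂ) * (2 * q * ((x i : ℝ) : ℂ) + b i)‖ ≤ ‖x‖ * (2 * R * ‖x‖ + R) := by
      rw [norm_mul]; exact mul_le_mul (abs_coord_le x j) l1 (norm_nonneg _) hx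
    have l5 : ‖m1 * (((x j : ℝ) : ℂ) * (2 * q * ((x i : ℝ) : ℂ) + b i) + if j = i then 1 else 0)‖
        ≤ R * (‖x‖ * (2 * R * ‖x‖ + R) + 1) := by
      rw [norm_mul]
      exact mul_le_mul h1 ((norm_add_le _ _).trans (add_le_add l4 l2)) (norm_nonneg _) hR
    refine (norm_add_le _ _).trans ((add_le_add l3 l5).trans ?_)
    nlinarith [mul_nonneg hR hx, mul_nonneg hR (sq_nonneg ‖x‖), mul_nonneg (sq_nonneg R) hx,
      mul_nonneg (sq_nonneg R) (sq_nonneg ‖x‖), sq_nonneg R]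

def lam (ε t : ℝ) : ℂ := ((Real.cos t : ℝ) : ℂ) + Complex.I * ε * ((Real.sin t : ℝ) : ℂ)
def lamd (ε t : ℝ) : ℂ := -((Real.sin t : ℝ) : ℂ) + Complex.I * ε * ((Real.cos t : ℝ) : ℂ)
def gq (ε t : ℝ) : ℂ := Complex.I * lamd ε t / (2 * ε * lam ε t)
def gb (ε : ℝ) (p : Fin n → ℂ) (t : ℝ) (i : Fin n) : ℂ := Complex.I * p i / lam ε t
def gc (ε : ℝ) (p : Fin n → ℂ) (t : ℝ) : ℂ := -(Complex.I * n * π / 4)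
  - n / 2 * Complex.log (-Complex.I * lam ε t)
  - Complex.I * ε / 2 * (∑ i, p i ^ 2) * (((Real.sin t : ℝ) : ℂ) / lam ε t)
/-- explicit Gaussian solutions -/
def psi (ε : ℝ) (p : Fin n → ℂ) (t : ℝ) : Rn n → ℂ := gau (gq ε t) (gb ε p t) (gc ε p t)

theorem sc_c (t : ℝ) : ((Real.sin t : ℝ) : ℂ) ^ 2 + ((Real.cos t : ℝ) : ℂ) ^ 2 = 1 := by
  exact_mod_cast Real.sin_sq_add_cos_sq t

theorem lam_normSq (ε t : ℝ) : Complex.normSq (lam ε t) = Real.cos t ^ 2 + ε ^ 2 * Real.sin t ^ 2 := by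
  rw [lam, Complex.normSq_apply]
  simp only [Complex.add_re, Complex.add_im, Complex.ofReal_re, Complex.ofReal_im, Complex.mul_re,
    Complex.mul_im, Complex.I_re, Complex.I_im]
  ring

theorem lam_ne {ε : ℝ} (he : 0 < ε) (t : ℝ) : lam ε t ≠ 0 := by
  rw [← Complex.normSq_pos, lam_normSq]
  by_cases h : Real.cos t = 0
  · have := Real.sin_sq_add_cos_sq t
    rw [h] at this ⊢
    have : Real.sin t ^ 2 = 1 := by linarith
    rw [this]; positivity
  · positivity

theorem lam_normSq_le {ε : ℝ} (he : 0 < ε) (he1 : ε ≤ 1) (t : ℝ) : Complex.normSq (lam ε t) ≤ 1 := by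
  rw [lam_normSq]
  have := Real.sin_sq_add_cos_sq t
  have h2 : ε ^ 2 ≤ 1 := by nlinarith
  nlinarith [sq_nonneg (Real.sin t)]

theorem gq_re {ε : ℝ} (he : 0 < ε) (t : ℝ) : (gq ε t).re = -1 / (2 * Complex.normSq (lam ε t)) := by
  have h : gq ε t = (Complex.I * lamd ε t * conj (lam ε t)) / ((2 * ε * Complex.normSq (lam ε t) : ℝ) : ℂ) := by
    have h1 := lam_ne he t
    have h2 : conj (lam ε t) ≠ 0 := by simpa using h1
    have hε : (ε : ℂ) ≠ 0 := by exact_mod_cast he.ne'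
    push_cast
    rw [← Complex.mul_conj, gq]
    field_simp
  rw [h, Complex.div_ofReal_re]
  have : (Complex.I * lamd ε t * conj (lam ε t)).re = -ε := by
    simp only [lam, lamd, map_add, map_mul, Complex.conj_ofReal, Complex.conj_I, Complex.add_re, Complex.add_im, Complex.ofReal_re, Complex.ofReal_im, Complex.mul_re,
      Complex.mul_im, Complex.I_re, Complex.I_im, Complex.neg_re, Complex.neg_im]
    linear_combination (-ε) * Real.sin_sq_add_cos_sq t
  have h3 : Complex.normSq (lam ε t) ≠ 0 := by simpa using lam_ne he t
  rw [this]; field_simp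

theorem gq_re_le {ε : ℝ} (he : 0 < ε) (he1 : ε ≤ 1) (t : ℝ) : (gq ε t).re ≤ -(1/2) := by
  rw [gq_re he]
  have h := lam_normSq_le he he1 t
  have h0 : 0 < Complex.normSq (lam ε t) := Complex.normSq_pos.2 (lam_ne he t)
  rw [div_le_iff₀ (by positivity)]; linarith

theorem lam_d (ε t : ℝ) : HasDerivAt (lam ε) (lamd ε t) t := by
  have h1 := (Real.hasDerivAt_cos t).ofReal_comp
  have h2 := (Real.hasDerivAt_sin t).ofReal_comp
  have := h1.add (h2.const_mul (Complex.I * ε))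
  refine this.congr_deriv ?_
  rw [lamd]; push_cast; ring

theorem lamd_d (ε t : ℝ) : HasDerivAt (lamd ε) (-lam ε t) t := by
  have h1 := (Real.hasDerivAt_cos t).ofReal_comp
  have h2 := (Real.hasDerivAt_sin t).ofReal_comp
  have := h2.neg.add (h1.const_mul (Complex.I * ε))
  refine this.congr_deriv ?_
  rw [lam]; push_cast; ring

theorem slit {ε : ℝ} (he : 0 < ε) {t : ℝ} (ht : t ∈ Set.Icc 0 π) : -Complex.I * lam ε t ∈ Complex.slitPlane := by
  rw [Complex.mem_slitPlane_iff]
  simp only [lam, Complex.mul_re, Complex.mul_im, Complex.add_re, Complex.add_im, Complex.neg_re, Complex.neg_im, Complex.I_re, Complex.I_im,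
    Complex.ofReal_re, Complex.ofReal_im]
  by_cases h : Real.cos t = 0
  · left
    have h1 := Real.sin_nonneg_of_nonneg_of_le_pi ht.1 ht.2
    have h2 := Real.sin_sq_add_cos_sq t
    have : 0 < Real.sin t := lt_of_le_of_ne h1 (fun h3 => by rw [← h3, h] at h2; norm_num at h2)
    have := mul_pos he this
    ring_nf; linarith
  · right
    intro h2; apply h; ring_nf at h2; linarith

theorem gq_d {ε : ℝ} (he : 0 < ε) (t : ℝ) :
    HasDerivAt (gq ε) (2 * Complex.I * ε * gq ε t ^ 2 - Complex.I / (2 * ε)) t := by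
  have hl := lam_ne he t
  have hε : (ε : ℂ) ≠ 0 := by exact_mod_cast he.ne'
  have := ((lamd_d ε t).const_mul Complex.I).div ((lam_d ε t).const_mul (2 * (ε : ℂ)))
    (mul_ne_zero (mul_ne_zero two_ne_zero hε) hl)
  refine this.congr_deriv ?_
  rw [gq]
  field_simp
  linear_combination (-lamd ε t ^ 2) * Complex.I_sq

theorem lamd_eq {ε : ℝ} (he : 0 < ε) (t : ℝ) : 2 * Complex.I * ε * gq ε t = - lamd ε t / lam ε t := by
  have hl := lam_ne he t
  have hε : (ε : ℂ) ≠ 0 := by exact_mod_cast he.ne'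
  rw [gq]; field_simp; linear_combination (lamd ε t) * Complex.I_sq

theorem gb_d {ε : ℝ} (he : 0 < ε) (p : Fin n → ℂ) (t : ℝ) (i : Fin n) :
    HasDerivAt (fun t => gb ε p t i) (2 * Complex.I * ε * gq ε t * gb ε p t i) t := by
  have hl := lam_ne he t
  have := (hasDerivAt_const t (Complex.I * p i)).div (lam_d ε t) hl
  refine this.congr_deriv ?_
  rw [lamd_eq he, gb]; field_simp; ring

theorem sl_d {ε : ℝ} (he : 0 < ε) (t : ℝ) :
    HasDerivAt (fun t => ((Real.sin t : ℝ) : ℂ) / lam ε t) (1 / lam ε t ^ 2) t := by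
  have hl := lam_ne he t
  have := (Real.hasDerivAt_sin t).ofReal_comp.div (lam_d ε t) hl
  refine this.congr_deriv ?_
  congr 1
  rw [lam, lamd]; linear_combination sc_c t

theorem cl_d {ε : ℝ} (he : 0 < ε) (t : ℝ) :
    HasDerivAt (fun t => ((Real.cos t : ℝ) : ℂ) / lam ε t) (-Complex.I * ε / lam ε t ^ 2) t := by
  have hl := lam_ne he t
  have := (Real.hasDerivAt_cos t).ofReal_comp.div (lam_d ε t) hl
  refine this.congr_deriv ?_
  congr 1
  rw [lam, lamd, Complex.ofReal_neg]; linear_combination (-Complex.I * ε) * sc_c t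

theorem gc_d {ε : ℝ} (he : 0 < ε) (p : Fin n → ℂ) {t : ℝ} (ht : t ∈ Set.Icc 0 π) :
    HasDerivAt (gc ε p) (Complex.I * ε / 2 * ∑ i, gb ε p t i ^ 2 + Complex.I * ε * n * gq ε t) t := by
  have hl := lam_ne he t
  have h1 := ((lam_d ε t).const_mul (-Complex.I)).clog_real (slit he ht)
  have := ((hasDerivAt_const t (-(Complex.I * n * π / 4))).sub (h1.const_mul ((n : ℂ) / 2))).sub
    ((sl_d he t).const_mul (Complex.I * ε / 2 * (∑ i, p i ^ 2)))
  refine this.congr_deriv ?_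
  have e1 : ∑ i, gb ε p t i ^ 2 = - (∑ i, p i ^ 2) / lam ε t ^ 2 := by
    rw [← Finset.sum_neg_distrib, Finset.sum_div]
    refine Finset.sum_congr rfl fun i _ => ?_
    rw [gb]; field_simp; rw [Complex.I_sq]; ring
  have e2 : Complex.I * ε * n * gq ε t = n / 2 * (- lamd ε t / lam ε t) := by
    rw [← lamd_eq he]; ring
  rw [e1, e2]
  have := Complex.I_ne_zero
  field_simp
  ring

theorem psi_isS {ε : ℝ} (he : 0 < ε) (he1 : ε ≤ 1) (p : Fin n → ℂ) (t : ℝ) : IsS (psi ε p t) :=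
  gau_isS (by have := gq_re_le he he1 t; linarith) _ _

/-- coefficients of `gop k psi` -/
def km0 (k : Option (Bool × Fin n)) (ε : ℝ) (p : Fin n → ℂ) (t : ℝ) : ℂ :=
  match k with
  | none => 1
  | some (true, j) => p j * (((Real.cos t : ℝ) : ℂ) / lam ε t)
  | some (false, j) => -ε * p j * (((Real.sin t : ℝ) : ℂ) / lam ε t)
def km1 (k : Option (Bool × Fin n)) (ε : ℝ) (t : ℝ) : ℂ :=
  match k with
  | none => 0
  | some (true, _) => Complex.I / lam ε t
  | some (false, _) => 1 / lam ε t
def kj (hn : 0 < n) (k : Option (Bool × Fin n)) : Fin n :=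
  match k with
  | none => ⟨0, hn⟩
  | some (_, j) => j

theorem gop_psi (hn : 0 < n) {ε : ℝ} (he : 0 < ε) (p : Fin n → ℂ) (t : ℝ) (k : Option (Bool × Fin n)) :
    gop k ε t (psi ε p t) = mg (kj hn k) (km0 k ε p t) (km1 k ε t) (gq ε t) (gb ε p t) (gc ε p t) := by
  have hl := lam_ne he t
  have hε : (ε : ℂ) ≠ 0 := by exact_mod_cast he.ne'
  have hq := lamd_eq he t
  have hq2 : gq ε t = Complex.I * lamd ε t / (2 * ε * lam ε t) := rfl
  have hsc := sc_c t
  have hI := Complex.I_sq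
  ext x
  rcases k with _ | ⟨b, j⟩
  · simp [gop, mg, km0, km1, psi]
  · have hp : pd j (psi ε p t) x = _ := pd_gau _ _ _ j x
    cases b
    · simp only [gop, Aop, gA, gB, hp, mg, km0, km1, kj, if_false, Bool.false_eq_true]
      have k1 : ((Real.cos t : ℝ) : ℂ) + Complex.I * ε * ((Real.sin t : ℝ) : ℂ) * (2 * gq ε t) = 1 / lam ε t := by
        have : Complex.I * ε * ((Real.sin t : ℝ) : ℂ) * (2 * gq ε t) = ((Real.sin t : ℝ) : ℂ) * (2 * Complex.I * ε * gq ε t) := by ring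
        rw [this, hq]; field_simp; rw [lam, lamd]; linear_combination hsc
      rw [psi, gb]
      push_cast at k1 ⊢
      linear_combination (gau (gq ε t) (gb ε p t) (gc ε p t) x * ((x j : ℝ) : ℂ)) * k1 + (gau (gq ε t) (gb ε p t) (gc ε p t) x * ε * Complex.sin t * p j / lam ε t) * hI
    · simp only [gop, Aop, gA, gB, hp, mg, km0, km1, kj, if_true]
      have k1 : ((Real.sin t : ℝ) : ℂ) / ε - Complex.I * ((Real.cos t : ℝ) : ℂ) * (2 * gq ε t) = Complex.I / lam ε t := by
        rw [hq2]; field_simp; rw [lam, lamd]; linear_combination Complex.I * ε * hsc - (((Real.cos t : ℝ) : ℂ) * (-((Real.sin t : ℝ) : ℂ) + Complex.I * ε * ((Real.cos t : ℝ) : ℂ))) * hI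
      rw [psi, gb]
      push_cast at k1 ⊢
      linear_combination (gau (gq ε t) (gb ε p t) (gc ε p t) x * ((x j : ℝ) : ℂ)) * k1 - (gau (gq ε t) (gb ε p t) (gc ε p t) x * Complex.cos t * p j / lam ε t) * hI

theorem km1_d {ε : ℝ} (he : 0 < ε) (k : Option (Bool × Fin n)) (t : ℝ) :
    HasDerivAt (km1 k ε) (2 * Complex.I * ε * gq ε t * km1 k ε t) t := by
  have hl := lam_ne he t
  rw [lamd_eq he]
  rcases k with _ | ⟨b, j⟩
  · simp only [km1, mul_zero]; exact hasDerivAt_const _ _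
  · cases b
    · have := (hasDerivAt_const t (1 : ℂ)).div (lam_d ε t) hl
      refine this.congr_deriv ?_
      simp only [km1]; field_simp; ring
    · have := (hasDerivAt_const t Complex.I).div (lam_d ε t) hl
      refine this.congr_deriv ?_
      simp only [km1]; field_simp; ring

theorem km0_d (hn : 0 < n) {ε : ℝ} (he : 0 < ε) (p : Fin n → ℂ) (k : Option (Bool × Fin n)) (t : ℝ) :
    HasDerivAt (km0 k ε p) (Complex.I * ε * km1 k ε t * gb ε p t (kj hn k)) t := by
  have hl := lam_ne he t
  have hI := Complex.I_sq
  rcases k with _ | ⟨b, j⟩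
  · simp only [km0, km1, mul_zero, zero_mul]; exact hasDerivAt_const _ _
  · cases b
    · have := (sl_d he t).const_mul (-ε * p j)
      refine this.congr_deriv ?_
      simp only [km1, kj, gb]; field_simp; linear_combination (-(ε * p j)) * hI
    · have := (cl_d he t).const_mul (p j)
      refine this.congr_deriv ?_
      simp only [km1, kj, gb]; field_simp; linear_combination (-(ε * p j)) * hI

theorem gop_psi_sol (hn : 0 < n) {ε : ℝ} (he : 0 < ε) (he1 : ε ≤ 1) (p : Fin n → ℂ) (k : Option (Bool × Fin n)) :
    ∃ zd, Sol ε (Set.Icc 0 π) (fun t => gop k ε t (psi ε p t)) zd (fun _ _ => 0) := by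
  simp only [gop_psi hn he]
  exact mg_sol he _ (fun t _ => by have := gq_re_le he he1 t; linarith) (fun t _ => gq_d he t)
    (fun t _ i => gb_d he p t i) (fun t ht => gc_d he p ht) (fun t _ => km1_d he k t)
    (fun t _ => km0_d hn he p k t)

theorem gop_psi_TB (hn : 0 < n) {ε : ℝ} (he : 0 < ε) (he1 : ε ≤ 1) (p : Fin n → ℂ) (k : Option (Bool × Fin n)) :
    ∃ B, ∀ t ∈ Set.Icc 0 π, TB B (gop k ε t (psi ε p t)) := by
  have bd : ∀ f : ℝ → ℂ, (∀ t ∈ Set.Icc 0 π, ContinuousAt f t) → ∃ R, ∀ t ∈ Set.Icc 0 π, ‖f t‖ ≤ R :=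
    fun f hf => isCompact_Icc.exists_bound_of_continuousOn fun t ht => (hf t ht).continuousWithinAt
  obtain ⟨R0, h0⟩ := bd (km0 k ε p) fun t _ => (km0_d hn he p k t).continuousAt
  obtain ⟨R1, h1⟩ := bd (km1 k ε) fun t _ => (km1_d he k t).continuousAt
  obtain ⟨R2, h2⟩ := bd (gq ε) fun t _ => (gq_d he t).continuousAt
  obtain ⟨R3, h3⟩ := bd (gc ε p) fun t ht => (gc_d he p ht).continuousAt
  choose R4 h4 using fun i => bd (fun t => gb ε p t i) fun t _ => (gb_d he p t i).continuousAt
  set R := |R0| + |R1| + |R2| + ∑ i, |R4 i| with hR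
  have hs : 0 ≤ ∑ i, |R4 i| := by positivity
  obtain ⟨B, hB⟩ := mg_TB (n := n) R R3 (by positivity)
  refine ⟨B, fun t ht => ?_⟩
  rw [gop_psi hn he]
  have a0 := le_abs_self R0; have a1 := le_abs_self R1; have a2 := le_abs_self R2
  have b0 := abs_nonneg R0; have b1 := abs_nonneg R1; have b2 := abs_nonneg R2
  refine hB _ _ _ _ _ _ ?_ ?_ ?_ (gq_re_le he he1 t) ?_ ((Complex.re_le_norm _).trans (h3 t ht))
  · have := h0 t ht; linarith
  · have := h1 t ht; linarith
  · have := h2 t ht; linarith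
  · have := Finset.sum_le_sum (s := Finset.univ) fun i _ => (h4 i t ht).trans (le_abs_self (R4 i))
    linarith

end HW
end

noncomputable section
open scoped FourierTransform
namespace HW
variable {n : ℕ}

theorem fourier_inj {h : Rn n → ℂ} (hi : Integrable h)
    (h0 : ∀ p : Rn n, ∫ x, Complex.exp (-(Complex.I * ((∑ i, p i * x i : ℝ) : ℂ))) * h x = 0) :
    ∀ᵐ x, h x = 0 := by
  have hF : 𝓕 h = 0 := by
    ext w
    rw [Real.fourier_eq', Pi.zero_apply, ← h0 ((2 * π) • w)]
    congr 1; ext v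
    rw [smul_eq_mul]
    congr 2
    have : inner ℝ v w = ∑ i, w i * v i := by simp [PiLp.inner_apply]
    rw [this, ← mul_neg, mul_comm, ← Complex.ofReal_neg]
    congr 2
    simp only [PiLp.smul_apply, smul_eq_mul, mul_assoc, ← Finset.mul_sum]
    ring
  refine ae_eq_zero_of_integral_contDiff_smul_eq_zero hi.locallyIntegrable fun g hg hc => ?_
  have hs : HasCompactSupport (fun x => ((g x : ℝ) : ℂ)) := hc.comp_left (g := fun r : ℝ => (r : ℂ)) (by simp)
  have hd : ContDiff ℝ (⊤ : ℕ∞) (fun x => ((g x : ℝ) : ℂ)) := Complex.ofRealCLM.contDiff.comp hg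
  set φ : SchwartzMap (Rn n) ℂ := hs.toSchwartzMap hd
  have hφ : ∀ x, φ x = ((g x : ℝ) : ℂ) := fun x => rfl
  have e : 𝓕 (𝓕⁻ φ) = φ := FourierTransform.fourier_fourierInv_eq φ
  have fl := VectorFourier.integral_fourierIntegral_smul_eq_flip (L := innerₗ (Rn n)) (μ := volume)
    (ν := volume) (e := 𝐞) (f := (𝓕⁻ φ : SchwartzMap (Rn n) ℂ)) (g := h) Real.continuous_fourierChar
    continuous_inner (SchwartzMap.integrable _) hi
  rw [flip_innerₗ] at fl
  have e1 : VectorFourier.fourierIntegral 𝐞 volume (innerₗ (Rn n)) h = 𝓕 h := rfl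
  have e2 : VectorFourier.fourierIntegral 𝐞 volume (innerₗ (Rn n)) (𝓕⁻ φ : SchwartzMap (Rn n) ℂ) = φ := by
    conv_rhs => rw [← e, SchwartzMap.fourier_coe]
    rfl
  rw [e1, e2, hF] at fl
  simpa [hφ] using fl

theorem gauss_dense (D : (Rn n → ℂ) → Prop) (q : ℂ) (hq : q.re < 0) (h0 : D (fun _ => 0))
    (hadd : ∀ φ ψ, D φ → D ψ → D (fun x => φ x + ψ x)) (hmul : ∀ (c : ℂ) φ, D φ → D (fun x => c * φ x))
    (hm : ∀ φ, D φ → MemLp φ 2 volume)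
    (hg : ∀ p : Rn n, D (gau q (fun i => Complex.I * ((p i : ℝ) : ℂ)) 0))
    {φ : Rn n → ℂ} (hφ : MemLp φ 2 volume) {η : ℝ} (hη : 0 < η) :
    ∃ ψ, D ψ ∧ l2 (fun x => φ x - ψ x) < η := by
  let K : Submodule ℂ (Lp ℂ 2 (volume : Measure (Rn n))) :=
    { carrier := {f | ∃ ψ, D ψ ∧ f =ᵐ[volume] ψ}
      add_mem' := by
        rintro f g ⟨a, ha, ha'⟩ ⟨b, hb, hb'⟩
        refine ⟨_, hadd a b ha hb, ?_⟩
        filter_upwards [ha', hb', Lp.coeFn_add f g] with x h1 h2 h3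
        rw [h3, Pi.add_apply, h1, h2]
      zero_mem' := ⟨_, h0, by filter_upwards [Lp.coeFn_zero ℂ 2 (volume : Measure (Rn n))] with x hx; rw [hx]; rfl⟩
      smul_mem' := by
        rintro c f ⟨a, ha, ha'⟩
        refine ⟨_, hmul c a ha, ?_⟩
        filter_upwards [ha', Lp.coeFn_smul c f] with x h1 h3
        rw [h3, Pi.smul_apply, h1, smul_eq_mul] }
  have hK : K.topologicalClosure = ⊤ := by
    rw [Submodule.topologicalClosure_eq_top_iff, Submodule.eq_bot_iff]
    intro f hf
    rw [Submodule.mem_orthogonal] at hf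
    have hgm : ∀ p : Rn n, MemLp (gau q (fun i => Complex.I * ((p i : ℝ) : ℂ)) 0) 2 volume :=
      fun p => hm _ (hg p)
    have z : ∀ᵐ x, f x * conj (gau q 0 0 x) = 0 := by
      refine fourier_inj ?_ ?_
      · exact int_mul (Lp.memLp f) (memLp_conj (gau_isS hq 0 0).memLp)
      · intro p
        have := hf (MemLp.toLp _ (hgm p)) ⟨_, hg p, MemLp.coeFn_toLp _⟩
        rw [L2.inner_def] at this
        refine Eq.trans (integral_congr_ae ?_) this
        filter_upwards [MemLp.coeFn_toLp (hgm p)] with x hx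
        rw [hx, RCLike.inner_apply]
        have : gau q (fun i => Complex.I * ((p i : ℝ) : ℂ)) 0 x = Complex.exp (Complex.I * ((∑ i, p i * x i : ℝ) : ℂ)) * gau q 0 0 x := by
          rw [gau, gau, ← Complex.exp_add]; congr 1
          push_cast
          simp only [Pi.zero_apply, zero_mul, Finset.sum_const_zero, Finset.mul_sum, mul_assoc]
          ring
        rw [this, map_mul, ← Complex.exp_conj]
        simp only [map_mul, Complex.conj_I, Complex.conj_ofReal]
        rw [neg_mul]; ring
    rw [Lp.eq_zero_iff_ae_eq_zero]
    filter_upwards [z] with x hx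
    have : conj (gau q 0 0 x) ≠ 0 := by simp [gau]
    simpa [this] using hx
  have hmem : MemLp.toLp φ hφ ∈ closure (K : Set (Lp ℂ 2 (volume : Measure (Rn n)))) := by
    rw [← Submodule.topologicalClosure_coe, hK]; trivial
  obtain ⟨f, ⟨ψ, hψ, hfψ⟩, hd⟩ := Metric.mem_closure_iff.1 hmem η hη
  refine ⟨ψ, hψ, ?_⟩
  rw [Lp.dist_def] at hd
  refine lt_of_eq_of_lt ?_ hd
  unfold l2
  congr 1
  refine eLpNorm_congr_ae ?_
  filter_upwards [hfψ, MemLp.coeFn_toLp hφ] with x h1 h2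
  rw [Pi.sub_apply, h1, h2]

end HW
end

noncomputable section
namespace HW
variable {n : ℕ}

theorem l2_dct {ι : Type*} {l : Filter ι} [l.IsCountablyGenerated] {g : ι → Rn n → ℂ} {φ D : Rn n → ℂ}
    (hD : MemLp D 2 volume) (hg : ∀ i, Continuous (g i)) (hφ : Continuous φ)
    (hb : ∀ᶠ i in l, ∀ x, ‖g i x‖ ≤ ‖D x‖) (hp : ∀ x, ‖φ x‖ ≤ ‖D x‖)
    (hl : ∀ x, Tendsto (fun i => g i x) l (𝓝 (φ x))) :
    Tendsto (fun i => l2 (fun x => g i x - φ x)) l (𝓝 0) := by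
  have mφ : MemLp φ 2 volume := hD.mono hφ.aestronglyMeasurable (Eventually.of_forall hp)
  have key : Tendsto (fun i => ∫ x, ‖g i x - φ x‖ ^ 2) l (𝓝 (∫ x : Rn n, (0 : ℝ))) := by
    refine tendsto_integral_filter_of_dominated_convergence (fun x => 4 * ‖D x‖ ^ 2) ?_ ?_ ?_ ?_
    · exact Eventually.of_forall fun i => (((hg i).sub hφ).norm.pow 2).aestronglyMeasurable
    · filter_upwards [hb] with i hi
      refine Eventually.of_forall fun x => ?_
      rw [Real.norm_of_nonneg (sq_nonneg _)]
      have := norm_sub_le (g i x) (φ x)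
      have h1 := hi x
      have h2 := hp x
      have h3 := norm_nonneg (g i x - φ x)
      nlinarith
    · exact ((memLp_two_iff_integrable_sq_norm hD.1).1 hD).const_mul 4
    · refine Eventually.of_forall fun x => ?_
      have := (((hl x).sub_const (φ x)).norm.pow 2)
      simpa using this
  rw [integral_zero] at key
  have k2 := key.sqrt
  rw [Real.sqrt_zero] at k2
  refine k2.congr' ?_
  filter_upwards [hb] with i hi
  have m : MemLp (g i) 2 volume := hD.mono (hg i).aestronglyMeasurable (Eventually.of_forall hi)
  have e := l2_sq (φ := fun x => g i x - φ x) (m.sub mφ)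
  rw [← e, Real.sqrt_sq (l2_nonneg _)]

theorem gau_tendsto {ι : Type*} {l : Filter ι} [l.IsCountablyGenerated] {q c : ι → ℂ} {b : ι → Fin n → ℂ}
    {q0 c0 : ℂ} {b0 : Fin n → ℂ} (hq : Tendsto q l (𝓝 q0)) (hc : Tendsto c l (𝓝 c0))
    (hb : ∀ i, Tendsto (fun t => b t i) l (𝓝 (b0 i))) (hre : ∀ᶠ t in l, (q t).re ≤ -(1/2))
    (hre0 : q0.re ≤ -(1/2)) :
    Tendsto (fun t => l2 (fun x => gau (q t) (b t) (c t) x - gau q0 b0 c0 x)) l (𝓝 0) := by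
  set R := (∑ j, ‖b0 j‖) + 1
  set K := c0.re + 1
  obtain ⟨M, hM, hd⟩ := dom (n := n) 0 R
  have co : ∀ (q c : ℂ) (b : Fin n → ℂ), Continuous (gau q b c) := by
    intro q c b; unfold gau; fun_prop
  have bd : ∀ (q c : ℂ) (b : Fin n → ℂ), q.re ≤ -(1/2) → ∑ j, ‖b j‖ ≤ R → c.re ≤ K → ∀ x,
      ‖gau q b c x‖ ≤ ‖((Real.exp K * M : ℝ) : ℂ) * G0 x‖ := by
    intro q c b h1 h2 h3 x
    refine (gau_norm_le h1 h2 h3 x).trans ?_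
    rw [norm_mul, Complex.norm_real, Real.norm_of_nonneg (by positivity), mul_assoc]
    refine mul_le_mul_of_nonneg_left ?_ (Real.exp_pos _).le
    simpa using hd x
  refine l2_dct (D := fun x => ((Real.exp K * M : ℝ) : ℂ) * G0 x) (G0_isS.cmul _).memLp (fun i => co _ _ _) (co _ _ _) ?_ ?_ ?_
  · have e1 : ∀ᶠ t in l, ∑ j, ‖b t j‖ ≤ R := by
      have : Tendsto (fun t => ∑ j, ‖b t j‖) l (𝓝 (∑ j, ‖b0 j‖)) := tendsto_finsetSum _ fun j _ => (hb j).norm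
      filter_upwards [this.eventually_lt_const (show ∑ j, ‖b0 j‖ < R by simp [R])] with t ht using ht.le
    have e2 : ∀ᶠ t in l, (c t).re ≤ K := by
      have : Tendsto (fun t => (c t).re) l (𝓝 c0.re) := (Complex.continuous_re.tendsto _).comp hc
      filter_upwards [this.eventually_lt_const (show c0.re < K by simp [K])] with t ht using ht.le
    filter_upwards [hre, e1, e2] with t h1 h2 h3 using bd _ _ _ h1 h2 h3
  · exact bd _ _ _ hre0 (by simp [R]) (by simp [K])
  · intro x
    unfold gau
    refine (Complex.continuous_exp.tendsto _).comp ?_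
    exact ((hq.mul_const _).add (tendsto_finsetSum _ fun j _ => (hb j).mul_const _)).add hc

theorem l2_tri {a b c : Rn n → ℂ} (ha : MemLp a 2 volume) (hb : MemLp b 2 volume) (hc : MemLp c 2 volume) :
    l2 (fun x => a x - c x) ≤ l2 (fun x => a x - b x) + l2 (fun x => b x - c x) := by
  have := l2_add (ha.sub hb) (hb.sub hc)
  have e : (fun x => (a - b) x + (b - c) x) = fun x => a x - c x := by ext x; simp
  rw [e] at this
  exact this

theorem l2_comm (a b : Rn n → ℂ) : l2 (fun x => a x - b x) = l2 (fun x => b x - a x) := by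
  rw [← l2_neg]; simp

end HW
end

noncomputable section
namespace HW
variable {n : ℕ}

theorem Sol.cmul {ε : ℝ} {S : Set ℝ} {z zd : ℝ → Rn n → ℂ} (h : Sol ε S z zd (fun _ _ => 0)) (c : ℂ) :
    Sol ε S (fun t x => c * z t x) (fun t x => c * zd t x) (fun _ _ => 0) where
  isS t ht := (h.isS t ht).cmul c
  FS t ht := IsS.zero
  der t ht x := (h.der t ht x).const_mul c
  cz := continuousOn_const.mul h.cz
  czd := continuousOn_const.mul h.czd
  eq t ht x := by
    rw [lap_cmul (h.isS t ht)]
    linear_combination c * h.eq t ht x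

theorem Sol.congr {ε : ℝ} {S : Set ℝ} {z z' zd F : ℝ → Rn n → ℂ} (h : Sol ε S z zd F)
    (e : ∀ t, z' t = z t) : Sol ε S z' zd F := by
  have : z' = z := funext e
  rw [this]; exact h

theorem TB.add {B B' : ℝ} {Θ Θ' : Rn n → ℂ} (h : TB B Θ) (h' : TB B' Θ') (s : IsS Θ) (s' : IsS Θ') :
    TB (B + B') (fun x => Θ x + Θ' x) := by
  refine ⟨(l2_add s.memLp s'.memLp).trans (add_le_add h.1 h'.1), fun j => ?_, fun j => ?_⟩
  · simp only [mul_add]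
    exact (l2_add (s.coord j).memLp (s'.coord j).memLp).trans (add_le_add (h.2.1 j) (h'.2.1 j))
  · rw [show pd j (fun x => Θ x + Θ' x) = fun x => pd j Θ x + pd j Θ' x from
      funext fun x => pd_add s.diff s'.diff j x]
    exact (l2_add (s.pd j).memLp (s'.pd j).memLp).trans (add_le_add (h.2.2 j) (h'.2.2 j))

theorem TB.cmul {B : ℝ} {Θ : Rn n → ℂ} (h : TB B Θ) (s : IsS Θ) (c : ℂ) :
    TB (‖c‖ * B) (fun x => c * Θ x) := by
  refine ⟨?_, fun j => ?_, fun j => ?_⟩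
  · rw [l2_cmul]; exact mul_le_mul_of_nonneg_left h.1 (norm_nonneg _)
  · rw [show (fun x : Rn n => ((x j : ℝ) : ℂ) * (c * Θ x)) = fun x => c * (((x j : ℝ) : ℂ) * Θ x) from
      funext fun x => by ring, l2_cmul]
    exact mul_le_mul_of_nonneg_left (h.2.1 j) (norm_nonneg _)
  · rw [show pd j (fun x => c * Θ x) = fun x => c * pd j Θ x from
      funext fun x => pd_cmul s.diff c j x, l2_cmul]
    exact mul_le_mul_of_nonneg_left (h.2.2 j) (norm_nonneg _)

theorem TB.mono {B B' : ℝ} {Θ : Rn n → ℂ} (h : TB B Θ) (hB : B ≤ B') : TB B' Θ :=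
  ⟨h.1.trans hB, fun j => (h.2.1 j).trans hB, fun j => (h.2.2 j).trans hB⟩

/-- test solutions -/
structure Test (ε : ℝ) (Θ : ℝ → Rn n → ℂ) : Prop where
  isS : ∀ t, IsS (Θ t)
  sol : ∀ k, ∃ zd, Sol ε (Set.Icc 0 π) (fun t => gop k ε t (Θ t)) zd (fun _ _ => 0)
  bd : ∀ k, ∃ B, ∀ t ∈ Set.Icc 0 π, TB B (gop k ε t (Θ t))

theorem Test.add {ε : ℝ} {Θ Θ' : ℝ → Rn n → ℂ} (h : Test ε Θ) (h' : Test ε Θ') :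
    Test ε (fun t x => Θ t x + Θ' t x) where
  isS t := (h.isS t).add (h'.isS t)
  sol k := by
    obtain ⟨zd, s⟩ := h.sol k
    obtain ⟨zd', s'⟩ := h'.sol k
    have := s.add s'
    simp only [add_zero] at this
    exact ⟨_, this.congr fun t => gop_add (h.isS t).diff (h'.isS t).diff k ε t⟩
  bd k := by
    obtain ⟨B, b⟩ := h.bd k
    obtain ⟨B', b'⟩ := h'.bd k
    refine ⟨B + B', fun t ht => ?_⟩
    rw [gop_add (h.isS t).diff (h'.isS t).diff k ε t]
    exact (b t ht).add (b' t ht) ((h.isS t).gop k ε t) ((h'.isS t).gop k ε t)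

theorem Test.cmul {ε : ℝ} {Θ : ℝ → Rn n → ℂ} (h : Test ε Θ) (c : ℂ) :
    Test ε (fun t x => c * Θ t x) where
  isS t := (h.isS t).cmul c
  sol k := by
    obtain ⟨zd, s⟩ := h.sol k
    exact ⟨_, (s.cmul c).congr fun t => gop_cmul (h.isS t).diff c k ε t⟩
  bd k := by
    obtain ⟨B, b⟩ := h.bd k
    refine ⟨‖c‖ * B, fun t ht => ?_⟩
    rw [gop_cmul (h.isS t).diff c k ε t]
    exact (b t ht).cmul ((h.isS t).gop k ε t) c

theorem Test.psi (hn : 0 < n) {ε : ℝ} (he : 0 < ε) (he1 : ε ≤ 1) (p : Fin n → ℂ) :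
    Test ε (psi ε p) :=
  ⟨psi_isS he he1 p, gop_psi_sol hn he he1 p, gop_psi_TB hn he he1 p⟩

theorem test_dense (hn : 0 < n) {ε : ℝ} (he : 0 < ε) (he1 : ε ≤ 1) {t : ℝ}
    {φ : Rn n → ℂ} (hφ : MemLp φ 2 volume) {η : ℝ} (hη : 0 < η) :
    ∃ Θ, Test ε Θ ∧ l2 (fun x => φ x - Θ t x) < η := by
  obtain ⟨ψ, ⟨Θ, h1, rfl⟩, h2⟩ := gauss_dense (fun ψ : Rn n → ℂ => ∃ Θ, Test ε Θ ∧ ψ = Θ t) (gq ε t)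
    (by have := gq_re_le he he1 t; linarith)
    ⟨fun t x => 0 * psi ε 0 t x, (Test.psi hn he he1 0).cmul 0, by simp⟩
    (by rintro _ _ ⟨Θ, h, rfl⟩ ⟨Θ', h', rfl⟩; exact ⟨_, h.add h', rfl⟩)
    (by rintro c _ ⟨Θ, h, rfl⟩; exact ⟨_, h.cmul c, rfl⟩)
    (by rintro _ ⟨Θ, h, rfl⟩; exact (h.isS t).memLp)
    (by
      intro p
      refine ⟨_, (Test.psi hn he he1 (fun i => lam ε t * ((p i : ℝ) : ℂ))).cmul
        (Complex.exp (-(gc ε (fun i => lam ε t * ((p i : ℝ) : ℂ)) t))), ?_⟩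
      ext x
      rw [HW.psi, gau, gau, ← Complex.exp_add]
      congr 1
      have : ∀ i, gb ε (fun i => lam ε t * ((p i : ℝ) : ℂ)) t i = Complex.I * ((p i : ℝ) : ℂ) := by
        intro i; rw [gb]; field_simp [lam_ne he t]
      simp only [this]; ring)
    hφ hη
  exact ⟨Θ, h1, h2⟩

theorem test_bd2 {ε : ℝ} {Θ : ℝ → Rn n → ℂ} (h : Test ε Θ) : ∃ B, ∀ t ∈ Set.Icc 0 π, l2 (Θ t) ≤ B := by
  obtain ⟨B, hB⟩ := h.bd none
  exact ⟨B, fun t ht => (hB t ht).1⟩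

theorem test_dot_aux {ε : ℝ} (he : 0 < ε) {Θ Ψ : ℝ → Rn n → ℂ} (h : Test ε Θ) (h' : Test ε Ψ) {a b : ℝ}
    (ha : 0 ≤ a) (hab : a ≤ b) (hb : b ≤ π) : dot (Ψ b) (Θ b) = dot (Ψ a) (Θ a) := by
  have hs : Set.Icc a b ⊆ Set.Icc 0 π := Set.Icc_subset_Icc ha hb
  obtain ⟨zd, s⟩ := h.sol none
  obtain ⟨zd', s'⟩ := h'.sol none
  obtain ⟨B, hB⟩ := h.bd none
  obtain ⟨B', hB'⟩ := h'.bd none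
  have := core (p := 0) (B := max B (max B' 0)) he hab (s'.mono hs) (s.mono hs) (K := fun _ => 0)
    (fun t ht => (hB' t (hs ht)).1.trans (by simp))
    (fun t ht => by simp [l2])
    (fun t ht => (hB t (hs ht)).mono (by simp))
    (fun t ht _ => by simp [dot]) (by simp)
  simp only [intervalIntegral.integral_zero, norm_le_zero_iff, sub_eq_zero] at this
  exact this

theorem test_l2 {ε : ℝ} (he : 0 < ε) {Θ : ℝ → Rn n → ℂ} (h : Test ε Θ) {a b : ℝ}
    (ha : 0 ≤ a) (hab : a ≤ b) (hb : b ≤ π) : l2 (Θ b) = l2 (Θ a) := by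
  have := test_dot_aux he h h ha hab hb
  rw [dot_self (h.isS _).memLp, dot_self (h.isS _).memLp, Complex.ofReal_inj] at this
  exact (sq_eq_sq₀ (l2_nonneg _) (l2_nonneg _)).1 this

theorem dual_bd (hn : 0 < n) {ε : ℝ} (he : 0 < ε) (he1 : ε ≤ 1) {t : ℝ}
    {h : Rn n → ℂ} (hh : MemLp h 2 volume) {A : ℝ} (hA : 0 ≤ A)
    (H : ∀ Θ, Test ε Θ → ‖dot h (Θ t)‖ ≤ A * l2 (Θ t)) : l2 h ≤ A := by
  have key : ∀ η : ℝ, 0 < η → l2 h ^ 2 ≤ A * l2 h + η * (A + l2 h) := by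
    intro η hη
    obtain ⟨Θ, h1, h2⟩ := test_dense hn he he1 (t := t) hh hη
    have m := (h1.isS t).memLp
    have e : dot h (fun x => h x - Θ t x) = dot h h - dot h (Θ t) := dot_sub_right hh m hh
    have e1 : l2 h ^ 2 = ‖dot h h‖ := by
      rw [dot_self hh, Complex.norm_real, Real.norm_of_nonneg (sq_nonneg _)]
    have e2 : dot h h = dot h (Θ t) + dot h (fun x => h x - Θ t x) := by rw [e]; ring
    have e3 : l2 (Θ t) ≤ l2 h + η := by
      have := l2_sub hh (hh.sub m)
      have r : (fun x => h x - (h - Θ t) x) = Θ t := by ext x; simp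
      rw [r] at this
      have : l2 (h - Θ t) < η := h2
      linarith
    rw [e1, e2]
    refine (norm_add_le _ _).trans ?_
    have b1 := H Θ h1
    have b2 := dot_le hh (hh.sub m)
    have b3 : l2 h * l2 (h - Θ t) ≤ l2 h * η := mul_le_mul_of_nonneg_left (le_of_lt h2) (l2_nonneg _)
    have b4 := mul_le_mul_of_nonneg_left e3 hA
    have b5 : ‖dot h (fun x => h x - Θ t x)‖ ≤ l2 h * η := b2.trans b3
    nlinarith
  have lim : l2 h ^ 2 ≤ A * l2 h := by
    refine le_of_forall_pos_le_add fun δ hδ => ?_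
    have p : 0 < A + l2 h + 1 := by linarith [l2_nonneg h]
    refine (key (δ / (A + l2 h + 1)) (div_pos hδ p)).trans ?_
    have : δ / (A + l2 h + 1) * (A + l2 h) ≤ δ := by
      rw [div_mul_eq_mul_div, div_le_iff₀ p]; nlinarith
    linarith
  by_contra hc
  push Not at hc
  nlinarith

/-- Duhamel estimate, in both time directions -/
theorem lemD (hn : 0 < n) {ε : ℝ} (he : 0 < ε) (he1 : ε ≤ 1) {a b : ℝ} (ha : 0 ≤ a) (hab : a ≤ b)
    (hb : b ≤ π) {z zd F : ℝ → Rn n → ℂ} (hz : Sol ε (Set.Icc a b) z zd F) {B : ℝ}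
    (bz : ∀ t ∈ Set.Icc a b, l2 (z t) ≤ B) (bF : ∀ t ∈ Set.Icc a b, l2 (F t) ≤ B)
    (k : Option (Bool × Fin n)) {Ψ : ℝ → Rn n → ℂ} (hΨ : Test ε Ψ) {K : ℝ → ℝ} {p : ℝ}
    (hK : ∀ t ∈ Set.Icc a b, t ≠ p → l2 (gop k ε t (F t)) ≤ K t)
    (iK : IntervalIntegrable K volume a b) :
    l2 (fun x => gop k ε b (z b) x - Ψ b x) ≤ l2 (fun x => gop k ε a (z a) x - Ψ a x) + ∫ t in a..b, K t
    ∧ l2 (fun x => gop k ε a (z a) x - Ψ a x) ≤ l2 (fun x => gop k ε b (z b) x - Ψ b x) + ∫ t in a..b, K t := by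
  have hs : Set.Icc a b ⊆ Set.Icc 0 π := Set.Icc_subset_Icc ha hb
  have K0 : 0 ≤ ∫ t in a..b, K t := by
    rw [intervalIntegral.integral_of_le hab]
    refine integral_nonneg_of_ae ?_
    filter_upwards [ae_restrict_mem measurableSet_Ioc, ae_restrict_of_ae (Measure.ae_ne volume p)] with t ht hp
    exact (l2_nonneg _).trans (hK t ⟨ht.1.le, ht.2⟩ hp)
  have ma : a ∈ Set.Icc a b := ⟨le_rfl, hab⟩
  have mb : b ∈ Set.Icc a b := ⟨hab, le_rfl⟩
  have Sa := (hz.isS a ma).gop k ε a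
  have Sb := (hz.isS b mb).gop k ε b
  have D : ∀ Θ, Test ε Θ → ‖dot (fun x => gop k ε b (z b) x - Ψ b x) (Θ b)
      - dot (fun x => gop k ε a (z a) x - Ψ a x) (Θ a)‖ ≤ (∫ t in a..b, K t) * l2 (Θ a) := by
    intro Θ hΘ
    obtain ⟨zd', s⟩ := hΘ.sol k
    obtain ⟨B', hB'⟩ := hΘ.bd k
    have c := core (p := p) (B := max B B') he hab hz (s.mono hs) (K := fun t => K t * l2 (Θ a))
      (fun t ht => (bz t ht).trans (le_max_left _ _)) (fun t ht => (bF t ht).trans (le_max_left _ _))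
      (fun t ht => (hB' t (hs ht)).mono (le_max_right _ _))
      (fun t ht hp => by
        rw [← gop_symm (hz.FS t ht) (hΘ.isS t)]
        refine (dot_le ((hz.FS t ht).gop k ε t).memLp (hΘ.isS t).memLp).trans ?_
        rw [test_l2 he hΘ ha ht.1 (hs ht).2]
        exact mul_le_mul_of_nonneg_right (hK t ht hp) (l2_nonneg _))
      (iK.mul_const _)
    rw [intervalIntegral.integral_mul_const] at c
    rw [dot_sub_left Sa.memLp (hΨ.isS a).memLp (hΘ.isS a).memLp,
      dot_sub_left Sb.memLp (hΨ.isS b).memLp (hΘ.isS b).memLp,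
      test_dot_aux he hΘ hΨ ha hab hb, gop_symm (hz.isS a ma) (hΘ.isS a),
      gop_symm (hz.isS b mb) (hΘ.isS b)]
    convert c using 2
    ring
  constructor
  · refine dual_bd (t := b) hn he he1 (Sb.sub (hΨ.isS b)).memLp (add_nonneg (l2_nonneg _) K0) fun Θ hΘ => ?_
    have d := D Θ hΘ
    have e := dot_le (Sa.sub (hΨ.isS a)).memLp (hΘ.isS a).memLp
    have := norm_sub_norm_le (dot (fun x => gop k ε b (z b) x - Ψ b x) (Θ b)) (dot (fun x => gop k ε a (z a) x - Ψ a x) (Θ a))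
    rw [test_l2 he hΘ ha hab hb]
    linarith
  · refine dual_bd (t := a) hn he he1 (Sa.sub (hΨ.isS a)).memLp (add_nonneg (l2_nonneg _) K0) fun Θ hΘ => ?_
    have d := D Θ hΘ
    have e := dot_le (Sb.sub (hΨ.isS b)).memLp (hΘ.isS b).memLp
    have := norm_sub_norm_le (dot (fun x => gop k ε a (z a) x - Ψ a x) (Θ a)) (dot (fun x => gop k ε b (z b) x - Ψ b x) (Θ b))
    rw [norm_sub_rev] at this
    rw [test_l2 he hΘ ha hab hb] at e
    linarith

/-- sum version with zero comparison -/
theorem lemN (hn : 0 < n) {ε : ℝ} (he : 0 < ε) (he1 : ε ≤ 1) {a b : ℝ} (ha : 0 ≤ a) (hab : a ≤ b)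
    (hb : b ≤ π) {z zd F : ℝ → Rn n → ℂ} (hz : Sol ε (Set.Icc a b) z zd F) {B : ℝ}
    (bz : ∀ t ∈ Set.Icc a b, l2 (z t) ≤ B) (bF : ∀ t ∈ Set.Icc a b, l2 (F t) ≤ B)
    {K : ℝ → ℝ} {p : ℝ}
    (hK : ∀ t ∈ Set.Icc a b, t ≠ p → nn ε t (F t) ≤ K t)
    (iK : IntervalIntegrable K volume a b) :
    nn ε b (z b) ≤ nn ε a (z a) + Fintype.card (Option (Bool × Fin n)) * ∫ t in a..b, K t
    ∧ nn ε a (z a) ≤ nn ε b (z b) + Fintype.card (Option (Bool × Fin n)) * ∫ t in a..b, K t := by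
  have h0 : Test ε (fun t (x : Rn n) => 0 * psi ε 0 t x) := (Test.psi hn he he1 0).cmul 0
  have L := fun k => lemD hn he he1 ha hab hb hz bz bF k h0 (fun t ht hp => (l2_gop_le_nn k ε t _).trans (hK t ht hp)) iK
  simp only [zero_mul, sub_zero] at L
  have e : ∀ c : ℝ, Fintype.card (Option (Bool × Fin n)) * c = ∑ _k : Option (Bool × Fin n), c := by simp
  rw [e, nn, nn, ← Finset.sum_add_distrib, ← Finset.sum_add_distrib]
  exact ⟨Finset.sum_le_sum fun k _ => (L k).1, Finset.sum_le_sum fun k _ => (L k).2⟩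

end HW
end

noncomputable section
namespace HW
variable {n : ℕ}

theorem gA_le {ε t : ℝ} (he : 0 < ε) (he1 : ε ≤ 1) (b : Bool) : |gA ε t b| ≤ 1 / ε := by
  have h1 : (1 : ℝ) ≤ 1 / ε := by rw [le_div_iff₀ he]; linarith
  cases b
  · simp only [gA, Bool.false_eq_true, if_false]; exact (Real.abs_cos_le_one t).trans h1
  · simp only [gA, if_true]; rw [abs_div, abs_of_pos he]
    exact div_le_div_of_nonneg_right (Real.abs_sin_le_one t) he.le

theorem gB_le {ε t : ℝ} (he : 0 < ε) (he1 : ε ≤ 1) (b : Bool) : |gB ε t b| ≤ 1 := by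
  cases b
  · simp only [gB, Bool.false_eq_true, if_false]; rw [abs_neg, abs_mul, abs_of_pos he]
    have := Real.abs_sin_le_one t
    have := abs_nonneg (Real.sin t)
    nlinarith
  · simp only [gB, if_true]; exact Real.abs_cos_le_one t

theorem Aop_l2 {φ : Rn n → ℂ} (h : IsS φ) (α β : ℝ) (j : Fin n) :
    l2 (Aop α β j φ) ≤ |α| * l2 (fun x => ((x j : ℝ) : ℂ) * φ x) + |β| * l2 (pd j φ) := by
  have e : Aop α β j φ = fun x => (α : ℂ) * (((x j : ℝ) : ℂ) * φ x) - (Complex.I * β) * pd j φ x := rfl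
  rw [e]
  refine (l2_sub ((h.coord j).cmul _).memLp ((h.pd j).cmul _).memLp).trans (le_of_eq ?_)
  rw [l2_cmul, l2_cmul, norm_mul]; simp

theorem nn_of_TB {ε t B : ℝ} (he : 0 < ε) (he1 : ε ≤ 1) {φ : Rn n → ℂ} (h : IsS φ) (hb : TB B φ) :
    nn ε t φ ≤ Fintype.card (Option (Bool × Fin n)) * (2 / ε * B) := by
  have hB : 0 ≤ B := (l2_nonneg _).trans hb.1
  have h1 : (1 : ℝ) ≤ 1 / ε := by rw [le_div_iff₀ he]; linarith
  have h2 : 2 / ε = 1 / ε + 1 / ε := by ring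
  unfold nn
  rw [← nsmul_eq_mul, ← Finset.card_univ]
  refine Finset.sum_le_card_nsmul _ _ _ fun k _ => ?_
  cases k with
  | none => refine hb.1.trans ?_; rw [h2]; nlinarith
  | some p =>
    refine (Aop_l2 h _ _ _).trans ?_
    have a := mul_le_mul (gA_le (t := t) he he1 p.1) (hb.2.1 p.2) (l2_nonneg _) (by positivity)
    have b := mul_le_mul (gB_le (t := t) he he1 p.1) (hb.2.2 p.2) (l2_nonneg _) (by positivity)
    rw [h2]; nlinarith

theorem TB_of_nn {ε t : ℝ} (he : 0 < ε) (he1 : ε ≤ 1) {φ : Rn n → ℂ} (h : IsS φ) :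
    TB (2 / ε * nn ε t φ) φ := by
  have h1 : (1 : ℝ) ≤ 1 / ε := by rw [le_div_iff₀ he]; linarith
  have h2 : 2 / ε = 1 / ε + 1 / ε := by ring
  have hN := nn_nonneg ε t φ
  have hg := fun k => l2_gop_le_nn k ε t φ
  have hs : (Complex.sin t) ^ 2 + (Complex.cos t) ^ 2 = 1 := Complex.sin_sq_add_cos_sq _
  have hec : (ε : ℂ) ≠ 0 := by exact_mod_cast he.ne'
  have key : ∀ (c d : ℝ) (j : Fin n), |c| ≤ 1 → |d| ≤ 1 / ε →
      l2 (fun x => (c : ℂ) * gop (some (true, j)) ε t φ x + (d : ℂ) * gop (some (false, j)) ε t φ x)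
        ≤ 2 / ε * nn ε t φ := by
    intro c d j hc hd
    refine (l2_add ((h.gop _ ε t).cmul _).memLp ((h.gop _ ε t).cmul _).memLp).trans ?_
    rw [l2_cmul, l2_cmul, Complex.norm_real, Complex.norm_real, Real.norm_eq_abs, Real.norm_eq_abs]
    have a := mul_le_mul hc (hg (some (true, j))) (l2_nonneg _) (by positivity)
    have b := mul_le_mul hd (hg (some (false, j))) (l2_nonneg _) (by positivity)
    rw [h2]; nlinarith
  refine ⟨?_, fun j => ?_, fun j => ?_⟩
  · refine (l2_le_nn ε t φ).trans ?_; rw [h2]; nlinarith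
  · have e := key (ε * Real.sin t) (Real.cos t) j
      (by have := gB_le (t := t) he he1 false; simpa [gB] using this) ((Real.abs_cos_le_one t).trans h1)
    refine le_trans (le_of_eq ?_) e
    congr 1; ext x
    simp only [gop, Aop, gA, gB, if_true, Bool.false_eq_true, if_false]
    push_cast
    field_simp
    linear_combination -(((x j : ℝ) : ℂ) * φ x) * hs
  · have e := key (Real.cos t) (-(Real.sin t / ε)) j (Real.abs_cos_le_one t)
      (by rw [abs_neg, abs_div, abs_of_pos he]; exact div_le_div_of_nonneg_right (Real.abs_sin_le_one t) he.le)
    refine le_trans (le_of_eq ?_) e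
    rw [show l2 (pd j φ) = l2 (fun x => (-Complex.I) * pd j φ x) by rw [l2_cmul]; simp]
    congr 1; ext x
    simp only [gop, Aop, gA, gB, if_true, Bool.false_eq_true, if_false]
    push_cast
    field_simp
    linear_combination ((ε : ℂ) * Complex.I * pd j φ x) * hs

theorem IsS.exTB {φ : Rn n → ℂ} (h : IsS φ) : ∃ B, TB B φ := ⟨_, TB_of_nn (ε := 1) (t := 0) one_pos le_rfl h⟩

/-- static forcing -/
def Gs (ε : ℝ) (φ : Rn n → ℂ) (x : Rn n) : ℂ :=
  ((ε / 2 : ℝ) : ℂ) * lap φ x - ((1 / (2 * ε) : ℝ) : ℂ) * (((‖x‖ ^ 2 : ℝ) : ℂ) * φ x)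

theorem normsq_sum (x : Rn n) : ((‖x‖ ^ 2 : ℝ) : ℂ) = ∑ j, ((x j : ℝ) : ℂ) * ((x j : ℝ) : ℂ) := by
  rw [EuclideanSpace.norm_sq_eq]; push_cast
  refine Finset.sum_congr rfl fun j _ => ?_
  rw [← Complex.ofReal_pow, Real.norm_eq_abs, sq_abs]; push_cast; ring

theorem IsS.normsq {φ : Rn n → ℂ} (h : IsS φ) : IsS (fun x => ((‖x‖ ^ 2 : ℝ) : ℂ) * φ x) := by
  have : (fun x => ((‖x‖ ^ 2 : ℝ) : ℂ) * φ x) = fun x => ∑ j, ((x j : ℝ) : ℂ) * (((x j : ℝ) : ℂ) * φ x) := by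
    ext x; rw [normsq_sum, Finset.sum_mul]; exact Finset.sum_congr rfl fun j _ => by ring
  rw [this]
  exact IsS.sum _ fun j _ => (h.coord j).coord j

theorem Gs_isS {φ : Rn n → ℂ} (h : IsS φ) (ε : ℝ) : IsS (Gs ε φ) :=
  (h.lap.cmul _).sub (h.normsq.cmul _)

theorem Gs_sol {φ : Rn n → ℂ} (h : IsS φ) {ε : ℝ} (he : 0 < ε) (S : Set ℝ) :
    Sol ε S (fun _ => φ) (fun _ _ => 0) (fun _ => Gs ε φ) where
  isS _ _ := h
  FS _ _ := Gs_isS h ε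
  der _ _ _ := hasDerivAt_const _ _
  cz := (h.cont.comp continuous_snd).continuousOn
  czd := continuousOn_const
  eq _ _ x := by
    have hec : (ε : ℂ) ≠ 0 := by exact_mod_cast he.ne'
    unfold Gs; push_cast; field_simp; ring

theorem dot_Gs {z φ : Rn n → ℂ} (hz : IsS z) (h : IsS φ) (ε : ℝ) :
    dot z (Gs ε φ) = -∑ j, (((ε / 2 : ℝ) : ℂ) * dot (pd j z) (pd j φ)
      + ((1 / (2 * ε) : ℝ) : ℂ) * dot (fun x => ((x j : ℝ) : ℂ) * z x) (fun x => ((x j : ℝ) : ℂ) * φ x)) := by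
  have e : ∀ x, z x * conj (Gs ε φ x) = ∑ j, (((ε / 2 : ℝ) : ℂ) * (z x * pd j (pd j (fun y => conj (φ y))) x)
      - ((1 / (2 * ε) : ℝ) : ℂ) * ((((x j : ℝ) : ℂ) * z x) * conj (((x j : ℝ) : ℂ) * φ x))) := by
    intro x
    unfold Gs
    have hl : conj (lap φ x) = ∑ j, pd j (pd j (fun y => conj (φ y))) x := by
      rw [lap_eq, map_sum]
      refine Finset.sum_congr rfl fun j _ => ?_
      rw [show pd j (fun y => conj (φ y)) = fun y => conj (pd j φ y) from funext fun y => pd_conj h.diff j y,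
        pd_conj (h.pd j).diff]
    rw [map_sub, map_mul, map_mul, map_mul, hl, normsq_sum, map_sum, Finset.sum_sub_distrib, ← Finset.mul_sum, ← Finset.mul_sum,
      ← Finset.mul_sum]
    simp only [map_mul, Complex.conj_ofReal, Finset.sum_mul, mul_sub]
    have : (∑ j : Fin n, ((x j : ℝ) : ℂ) * z x * (((x j : ℝ) : ℂ) * conj (φ x))) = z x * ∑ j, ((x j : ℝ) : ℂ) * ((x j : ℝ) : ℂ) * conj (φ x) := by
      rw [Finset.mul_sum]; exact Finset.sum_congr rfl fun j _ => by ring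
    rw [this]; ring
  unfold dot
  simp only [e]
  rw [integral_finsetSum _ fun j _ => ((((hz.mul (((h.conj).pd j).pd j)).cmul _).sub
    (((hz.coord j).mul ((h.coord j).conj)).cmul _)).int), ← Finset.sum_neg_distrib]
  refine Finset.sum_congr rfl fun j _ => ?_
  rw [integral_sub (((hz.mul (((h.conj).pd j).pd j)).cmul _).int) ((((hz.coord j).mul ((h.coord j).conj)).cmul _).int),
    integral_const_mul, integral_const_mul, ibp hz ((h.conj).pd j)]
  rw [show pd j (fun y => conj (φ y)) = fun y => conj (pd j φ y) from funext fun y => pd_conj h.diff j y]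
  ring

theorem dot_Gs_le {z φ : Rn n → ℂ} (hz : IsS z) (h : IsS φ) {ε B : ℝ} (he : 0 < ε) (bz : TB B z) (bφ : TB B φ) :
    ‖dot z (Gs ε φ)‖ ≤ n * ((ε / 2 + 1 / (2 * ε)) * B ^ 2) := by
  have hB : 0 ≤ B := (l2_nonneg _).trans bz.1
  rw [dot_Gs hz h, norm_neg]
  refine (norm_sum_le _ _).trans ?_
  have : ∀ j ∈ (Finset.univ : Finset (Fin n)), ‖((ε / 2 : ℝ) : ℂ) * dot (pd j z) (pd j φ)
      + ((1 / (2 * ε) : ℝ) : ℂ) * dot (fun x => ((x j : ℝ) : ℂ) * z x) (fun x => ((x j : ℝ) : ℂ) * φ x)‖ ≤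
      (ε / 2 + 1 / (2 * ε)) * B ^ 2 := by
    intro j _
    refine (norm_add_le _ _).trans ?_
    rw [norm_mul, norm_mul, Complex.norm_real, Complex.norm_real, Real.norm_of_nonneg (by positivity),
      Real.norm_of_nonneg (by positivity), add_mul]
    have a := (dot_le (hz.pd j).memLp (h.pd j).memLp).trans (mul_le_mul (bz.2.2 j) (bφ.2.2 j) (l2_nonneg _) hB)
    have b := (dot_le (hz.coord j).memLp (h.coord j).memLp).trans (mul_le_mul (bz.2.1 j) (bφ.2.1 j) (l2_nonneg _) hB)
    rw [sq]
    exact add_le_add (mul_le_mul_of_nonneg_left a (by positivity)) (mul_le_mul_of_nonneg_left b (by positivity))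
  refine (Finset.sum_le_card_nsmul _ _ _ this).trans ?_
  simp

end HW
end

noncomputable section
namespace HW
variable {n : ℕ}

/-- sup bound of the potential with static norms -/
theorem V_TB {γ : ℝ} (hn : 2 ≤ n) (h0 : 0 < γ) (h1 : γ < 1) : ∃ C : ℝ, 0 < C ∧
    ∀ (B : ℝ) (a b : Rn n → ℂ), IsS a → IsS b → TB B a → ∀ x : Rn n,
    ‖convC γ (fun y => a y * conj (b y)) x‖ ≤ C * B * l2 b ∧
    ‖convC γ (fun y => b y * conj (a y)) x‖ ≤ C * B * l2 b := by
  obtain ⟨C, hC, H⟩ := convC_bd (n := n) hn h0 h1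
  refine ⟨C * (n + 1), by positivity, fun B a b ha hb hB x => ?_⟩
  have h := H 0 1 one_ne_zero a b ha hb x
  have e : nA 0 1 a ≤ (n + 1) * B := by
    unfold nA
    have : ∀ j ∈ (Finset.univ : Finset (Fin n)), l2 (Aop 0 1 j a) ≤ B := fun j _ => by
      have := Aop_l2 ha 0 1 j
      simp only [abs_zero, zero_mul, abs_one, one_mul, zero_add] at this
      exact this.trans (hB.2.2 j)
    have := Finset.sum_le_card_nsmul _ _ _ this
    simp only [Finset.card_univ, Fintype.card_fin, nsmul_eq_mul] at this
    linarith [hB.1]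
  have : C * |(1:ℝ)| ^ (-γ) * nA 0 1 a * l2 b ≤ C * (n + 1) * B * l2 b := by
    rw [abs_one, Real.one_rpow, mul_one, mul_assoc C ((n:ℝ)+1) B]
    exact mul_le_mul_of_nonneg_right (mul_le_mul_of_nonneg_left e hC.le) (l2_nonneg _)
  exact ⟨h.1.trans this, h.2.trans this⟩

theorem T_l2_TB {γ : ℝ} (hn : 2 ≤ n) (h0 : 0 < γ) (h1 : γ < 1) : ∃ C : ℝ, 0 < C ∧
    ∀ (B : ℝ) (a b : Rn n → ℂ), IsS a → IsS b → TB B a → TB B b →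
    l2 (T γ a a a) ≤ C * B ^ 3 ∧ (∀ x, ‖convC γ (fun y => a y * conj (a y)) x - convC γ (fun y => b y * conj (b y)) x‖
      ≤ C * B * l2 (fun x => a x - b x)) ∧
    l2 (fun x => T γ a a a x - T γ b b b x) ≤ C * B ^ 2 * l2 (fun x => a x - b x) := by
  obtain ⟨C, hC, H⟩ := V_TB (n := n) hn h0 h1
  have hn' : (2 : ℝ) ≤ n := by exact_mod_cast hn
  refine ⟨3 * C, by positivity, fun B a b ha hb tA tB => ?_⟩
  have hB : 0 ≤ B := (l2_nonneg _).trans tA.1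
  have hd := ha.sub hb
  have hV : ∀ x, ‖convC γ (fun y => a y * conj (a y)) x - convC γ (fun y => b y * conj (b y)) x‖
      ≤ 2 * C * B * l2 (fun x => a x - b x) := by
    intro x
    have e : convC γ (fun y => a y * conj (a y)) x - convC γ (fun y => b y * conj (b y)) x =
        convC γ (fun y => a y * conj (a y - b y)) x + convC γ (fun y => (a y - b y) * conj (b y)) x := by
      rw [← convC_sub (by lia) h0.le (by linarith) (ha.mul ha.conj) (hb.mul hb.conj),
        ← convC_add (by lia) h0.le (by linarith) (ha.mul hd.conj) (hd.mul hb.conj)]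
      congr 1; ext y; rw [map_sub]; ring
    rw [e]
    refine (norm_add_le _ _).trans ?_
    have := (H B a _ ha hd tA x).1
    have := (H B b _ hb hd tB x).2
    linarith
  have hl := l2_nonneg (fun x => a x - b x)
  refine ⟨?_, fun x => (hV x).trans ?_, ?_⟩
  · have := l2_mul_le (φ := a) (g := convC γ (fun y => a y * conj (a y))) (C := C * B * B) (by positivity) ha.memLp
      (fun x => ((H B a a ha ha tA x).1).trans (mul_le_mul_of_nonneg_left tA.1 (by positivity)))
    refine this.trans ((mul_le_mul_of_nonneg_left tA.1 (by positivity)).trans ?_)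
    nlinarith [pow_nonneg hB 3, mul_nonneg hC.le (pow_nonneg hB 3)]
  · have : 0 ≤ C * B * l2 (fun x => a x - b x) := by positivity
    linarith
  · have e : (fun x => T γ a a a x - T γ b b b x) = fun x => (convC γ (fun y => a y * conj (a y)) x - convC γ (fun y => b y * conj (b y)) x) * a x
        + convC γ (fun y => b y * conj (b y)) x * (a x - b x) := by
      ext x; unfold T; ring
    have tV : ∀ {c : Rn n → ℂ}, IsS c → (convC γ (fun y => c y * conj (c y))).HasTemperateGrowth := fun hc =>
      convC_temp (by lia) h0.le (by linarith) (hc.mul hc.conj)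
    have m1 : MemLp (fun x => (convC γ (fun y => a y * conj (a y)) x - convC γ (fun y => b y * conj (b y)) x) * a x) 2 volume :=
      (IsS.tmul ((tV ha).sub (tV hb)) ha).memLp
    rw [e]
    refine (l2_add m1 (IsS.tmul (tV hb) hd).memLp).trans ?_
    have x1 := l2_mul_le (φ := a) (C := 2 * C * B * l2 (fun x => a x - b x)) (by positivity) ha.memLp hV
    have x2 := l2_mul_le (φ := fun x => a x - b x) (g := convC γ (fun y => b y * conj (b y))) (C := C * B * B) (by positivity) hd.memLp
      (fun x => ((H B b b hb hb tB x).1).trans (mul_le_mul_of_nonneg_left tB.1 (by positivity)))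
    have x3 := mul_le_mul_of_nonneg_left tA.1 (show 0 ≤ 2 * C * B * l2 (fun x => a x - b x) by positivity)
    nlinarith

theorem convC_sq_conj (γ : ℝ) (a : Rn n → ℂ) (x : Rn n) :
    conj (convC γ (fun y => a y * conj (a y)) x) = convC γ (fun y => a y * conj (a y)) x := by
  rw [← hartree_eq, Complex.conj_ofReal]

theorem T_swap {γ : ℝ} (hn : 1 ≤ n) (h0 : 0 ≤ γ) (h1 : γ < n) {a b : Rn n → ℂ} (ha : IsS a) (hb : IsS b) :
    dot (T γ a a b) b = dot (T γ b b a) a := by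
  obtain ⟨ρ, hρe⟩ : ∃ ρ : Rn n → ℂ, ρ = fun y => a y * conj (a y) := ⟨_, rfl⟩
  obtain ⟨σ, hσe⟩ : ∃ σ : Rn n → ℂ, σ = fun y => b y * conj (b y) := ⟨_, rfl⟩
  have hρ : IsS ρ := hρe ▸ ha.mul ha.conj
  have hσ : IsS σ := hσe ▸ hb.mul hb.conj
  obtain ⟨k, hk⟩ : ∃ k : Rn n → Rn n → ℂ, k = fun x y => ((‖x - y‖ ^ (-γ) : ℝ) : ℂ) * ρ y * σ x := ⟨_, rfl⟩
  have l : dot (T γ a a b) b = ∫ x, ∫ y, k x y := by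
    unfold dot T convC
    refine integral_congr_ae (Eventually.of_forall fun x => ?_)
    simp only [hk, hρe, hσe]
    rw [integral_mul_const]; ring
  have r : dot (T γ b b a) a = ∫ y, ∫ x, k x y := by
    unfold dot T convC
    refine integral_congr_ae (Eventually.of_forall fun y => ?_)
    simp only [hk, hρe, hσe]
    rw [mul_assoc, ← integral_mul_const]
    refine integral_congr_ae (Eventually.of_forall fun x => ?_)
    simp only
    rw [norm_sub_rev]; ring
  have meas : AEStronglyMeasurable (Function.uncurry k)
      ((volume : Measure (Rn n)).prod (volume : Measure (Rn n))) := by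
    have c1 := hρ.cont
    have c2 := hσ.cont
    rw [hk]
    refine AEStronglyMeasurable.mul (AEStronglyMeasurable.mul ?_ (c1.comp continuous_snd).aestronglyMeasurable)
      (c2.comp continuous_fst).aestronglyMeasurable
    refine Measurable.aestronglyMeasurable ?_
    refine Complex.measurable_ofReal.comp ?_
    exact (measurable_fst.sub measurable_snd).norm.pow_const _
  have int : Integrable (Function.uncurry k) ((volume : Measure (Rn n)).prod (volume : Measure (Rn n))) := by
    rw [integrable_prod_iff meas]
    constructor
    · refine Eventually.of_forall fun x => ?_
      have := (convC_int hn h0 h1 hρ x).mul_const (σ x)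
      simpa only [hk, Function.uncurry] using this
    have := (IsS.tmul (convC_temp hn h0 h1 hρ) hσ).int.norm
    refine this.congr (Eventually.of_forall fun x => ?_)
    have e : ∀ y, ‖k x y‖ = (‖x - y‖ ^ (-γ) * Complex.normSq (a y)) * ‖σ x‖ := by
      intro y
      rw [hk]
      simp only
      rw [norm_mul, norm_mul, Complex.norm_real, Real.norm_of_nonneg (by positivity), hρe]
      simp only
      rw [Complex.mul_conj, Complex.norm_real, Real.norm_of_nonneg (Complex.normSq_nonneg _)]
    simp only [Function.uncurry, e]
    rw [integral_mul_const, norm_mul, hρe, ← hartree_eq, Complex.norm_real, Real.norm_of_nonneg]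
    · simp only [hartree, conv]
    · exact integral_nonneg fun y => mul_nonneg (by positivity) (Complex.normSq_nonneg _)
  rw [l, r]
  exact integral_integral_swap int

theorem P_id {γ : ℝ} (hn : 1 ≤ n) (h0 : 0 ≤ γ) (h1 : γ < n) {a b : Rn n → ℂ} (ha : IsS a) (hb : IsS b) {M : ℝ}
    (hM : 0 ≤ M)
    (h : ∀ x, ‖convC γ (fun y => a y * conj (a y)) x - convC γ (fun y => b y * conj (b y)) x‖ ≤ M) :
    |2 * (dot (T γ a a a) b - dot a (T γ b b b)).re - ((dot (T γ a a a) a).re - (dot (T γ b b b) b).re)| ≤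
      M * l2 (fun x => a x - b x) ^ 2 := by
  have tS : ∀ {c d : Rn n → ℂ}, IsS c → IsS d → IsS (T γ c c d) := fun hc hd => T_isS hn h0 h1 hc hc hd
  have sym : ∀ (c d e : Rn n → ℂ), dot d (T γ c c e) = dot (T γ c c d) e := by
    intro c d e
    unfold dot T
    congr 1; ext x; rw [map_mul, convC_sq_conj]; ring
  have cj : ∀ (c d : Rn n → ℂ), conj (dot c d) = dot d c := by
    intro c d
    unfold dot
    rw [← integral_conj]; congr 1; ext x; simp; ring
  have lin : ∀ {c : Rn n → ℂ}, IsS c → dot (T γ c c (fun x => a x - b x)) (fun x => a x - b x) =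
      dot (T γ c c a) a - dot (T γ c c a) b - dot (T γ c c b) a + dot (T γ c c b) b := by
    intro c hc
    have e : T γ c c (fun x => a x - b x) = fun x => T γ c c a x - T γ c c b x := by
      ext x; unfold T; ring
    rw [e, dot_sub_right ha.memLp hb.memLp ((tS hc ha).sub (tS hc hb)).memLp,
      dot_sub_left (tS hc ha).memLp (tS hc hb).memLp ha.memLp,
      dot_sub_left (tS hc ha).memLp (tS hc hb).memLp hb.memLp]
    ring
  set X := dot (T γ a a a) b - dot a (T γ b b b) with hX
  have hXc : conj X = dot (T γ a a b) a - dot (T γ b b b) a := by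
    rw [hX, map_sub, cj, cj, sym]
  have key : X + conj X = dot (T γ a a a) a - dot (T γ b b b) b -
      (dot (T γ a a (fun x => a x - b x)) (fun x => a x - b x) - dot (T γ b b (fun x => a x - b x)) (fun x => a x - b x)) := by
    rw [hXc, lin ha, lin hb, hX, sym, T_swap hn h0 h1 ha hb]; ring
  have hd := ha.sub hb
  have e2 : dot (T γ a a (fun x => a x - b x)) (fun x => a x - b x) - dot (T γ b b (fun x => a x - b x)) (fun x => a x - b x)
      = dot (fun x => (convC γ (fun y => a y * conj (a y)) x - convC γ (fun y => b y * conj (b y)) x) * (a x - b x)) (fun x => a x - b x) := by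
    rw [← dot_sub_left (tS ha hd).memLp (tS hb hd).memLp hd.memLp]
    congr 1; ext x; unfold T; ring
  have m1 : MemLp (fun x => (convC γ (fun y => a y * conj (a y)) x - convC γ (fun y => b y * conj (b y)) x) * (a x - b x)) 2 volume := by
    have := ((tS ha hd).sub (tS hb hd)).memLp
    refine (memLp_congr_ae (Eventually.of_forall fun x => ?_)).1 this
    simp only [T]; ring
  have bd := (dot_le m1 hd.memLp).trans (mul_le_mul_of_nonneg_right (l2_mul_le hM hd.memLp h) (l2_nonneg _))
  rw [← e2] at bd
  set W := dot (T γ a a (fun x => a x - b x)) (fun x => a x - b x) - dot (T γ b b (fun x => a x - b x)) (fun x => a x - b x)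
  have kr := congrArg Complex.re key
  simp only [Complex.add_re, Complex.sub_re, Complex.conj_re] at kr
  have : 2 * X.re - ((dot (T γ a a a) a).re - (dot (T γ b b b) b).re) = - W.re := by
    linarith
  rw [this, abs_neg]
  refine (Complex.abs_re_le_norm W).trans (bd.trans (le_of_eq (by ring)))

end HW
end

noncomputable section
namespace HW
variable {n : ℕ}

/-- local bounded solution -/
structure Loc (γ ε a b B : ℝ) (u ud : ℝ → Rn n → ℂ) : Prop where
  hn : 2 ≤ n
  h0 : 0 < γ
  h1 : γ < 1
  he : 0 < ε
  he1 : ε ≤ 1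
  sol : Sol ε (Set.Icc a b) u ud (fun t => T γ (u t) (u t) (u t))
  tb : ∀ t ∈ Set.Icc a b, TB B (u t)

theorem Loc.mono {γ ε a b B a' b' : ℝ} {u ud : ℝ → Rn n → ℂ} (L : Loc γ ε a b B u ud)
    (h : Set.Icc a' b' ⊆ Set.Icc a b) : Loc γ ε a' b' B u ud :=
  ⟨L.hn, L.h0, L.h1, L.he, L.he1, L.sol.mono h, fun t ht => L.tb t (h ht)⟩

theorem cont_of_sqrt {f : ℝ → ℂ} {S : Set ℝ} {C : ℝ}
    (h : ∀ s ∈ S, ∀ t ∈ S, ‖f t - f s‖ ≤ C * √|t - s|) : ContinuousOn f S := by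
  intro s hs
  have : Tendsto (fun t => C * √|t - s|) (𝓝[S] s) (𝓝 0) := by
    have : Continuous (fun t => C * √|t - s|) := by fun_prop
    have := (this.tendsto s).mono_left (nhdsWithin_le_nhds (s := S))
    simpa using this
  refine tendsto_iff_norm_sub_tendsto_zero.2 (squeeze_zero' (Eventually.of_forall fun t => norm_nonneg _) ?_ this)
  filter_upwards [self_mem_nhdsWithin] with t ht using h s hs t ht

theorem dot_T_comm (γ : ℝ) (c d e : Rn n → ℂ) : dot d (T γ c c e) = dot (T γ c c d) e := by
  unfold dot T
  congr 1; ext x; rw [map_mul, convC_sq_conj]; ring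

theorem dot_conj (c d : Rn n → ℂ) : conj (dot c d) = dot d c := by
  unfold dot
  rw [← integral_conj]; congr 1; ext x; simp; ring

theorem Loc.FS {γ ε a b B : ℝ} {u ud : ℝ → Rn n → ℂ} (L : Loc γ ε a b B u ud) :
    ∃ B', B ≤ B' ∧ 0 ≤ B' ∧ ∀ t ∈ Set.Icc a b, TB B' (T γ (u t) (u t) (u t)) ∧ TB B' (u t) := by
  obtain ⟨C, hC, H⟩ := T_bd_eps L.hn L.h0 L.h1 L.he L.he1
  set N := Fintype.card (Option (Bool × Fin n)) * (2 / ε * |B|) with hN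
  have he := L.he
  have hN0 : 0 ≤ N := by positivity
  refine ⟨max |B| (2 / ε * (C * N * N * N)), (le_abs_self B).trans (le_max_left _ _),
    (abs_nonneg B).trans (le_max_left _ _), fun t ht => ⟨?_, (L.tb t ht).mono ((le_abs_self B).trans (le_max_left _ _))⟩⟩
  have hS := L.sol.isS t ht
  refine (TB_of_nn (t := t) L.he L.he1 (L.sol.FS t ht)).mono (le_trans ?_ (le_max_right _ _))
  refine mul_le_mul_of_nonneg_left ?_ (by positivity)
  refine (H t _ _ _ hS hS hS).trans ?_
  have hu : nn ε t (u t) ≤ N := nn_of_TB L.he L.he1 hS ((L.tb t ht).mono (le_abs_self B))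
  have h0 := nn_nonneg ε t (u t)
  have := mul_le_mul hu hu h0 hN0
  have := mul_le_mul this hu h0 (by positivity)
  calc C * nn ε t (u t) * nn ε t (u t) * nn ε t (u t) = C * (nn ε t (u t) * nn ε t (u t) * nn ε t (u t)) := by ring
    _ ≤ C * (N * N * N) := mul_le_mul_of_nonneg_left this hC.le
    _ = _ := by ring

theorem Loc.mass {γ ε a b B : ℝ} {u ud : ℝ → Rn n → ℂ} (L : Loc γ ε a b B u ud) {s t : ℝ}
    (hs : s ∈ Set.Icc a b) (ht : t ∈ Set.Icc a b) (hst : s ≤ t) : l2 (u t) = l2 (u s) := by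
  have L' := L.mono (Set.Icc_subset_Icc hs.1 ht.2)
  obtain ⟨B', h1, h2, h3⟩ := L'.FS
  have := coreG L.he hst L'.sol L'.sol (fun r hr => (h3 r hr).2.1) (fun r hr => (h3 r hr).1.1)
    (fun r hr => (h3 r hr).2) (fun r hr => (h3 r hr).1) 0 (K := fun _ => 0) (p := s - 1)
    (fun r hr _ => by rw [dot_T_comm]; simp) intervalIntegrable_const
  simp only [mul_zero, zero_mul, add_zero, intervalIntegral.integral_zero] at this
  have := norm_le_zero_iff.1 this
  rw [dot_self (L.sol.isS t ht).memLp, dot_self (L.sol.isS s hs).memLp, sub_eq_zero] at this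
  have : l2 (u t) ^ 2 = l2 (u s) ^ 2 := by exact_mod_cast this
  exact (sq_eq_sq₀ (l2_nonneg _) (l2_nonneg _)).1 this

theorem l2_sub_sq {φ ψ : Rn n → ℂ} (h : IsS φ) (k : IsS ψ) (e : l2 φ = l2 ψ) :
    l2 (fun x => φ x - ψ x) ^ 2 ≤ 2 * ‖dot φ ψ - dot ψ ψ‖ := by
  have h1 := dot_self (h.sub k).memLp
  rw [dot_sub_right h.memLp k.memLp (h.sub k).memLp, dot_sub_left h.memLp k.memLp h.memLp,
    dot_sub_left h.memLp k.memLp k.memLp, dot_self h.memLp, e, ← dot_self k.memLp] at h1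
  have h2 : conj (dot φ ψ) = dot ψ φ := dot_conj _ _
  have hc : conj (dot ψ ψ) = dot ψ ψ := dot_conj _ _
  have h3 := congrArg Complex.re h1
  rw [← h2, Complex.ofReal_re] at h3
  rw [← h3]
  have := Complex.abs_re_le_norm (dot φ ψ - dot ψ ψ)
  have := neg_le_of_abs_le this
  simp only [Complex.sub_re, Complex.conj_re] at *
  linarith

theorem Loc.static {γ ε a b B : ℝ} {u ud : ℝ → Rn n → ℂ} (L : Loc γ ε a b B u ud) {s t : ℝ}
    (hs : s ∈ Set.Icc a b) (ht : t ∈ Set.Icc a b) (hst : s ≤ t) {φ : Rn n → ℂ} (hφ : IsS φ) (c : ℂ) {K : ℝ}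
    (hK : ∀ r ∈ Set.Icc s t, ‖dot (T γ (u r) (u r) (u r)) φ - dot (u r) (Gs ε φ) - c‖ ≤ K) :
    ‖dot (u t) φ - dot (u s) φ + Complex.I * c * ((t - s : ℝ) : ℂ)‖ ≤ (t - s) * K := by
  have L' := L.mono (Set.Icc_subset_Icc hs.1 ht.2)
  obtain ⟨B', h1, h2, h3⟩ := L'.FS
  obtain ⟨B1, hB1⟩ := hφ.exTB
  obtain ⟨B2, hB2⟩ := (Gs_isS hφ ε).exTB
  have := coreG L.he hst L'.sol (Gs_sol hφ L.he (Set.Icc s t)) (B := max B' (max B1 B2))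
    (fun r hr => (h3 r hr).2.1.trans (le_max_left _ _)) (fun r hr => (h3 r hr).1.1.trans (le_max_left _ _))
    (fun r hr => hB1.mono ((le_max_left _ _).trans (le_max_right _ _)))
    (fun r hr => hB2.mono ((le_max_right _ _).trans (le_max_right _ _))) c (K := fun _ => K) (p := s - 1)
    (fun r hr _ => hK r hr) intervalIntegrable_const
  simpa using this

theorem Loc.holder {γ ε a b B : ℝ} {u ud : ℝ → Rn n → ℂ} (L : Loc γ ε a b B u ud) :
    ∃ C, 0 ≤ C ∧ ∀ s ∈ Set.Icc a b, ∀ t ∈ Set.Icc a b,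
      l2 (fun x => u t x - u s x) ≤ C * √|t - s| ∧
      l2 (fun x => T γ (u t) (u t) (u t) x - T γ (u s) (u s) (u s) x) ≤ C * √|t - s| := by
  obtain ⟨C, hC, H⟩ := T_l2_TB (n := n) L.hn L.h0 L.h1
  by_cases hab : (Set.Icc a b).Nonempty
  swap
  · exact ⟨0, le_rfl, fun s hs => absurd ⟨s, hs⟩ hab⟩
  have hB : 0 ≤ B := (l2_nonneg _).trans (L.tb _ hab.some_mem).1
  have he := L.he
  set D := C * B ^ 3 * B + n * ((ε / 2 + 1 / (2 * ε)) * B ^ 2) with hD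
  have hD0 : 0 ≤ D := by positivity
  have key : ∀ s ∈ Set.Icc a b, ∀ t ∈ Set.Icc a b, s ≤ t → l2 (fun x => u t x - u s x) ≤ √(2 * D) * √|t - s| := by
    intro s hs t ht hst
    have st := L.static hs ht hst (L.sol.isS s hs) 0 (K := D) (fun r hr => by
      have hr' := Set.Icc_subset_Icc hs.1 ht.2 hr
      rw [sub_zero]
      refine (norm_sub_le _ _).trans (add_le_add ?_ (dot_Gs_le (L.sol.isS r hr') (L.sol.isS s hs) L.he (L.tb r hr') (L.tb s hs)))
      refine (dot_le (L.sol.FS r hr').memLp (L.sol.isS s hs).memLp).trans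
        (mul_le_mul (H B _ _ (L.sol.isS r hr') (L.sol.isS r hr') (L.tb r hr') (L.tb r hr')).1 (L.tb s hs).1 (l2_nonneg _) (by positivity)))
    simp only [mul_zero, zero_mul, add_zero] at st
    have := l2_sub_sq (L.sol.isS t ht) (L.sol.isS s hs) (L.mass hs ht hst)
    rw [← Real.sqrt_mul (by positivity), abs_of_nonneg (by linarith)]
    refine Real.le_sqrt_of_sq_le ?_
    linarith
  have key2 : ∀ s ∈ Set.Icc a b, ∀ t ∈ Set.Icc a b, l2 (fun x => u t x - u s x) ≤ √(2 * D) * √|t - s| := by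
    intro s hs t ht
    rcases le_total s t with h | h
    · exact key s hs t ht h
    · rw [l2_comm, abs_sub_comm]; exact key t ht s hs h
  refine ⟨max (√(2 * D)) (C * B ^ 2 * √(2 * D)), le_max_of_le_left (Real.sqrt_nonneg _), fun s hs t ht => ⟨?_, ?_⟩⟩
  · exact (key2 s hs t ht).trans (mul_le_mul_of_nonneg_right (le_max_left _ _) (Real.sqrt_nonneg _))
  · refine ((H B _ _ (L.sol.isS t ht) (L.sol.isS s hs) (L.tb t ht) (L.tb s hs)).2.2).trans ?_
    refine (mul_le_mul_of_nonneg_left (key2 s hs t ht) (by positivity)).trans ?_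
    rw [← mul_assoc]
    exact mul_le_mul_of_nonneg_right (le_max_right _ _) (Real.sqrt_nonneg _)

theorem dot_holder {f g : ℝ → Rn n → ℂ} {S : Set ℝ} {C M : ℝ} (hM : 0 ≤ M) (hf : ∀ t ∈ S, IsS (f t)) (hg : ∀ t ∈ S, IsS (g t))
    (bf : ∀ t ∈ S, l2 (f t) ≤ M) (bg : ∀ t ∈ S, l2 (g t) ≤ M)
    (cf : ∀ s ∈ S, ∀ t ∈ S, l2 (fun x => f t x - f s x) ≤ C * √|t - s|)
    (cg : ∀ s ∈ S, ∀ t ∈ S, l2 (fun x => g t x - g s x) ≤ C * √|t - s|) :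
    ∀ s ∈ S, ∀ t ∈ S, ‖dot (f t) (g t) - dot (f s) (g s)‖ ≤ (2 * M * C) * √|t - s| := by
  intro s hs t ht
  have e : dot (f t) (g t) - dot (f s) (g s) = dot (fun x => f t x - f s x) (g t) + dot (f s) (fun x => g t x - g s x) := by
    rw [dot_sub_left (hf t ht).memLp (hf s hs).memLp (hg t ht).memLp,
      dot_sub_right (hg t ht).memLp (hg s hs).memLp (hf s hs).memLp]; ring
  rw [e]
  refine (norm_add_le _ _).trans ?_
  have h1 := (dot_le ((hf t ht).sub (hf s hs)).memLp (hg t ht).memLp).trans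
    (mul_le_mul (cf s hs t ht) (bg t ht) (l2_nonneg _) ((l2_nonneg _).trans (cf s hs t ht)))
  have h2 := (dot_le (hf s hs).memLp ((hg t ht).sub (hg s hs)).memLp).trans
    (mul_le_mul (bf s hs) (cg s hs t ht) (l2_nonneg _) hM)
  linarith

theorem Sol.shift {ε a b h : ℝ} {z zd F : ℝ → Rn n → ℂ} (hz : Sol ε (Set.Icc (a + h) (b + h)) z zd F) :
    Sol ε (Set.Icc a b) (fun t => z (t + h)) (fun t => zd (t + h)) (fun t => F (t + h)) := by
  have m : ∀ t ∈ Set.Icc a b, t + h ∈ Set.Icc (a + h) (b + h) := fun t ht => ⟨by linarith [ht.1], by linarith [ht.2]⟩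
  have mp : Set.MapsTo (fun q : ℝ × Rn n => (q.1 + h, q.2)) (Set.Icc a b ×ˢ Set.univ) (Set.Icc (a + h) (b + h) ×ˢ Set.univ) :=
    fun q hq => ⟨m _ hq.1, trivial⟩
  have mc : Continuous (fun q : ℝ × Rn n => (q.1 + h, q.2)) := by fun_prop
  exact ⟨fun t ht => hz.isS _ (m t ht), fun t ht => hz.FS _ (m t ht),
    fun t ht x => (hz.der _ (m t ht) x).comp_add_const t h,
    hz.cz.comp mc.continuousOn mp, hz.czd.comp mc.continuousOn mp, fun t ht => hz.eq _ (m t ht)⟩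

end HW
end

noncomputable section
namespace HW
variable {n : ℕ}

/-- potential energy -/
def Pe (γ : ℝ) (φ : Rn n → ℂ) : ℝ := (dot (T γ φ φ φ) φ).re
/-- energy -/
def En (γ ε : ℝ) (φ : Rn n → ℂ) : ℝ := Pe γ φ / 2 - (dot φ (Gs ε φ)).re

theorem Loc.stat_asym {γ ε a b B : ℝ} {u ud : ℝ → Rn n → ℂ} (L : Loc γ ε a b B u ud) {t : ℝ}
    (ht : t ∈ Set.Icc a b) : ∃ A, ∀ h, 0 < h → t + h ≤ b →
      |(dot (u (t + h)) (u t)).im + h * (En γ ε (u t) + Pe γ (u t) / 2)| ≤ A * (h * √h) := by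
  obtain ⟨C, hC, H⟩ := L.holder
  set φ := u t with hφ
  have Sφ : IsS φ := L.sol.isS t ht
  refine ⟨C * l2 φ + C * l2 (Gs ε φ), fun h hh hb => ?_⟩
  have ht' : t + h ∈ Set.Icc a b := ⟨by linarith [ht.1], hb⟩
  set c := dot (T γ φ φ φ) φ - dot φ (Gs ε φ) with hc
  have st := L.static ht ht' (by linarith) Sφ c (K := (C * l2 φ + C * l2 (Gs ε φ)) * √h) (fun r hr => by
    have hr' : r ∈ Set.Icc a b := Set.Icc_subset_Icc ht.1 ht'.2 hr
    have e : dot (T γ (u r) (u r) (u r)) φ - dot (u r) (Gs ε φ) - c =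
        dot (fun x => T γ (u r) (u r) (u r) x - T γ φ φ φ x) φ - dot (fun x => u r x - φ x) (Gs ε φ) := by
      rw [dot_sub_left (L.sol.FS r hr').memLp (L.sol.FS t ht).memLp Sφ.memLp,
        dot_sub_left (L.sol.isS r hr').memLp Sφ.memLp (Gs_isS Sφ ε).memLp, hc]; ring
    rw [e]
    have hs : √|r - t| ≤ √h := Real.sqrt_le_sqrt (by rw [abs_of_nonneg (by linarith [hr.1])]; linarith [hr.2])
    have h1 := H t ht r hr'
    refine (norm_sub_le _ _).trans ?_
    have a1 := (dot_le ((L.sol.FS r hr').sub (L.sol.FS t ht)).memLp Sφ.memLp).trans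
      (mul_le_mul_of_nonneg_right (h1.2.trans (mul_le_mul_of_nonneg_left hs hC)) (l2_nonneg _))
    have a2 := (dot_le ((L.sol.isS r hr').sub Sφ).memLp (Gs_isS Sφ ε).memLp).trans
      (mul_le_mul_of_nonneg_right (h1.1.trans (mul_le_mul_of_nonneg_left hs hC)) (l2_nonneg _))
    linarith)
  have im := (Complex.abs_im_le_norm _).trans st
  rw [← hφ, dot_self Sφ.memLp] at im
  have e2 : (dot (u (t + h)) φ - ((l2 φ ^ 2 : ℝ) : ℂ) + Complex.I * c * ((t + h - t : ℝ) : ℂ)).im =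
      (dot (u (t + h)) φ).im + h * (En γ ε φ + Pe γ φ / 2) := by
    have : t + h - t = h := by ring
    rw [this, mul_assoc, Complex.add_im, Complex.sub_im, Complex.I_mul_im, Complex.ofReal_im, mul_comm c, Complex.re_ofReal_mul]
    unfold En Pe
    rw [hc, Complex.sub_re]; ring
  rw [e2] at im
  refine im.trans (le_of_eq ?_)
  ring

theorem Loc.pe_holder {γ ε a b B : ℝ} {u ud : ℝ → Rn n → ℂ} (L : Loc γ ε a b B u ud) :
    ∃ A, 0 ≤ A ∧ ∀ s ∈ Set.Icc a b, ∀ t ∈ Set.Icc a b, |Pe γ (u t) - Pe γ (u s)| ≤ A * √|t - s| := by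
  obtain ⟨C, hC, H⟩ := L.holder
  obtain ⟨B', h1, h2, h3⟩ := L.FS
  refine ⟨2 * B' * C, by positivity, fun s hs t ht => ?_⟩
  have := dot_holder (S := Set.Icc a b) h2 (fun t ht => L.sol.FS t ht) (fun t ht => L.sol.isS t ht) (fun r hr => (h3 r hr).1.1)
    (fun r hr => (h3 r hr).2.1) (fun s hs t ht => (H s hs t ht).2) (fun s hs t ht => (H s hs t ht).1) s hs t ht
  refine le_trans ?_ this
  have := Complex.abs_re_le_norm (dot (T γ (u t) (u t) (u t)) (u t) - dot (T γ (u s) (u s) (u s)) (u s))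
  rwa [Complex.sub_re] at this

theorem Loc.dyn {γ ε a b B : ℝ} {u ud : ℝ → Rn n → ℂ} (L : Loc γ ε a b B u ud) :
    ∃ A, ∀ s t h, a ≤ s → s ≤ t → 0 < h → t + h ≤ b →
      |2 * ((dot (u (t + h)) (u t)).im - (dot (u (s + h)) (u s)).im) +
        ∫ r in s..t, (Pe γ (u (r + h)) - Pe γ (u r))| ≤ (t - s) * (A * (h * √h)) := by
  obtain ⟨C, hC, H⟩ := L.holder
  obtain ⟨B', h1, h2, h3⟩ := L.FS
  obtain ⟨C1, hC1, H1⟩ := T_l2_TB (n := n) L.hn L.h0 L.h1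
  have hn1 : 1 ≤ n := le_trans (by norm_num) L.hn
  have hnγ : γ < n := L.h1.trans_le (by exact_mod_cast hn1)
  obtain ⟨A0, hA0, HA⟩ := L.pe_holder
  refine ⟨C1 * B' * C ^ 3, fun s t h has hst hh htb => ?_⟩
  have S1 : Set.Icc s t ⊆ Set.Icc a b := Set.Icc_subset_Icc has (by linarith)
  have S2 : ∀ r ∈ Set.Icc s t, r + h ∈ Set.Icc a b := fun r hr => ⟨by linarith [hr.1], by linarith [hr.2]⟩
  have sol1 := L.sol.mono S1
  have sol2 : Sol ε (Set.Icc s t) (fun r => u (r + h)) (fun r => ud (r + h)) (fun r => T γ (u (r + h)) (u (r + h)) (u (r + h))) :=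
    (L.sol.mono (show Set.Icc (s + h) (t + h) ⊆ Set.Icc a b from Set.Icc_subset_Icc (by linarith) (by linarith))).shift
  set F := fun r => T γ (u r) (u r) (u r) with hF
  set c : ℝ → ℂ := fun r => dot (F (r + h)) (u r) - dot (u (r + h)) (F r) with hc
  have hsh : ∀ r q : ℝ, |r + h - (q + h)| = |r - q| := fun r q => by congr 1; ring
  have cc : ContinuousOn c (Set.Icc s t) := by
    refine ContinuousOn.sub (cont_of_sqrt (C := 2 * B' * C) ?_) (cont_of_sqrt (C := 2 * B' * C) ?_)
    · exact dot_holder h2 (fun r hr => L.sol.FS _ (S2 r hr)) (fun r hr => L.sol.isS _ (S1 hr)) (fun r hr => (h3 _ (S2 r hr)).1.1)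
        (fun r hr => (h3 _ (S1 hr)).2.1) (fun q hq r hr => by have := (H _ (S2 q hq) _ (S2 r hr)).2; rwa [hsh] at this)
        (fun q hq r hr => (H _ (S1 hq) _ (S1 hr)).1)
    · exact dot_holder h2 (fun r hr => L.sol.isS _ (S2 r hr)) (fun r hr => L.sol.FS _ (S1 hr)) (fun r hr => (h3 _ (S2 r hr)).2.1)
        (fun r hr => (h3 _ (S1 hr)).1.1) (fun q hq r hr => by have := (H _ (S2 q hq) _ (S2 r hr)).1; rwa [hsh] at this)
        (fun q hq r hr => (H _ (S1 hq) _ (S1 hr)).2)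
  have ic : IntervalIntegrable c volume s t := cc.intervalIntegrable_of_Icc hst
  have core := coreF L.he hst sol2 sol1 (B := B') (fun r hr => (h3 _ (S2 r hr)).2.1) (fun r hr => (h3 _ (S2 r hr)).1.1)
    (fun r hr => (h3 _ (S1 hr)).2) (fun r hr => (h3 _ (S1 hr)).1) c ic (K := fun _ => 0) (p := s - 1)
    (fun r hr _ => by simp [hc, hF]) intervalIntegrable_const
  simp only [intervalIntegral.integral_zero] at core
  have core := norm_le_zero_iff.1 core
  have im := congrArg Complex.im core
  rw [Complex.add_im, Complex.I_mul_im, Complex.sub_im, Complex.zero_im] at im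
  have re : (∫ r in s..t, c r).re = ∫ r in s..t, (c r).re := by
    have := Complex.reCLM.intervalIntegral_comp_comm ic
    simpa using this.symm
  rw [re] at im
  have cp : ContinuousOn (fun r => Pe γ (u (r + h)) - Pe γ (u r)) (Set.Icc s t) := by
    have c1 : ContinuousOn (fun r => Pe γ (u r)) (Set.Icc a b) := by
      have : ContinuousOn (fun r => ((Pe γ (u r) : ℝ) : ℂ)) (Set.Icc a b) := cont_of_sqrt (C := A0) fun s hs t ht => by
        rw [← Complex.ofReal_sub, Complex.norm_real]; exact HA s hs t ht
      have := Complex.continuous_re.comp_continuousOn this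
      simpa [Function.comp_def] using this
    refine ContinuousOn.sub ?_ (c1.mono S1)
    exact c1.comp (f := fun r => r + h) (by fun_prop) S2
  have icr : IntervalIntegrable (fun r => (c r).re) volume s t :=
    (Complex.continuous_re.comp_continuousOn cc).intervalIntegrable_of_Icc hst
  have icp := cp.intervalIntegrable_of_Icc hst (μ := volume)
  have e : 2 * ((dot (u (t + h)) (u t)).im - (dot (u (s + h)) (u s)).im) +
        ∫ r in s..t, (Pe γ (u (r + h)) - Pe γ (u r)) = ∫ r in s..t, ((Pe γ (u (r + h)) - Pe γ (u r)) - 2 * (c r).re) := by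
    rw [intervalIntegral.integral_sub icp (icr.const_mul 2), intervalIntegral.integral_const_mul]
    linarith
  rw [e, ← Real.norm_eq_abs]
  have bd : ∀ r ∈ Set.uIoc s t, ‖(Pe γ (u (r + h)) - Pe γ (u r)) - 2 * (c r).re‖ ≤ C1 * B' * C ^ 3 * (h * √h) := by
    intro r hr
    rw [Set.uIoc_of_le hst] at hr
    have hr : r ∈ Set.Icc s t := ⟨hr.1.le, hr.2⟩
    have hd := (H _ (S1 hr) _ (S2 r hr)).1
    rw [show r + h - r = h by ring, abs_of_pos hh] at hd
    have hl := l2_nonneg (fun x => u (r + h) x - u r x)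
    have hV := (H1 B' _ _ (L.sol.isS _ (S2 r hr)) (L.sol.isS _ (S1 hr)) (h3 _ (S2 r hr)).2 (h3 _ (S1 hr)).2).2.1
    have p := P_id hn1 L.h0.le hnγ (L.sol.isS _ (S2 r hr)) (L.sol.isS _ (S1 hr)) (by positivity) hV
    rw [Real.norm_eq_abs, abs_sub_comm]
    refine p.trans ?_
    have : l2 (fun x => u (r + h) x - u r x) ^ 3 ≤ (C * √h) ^ 3 := pow_le_pow_left₀ hl hd 3
    have hs : √h ^ 3 = h * √h := by rw [pow_succ, Real.sq_sqrt hh.le]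
    rw [mul_pow, hs] at this
    calc _ = C1 * B' * l2 (fun x => u (r + h) x - u r x) ^ 3 := by ring
      _ ≤ C1 * B' * (C ^ 3 * (h * √h)) := mul_le_mul_of_nonneg_left this (by positivity)
      _ = _ := by ring
  have := intervalIntegral.norm_integral_le_of_norm_le_const bd
  rw [abs_of_nonneg (by linarith)] at this
  linarith

theorem Loc.energy {γ ε a b B : ℝ} {u ud : ℝ → Rn n → ℂ} (L : Loc γ ε a b B u ud) {s t : ℝ}
    (has : a ≤ s) (hst : s ≤ t) (htb : t < b) : En γ ε (u t) = En γ ε (u s) := by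
  have hs : s ∈ Set.Icc a b := ⟨has, by linarith⟩
  have ht : t ∈ Set.Icc a b := ⟨by linarith, htb.le⟩
  obtain ⟨A1, H1⟩ := L.stat_asym hs
  obtain ⟨A2, H2⟩ := L.stat_asym ht
  obtain ⟨A3, H3⟩ := L.dyn
  obtain ⟨A0, hA0, HA⟩ := L.pe_holder
  have c1 : ContinuousOn (fun r => Pe γ (u r)) (Set.Icc a b) := by
    have : ContinuousOn (fun r => ((Pe γ (u r) : ℝ) : ℂ)) (Set.Icc a b) := cont_of_sqrt (C := A0) fun s hs t ht => by
      rw [← Complex.ofReal_sub, Complex.norm_real]; exact HA s hs t ht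
    have := Complex.continuous_re.comp_continuousOn this
    simpa [Function.comp_def] using this
  have ii : ∀ p q, p ∈ Set.Icc a b → q ∈ Set.Icc a b → IntervalIntegrable (fun r => Pe γ (u r)) volume p q := by
    intro p q hp hq
    exact (c1.mono (Set.uIcc_subset_Icc hp hq)).intervalIntegrable
  have avg : ∀ q h, q ∈ Set.Icc a b → 0 < h → q + h ≤ b → |(∫ r in q..(q + h), Pe γ (u r)) - h * Pe γ (u q)| ≤ A0 * (h * √h) := by
    intro q h hq hh hqb
    have hq' : q + h ∈ Set.Icc a b := ⟨by linarith [hq.1], hqb⟩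
    have e : (∫ r in q..(q + h), Pe γ (u r)) - h * Pe γ (u q) = ∫ r in q..(q + h), (Pe γ (u r) - Pe γ (u q)) := by
      rw [intervalIntegral.integral_sub (ii _ _ hq hq') intervalIntegrable_const]; simp
    rw [e, ← Real.norm_eq_abs]
    have := intervalIntegral.norm_integral_le_of_norm_le_const (a := q) (b := q + h) (C := A0 * √h)
      (f := fun r => Pe γ (u r) - Pe γ (u q)) (fun r hr => by
        rw [Set.uIoc_of_le (by linarith)] at hr
        refine (HA q hq r ⟨by linarith [hr.1, hq.1], by linarith [hr.2]⟩).trans ?_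
        refine mul_le_mul_of_nonneg_left (Real.sqrt_le_sqrt ?_) hA0
        rw [abs_of_nonneg (by linarith [hr.1])]; linarith [hr.2])
    rw [show q + h - q = h by ring, abs_of_pos hh] at this
    linarith
  have main : ∀ h, 0 < h → t + h ≤ b → 2 * |En γ ε (u t) - En γ ε (u s)| ≤
      (2 * A1 + 2 * A2 + (t - s) * A3 + 2 * A0) * √h := by
    intro h hh hb
    have x1 := H1 h hh (by linarith)
    have x2 := H2 h hh hb
    have x3 := H3 s t h has hst hh hb
    have y1 := avg s h hs hh (by linarith)
    have y2 := avg t h ht hh hb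
    have hs' : s + h ∈ Set.Icc a b := ⟨by linarith, by linarith⟩
    have ht' : t + h ∈ Set.Icc a b := ⟨by linarith, hb⟩
    have e : ∫ r in s..t, (Pe γ (u (r + h)) - Pe γ (u r)) = (∫ r in t..(t + h), Pe γ (u r)) - ∫ r in s..(s + h), Pe γ (u r) := by
      have i1 : IntervalIntegrable (fun r => Pe γ (u (r + h))) volume s t := by
        have := (ii _ _ hs' ht').comp_add_right h
        simpa using this
      rw [intervalIntegral.integral_sub i1 (ii _ _ hs ht), intervalIntegral.integral_comp_add_right (fun r => Pe γ (u r))]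
      have := intervalIntegral.integral_add_adjacent_intervals (ii _ _ hs ht) (ii _ _ ht ht')
      have := intervalIntegral.integral_add_adjacent_intervals (ii _ _ hs hs') (ii _ _ hs' ht')
      linarith
    rw [e] at x3
    have hsq := Real.sqrt_nonneg h
    have fin : h * (2 * |En γ ε (u t) - En γ ε (u s)|) ≤ h * ((2 * A1 + 2 * A2 + (t - s) * A3 + 2 * A0) * √h) := by
      have : h * (2 * |En γ ε (u t) - En γ ε (u s)|) = |2 * h * (En γ ε (u t) - En γ ε (u s))| := by
        rw [abs_mul, abs_of_pos (by linarith : 0 < 2 * h)]; ring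
      rw [this]
      rw [abs_le] at x1 x2 x3 y1 y2 ⊢
      constructor <;> nlinarith
    exact le_of_mul_le_mul_left fin hh
  have lim : Tendsto (fun h : ℝ => (2 * A1 + 2 * A2 + (t - s) * A3 + 2 * A0) * √h) (𝓝[>] 0) (𝓝 0) := by
    have : Continuous (fun h : ℝ => (2 * A1 + 2 * A2 + (t - s) * A3 + 2 * A0) * √h) := by fun_prop
    have := (this.tendsto 0).mono_left (nhdsWithin_le_nhds (s := Set.Ioi 0))
    simpa using this
  have : 2 * |En γ ε (u t) - En γ ε (u s)| ≤ 0 := by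
    refine ge_of_tendsto lim ?_
    filter_upwards [Ioc_mem_nhdsGT (show (0:ℝ) < b - t by linarith)] with h hh
    exact main h hh.1 (by linarith [hh.2])
  have := abs_nonneg (En γ ε (u t) - En γ ε (u s))
  have : |En γ ε (u t) - En γ ε (u s)| = 0 := by linarith
  linarith [abs_eq_zero.1 this]

end HW
end

noncomputable section
namespace HW
variable {n : ℕ}

theorem Pe_nonneg (γ : ℝ) (φ : Rn n → ℂ) : 0 ≤ Pe γ φ := by
  have e : dot (T γ φ φ φ) φ = ((∫ x, hartree γ φ x * Complex.normSq (φ x) : ℝ) : ℂ) := by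
    rw [← integral_complex_ofReal]
    unfold dot T
    congr 1; ext x
    rw [← hartree_eq, mul_assoc, Complex.mul_conj]; push_cast; ring
  unfold Pe
  rw [e, Complex.ofReal_re]
  refine integral_nonneg fun x => mul_nonneg ?_ (Complex.normSq_nonneg _)
  exact integral_nonneg fun y => mul_nonneg (by positivity) (Complex.normSq_nonneg _)

theorem En_ge {γ ε : ℝ} (he : 0 < ε) {φ : Rn n → ℂ} (h : IsS φ) (j : Fin n) :
    ε / 2 * l2 (pd j φ) ^ 2 + 1 / (2 * ε) * l2 (fun x => ((x j : ℝ) : ℂ) * φ x) ^ 2 ≤ En γ ε φ := by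
  unfold En
  have : (dot φ (Gs ε φ)).re = -∑ j, (ε / 2 * l2 (pd j φ) ^ 2 + 1 / (2 * ε) * l2 (fun x => ((x j : ℝ) : ℂ) * φ x) ^ 2) := by
    rw [dot_Gs h h, Complex.neg_re, Complex.re_sum]
    congr 1
    refine Finset.sum_congr rfl fun j _ => ?_
    rw [dot_self (h.pd j).memLp, dot_self (h.coord j).memLp, ← Complex.ofReal_mul, ← Complex.ofReal_mul, ← Complex.ofReal_add, Complex.ofReal_re]
  rw [this]
  have h1 := Finset.single_le_sum (f := fun j => ε / 2 * l2 (pd j φ) ^ 2 + 1 / (2 * ε) * l2 (fun x => ((x j : ℝ) : ℂ) * φ x) ^ 2)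
    (fun j _ => by positivity) (Finset.mem_univ j)
  have h2 := Pe_nonneg γ φ
  simp only at h1
  linarith

theorem En_TB {γ ε : ℝ} (he : 0 < ε) {φ : Rn n → ℂ} (h : IsS φ) :
    TB (l2 φ + √(2 / ε * En γ ε φ) + √(2 * ε * En γ ε φ)) φ := by
  have s1 := Real.sqrt_nonneg (2 / ε * En γ ε φ)
  have s2 := Real.sqrt_nonneg (2 * ε * En γ ε φ)
  have s3 := l2_nonneg φ
  refine ⟨by linarith, fun j => ?_, fun j => ?_⟩
  · have := En_ge (γ := γ) he h j
    have : l2 (fun x => ((x j : ℝ) : ℂ) * φ x) ≤ √(2 * ε * En γ ε φ) := by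
      refine Real.le_sqrt_of_sq_le ?_
      have h2 : 1 / (2 * ε) * l2 (fun x => ((x j : ℝ) : ℂ) * φ x) ^ 2 ≤ En γ ε φ := by
        have : 0 ≤ ε / 2 * l2 (pd j φ) ^ 2 := by positivity
        linarith
      have := mul_le_mul_of_nonneg_left h2 (show 0 ≤ 2 * ε by positivity)
      refine le_trans (le_of_eq ?_) this
      field_simp
    linarith
  · have := En_ge (γ := γ) he h j
    have : l2 (pd j φ) ≤ √(2 / ε * En γ ε φ) := by
      refine Real.le_sqrt_of_sq_le ?_
      have h2 : ε / 2 * l2 (pd j φ) ^ 2 ≤ En γ ε φ := by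
        have : 0 ≤ 1 / (2 * ε) * l2 (fun x => ((x j : ℝ) : ℂ) * φ x) ^ 2 := by positivity
        linarith
      have := mul_le_mul_of_nonneg_left h2 (show 0 ≤ 2 / ε by positivity)
      refine le_trans (le_of_eq ?_) this
      field_simp
    linarith

/-- continuous induction -/
theorem boot {f : ℝ → ℝ} {a b B : ℝ} (hf : ContinuousOn f (Set.Icc a b)) (h0 : f a < B)
    (step : ∀ t ∈ Set.Icc a b, (∀ r ∈ Set.Icc a t, f r ≤ B) → f t < B) : ∀ t ∈ Set.Icc a b, f t < B := by
  by_cases hab : a ≤ b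
  swap
  · intro t ht; exact absurd (ht.1.trans ht.2) hab
  set S := {t | ∀ r ∈ Set.Icc a t, r ≤ b → f r ≤ B} with hS
  have hcl : IsClosed (S ∩ Set.Icc a b) := by
    rw [← isSeqClosed_iff_isClosed]
    intro x y hx hxy
    have hy : y ∈ Set.Icc a b := isClosed_Icc.mem_of_tendsto hxy (Eventually.of_forall fun i => (hx i).2)
    refine ⟨fun r hr hrb => ?_, hy⟩
    rcases hr.2.lt_or_eq with h | h
    · obtain ⟨i, hi⟩ := (hxy.eventually_const_lt h).exists
      exact (hx i).1 r ⟨hr.1, hi.le⟩ hrb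
    · subst h
      have t1 : Tendsto (fun i => f (x i)) atTop (𝓝 (f r)) :=
        (hf r hy).tendsto.comp (tendsto_nhdsWithin_iff.2 ⟨hxy, Eventually.of_forall fun i => (hx i).2⟩)
      exact le_of_tendsto t1 (Eventually.of_forall fun i => (hx i).1 _ ⟨(hx i).2.1, le_rfl⟩ (hx i).2.2)
  have sub : Set.Icc a b ⊆ S := by
    refine IsClosed.Icc_subset_of_forall_mem_nhdsWithin hcl ?_ ?_
    · intro r hr _
      rw [show r = a from le_antisymm hr.2 hr.1]; exact h0.le
    · rintro x ⟨hx, hxab⟩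
      have hx' : x ∈ Set.Icc a b := ⟨hxab.1, hxab.2.le⟩
      have hlt := step x hx' (fun r hr => hx r hr (hr.2.trans hx'.2))
      have ev : ∀ᶠ y in 𝓝[Set.Icc a b] x, f y < B := (hf x hx').tendsto.eventually_lt_const hlt
      obtain ⟨δ, hδ, hd⟩ := Metric.mem_nhdsWithin_iff.1 ev
      filter_upwards [Ioo_mem_nhdsGT (show x < x + δ by linarith)] with y hy r hr hrb
      rcases le_or_gt r x with h | h
      · exact hx r ⟨hr.1, h⟩ hrb
      · have : r ∈ Metric.ball x δ ∩ Set.Icc a b := by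
          refine ⟨?_, hr.1, hrb⟩
          rw [Metric.mem_ball, Real.dist_eq, abs_of_pos (by linarith)]
          linarith [hr.2, hy.2]
        exact (hd this).le
  intro t ht
  exact step t ht (fun r hr => sub ht r hr (hr.2.trans ht.2))

theorem boot_back {f : ℝ → ℝ} {a b B : ℝ} (hf : ContinuousOn f (Set.Icc a b)) (h0 : f b < B)
    (step : ∀ t ∈ Set.Icc a b, (∀ r ∈ Set.Icc t b, f r ≤ B) → f t < B) : ∀ t ∈ Set.Icc a b, f t < B := by
  have := boot (f := fun t => f (-t)) (a := -b) (b := -a) (B := B)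
    (hf.comp continuous_neg.continuousOn fun t ht => ⟨by linarith [ht.2], by linarith [ht.1]⟩) (by simpa using h0)
    (fun t ht h => step (-t) ⟨by linarith [ht.2], by linarith [ht.1]⟩ fun r hr => by
      have := h (-r) ⟨by linarith [hr.2], by linarith [hr.1]⟩
      simpa using this)
  intro t ht
  simpa using this (-t) ⟨by linarith [ht.2], by linarith [ht.1]⟩

/-- a global classical solution at fixed epsilon -/
structure Glob (γ ε : ℝ) (u ud : ℝ → Rn n → ℂ) : Prop where
  hn : 2 ≤ n
  h0 : 0 < γ
  h1 : γ < 1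
  he : 0 < ε
  he1 : ε ≤ 1
  sol : Sol ε Set.univ u ud (fun t => T γ (u t) (u t) (u t))
  pdc : ∀ j x, Continuous (fun t => pd j (u t) x)

/-- boundedness of the norm -/
def Bdd (ε : ℝ) (u : ℝ → Rn n → ℂ) (S : Set ℝ) : Prop := ∃ B, ∀ t ∈ S, nn ε t (u t) ≤ B

theorem Glob.loc {γ ε : ℝ} {u ud : ℝ → Rn n → ℂ} (G : Glob γ ε u ud) {a b : ℝ} (h : Bdd ε u (Set.Icc a b)) :
    ∃ B, Loc γ ε a b B u ud := by
  obtain ⟨B, hB⟩ := h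
  refine ⟨2 / ε * B, G.hn, G.h0, G.h1, G.he, G.he1, G.sol.mono (Set.subset_univ _), fun t ht => ?_⟩
  have he := G.he
  exact (TB_of_nn (t := t) G.he G.he1 (G.sol.isS t trivial)).mono (mul_le_mul_of_nonneg_left (hB t ht) (by positivity))

theorem Glob.inc {γ ε : ℝ} {u ud : ℝ → Rn n → ℂ} (G : Glob γ ε u ud) : ∃ C, 0 < C ∧
    ∀ a b M, 0 ≤ a → a ≤ b → b ≤ π → (∀ t ∈ Set.Icc a b, nn ε t (u t) ≤ M) →
      |nn ε b (u b) - nn ε a (u a)| ≤ C * M ^ 3 * (b - a) := by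
  obtain ⟨C, hC, H⟩ := T_bd_eps G.hn G.h0 G.h1 G.he G.he1
  set N : ℝ := ((Fintype.card (Option (Bool × Fin n)) : ℕ) : ℝ) with hN
  have hN0 : 0 < N := by rw [hN]; exact_mod_cast Fintype.card_pos
  refine ⟨N * C, by positivity, fun a b M ha hab hb hM => ?_⟩
  have hM0 : 0 ≤ M := (nn_nonneg _ _ _).trans (hM a ⟨le_rfl, hab⟩)
  have hF : ∀ t ∈ Set.Icc a b, nn ε t (T γ (u t) (u t) (u t)) ≤ C * M ^ 3 := by
    intro t ht
    have hS := G.sol.isS t trivial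
    refine (H t _ _ _ hS hS hS).trans ?_
    have := pow_le_pow_left₀ (nn_nonneg ε t (u t)) (hM t ht) 3
    have := mul_le_mul_of_nonneg_left this hC.le
    linarith [this]
  have := lemN (by linarith [G.hn]) G.he G.he1 ha hab hb (G.sol.mono (Set.subset_univ _)) (B := max M (C * M ^ 3))
    (fun t ht => ((l2_le_nn ε t _).trans (hM t ht)).trans (le_max_left _ _))
    (fun t ht => ((l2_le_nn ε t _).trans (hF t ht)).trans (le_max_right _ _))
    (K := fun _ => C * M ^ 3) (p := a - 1) (fun t ht _ => hF t ht) intervalIntegrable_const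
  simp only [intervalIntegral.integral_const, smul_eq_mul] at this
  rw [abs_le]
  constructor <;> nlinarith [this.1, this.2]

theorem Glob.cont {γ ε : ℝ} {u ud : ℝ → Rn n → ℂ} (G : Glob γ ε u ud) {a b : ℝ} (ha : 0 ≤ a) (hb : b ≤ π)
    (h : Bdd ε u (Set.Icc a b)) : ContinuousOn (fun t => nn ε t (u t)) (Set.Icc a b) := by
  obtain ⟨C, hC, H⟩ := G.inc
  obtain ⟨M, hM⟩ := h
  by_cases hab : (Set.Icc a b).Nonempty
  swap
  · rw [Set.not_nonempty_iff_eq_empty.1 hab]; exact continuousOn_empty _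
  have hM0 : 0 ≤ M := (nn_nonneg _ _ _).trans (hM _ hab.some_mem)
  have key : ∀ s ∈ Set.Icc a b, ∀ t ∈ Set.Icc a b, s ≤ t → |nn ε t (u t) - nn ε s (u s)| ≤ C * M ^ 3 * |t - s| := by
    intro s hs t ht hst
    rw [abs_of_nonneg (show 0 ≤ t - s by linarith)]
    exact H s t M (by linarith [hs.1]) hst (by linarith [ht.2]) (fun r hr => hM r (Set.Icc_subset_Icc hs.1 ht.2 hr))
  refine (LipschitzOnWith.of_dist_le_mul (K := ⟨C * M ^ 3, by positivity⟩) (fun t ht s hs => ?_)).continuousOn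
  rw [Real.dist_eq, Real.dist_eq]
  change _ ≤ C * M ^ 3 * _
  rcases le_total s t with h | h
  · exact key s hs t ht h
  · rw [abs_sub_comm, abs_sub_comm t]; exact key t ht s hs h

theorem Glob.double {γ ε : ℝ} {u ud : ℝ → Rn n → ℂ} (G : Glob γ ε u ud) {M : ℝ} (hM : 0 < M) : ∃ r, 0 < r ∧
    ∀ a b s, 0 ≤ a → b ≤ π → b - a ≤ r → s ∈ Set.Icc a b → Bdd ε u (Set.Icc a b) → nn ε s (u s) ≤ M →
      ∀ t ∈ Set.Icc a b, nn ε t (u t) ≤ 2 * M := by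
  obtain ⟨C, hC, H⟩ := G.inc
  refine ⟨1 / (16 * C * M ^ 2), by positivity, fun a b s ha hb hr hs hB hsM t ht => ?_⟩
  have hc := G.cont ha hb hB
  have small : ∀ d, d ≤ b - a → C * (2 * M) ^ 3 * d ≤ M / 2 := by
    intro d hd
    have : d ≤ 1 / (16 * C * M ^ 2) := hd.trans hr
    refine (mul_le_mul_of_nonneg_left this (by positivity)).trans (le_of_eq ?_)
    field_simp; norm_num
  rcases le_total s t with h | h
  · refine (boot (a := s) (b := b) (B := 2 * M) (hc.mono (Set.Icc_subset_Icc hs.1 le_rfl)) (by linarith) (fun q hq hl => ?_) t ⟨h, ht.2⟩).le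
    have := H s q (2 * M) (by linarith [hs.1]) hq.1 (by linarith [hq.2]) hl
    have := le_of_abs_le this
    have := small (q - s) (by linarith [hq.2, hs.1])
    linarith
  · refine (boot_back (a := a) (b := s) (B := 2 * M) (hc.mono (Set.Icc_subset_Icc le_rfl hs.2)) (by linarith) (fun q hq hl => ?_) t ⟨ht.1, h⟩).le
    have := H q s (2 * M) (by linarith [hq.1]) hq.2 (by linarith [hs.2]) hl
    have := neg_le_of_abs_le this
    have := small (s - q) (by linarith [hs.2, hq.1])
    linarith

end HW
end

noncomputable section
namespace HW
variable {n : ℕ}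

/-- abstract Baire category argument -/
theorem baire_bdd {Y : ℝ → ℝ} {P : ℝ} (hP : 0 < P) (F : ℕ → Set ℝ) (hF : ∀ m, IsClosed (F m))
    (hU : ∀ t, ∃ m, t ∈ F m) (N : ℝ) (hN : 0 ≤ N) (hY : ∀ m, ∀ t ∈ F m, Y t ≤ N * m)
    (gap : ∀ c d, 0 ≤ c → c < d → d ≤ P →
      (∀ c' d', c < c' → d' < d → ∃ B, ∀ t ∈ Set.Icc c' d', Y t ≤ B) → ∃ B, ∀ t ∈ Set.Icc c d, Y t ≤ B)
    (dbl : ∀ M, 0 < M → ∃ r, 0 < r ∧ ∀ a b s, 0 ≤ a → b ≤ P → b - a ≤ r → s ∈ Set.Icc a b →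
      (∃ B, ∀ t ∈ Set.Icc a b, Y t ≤ B) → Y s ≤ M → ∀ t ∈ Set.Icc a b, Y t ≤ 2 * M) :
    ∃ B, ∀ t ∈ Set.Icc 0 P, Y t ≤ B := by
  set E : Set ℝ := {t | t ∈ Set.Icc 0 P ∧ ∀ U ∈ 𝓝 t, ∀ B, ∃ s ∈ U ∩ Set.Icc 0 P, B < Y s} with hE
  have cpt : ∀ c d, 0 ≤ c → d ≤ P → (∀ t ∈ Set.Icc c d, t ∉ E) → ∃ B, ∀ t ∈ Set.Icc c d, Y t ≤ B := by
    intro c d hc hd h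
    refine isCompact_Icc.induction_on (p := fun s => ∃ B, ∀ t ∈ s, Y t ≤ B) ⟨0, by simp⟩
      (fun s t hst ⟨B, hB⟩ => ⟨B, fun r hr => hB r (hst hr)⟩)
      (fun s t ⟨B, hB⟩ ⟨B', hB'⟩ => ⟨max B B', fun r hr => hr.elim (fun h => (hB r h).trans (le_max_left _ _))
        (fun h => (hB' r h).trans (le_max_right _ _))⟩) (fun x hx => ?_)
    have hx0 : x ∈ Set.Icc 0 P := ⟨hc.trans hx.1, hx.2.trans hd⟩
    have := h x hx
    simp only [hE, Set.mem_setOf_eq, not_and, not_forall, not_exists, not_lt] at this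
    obtain ⟨U, hU, B, hB⟩ := this hx0
    exact ⟨U ∩ Set.Icc c d, inter_mem (mem_nhdsWithin_of_mem_nhds hU) self_mem_nhdsWithin, B,
      fun s hs => hB s ⟨hs.1, hc.trans hs.2.1, hs.2.2.trans hd⟩⟩
  have gap' : ∀ c d, 0 ≤ c → c < d → d ≤ P → (∀ t ∈ Set.Ioo c d, t ∉ E) → ∃ B, ∀ t ∈ Set.Icc c d, Y t ≤ B := by
    intro c d hc hcd hd h
    refine gap c d hc hcd hd fun c' d' h1 h2 => cpt c' d' (by linarith) (by linarith) fun t ht =>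
      h t ⟨by linarith [ht.1], by linarith [ht.2]⟩
  have Ecl : IsClosed E := by
    rw [← isOpen_compl_iff, isOpen_iff_mem_nhds]
    intro t ht
    by_cases h0 : t ∈ Set.Icc 0 P
    · simp only [hE, Set.mem_compl_iff, Set.mem_setOf_eq, not_and, not_forall, not_exists, not_lt] at ht
      obtain ⟨U, hU, B, hB⟩ := ht h0
      filter_upwards [eventually_mem_nhds_iff.2 hU] with y hy
      simp only [hE, Set.mem_compl_iff, Set.mem_setOf_eq, not_and, not_forall, not_exists, not_lt]
      exact fun _ => ⟨U, hy, B, hB⟩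
    · filter_upwards [isClosed_Icc.isOpen_compl.mem_nhds h0] with y hy hyE
      exact hy hyE.1
  by_cases hne : E.Nonempty
  swap
  · refine cpt 0 P le_rfl le_rfl fun t _ ht => hne ⟨t, ht⟩
  exfalso
  haveI : CompleteSpace E := Ecl.completeSpace_coe
  haveI : Nonempty E := hne.to_subtype
  obtain ⟨m, ⟨t0, ht0E⟩, hm⟩ := nonempty_interior_of_iUnion_of_closed
    (f := fun m : ℕ => (Subtype.val ⁻¹' F m : Set E)) (fun m => (hF m).preimage continuous_subtype_val)
    (by ext t; simpa using hU t)
  rw [mem_interior_iff_mem_nhds, nhds_subtype, mem_comap] at hm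
  obtain ⟨V, hV, hVF⟩ := hm
  obtain ⟨ρ, hρ, hρV⟩ := Metric.mem_nhds_iff.1 hV
  set M := N * m + 1 with hMd
  have hM : 0 < M := by positivity
  obtain ⟨r, hr, hr2⟩ := dbl M hM
  have onE : ∀ s ∈ E, |s - t0| < ρ → Y s ≤ M := by
    intro s hs hsr
    have := hVF (show (⟨s, hs⟩ : E) ∈ Subtype.val ⁻¹' V from hρV (by rw [Metric.mem_ball, Real.dist_eq]; exact hsr))
    have := hY m s this
    linarith
  obtain ⟨t, ⟨ht1, ht2⟩, ht3⟩ := ht0E.2 (Metric.ball t0 (min ρ r)) (Metric.ball_mem_nhds _ (by positivity)) (2 * M)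
  rw [Metric.mem_ball, Real.dist_eq, lt_min_iff] at ht1
  have tE : t ∉ E := fun h => by
    have := onE t h ht1.1
    linarith
  rcases le_total t0 t with h | h
  · have hb : BddAbove (E ∩ Set.Icc t0 t) := ⟨t, fun s hs => hs.2.2⟩
    have hs := IsClosed.csSup_mem (Ecl.inter isClosed_Icc) ⟨t0, ht0E, le_rfl, h⟩ hb
    set s := sSup (E ∩ Set.Icc t0 t) with hsd
    have hst : s < t := lt_of_le_of_ne hs.2.2 fun e => tE (e ▸ hs.1)
    have hr1 := abs_lt.1 ht1.1
    have hr3 := abs_lt.1 ht1.2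
    obtain ⟨B, hB⟩ := gap' s t hs.1.1.1 hst ht2.2 fun q hq hqE => by
      have := le_csSup hb ⟨hqE, by linarith [hq.1, hs.2.1], hq.2.le⟩
      linarith [hq.1]
    have := hr2 s t s hs.1.1.1 ht2.2 (by linarith [hs.2.1]) ⟨le_rfl, hst.le⟩ ⟨B, hB⟩
      (onE s hs.1 (by rw [abs_lt]; constructor <;> linarith [hs.2.1])) t ⟨hst.le, le_rfl⟩
    linarith
  · have hb : BddBelow (E ∩ Set.Icc t t0) := ⟨t, fun s hs => hs.2.1⟩
    have hs := IsClosed.csInf_mem (Ecl.inter isClosed_Icc) ⟨t0, ht0E, h, le_rfl⟩ hb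
    set s := sInf (E ∩ Set.Icc t t0) with hsd
    have hst : t < s := lt_of_le_of_ne hs.2.1 fun e => tE (e ▸ hs.1)
    have hr1 := abs_lt.1 ht1.1
    have hr3 := abs_lt.1 ht1.2
    obtain ⟨B, hB⟩ := gap' t s ht2.1 hst hs.1.1.2 fun q hq hqE => by
      have := csInf_le hb ⟨hqE, hq.1.le, by linarith [hq.2, hs.2.2]⟩
      linarith [hq.2]
    have := hr2 t s s ht2.1 hs.1.1.2 (by linarith [hs.2.2]) ⟨hst.le, le_rfl⟩ ⟨B, hB⟩
      (onE s hs.1 (by rw [abs_lt]; constructor <;> linarith [hs.2.2])) t ⟨le_rfl, hst.le⟩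
    linarith

theorem Glob.gop_cont {γ ε : ℝ} {u ud : ℝ → Rn n → ℂ} (G : Glob γ ε u ud) (k : Option (Bool × Fin n)) (x : Rn n) :
    Continuous (fun t => gop k ε t (u t) x) := by
  have hu : Continuous (fun t => u t x) := continuous_iff_continuousAt.2 fun t => (G.sol.der t trivial x).continuousAt
  cases k with
  | none => exact hu
  | some p =>
    obtain ⟨b, j⟩ := p
    have := G.pdc j x
    cases b
    · simp only [gop, Aop, gA, gB, if_false, Bool.false_eq_true]
      fun_prop
    · simp only [gop, Aop, gA, gB, if_true]
      fun_prop

theorem Glob.closed {γ ε : ℝ} {u ud : ℝ → Rn n → ℂ} (G : Glob γ ε u ud) (m : ℕ) :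
    IsClosed {t : ℝ | ∀ k, l2 (gop k ε t (u t)) ≤ m} := by
  rw [← isSeqClosed_iff_isClosed]
  intro x y hx hxy k
  have hS := fun t => (G.sol.isS t trivial).gop k ε t
  have h1 : eLpNorm (gop k ε y (u y)) 2 volume ≤ (m : ℝ≥0∞) := by
    refine (Lp.eLpNorm_lim_le_liminf_eLpNorm (fun i => (hS (x i)).memLp.1) _
      (Eventually.of_forall fun z => ((G.gop_cont k z).tendsto y).comp hxy)).trans ?_
    refine liminf_le_of_frequently_le' (Eventually.of_forall fun i => ?_).frequently
    have := hx i k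
    unfold l2 at this
    rw [← ENNReal.ofReal_natCast]
    exact (ENNReal.le_ofReal_iff_toReal_le (hS (x i)).memLp.2.ne (by positivity)).2 this
  unfold l2
  refine ENNReal.toReal_le_of_le_ofReal (by positivity) ?_
  rwa [ENNReal.ofReal_natCast]

theorem Glob.bdd {γ ε : ℝ} {u ud : ℝ → Rn n → ℂ} (G : Glob γ ε u ud) : Bdd ε u (Set.Icc 0 π) := by
  refine baire_bdd Real.pi_pos (fun m => {t : ℝ | ∀ k, l2 (gop k ε t (u t)) ≤ m}) G.closed (fun t => ?_)
    ((Fintype.card (Option (Bool × Fin n)) : ℕ) : ℝ) (by positivity) (fun m t ht => ?_) (fun c d hc hcd hd h => ?_)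
    (fun M hM => G.double hM)
  · obtain ⟨m, hm⟩ := exists_nat_ge (nn ε t (u t))
    exact ⟨m, fun k => (l2_gop_le_nn k ε t _).trans hm⟩
  · unfold nn
    refine (Finset.sum_le_sum fun k _ => ht k).trans (le_of_eq ?_)
    simp
  · set e := (c + d) / 2 with he
    have H : ∀ t ∈ Set.Ioo c d, En γ ε (u t) = En γ ε (u e) ∧ l2 (u t) = l2 (u e) := by
      intro t ht
      have ⟨q1, q2⟩ := ht
      obtain ⟨B, L⟩ := G.loc (h ((c + min t e) / 2) ((d + max t e) / 2)
        (by have : c < min t e := lt_min (by linarith) (by linarith)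
            linarith) (by have : max t e < d := max_lt (by linarith) (by linarith)
                          linarith))
      have hm1 : (c + min t e) / 2 < t := by have := min_le_left t e; linarith
      have hm2 : (c + min t e) / 2 < e := by have := min_le_right t e; linarith
      have hm3 : t < (d + max t e) / 2 := by have := le_max_left t e; linarith
      have hm4 : e < (d + max t e) / 2 := by have := le_max_right t e; linarith
      rcases le_total t e with h' | h'
      · exact ⟨(L.energy hm1.le h' hm4).symm, (L.mass ⟨hm1.le, hm3.le⟩ ⟨hm2.le, hm4.le⟩ h').symm⟩
      · exact ⟨L.energy hm2.le h' hm3, L.mass ⟨hm2.le, hm4.le⟩ ⟨hm1.le, hm3.le⟩ h'⟩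
    set A := l2 (u e) + √(2 / ε * En γ ε (u e)) + √(2 * ε * En γ ε (u e))
    refine ⟨max (max (nn ε c (u c)) (nn ε d (u d))) (Fintype.card (Option (Bool × Fin n)) * (2 / ε * A)), fun t ht => ?_⟩
    rcases ht.1.eq_or_lt with h1 | h1
    · rw [← h1]; exact (le_max_left _ _).trans (le_max_left _ _)
    rcases ht.2.eq_or_lt with h2 | h2
    · rw [h2]; exact (le_max_right _ _).trans (le_max_left _ _)
    refine le_trans ?_ (le_max_right _ _)
    have hS := G.sol.isS t trivial
    have := En_TB (γ := γ) G.he hS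
    rw [(H t ⟨h1, h2⟩).1, (H t ⟨h1, h2⟩).2] at this
    exact nn_of_TB G.he G.he1 hS this

theorem Glob.nn_cont {γ ε : ℝ} {u ud : ℝ → Rn n → ℂ} (G : Glob γ ε u ud) :
    ContinuousOn (fun t => nn ε t (u t)) (Set.Icc 0 π) := G.cont le_rfl le_rfl G.bdd

theorem pd_joint {u : ℝ → Rn n → ℂ} (h : ContDiff ℝ (⊤ : ℕ∞) (fun p : ℝ × Rn n => u p.1 p.2)) (j : Fin n) (t : ℝ) (x : Rn n) :
    pd j (u t) x = fderiv ℝ (fun p : ℝ × Rn n => u p.1 p.2) (t, x) (0, EuclideanSpace.single j 1) := by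
  have h1 : HasFDerivAt (fun p : ℝ × Rn n => u p.1 p.2) _ (t, x) :=
    ((h.differentiable (by simp)) (t, x)).hasFDerivAt
  have h2 := hasFDerivAt_prodMk_right (𝕜 := ℝ) t x
  have := h1.comp x h2
  have h3 : HasFDerivAt (u t) _ x := this
  unfold pd
  rw [h3.fderiv]; simp

theorem dt_joint {u : ℝ → Rn n → ℂ} (h : ContDiff ℝ (⊤ : ℕ∞) (fun p : ℝ × Rn n => u p.1 p.2)) (t : ℝ) (x : Rn n) :
    HasDerivAt (fun s => u s x) (fderiv ℝ (fun p : ℝ × Rn n => u p.1 p.2) (t, x) (1, 0)) t := by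
  have h1 : HasFDerivAt (fun p : ℝ × Rn n => u p.1 p.2) _ (t, x) :=
    ((h.differentiable (by simp)) (t, x)).hasFDerivAt
  have h2 : HasDerivAt (fun s : ℝ => ((s, x) : ℝ × Rn n)) (1, 0) t := (hasDerivAt_id t).prodMk (hasDerivAt_const t x)
  exact h1.comp_hasDerivAt t h2

theorem glob_of {γ ε : ℝ} (hn : 2 ≤ n) (h0 : 0 < γ) (h1 : γ < 1) (he : 0 < ε) (he1 : ε ≤ 1) {f : Rn n → ℂ}
    {u : ℝ → Rn n → ℂ} (H : IsSolutionH n 1 γ ε f u) :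
    Glob γ ε u (fun t x => fderiv ℝ (fun p : ℝ × Rn n => u p.1 p.2) (t, x) (1, 0)) := by
  have hc := H.smooth.continuous_fderiv (by simp)
  have hS : ∀ t, IsS (u t) := H.schwartz
  have hγn : γ < n := by
    have : (2 : ℝ) ≤ n := by exact_mod_cast hn
    linarith
  refine ⟨hn, h0, h1, he, he1, ⟨fun t _ => hS t, fun t _ => T_isS (by linarith) h0.le hγn (hS t) (hS t) (hS t),
    fun t _ x => dt_joint H.smooth t x, H.smooth.continuous.continuousOn, ?_, fun t _ x => ?_⟩, fun j x => ?_⟩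
  · refine Continuous.continuousOn ?_
    exact hc.clm_apply continuous_const
  · have := H.eq t x
    rw [(dt_joint H.smooth t x).deriv] at this
    simp only [T]
    rw [← hartree_eq]
    simp only [Real.rpow_one] at this
    push_cast at this ⊢
    linear_combination this
  · simp only [pd_joint H.smooth]
    exact (hc.comp (by fun_prop : Continuous fun t : ℝ => ((t, x) : ℝ × Rn n))).clm_apply continuous_const
end HW
end

noncomputable section
namespace HW
variable {n : ℕ}

/-- quadratic chirp -/
def ch (r : ℝ) (x : Rn n) : ℂ := Complex.exp (Complex.I * ((-(‖x‖ ^ 2 * r) : ℝ) : ℂ))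

theorem ch_norm (r : ℝ) (x : Rn n) : ‖ch r x‖ = 1 := by
  unfold ch; rw [mul_comm, Complex.norm_exp_ofReal_mul_I]

theorem ch_temp (r : ℝ) : (ch (n := n) r).HasTemperateGrowth := by
  have : (fun x : Rn n => -(‖x‖ ^ 2 * r)).HasTemperateGrowth := by
    have h := (Function.hasTemperateGrowth_norm_sq (H := Rn n)).mul (Function.HasTemperateGrowth.const (-r))
    have e : (fun x : Rn n => -(‖x‖ ^ 2 * r)) = (fun x : Rn n => ‖x‖ ^ 2) * fun _ => -r := by ext x; simp
    rw [e]; exact h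
  exact temp_cis_comp this

theorem pd_ch (r : ℝ) (j : Fin n) (x : Rn n) : pd j (ch r) x = -(2 * Complex.I * r * x j) * ch r x := by
  have h1 : HasFDerivAt (fun x : Rn n => ‖x‖ ^ 2) (2 • (innerSL ℝ x)) x := (hasStrictFDerivAt_norm_sq x).hasFDerivAt
  have h2 : HasFDerivAt (fun x : Rn n => -(‖x‖ ^ 2 * r)) _ x := (h1.mul_const r).neg
  have h3 : HasFDerivAt (fun x : Rn n => ((-(‖x‖ ^ 2 * r) : ℝ) : ℂ)) _ x :=
    (Complex.ofRealCLM.hasFDerivAt).comp x h2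
  have h4 : HasFDerivAt (fun x : Rn n => Complex.exp (Complex.I * ((-(‖x‖ ^ 2 * r) : ℝ) : ℂ))) _ x := (h3.const_mul Complex.I).cexp
  unfold pd
  have h5 : HasFDerivAt (ch r) _ x := h4
  rw [h5.fderiv]
  simp only [ch, ContinuousLinearMap.smul_apply, ContinuousLinearMap.comp_apply, ContinuousLinearMap.neg_apply, smul_eq_mul,
    innerSL_apply_apply, EuclideanSpace.inner_single_right]
  simp
  ring

/-- the lens transform -/
def L (K : ℂ) (c r : ℝ) (a : Rn n → ℂ) (x : Rn n) : ℂ := K * (ch r x * a (c⁻¹ • x))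

theorem L_isS (K : ℂ) {c : ℝ} (hc : c ≠ 0) (r : ℝ) {a : Rn n → ℂ} (h : IsS a) : IsS (L K c r a) :=
  ((h.comp_smul (inv_ne_zero hc)).tmul (ch_temp r)).cmul K

theorem L_sub (K : ℂ) (c r : ℝ) (a b : Rn n → ℂ) : L K c r (fun y => a y - b y) = fun x => L K c r a x - L K c r b x := by
  ext x; unfold L; ring

theorem L_add (K : ℂ) (c r : ℝ) (a b : Rn n → ℂ) : L K c r (fun y => a y + b y) = fun x => L K c r a x + L K c r b x := by
  ext x; unfold L; ring

theorem L_cmul (K : ℂ) (c r : ℝ) (d : ℂ) (a : Rn n → ℂ) : L K c r (fun y => d * a y) = fun x => d * L K c r a x := by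
  ext x; unfold L; ring

theorem L_coord (K : ℂ) {c : ℝ} (hc : c ≠ 0) (r : ℝ) (a : Rn n → ℂ) (j : Fin n) (x : Rn n) :
    ((x j : ℝ) : ℂ) * L K c r a x = L K c r (fun y => (c : ℂ) * (((y j : ℝ) : ℂ) * a y)) x := by
  unfold L
  have hc' : (c : ℂ) ≠ 0 := by exact_mod_cast hc
  simp
  field_simp

/-- conjugated derivative -/
def Dc (c r : ℝ) (j : Fin n) (a : Rn n → ℂ) (y : Rn n) : ℂ :=
  (c : ℂ)⁻¹ * pd j a y - (2 * Complex.I * r * c) * (((y j : ℝ) : ℂ) * a y)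

theorem Dc_isS (c r : ℝ) (j : Fin n) {a : Rn n → ℂ} (h : IsS a) : IsS (Dc c r j a) :=
  ((h.pd j).cmul _).sub ((h.coord j).cmul _)

theorem pd_L (K : ℂ) {c : ℝ} (hc : c ≠ 0) (r : ℝ) {a : Rn n → ℂ} (h : IsS a) (j : Fin n) :
    pd j (L K c r a) = L K c r (Dc c r j a) := by
  ext x
  have hs := h.comp_smul (inv_ne_zero hc)
  unfold L
  rw [pd_cmul (hs.tmul (ch_temp r)).diff, pd_mul (temp_diff (ch_temp r)) hs.diff, pd_comp_smul h.diff, pd_ch]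
  have hc' : (c : ℂ) ≠ 0 := by exact_mod_cast hc
  simp only [Dc, PiLp.smul_apply, smul_eq_mul]
  push_cast
  field_simp
  ring

theorem lap_L (K : ℂ) {c : ℝ} (hc : c ≠ 0) (r : ℝ) {a : Rn n → ℂ} (h : IsS a) (x : Rn n) :
    lap (L K c r a) x = L K c r (fun y => ∑ j, Dc c r j (Dc c r j a) y) x := by
  rw [lap_eq]
  simp only [pd_L K hc r h, fun j => pd_L K hc r (Dc_isS c r j h) j]
  simp only [L, Finset.mul_sum]

theorem Dc_Dc {c : ℝ} (hc : c ≠ 0) (r : ℝ) (j : Fin n) {a : Rn n → ℂ} (h : IsS a) (y : Rn n) :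
    Dc c r j (Dc c r j a) y = (c : ℂ)⁻¹ ^ 2 * pd j (pd j a) y - 4 * Complex.I * r * (((y j : ℝ) : ℂ) * pd j a y)
      - 2 * Complex.I * r * a y - 4 * r ^ 2 * c ^ 2 * (((y j : ℝ) : ℂ) ^ 2 * a y) := by
  have hc' : (c : ℂ) ≠ 0 := by exact_mod_cast hc
  rw [Dc]
  have : pd j (Dc c r j a) y = (c : ℂ)⁻¹ * pd j (pd j a) y - (2 * Complex.I * r * c) * (((y j : ℝ) : ℂ) * pd j a y + a y) := by
    unfold Dc
    rw [pd_sub ((h.pd j).cmul _).diff ((h.coord j).cmul _).diff, pd_cmul (h.pd j).diff, pd_cmul (h.coord j).diff,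
      pd_mul (diff_coord j) h.diff, show pd j (fun x : Rn n => ((x j : ℝ) : ℂ)) y = _ from pd_coord _ _ _]
    simp
  rw [this]
  simp only [Dc]
  field_simp
  linear_combination (c ^ 4 * ((y j : ℝ) : ℂ) ^ 2 * a y * 4 * r ^ 2) * Complex.I_sq

theorem lap_L' (K : ℂ) {c : ℝ} (hc : c ≠ 0) (r : ℝ) {a : Rn n → ℂ} (h : IsS a) (x : Rn n) :
    lap (L K c r a) x = L K c r (fun y => (c : ℂ)⁻¹ ^ 2 * lap a y - 4 * Complex.I * r * (∑ j, ((y j : ℝ) : ℂ) * pd j a y)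
      - 2 * n * Complex.I * r * a y - 4 * r ^ 2 * c ^ 2 * (((‖y‖ ^ 2 : ℝ) : ℂ) * a y)) x := by
  rw [lap_L K hc r h]
  congr 1
  ext y
  simp only [Dc_Dc hc r _ h]
  rw [Finset.sum_sub_distrib, Finset.sum_sub_distrib, Finset.sum_sub_distrib, ← Finset.mul_sum, ← Finset.mul_sum, ← Finset.mul_sum, ← Finset.mul_sum,
    ← Finset.sum_mul, lap_eq, normsq_c]
  simp
  ring

theorem L_l2 {K : ℂ} {c : ℝ} (hc : c ≠ 0) (hK : ‖K‖ = |c| ^ (-(n : ℝ) / 2)) (r : ℝ) {a : Rn n → ℂ} (h : IsS a) :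
    l2 (L K c r a) = l2 a := by
  have h1 : l2 (L K c r a) ^ 2 = l2 a ^ 2 := by
    rw [l2_sq (L_isS K hc r h).memLp, l2_sq h.memLp]
    have e : ∀ x : Rn n, ‖L K c r a x‖ ^ 2 = |c| ^ (-(n : ℝ)) * ‖a (c⁻¹ • x)‖ ^ 2 := by
      intro x
      unfold L
      rw [norm_mul, norm_mul, ch_norm, one_mul, mul_pow, hK, ← Real.rpow_natCast, ← Real.rpow_mul (abs_nonneg c)]
      congr 2; push_cast; ring
    simp only [e]
    rw [integral_const_mul, Measure.integral_comp_inv_smul volume (fun y : Rn n => ‖a y‖ ^ 2) c]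
    rw [finrank_euclideanSpace, Fintype.card_fin, smul_eq_mul, ← mul_assoc, Real.rpow_neg (abs_nonneg c), Real.rpow_natCast, abs_pow,
      inv_mul_cancel₀ (by positivity), one_mul]
  exact (sq_eq_sq₀ (l2_nonneg _) (l2_nonneg _)).1 h1

theorem convC_L {K : ℂ} {c γ : ℝ} (hc : c ≠ 0) (hK : ‖K‖ = |c| ^ (-(n : ℝ) / 2)) (r : ℝ) (a : Rn n → ℂ) (x : Rn n) :
    convC γ (fun y => L K c r a y * conj (L K c r a y)) x
      = ((|c| ^ (-γ) : ℝ) : ℂ) * convC γ (fun y => a y * conj (a y)) (c⁻¹ • x) := by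
  have e : ∀ y : Rn n, L K c r a y * conj (L K c r a y) = ((|c| ^ (-(n : ℝ)) : ℝ) : ℂ) * (a (c⁻¹ • y) * conj (a (c⁻¹ • y))) := by
    intro y
    rw [Complex.mul_conj', Complex.mul_conj']
    unfold L
    rw [norm_mul, norm_mul, ch_norm, one_mul, hK]
    have : |c| ^ (-(n : ℝ)) = (|c| ^ (-(n : ℝ) / 2)) ^ 2 := by
      rw [← Real.rpow_natCast, ← Real.rpow_mul (abs_nonneg c)]
      congr 1; push_cast; ring
    rw [this]; push_cast; ring
  unfold convC
  simp only [e]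
  have e2 : ∀ y : Rn n, ((‖x - y‖ ^ (-γ) : ℝ) : ℂ) * (((|c| ^ (-(n : ℝ)) : ℝ) : ℂ) * (a (c⁻¹ • y) * conj (a (c⁻¹ • y))))
      = (((|c| ^ (-(n : ℝ)) : ℝ) : ℂ) * ((|c| ^ (-γ) : ℝ) : ℂ)) * (fun z : Rn n => ((‖c⁻¹ • x - z‖ ^ (-γ) : ℝ) : ℂ) * (a z * conj (a z))) (c⁻¹ • y) := by
    intro y
    have : ‖x - y‖ ^ (-γ) = |c| ^ (-γ) * ‖c⁻¹ • x - c⁻¹ • y‖ ^ (-γ) := by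
      rw [← smul_sub, norm_smul, ← Real.mul_rpow (abs_nonneg c) (by positivity), norm_inv, Real.norm_eq_abs, ← mul_assoc,
        mul_inv_cancel₀ (abs_pos.2 hc).ne', one_mul]
    rw [this]; push_cast; ring
  simp only [e2]
  rw [integral_const_mul, Measure.integral_comp_inv_smul volume (fun z : Rn n => ((‖c⁻¹ • x - z‖ ^ (-γ) : ℝ) : ℂ) * (a z * conj (a z))) c]
  rw [finrank_euclideanSpace, Fintype.card_fin, Complex.real_smul, Real.rpow_neg (abs_nonneg c), Real.rpow_natCast, abs_pow]
  have : ((|c| ^ n : ℝ) : ℂ) ≠ 0 := by exact_mod_cast (pow_pos (abs_pos.2 hc) n).ne'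
  push_cast at this ⊢
  field_simp

theorem T_L {K : ℂ} {c γ : ℝ} (hc : c ≠ 0) (hK : ‖K‖ = |c| ^ (-(n : ℝ) / 2)) (r : ℝ) (a : Rn n → ℂ) (x : Rn n) :
    T γ (L K c r a) (L K c r a) (L K c r a) x = L K c r (fun y => ((|c| ^ (-γ) : ℝ) : ℂ) * T γ a a a y) x := by
  unfold T
  rw [convC_L hc hK]
  unfold L
  ring

/-- the standard lens at time t -/
def lens (θ : ℂ) (ε t : ℝ) (a : Rn n → ℂ) : Rn n → ℂ :=
  L (θ * ((|Real.cos t| ^ (-(n : ℝ) / 2) : ℝ) : ℂ)) (Real.cos t) (Real.tan t / (2 * ε)) a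

theorem lens_K {θ : ℂ} (hθ : ‖θ‖ = 1) (t : ℝ) : ‖θ * ((|Real.cos t| ^ (-(n : ℝ) / 2) : ℝ) : ℂ)‖ = |Real.cos t| ^ (-(n : ℝ) / 2) := by
  rw [norm_mul, hθ, one_mul, Complex.norm_real, Real.norm_of_nonneg (by positivity)]

theorem lens_isS (θ : ℂ) (ε : ℝ) {t : ℝ} (hc : Real.cos t ≠ 0) {a : Rn n → ℂ} (h : IsS a) : IsS (lens θ ε t a) :=
  L_isS _ hc _ h

theorem lens_l2 {θ : ℂ} (hθ : ‖θ‖ = 1) (ε : ℝ) {t : ℝ} (hc : Real.cos t ≠ 0) {a : Rn n → ℂ} (h : IsS a) :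
    l2 (lens θ ε t a) = l2 a := L_l2 hc (lens_K hθ t) _ h

theorem lens_sub (θ : ℂ) (ε t : ℝ) (a b : Rn n → ℂ) : lens θ ε t (fun y => a y - b y) = fun x => lens θ ε t a x - lens θ ε t b x :=
  L_sub _ _ _ _ _

/-- operators before the lens -/
def gop0 (k : Option (Bool × Fin n)) (a : Rn n → ℂ) : Rn n → ℂ :=
  match k with
  | none => a
  | some (true, j) => fun y => -Complex.I * pd j a y
  | some (false, j) => fun y => ((y j : ℝ) : ℂ) * a y

/-- the correction for H -/
def gop1 (k : Option (Bool × Fin n)) (a : Rn n → ℂ) : Rn n → ℂ :=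
  match k with
  | none => fun _ => 0
  | some (true, _) => fun _ => 0
  | some (false, j) => fun y => Complex.I * pd j a y

theorem gop0_isS (k : Option (Bool × Fin n)) {a : Rn n → ℂ} (h : IsS a) : IsS (gop0 k a) := by
  match k with
  | none => exact h
  | some (true, j) => exact (h.pd j).cmul _
  | some (false, j) => exact h.coord j

theorem gop1_isS (k : Option (Bool × Fin n)) {a : Rn n → ℂ} (h : IsS a) : IsS (gop1 k a) := by
  match k with
  | none => exact IsS.zero
  | some (true, j) => exact IsS.zero
  | some (false, j) => exact (h.pd j).cmul _

theorem gop_lens (k : Option (Bool × Fin n)) (θ : ℂ) {ε t : ℝ} (he : ε ≠ 0) (hc : Real.cos t ≠ 0) {a : Rn n → ℂ} (h : IsS a) :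
    gop k ε t (lens θ ε t a) = lens θ ε t (fun y => gop0 k a y + ((ε * Real.tan t : ℝ) : ℂ) * gop1 k a y) := by
  have hc' : ((Real.cos t : ℝ) : ℂ) ≠ 0 := by exact_mod_cast hc
  have he' : (ε : ℂ) ≠ 0 := by exact_mod_cast he
  have hsc := sc_c t
  match k with
  | none => simp [gop, gop0, gop1]
  | some (true, j) =>
    ext x
    simp only [gop, Aop, gop0, gop1, gA, gB, if_true]
    unfold lens
    rw [pd_L _ hc _ h, L_coord _ hc]
    simp only [L, Dc]
    generalize ch (Real.tan t / (2 * ε)) x = X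
    generalize a ((Real.cos t)⁻¹ • x) = A
    generalize pd j a ((Real.cos t)⁻¹ • x) = P
    generalize ((Real.cos t)⁻¹ • x) j = Y
    generalize θ * ((|Real.cos t| ^ (-(n : ℝ) / 2) : ℝ) : ℂ) = K
    rw [Real.tan_eq_sin_div_cos]
    push_cast [-Complex.ofReal_sin, -Complex.ofReal_cos]
    field_simp
    linear_combination (K * X * ((Real.cos t : ℝ) : ℂ) ^ 2 * ((Real.sin t : ℝ) : ℂ) * Y * A) * Complex.I_sq
  | some (false, j) =>
    ext x
    simp only [gop, Aop, gop0, gop1, gA, gB, if_false, Bool.false_eq_true]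
    unfold lens
    rw [pd_L _ hc _ h, L_coord _ hc]
    simp only [L, Dc]
    generalize ch (Real.tan t / (2 * ε)) x = X
    generalize a ((Real.cos t)⁻¹ • x) = A
    generalize pd j a ((Real.cos t)⁻¹ • x) = P
    generalize ((Real.cos t)⁻¹ • x) j = Y
    generalize θ * ((|Real.cos t| ^ (-(n : ℝ) / 2) : ℝ) : ℂ) = K
    rw [Real.tan_eq_sin_div_cos]
    push_cast [-Complex.ofReal_sin, -Complex.ofReal_cos]
    field_simp
    linear_combination (K * X * ((Real.cos t : ℝ) : ℂ) * Y * A) * hsc - (K * X * ((Real.cos t : ℝ) : ℂ) * Y * A * ((Real.sin t : ℝ) : ℂ) ^ 2) * Complex.I_sq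
end HW
end

noncomputable section
namespace HW
variable {n : ℕ}

/-- weight -/
def wt (γ t : ℝ) : ℝ := |Real.cos t| ^ (-γ)

theorem wt_nonneg (γ t : ℝ) : 0 ≤ wt γ t := by unfold wt; positivity

theorem wt_cont (γ : ℝ) {t : ℝ} (h : Real.cos t ≠ 0) : ContinuousAt (wt γ) t := by
  unfold wt
  exact (Real.continuous_cos.abs.continuousAt).rpow_const (Or.inl (abs_pos.2 h).ne')

theorem wt_meas (γ : ℝ) : Measurable (wt γ) := by unfold wt; fun_prop

theorem cos_ge {t : ℝ} (h0 : 0 ≤ t) (h1 : t ≤ π) : 2 / π * |t - π / 2| ≤ |Real.cos t| := by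
  have hp := Real.pi_pos
  have e : Real.cos t = Real.sin (π / 2 - t) := (Real.sin_pi_div_two_sub t).symm
  rcases le_total t (π / 2) with h | h
  · rw [abs_of_nonpos (by linarith), e]
    have := Real.mul_le_sin (x := π / 2 - t) (by linarith) (by linarith)
    refine le_trans (le_of_eq (by ring)) (this.trans (le_abs_self _))
  · rw [abs_of_nonneg (by linarith), e, ← abs_neg, ← Real.sin_neg]
    have := Real.mul_le_sin (x := -(π / 2 - t)) (by linarith) (by linarith)
    refine le_trans (le_of_eq (by ring)) (this.trans (le_abs_self _))

theorem int_abs_rpow {γ : ℝ} (h1 : γ < 1) (a b : ℝ) : IntervalIntegrable (fun x : ℝ => |x| ^ (-γ)) volume a b := by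
  have pos : ∀ d, 0 ≤ d → IntervalIntegrable (fun x : ℝ => |x| ^ (-γ)) volume 0 d := by
    intro d hd
    have := intervalIntegral.intervalIntegrable_rpow' (r := -γ) (by linarith) (a := 0) (b := d)
    refine this.congr ?_
    intro x hx
    rw [Set.uIoc_of_le hd] at hx
    simp only [abs_of_pos hx.1]
  have all : ∀ d, IntervalIntegrable (fun x : ℝ => |x| ^ (-γ)) volume 0 d := by
    intro d
    rcases le_total 0 d with h | h
    · exact pos d h
    · have := (pos (-d) (by linarith))
      rw [IntervalIntegrable.iff_comp_neg (by simp)] at this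
      simpa using this
  exact (all a).symm.trans (all b)

theorem wt_int {γ : ℝ} (h0 : 0 < γ) (h1 : γ < 1) {a b : ℝ} (ha : a ∈ Set.Icc 0 π) (hb : b ∈ Set.Icc 0 π) :
    IntervalIntegrable (wt γ) volume a b := by
  have hp := Real.pi_pos
  have h := (int_abs_rpow h1 (a - π / 2) (b - π / 2)).comp_sub_right (π / 2)
  simp only [sub_add_cancel] at h
  refine (h.const_mul ((2 / π) ^ (-γ))).mono_fun (wt_meas γ).aestronglyMeasurable ?_
  have : ∀ᵐ t ∂(volume.restrict (Set.uIoc a b)), t ≠ π / 2 := (Measure.ae_ne volume (π / 2)).filter_mono (ae_mono Measure.restrict_le_self)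
  filter_upwards [this, ae_restrict_mem measurableSet_uIoc] with t ht hm
  have htm : t ∈ Set.Icc 0 π := (Set.uIoc_subset_uIcc.trans (Set.uIcc_subset_Icc ha hb)) hm
  rw [Real.norm_of_nonneg (wt_nonneg _ _), Real.norm_of_nonneg (by positivity), ← Real.mul_rpow (by positivity) (by positivity)]
  unfold wt
  have hpos : 0 < 2 / π * |t - π / 2| := mul_pos (by positivity) (abs_pos.2 (sub_ne_zero.2 ht))
  exact Real.rpow_le_rpow_of_nonpos hpos (cos_ge htm.1 htm.2) (by linarith)

/-- slow time -/
def Lam (γ t : ℝ) : ℝ := ∫ τ in (0 : ℝ)..t, wt γ τ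

theorem Lam_deriv {γ : ℝ} (h0 : 0 < γ) (h1 : γ < 1) {t : ℝ} (ht : t ∈ Set.Icc 0 π) (hc : Real.cos t ≠ 0) :
    HasDerivAt (Lam γ) (wt γ t) t :=
  intervalIntegral.integral_hasDerivAt_right (wt_int h0 h1 ⟨le_rfl, Real.pi_pos.le⟩ ht)
    (wt_meas γ).stronglyMeasurable.stronglyMeasurableAtFilter (wt_cont γ hc)

theorem Lam_cont {γ : ℝ} (h0 : 0 < γ) (h1 : γ < 1) : ContinuousOn (Lam γ) (Set.Icc 0 π) := by
  have := wt_int h0 h1 (a := 0) (b := π) ⟨le_rfl, Real.pi_pos.le⟩ ⟨Real.pi_pos.le, le_rfl⟩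
  have h := intervalIntegral.continuousOn_primitive_interval' this (a := 0) Set.left_mem_uIcc
  rwa [Set.uIcc_of_le Real.pi_pos.le] at h

theorem Lam_sub {γ : ℝ} (h0 : 0 < γ) (h1 : γ < 1) {a b : ℝ} (ha : a ∈ Set.Icc 0 π) (hb : b ∈ Set.Icc 0 π) :
    ∫ τ in a..b, wt γ τ = Lam γ b - Lam γ a :=
  (intervalIntegral.integral_interval_sub_left (wt_int h0 h1 ⟨le_rfl, Real.pi_pos.le⟩ hb) (wt_int h0 h1 ⟨le_rfl, Real.pi_pos.le⟩ ha)).symm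

theorem Lam_mono {γ : ℝ} (h0 : 0 < γ) (h1 : γ < 1) {a b : ℝ} (ha : a ∈ Set.Icc 0 π) (hb : b ∈ Set.Icc 0 π) (hab : a ≤ b) :
    Lam γ a ≤ Lam γ b := by
  have : 0 ≤ ∫ τ in a..b, wt γ τ := intervalIntegral.integral_nonneg hab fun _ _ => wt_nonneg _ _
  rw [Lam_sub h0 h1 ha hb] at this; linarith

theorem Lam_zero (γ : ℝ) : Lam γ 0 = 0 := by simp [Lam]

/-- oscillating phase factor -/
def Es (V : Rn n → ℝ) (s : ℝ) (y : Rn n) : ℂ := Complex.exp (Complex.I * ((-(V y) * s : ℝ) : ℂ))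

theorem Es_norm (V : Rn n → ℝ) (s : ℝ) (y : Rn n) : ‖Es V s y‖ = 1 := by
  unfold Es; rw [mul_comm, Complex.norm_exp_ofReal_mul_I]

theorem Es_temp {V : Rn n → ℝ} (hV : V.HasTemperateGrowth) (s : ℝ) : (Es V s).HasTemperateGrowth := by
  have h : (fun x : Rn n => -(V x) * s).HasTemperateGrowth := by
    have h := hV.mul (Function.HasTemperateGrowth.const (-s))
    have e : (fun x : Rn n => -(V x) * s) = V * fun _ => -s := by ext x; simp
    rw [e]; exact h
  exact temp_cis_comp h

theorem V_c {V : Rn n → ℝ} (hV : V.HasTemperateGrowth) : (fun y => ((V y : ℝ) : ℂ)).HasTemperateGrowth :=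
  Function.Complex.hasTemperateGrowth_ofReal.comp hV

theorem Es_fderiv {V : Rn n → ℝ} (hV : V.HasTemperateGrowth) (s : ℝ) (y : Rn n) (v : Rn n) :
    fderiv ℝ (Es V s) y v = -(Complex.I * s * fderiv ℝ V y v) * Es V s y := by
  have h1 := (temp_diff hV y).hasFDerivAt
  have h2 : HasFDerivAt (fun x : Rn n => -(V x) * s) _ y := h1.neg.mul_const s
  have h3 : HasFDerivAt (fun x : Rn n => ((-(V x) * s : ℝ) : ℂ)) _ y :=
    (Complex.ofRealCLM.hasFDerivAt).comp y h2
  have h4 : HasFDerivAt (fun x : Rn n => Complex.exp (Complex.I * ((-(V x) * s : ℝ) : ℂ))) _ y := (h3.const_mul Complex.I).cexp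
  have h5 : HasFDerivAt (Es V s) _ y := h4
  rw [h5.fderiv]
  simp [Es]
  ring

theorem pd_Es {V : Rn n → ℝ} (hV : V.HasTemperateGrowth) (s : ℝ) (j : Fin n) (y : Rn n) :
    pd j (Es V s) y = -(Complex.I * s * pd j (fun y => ((V y : ℝ) : ℂ)) y) * Es V s y := by
  have : pd j (fun y => ((V y : ℝ) : ℂ)) y = ((fderiv ℝ V y (EuclideanSpace.single j 1) : ℝ) : ℂ) := by
    unfold pd
    have h3 : HasFDerivAt (fun x : Rn n => ((V x : ℝ) : ℂ)) _ y :=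
      (Complex.ofRealCLM.hasFDerivAt).comp y (temp_diff hV y).hasFDerivAt
    rw [h3.fderiv]; rfl
  rw [this]
  exact Es_fderiv hV s y _

/-- polynomial in s times phase -/
inductive PS (V : Rn n → ℝ) : (ℝ → Rn n → ℂ) → Prop
  | base (g : Rn n → ℂ) (hg : IsS g) : PS V (fun s y => Es V s y * g y)
  | add (a b : ℝ → Rn n → ℂ) (ha : PS V a) (hb : PS V b) : PS V (fun s y => a s y + b s y)
  | smul (a : ℝ → Rn n → ℂ) (ha : PS V a) : PS V (fun s y => (s : ℂ) * a s y)

theorem PS.isS {V : Rn n → ℝ} (hV : V.HasTemperateGrowth) {a : ℝ → Rn n → ℂ} (h : PS V a) (s : ℝ) : IsS (a s) := by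
  induction h with
  | base g hg => exact hg.tmul (Es_temp hV s)
  | add a b _ _ ha hb => exact ha.add hb
  | smul a _ ha => exact ha.cmul _

theorem pd_temp {g : Rn n → ℂ} (h : g.HasTemperateGrowth) (j : Fin n) : (pd j g).HasTemperateGrowth := by
  have hf : (fderiv ℝ g).HasTemperateGrowth := by
    refine ⟨h.1.fderiv_right (by simp), fun m => ?_⟩
    obtain ⟨k, C, hC⟩ := h.2 (m + 1)
    exact ⟨k, C, fun x => by rw [norm_iteratedFDeriv_fderiv]; exact hC x⟩
  have := ((ContinuousLinearMap.apply ℝ ℂ (EuclideanSpace.single j (1 : ℝ) : Rn n))).hasTemperateGrowth.comp hf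
  exact this

theorem PS.pd {V : Rn n → ℝ} (hV : V.HasTemperateGrowth) {a : ℝ → Rn n → ℂ} (h : PS V a) (j : Fin n) :
    PS V (fun s => pd j (a s)) := by
  induction h with
  | base g hg =>
    have hW := pd_temp (V_c hV) j
    have e : (fun s => HW.pd j (fun y => Es V s y * g y)) = fun s y => Es V s y * HW.pd j g y
        + (s : ℂ) * (Es V s y * (-Complex.I * (HW.pd j (fun y => ((V y : ℝ) : ℂ)) y * g y))) := by
      ext s y
      rw [pd_mul (temp_diff (Es_temp hV s)) hg.diff, pd_Es hV]
      ring
    rw [e]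
    exact PS.add _ _ (PS.base _ (hg.pd j)) (PS.smul _ (PS.base _ ((hg.tmul hW).cmul _)))
  | add a b pa pb ha hb =>
    have e : (fun s => HW.pd j (fun y => a s y + b s y)) = fun s y => HW.pd j (a s) y + HW.pd j (b s) y := by
      ext s y; exact pd_add (pa.isS hV s).diff (pb.isS hV s).diff j y
    rw [e]; exact PS.add _ _ ha hb
  | smul a pa ha =>
    have e : (fun s : ℝ => HW.pd j (fun y => (s : ℂ) * a s y)) = fun (s : ℝ) (y : Rn n) => (s : ℂ) * HW.pd j (a s) y := by
      ext s y; exact pd_cmul (pa.isS hV s).diff _ j y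
    rw [e]; exact PS.smul _ ha

theorem PS.coord {V : Rn n → ℝ} {a : ℝ → Rn n → ℂ} (h : PS V a) (j : Fin n) :
    PS V (fun s y => ((y j : ℝ) : ℂ) * a s y) := by
  induction h with
  | base g hg =>
    have e : (fun s y => ((y j : ℝ) : ℂ) * (Es V s y * g y)) = fun s y => Es V s y * (((y j : ℝ) : ℂ) * g y) := by
      ext s y; ring
    rw [e]; exact PS.base _ (hg.coord j)
  | add a b _ _ ha hb => simp only [mul_add]; exact PS.add _ _ ha hb
  | smul a _ ha =>
    have e : (fun (s : ℝ) (y : Rn n) => ((y j : ℝ) : ℂ) * ((s : ℂ) * a s y)) = fun (s : ℝ) (y : Rn n) => (s : ℂ) * (((y j : ℝ) : ℂ) * a s y) := by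
      ext s y; ring
    rw [e]; exact PS.smul _ ha

theorem PS.cmul {V : Rn n → ℝ} {a : ℝ → Rn n → ℂ} (h : PS V a) (c : ℂ) :
    PS V (fun s y => c * a s y) := by
  induction h with
  | base g hg =>
    have e : (fun s y => c * (Es V s y * g y)) = fun s y => Es V s y * (c * g y) := by
      ext s y; ring
    rw [e]; exact PS.base _ (hg.cmul c)
  | add a b _ _ ha hb => simp only [mul_add]; exact PS.add _ _ ha hb
  | smul a _ ha =>
    have e : (fun (s : ℝ) (y : Rn n) => c * ((s : ℂ) * a s y)) = fun (s : ℝ) (y : Rn n) => (s : ℂ) * (c * a s y) := by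
      ext s y; ring
    rw [e]; exact PS.smul _ ha

theorem PS.sum {V : Rn n → ℝ} {ι : Type} (S : Finset ι) {a : ι → ℝ → Rn n → ℂ} (h : ∀ i, PS V (a i)) :
    PS V (fun s y => ∑ i ∈ S, a i s y) := by
  classical
  induction S using Finset.induction_on with
  | empty =>
    simp only [Finset.sum_empty]
    have := PS.base (V := V) _ (IsS.zero (n := n))
    simpa using this
  | insert i S hi ih =>
    simp only [Finset.sum_insert hi]
    exact PS.add _ _ (h i) ih

theorem PS.gop0 {V : Rn n → ℝ} (hV : V.HasTemperateGrowth) {a : ℝ → Rn n → ℂ} (h : PS V a) (k : Option (Bool × Fin n)) :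
    PS V (fun s => gop0 k (a s)) := by
  match k with
  | none => exact h
  | some (true, j) => exact (h.pd hV j).cmul _
  | some (false, j) => exact h.coord j

theorem PS.gop1 {V : Rn n → ℝ} (hV : V.HasTemperateGrowth) {a : ℝ → Rn n → ℂ} (h : PS V a) (k : Option (Bool × Fin n)) :
    PS V (fun s => gop1 k (a s)) := by
  have z : PS V (fun _ _ => (0 : ℂ)) := by simpa using PS.base (V := V) _ (IsS.zero (n := n))
  match k with
  | none => exact z
  | some (true, j) => exact z
  | some (false, j) => exact (h.pd hV j).cmul _

theorem PS.lap {V : Rn n → ℝ} (hV : V.HasTemperateGrowth) {a : ℝ → Rn n → ℂ} (h : PS V a) :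
    PS V (fun s => _root_.lap (a s)) := by
  have : (fun s => _root_.lap (a s)) = fun s y => ∑ j, HW.pd j (HW.pd j (a s)) y := by ext s y; rfl
  rw [this]
  exact PS.sum _ fun j => (h.pd hV j).pd hV j

theorem PS.l2_bdd {V : Rn n → ℝ} (hV : V.HasTemperateGrowth) {a : ℝ → Rn n → ℂ} (h : PS V a) (S : ℝ) :
    ∃ C, 0 ≤ C ∧ ∀ s, |s| ≤ S → l2 (a s) ≤ C := by
  induction h with
  | base g hg =>
    refine ⟨l2 g, l2_nonneg _, fun s _ => l2_mono hg.memLp fun x => ?_⟩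
    rw [norm_mul, Es_norm, one_mul]
  | add a b pa pb ha hb =>
    obtain ⟨C, hC, h1⟩ := ha
    obtain ⟨D, hD, h2⟩ := hb
    exact ⟨C + D, by positivity, fun s hs => (l2_add (pa.isS hV s).memLp (pb.isS hV s).memLp).trans (add_le_add (h1 s hs) (h2 s hs))⟩
  | smul a pa ha =>
    obtain ⟨C, hC, h1⟩ := ha
    refine ⟨|S| * C, by positivity, fun s hs => ?_⟩
    rw [l2_cmul, Complex.norm_real, Real.norm_eq_abs]
    exact mul_le_mul (hs.trans (le_abs_self S)) (h1 s hs) (l2_nonneg _) (abs_nonneg _)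

theorem PS.l2_cont {V : Rn n → ℝ} (hV : V.HasTemperateGrowth) {a : ℝ → Rn n → ℂ} (h : PS V a) (s0 : ℝ) :
    Tendsto (fun s => l2 (fun y => a s y - a s0 y)) (𝓝 s0) (𝓝 0) := by
  induction h with
  | base g hg =>
    have hVg := hg.tmul (V_c hV)
    have : Tendsto (fun s => |s - s0| * l2 (fun y => ((V y : ℝ) : ℂ) * g y)) (𝓝 s0) (𝓝 0) := by
      have : Continuous (fun s => |s - s0| * l2 (fun y => ((V y : ℝ) : ℂ) * g y)) := by fun_prop
      simpa using this.tendsto s0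
    refine squeeze_zero (fun _ => l2_nonneg _) (fun s => ?_) this
    have e : |s - s0| * l2 (fun y => ((V y : ℝ) : ℂ) * g y) = l2 (fun y => ((s - s0 : ℝ) : ℂ) * (((V y : ℝ) : ℂ) * g y)) := by
      rw [l2_cmul, Complex.norm_real, Real.norm_eq_abs]
    rw [e]
    refine l2_mono (hVg.cmul _).memLp fun y => ?_
    have h1 : Es V s y - Es V s0 y = Es V s0 y * (Complex.exp (Complex.I * ((-(V y) * (s - s0) : ℝ) : ℂ)) - 1) := by
      unfold Es
      rw [mul_sub, ← Complex.exp_add, mul_one]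
      congr 2; push_cast; ring
    rw [← sub_mul, h1, norm_mul, norm_mul, Es_norm, one_mul, ← mul_assoc, norm_mul, ← Complex.ofReal_mul, Complex.norm_real]
    refine mul_le_mul_of_nonneg_right ((Real.norm_exp_I_mul_ofReal_sub_one_le).trans (le_of_eq ?_)) (norm_nonneg _)
    rw [Real.norm_eq_abs, Real.norm_eq_abs, neg_mul, abs_neg, mul_comm]
  | add a b pa pb ha hb =>
    refine squeeze_zero (fun _ => l2_nonneg _) (fun s => ?_) (by simpa using ha.add hb)
    have e : (fun y => a s y + b s y - (a s0 y + b s0 y)) = fun y => (a s y - a s0 y) + (b s y - b s0 y) := by ext y; ring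
    rw [e]
    exact l2_add ((pa.isS hV s).sub (pa.isS hV s0)).memLp ((pb.isS hV s).sub (pb.isS hV s0)).memLp
  | smul a pa ha =>
    have c1 : Tendsto (fun s : ℝ => |s|) (𝓝 s0) (𝓝 |s0|) := continuous_abs.tendsto s0
    have c2 : Tendsto (fun s : ℝ => |s - s0| * l2 (a s0)) (𝓝 s0) (𝓝 0) := by
      have : Continuous (fun s => |s - s0| * l2 (a s0)) := by fun_prop
      simpa using this.tendsto s0
    refine squeeze_zero (fun _ => l2_nonneg _) (fun s => ?_) (by simpa using (c1.mul ha).add c2)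
    have e : (fun y => (s : ℂ) * a s y - (s0 : ℂ) * a s0 y) = fun y => (s : ℂ) * (a s y - a s0 y) + ((s - s0 : ℝ) : ℂ) * a s0 y := by
      ext y; push_cast; ring
    rw [e]
    refine (l2_add (((pa.isS hV s).sub (pa.isS hV s0)).cmul _).memLp ((pa.isS hV s0).cmul _).memLp).trans (le_of_eq ?_)
    rw [l2_cmul, l2_cmul, Complex.norm_real, Complex.norm_real, Real.norm_eq_abs, Real.norm_eq_abs]
end HW
end

noncomputable section
namespace HW
variable {n : ℕ}

/-- slow amplitude -/
def aT (V : Rn n → ℝ) (f : Rn n → ℂ) (s : ℝ) (y : Rn n) : ℂ := Es V s y * f y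

/-- derivative amplitude -/
def bT (V : Rn n → ℝ) (f : Rn n → ℂ) (γ ε t : ℝ) (y : Rn n) : ℂ :=
  Es V (Lam γ t) y * ((((n / 2 * Real.tan t : ℝ) : ℂ) - Complex.I * ((‖y‖ ^ 2 / (2 * ε) : ℝ) : ℂ)) * f y
    + ((Real.tan t : ℝ) : ℂ) * (fderiv ℝ f y y - Complex.I * (((Lam γ t) * fderiv ℝ V y y : ℝ) : ℂ) * f y)
    - Complex.I * ((wt γ t * V y : ℝ) : ℂ) * f y)

theorem hd_cospow (m : ℕ) {t : ℝ} (hc : Real.cos t ≠ 0) :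
    HasDerivAt (fun τ => |Real.cos τ| ^ (-(m : ℝ) / 2)) (m / 2 * Real.tan t * |Real.cos t| ^ (-(m : ℝ) / 2)) t := by
  have h1 : HasDerivAt (fun τ => |Real.cos τ|) (SignType.sign (Real.cos t) * -Real.sin t) t := 
    (hasDerivAt_abs hc).comp t (Real.hasDerivAt_cos t)
  have h2 := h1.rpow_const (p := -(m : ℝ) / 2) (Or.inl (abs_pos.2 hc).ne')
  convert h2 using 1
  rw [Real.rpow_sub_one (abs_pos.2 hc).ne', Real.tan_eq_sin_div_cos]
  have h3 : |Real.cos t| ≠ 0 := (abs_pos.2 hc).ne'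
  rcases lt_or_gt_of_ne hc with h | h
  · rw [abs_of_neg h] at h3 ⊢
    rw [sign_neg h]
    simp only [SignType.coe_neg, SignType.coe_one]
    field_simp
  · rw [abs_of_pos h]
    rw [sign_pos h]
    simp only [SignType.coe_one]
    field_simp

theorem hd_ch (ε : ℝ) {t : ℝ} (hc : Real.cos t ≠ 0) (x : Rn n) :
    HasDerivAt (fun τ => ch (Real.tan τ / (2 * ε)) x) (-(Complex.I * ((‖(Real.cos t)⁻¹ • x‖ ^ 2 / (2 * ε) : ℝ) : ℂ)) * ch (Real.tan t / (2 * ε)) x) t := by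
  have h1 : HasDerivAt (fun τ => -(‖x‖ ^ 2 * (Real.tan τ / (2 * ε)))) (-(‖x‖ ^ 2 * (1 / Real.cos t ^ 2 / (2 * ε)))) t :=
    (((Real.hasDerivAt_tan hc).div_const _).const_mul _).neg
  have h2 := (h1.ofReal_comp.const_mul Complex.I).cexp
  unfold ch
  convert h2 using 1
  rw [norm_smul, mul_pow, norm_inv, Real.norm_eq_abs, inv_pow, sq_abs]
  push_cast
  ring

theorem hd_h {t : ℝ} (hc : Real.cos t ≠ 0) (x : Rn n) :
    HasDerivAt (fun τ => (Real.cos τ)⁻¹ • x) (Real.tan t • ((Real.cos t)⁻¹ • x)) t := by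
  have h := ((Real.hasDerivAt_cos t).inv hc).smul_const x
  refine h.congr_deriv ?_
  rw [smul_smul, Real.tan_eq_sin_div_cos]
  congr 1
  field_simp

theorem w_der {V : Rn n → ℝ} (hV : V.HasTemperateGrowth) {f : Rn n → ℂ} (hf : IsS f) (θ : ℂ) (ε : ℝ) {γ : ℝ} (h0 : 0 < γ) (h1 : γ < 1)
    {t : ℝ} (ht : t ∈ Set.Icc 0 π) (hc : Real.cos t ≠ 0) (x : Rn n) :
    HasDerivAt (fun τ => lens θ ε τ (aT V f (Lam γ τ)) x) (lens θ ε t (bT V f γ ε t) x) t := by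
  have d1 := ((hd_cospow n hc).ofReal_comp).const_mul θ
  have d2 := hd_ch ε hc x
  have hh := hd_h hc x
  have d3 := (hf.diff ((Real.cos t)⁻¹ • x)).hasFDerivAt.comp_hasDerivAt t hh
  have d4 := (temp_diff hV ((Real.cos t)⁻¹ • x)).hasFDerivAt.comp_hasDerivAt t hh
  have d5 := ((d4.neg.mul (Lam_deriv h0 h1 ht hc)).ofReal_comp.const_mul Complex.I).cexp
  have := d1.mul (d2.mul (d5.mul d3))
  refine this.congr_deriv ?_
  simp only [lens, L, bT, Es, Function.comp_def, map_smul, smul_eq_mul, Complex.real_smul]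
  simp only [Pi.mul_apply, Pi.neg_apply]
  push_cast
  ring

theorem fd_sum (φ : Rn n → ℂ) (y v : Rn n) : fderiv ℝ φ y v = ∑ j, ((v j : ℝ) : ℂ) * pd j φ y := by
  have : v = ∑ j, v j • (EuclideanSpace.single j (1 : ℝ) : Rn n) := by
    ext i
    simp [Finset.sum_apply, Pi.single_apply]
  conv_lhs => rw [this]
  rw [map_sum]
  refine Finset.sum_congr rfl fun j _ => ?_
  rw [map_smul, Complex.real_smul]; rfl

theorem aT_fd {V : Rn n → ℝ} (hV : V.HasTemperateGrowth) {f : Rn n → ℂ} (hf : IsS f) (s : ℝ) (y v : Rn n) :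
    fderiv ℝ (aT V f s) y v = Es V s y * (fderiv ℝ f y v - Complex.I * ((s * fderiv ℝ V y v : ℝ) : ℂ) * f y) := by
  have : aT V f s = fun y => Es V s y * f y := rfl
  rw [this, fderiv_fun_mul (temp_diff (Es_temp hV s) y) (hf.diff y)]
  have e := Es_fderiv hV s y v
  simp only [add_apply, smul_apply, smul_eq_mul]
  rw [e]
  push_cast
  ring

theorem bT_eq {V : Rn n → ℝ} (hV : V.HasTemperateGrowth) {f : Rn n → ℂ} (hf : IsS f) (γ ε t : ℝ) (y : Rn n) :
    bT V f γ ε t y = ((n / 2 * Real.tan t : ℝ) : ℂ) * aT V f (Lam γ t) y - Complex.I * ((‖y‖ ^ 2 / (2 * ε) : ℝ) : ℂ) * aT V f (Lam γ t) y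
      + ((Real.tan t : ℝ) : ℂ) * (∑ j, ((y j : ℝ) : ℂ) * pd j (aT V f (Lam γ t)) y)
      - Complex.I * ((wt γ t * V y : ℝ) : ℂ) * aT V f (Lam γ t) y := by
  rw [← fd_sum, aT_fd hV hf]
  unfold bT aT
  ring

theorem aT_isS {V : Rn n → ℝ} (hV : V.HasTemperateGrowth) {f : Rn n → ℂ} (hf : IsS f) (s : ℝ) : IsS (aT V f s) :=
  hf.tmul (Es_temp hV s)

theorem aT_PS {V : Rn n → ℝ} {f : Rn n → ℂ} (hf : IsS f) : PS V (aT V f) := PS.base f hf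

theorem har_temp {γ : ℝ} (hn : 1 ≤ n) (h0 : 0 ≤ γ) (h1 : γ < n) {f : Rn n → ℂ} (hf : IsS f) : (hartree γ f).HasTemperateGrowth := by
  have := Complex.reCLM.hasTemperateGrowth.comp (convC_temp hn h0 h1 (hf.mul hf.conj))
  have e : hartree γ f = Complex.reCLM ∘ (convC γ fun x => f x * conj (f x)) := by
    ext x
    have := congrArg Complex.re (hartree_eq γ f x)
    simpa using this
  rw [e]; exact this

theorem T_aT (γ : ℝ) (f : Rn n → ℂ) (s : ℝ) (y : Rn n) :
    T γ (aT (hartree γ f) f s) (aT (hartree γ f) f s) (aT (hartree γ f) f s) y = ((hartree γ f y : ℝ) : ℂ) * aT (hartree γ f) f s y := by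
  unfold T
  rw [hartree_eq]
  congr 2
  ext z
  rw [Complex.mul_conj', Complex.mul_conj']
  unfold aT
  rw [norm_mul, Es_norm, one_mul]

/-- the WKB solution -/
def wf (γ : ℝ) (f : Rn n → ℂ) (θ : ℂ) (ε t : ℝ) : Rn n → ℂ := lens θ ε t (aT (hartree γ f) f (Lam γ t))

/-- the WKB error term -/
def Rf (γ : ℝ) (f : Rn n → ℂ) (θ : ℂ) (ε t : ℝ) : Rn n → ℂ :=
  lens θ ε t (fun y => ((ε / (2 * Real.cos t ^ 2) : ℝ) : ℂ) * lap (aT (hartree γ f) f (Lam γ t)) y)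

theorem w_contOn {S : Set ℝ} (hS : ∀ t ∈ S, t ∈ Set.Icc 0 π ∧ Real.cos t ≠ 0) (θ : ℂ) (ε γ : ℝ) (h0 : 0 < γ) (h1 : γ < 1)
    (V : Rn n → ℝ) (hV : V.HasTemperateGrowth) {g : ℝ → Rn n → ℂ}
    (hg : ContinuousOn (fun p : ℝ × Rn n => g p.1 ((Real.cos p.1)⁻¹ • p.2)) (S ×ˢ Set.univ)) :
    ContinuousOn (fun p : ℝ × Rn n => lens θ ε p.1 (fun y => Es V (Lam γ p.1) y * g p.1 y) p.2) (S ×ˢ Set.univ) := by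
  have c0 : ContinuousOn (fun p : ℝ × Rn n => Real.cos p.1) (S ×ˢ Set.univ) := by fun_prop
  have c1 : ContinuousOn (fun p : ℝ × Rn n => (Real.cos p.1)⁻¹ • p.2) (S ×ˢ Set.univ) :=
    (c0.inv₀ fun p hp => (hS p.1 hp.1).2).smul continuousOn_snd
  have c2 : ContinuousOn (fun p : ℝ × Rn n => Lam γ p.1) (S ×ˢ Set.univ) :=
    (Lam_cont h0 h1).comp continuousOn_fst fun p hp => (hS p.1 hp.1).1
  have c3 : ContinuousOn (fun p : ℝ × Rn n => Real.tan p.1) (S ×ˢ Set.univ) := by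
    simp only [Real.tan_eq_sin_div_cos]
    exact ContinuousOn.div (by fun_prop) c0 fun p hp => (hS p.1 hp.1).2
  have c4 : ContinuousOn (fun p : ℝ × Rn n => V ((Real.cos p.1)⁻¹ • p.2)) (S ×ˢ Set.univ) :=
    (temp_diff hV).continuous.comp_continuousOn c1
  have c5 : ContinuousOn (fun p : ℝ × Rn n => |Real.cos p.1| ^ (-(n : ℝ) / 2)) (S ×ˢ Set.univ) :=
    c0.abs.rpow_const fun p hp => Or.inl (abs_pos.2 (hS p.1 hp.1).2).ne'
  have c6 : ContinuousOn (fun p : ℝ × Rn n => Es V (Lam γ p.1) ((Real.cos p.1)⁻¹ • p.2)) (S ×ˢ Set.univ) := by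
    unfold Es
    exact (continuousOn_const.mul (Complex.continuous_ofReal.comp_continuousOn (c4.neg.mul c2))).cexp
  have c7 : ContinuousOn (fun p : ℝ × Rn n => ch (Real.tan p.1 / (2 * ε)) p.2) (S ×ˢ Set.univ) := by
    unfold ch
    refine (continuousOn_const.mul (Complex.continuous_ofReal.comp_continuousOn (ContinuousOn.neg (ContinuousOn.mul ?_ (c3.div_const _))))).cexp
    fun_prop
  unfold lens L
  exact (continuousOn_const.mul (Complex.continuous_ofReal.comp_continuousOn c5)).mul (c7.mul (c6.mul hg))

theorem w_sol {S : Set ℝ} (hS : ∀ t ∈ S, t ∈ Set.Icc 0 π ∧ Real.cos t ≠ 0) {θ : ℂ} (hθ : ‖θ‖ = 1) {ε γ : ℝ} (he : 0 < ε) (hn : 2 ≤ n) (h0 : 0 < γ) (h1 : γ < 1)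
    {f : Rn n → ℂ} (hf : IsS f) :
    Sol ε S (wf γ f θ ε) (fun t => lens θ ε t (bT (hartree γ f) f γ ε t))
      (fun t x => T γ (wf γ f θ ε t) (wf γ f θ ε t) (wf γ f θ ε t) x + Rf γ f θ ε t x) := by
  have hγn : γ < n := by
    have : (2 : ℝ) ≤ n := by exact_mod_cast hn
    linarith
  have hV := har_temp (show 1 ≤ n by linarith) h0.le hγn hf
  have wS : ∀ t ∈ S, IsS (wf γ f θ ε t) := fun t ht => lens_isS θ ε (hS t ht).2 (aT_isS hV hf _)
  have c0 : ContinuousOn (fun p : ℝ × Rn n => Real.cos p.1) (S ×ˢ Set.univ) := by fun_prop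
  have c1 : ContinuousOn (fun p : ℝ × Rn n => (Real.cos p.1)⁻¹ • p.2) (S ×ˢ Set.univ) :=
    (c0.inv₀ fun p hp => (hS p.1 hp.1).2).smul continuousOn_snd
  refine ⟨wS, fun t ht => (T_isS (by linarith) h0.le hγn (wS t ht) (wS t ht) (wS t ht)).add ?_, fun t ht x => w_der hV hf θ ε h0 h1 (hS t ht).1 (hS t ht).2 x, ?_, ?_, ?_⟩
  · exact lens_isS θ ε (hS t ht).2 ((aT_isS hV hf _).lap.cmul _)
  · exact w_contOn hS θ ε γ h0 h1 _ hV (g := fun _ => f) (hf.cont.comp_continuousOn c1)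
  · refine w_contOn hS θ ε γ h0 h1 _ hV (g := fun t y => ((((n / 2 * Real.tan t : ℝ) : ℂ) - Complex.I * ((‖y‖ ^ 2 / (2 * ε) : ℝ) : ℂ)) * f y
    + ((Real.tan t : ℝ) : ℂ) * (fderiv ℝ f y y - Complex.I * (((Lam γ t) * fderiv ℝ (hartree γ f) y y : ℝ) : ℂ) * f y)
    - Complex.I * ((wt γ t * (hartree γ f) y : ℝ) : ℂ) * f y)) ?_
    have c2 : ContinuousOn (fun p : ℝ × Rn n => Lam γ p.1) (S ×ˢ Set.univ) :=
      (Lam_cont h0 h1).comp continuousOn_fst fun p hp => (hS p.1 hp.1).1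
    have c3 : ContinuousOn (fun p : ℝ × Rn n => Real.tan p.1) (S ×ˢ Set.univ) := by
      simp only [Real.tan_eq_sin_div_cos]
      exact ContinuousOn.div (by fun_prop) c0 fun p hp => (hS p.1 hp.1).2
    have c4 : ContinuousOn (fun p : ℝ × Rn n => hartree γ f ((Real.cos p.1)⁻¹ • p.2)) (S ×ˢ Set.univ) :=
      (temp_diff hV).continuous.comp_continuousOn c1
    have c5 : ContinuousOn (fun p : ℝ × Rn n => wt γ p.1) (S ×ˢ Set.univ) :=
      ContinuousOn.comp (t := S) (fun t ht => (wt_cont γ (hS t ht).2).continuousWithinAt) continuousOn_fst fun p hp => hp.1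
    have c6 : ContinuousOn (fun p : ℝ × Rn n => f ((Real.cos p.1)⁻¹ • p.2)) (S ×ˢ Set.univ) := hf.cont.comp_continuousOn c1
    have c7 : ContinuousOn (fun p : ℝ × Rn n => fderiv ℝ f ((Real.cos p.1)⁻¹ • p.2) ((Real.cos p.1)⁻¹ • p.2)) (S ×ˢ Set.univ) :=
      (((hf.contDiff 1).continuous_fderiv (by simp)).comp_continuousOn c1).clm_apply c1
    have c8 : ContinuousOn (fun p : ℝ × Rn n => fderiv ℝ (hartree γ f) ((Real.cos p.1)⁻¹ • p.2) ((Real.cos p.1)⁻¹ • p.2)) (S ×ˢ Set.univ) :=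
      ((hV.1.continuous_fderiv (by simp)).comp_continuousOn c1).clm_apply c1
    have r := fun {g : ℝ × Rn n → ℝ} (h : ContinuousOn g (S ×ˢ Set.univ)) => Complex.continuous_ofReal.comp_continuousOn h
    exact (((r (continuousOn_const.mul c3)).sub (continuousOn_const.mul (r ((c1.norm.pow 2).div_const _)))).mul c6 |>.add
      ((r c3).mul (c7.sub ((continuousOn_const.mul (r (c2.mul c8))).mul c6)))).sub ((continuousOn_const.mul (r (c5.mul c4))).mul c6)
  · intro t ht x
    have hc := (hS t ht).2
    have hc' : ((Real.cos t : ℝ) : ℂ) ≠ 0 := by exact_mod_cast hc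
    have he' : (ε : ℂ) ≠ 0 := by exact_mod_cast he.ne'
    unfold wf Rf
    unfold lens
    rw [T_L hc (lens_K hθ t), lap_L' _ hc _ (aT_isS hV hf _)]
    have hx : ‖x‖ ^ 2 = Real.cos t ^ 2 * ‖(Real.cos t)⁻¹ • x‖ ^ 2 := by
      rw [norm_smul, mul_pow, norm_inv, Real.norm_eq_abs, inv_pow, sq_abs]; field_simp
    rw [hx]
    simp only [L, T_aT, bT_eq hV hf]
    have hsc := sc_c t
    unfold wt
    generalize ch (Real.tan t / (2 * ε)) x = X
    generalize aT (hartree γ f) f (Lam γ t) ((Real.cos t)⁻¹ • x) = A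
    generalize (∑ j, ((((Real.cos t)⁻¹ • x) j : ℝ) : ℂ) * pd j (aT (hartree γ f) f (Lam γ t)) ((Real.cos t)⁻¹ • x)) = P
    generalize lap (aT (hartree γ f) f (Lam γ t)) ((Real.cos t)⁻¹ • x) = Q
    generalize hartree γ f ((Real.cos t)⁻¹ • x) = W
    generalize ‖(Real.cos t)⁻¹ • x‖ = Y
    generalize θ * ((|Real.cos t| ^ (-(n : ℝ) / 2) : ℝ) : ℂ) = K
    generalize |Real.cos t| ^ (-γ) = w
    rw [Real.tan_eq_sin_div_cos]
    push_cast [-Complex.ofReal_sin, -Complex.ofReal_cos]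
    field_simp
    linear_combination (-(8 * K * X * ((Real.cos t : ℝ) : ℂ) ^ 2 * A * ε * w * W + 4 * K * X * ((Real.cos t : ℝ) : ℂ) ^ 2 * A * Y ^ 2)) * Complex.I_sq - 4 * K * X * ((Real.cos t : ℝ) : ℂ) ^ 2 * A * Y ^ 2 * hsc
end HW
end

noncomputable section
namespace HW
variable {n : ℕ}

/-- Maslov phase -/
def th (n : ℕ) (t : ℝ) : ℂ := if 0 < Real.cos t then 1 else Complex.exp (-Complex.I * (n : ℂ) * ((π / 2 : ℝ) : ℂ))

theorem th_norm (n : ℕ) (t : ℝ) : ‖th n t‖ = 1 := by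
  unfold th
  split_ifs
  · simp
  · rw [Complex.norm_exp]; simp

/-- the small parameter filter -/
abbrev l0 : Filter ℝ := 𝓝[Set.Ioc 0 1] (0 : ℝ)

theorem l0_mem : ∀ᶠ ε in l0, 0 < ε ∧ ε ≤ 1 := by
  filter_upwards [self_mem_nhdsWithin] with ε h using h

theorem l0_id : Tendsto (fun ε : ℝ => ε) l0 (𝓝 0) := tendsto_id.mono_left nhdsWithin_le_nhds

theorem l2_uni {g φ : Rn n → ℂ} (h : ∀ x, ‖g x‖ = 1) : l2 (fun x => g x * φ x) = l2 φ := by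
  unfold l2
  congr 1
  refine eLpNorm_congr_norm_ae (Eventually.of_forall fun x => ?_)
  rw [norm_mul, h, one_mul]

/-- limit exponent -/
def c0 (n : ℕ) (t : ℝ) : ℂ := -(Complex.I * n * π / 4) - n / 2 * Complex.log (-Complex.I * ((Real.cos t : ℝ) : ℂ))

theorem exp_c0 (n : ℕ) {t : ℝ} (hc : Real.cos t ≠ 0) :
    Complex.exp (c0 n t) = th n t * ((|Real.cos t| ^ (-(n : ℝ) / 2) : ℝ) : ℂ) := by
  have hp := abs_pos.2 hc
  have e : ((|Real.cos t| ^ (-(n : ℝ) / 2) : ℝ) : ℂ) = Complex.exp (-(n / 2 * ((Real.log |Real.cos t| : ℝ) : ℂ))) := by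
    rw [Real.rpow_def_of_pos hp, Complex.ofReal_exp]
    congr 1
    push_cast
    ring
  rw [e]
  unfold th c0
  split_ifs with h
  · have : Complex.log (-Complex.I * ((Real.cos t : ℝ) : ℂ)) = ((Real.log |Real.cos t| : ℝ) : ℂ) + -(π / 2 * Complex.I) := by
      rw [mul_comm, Complex.log_ofReal_mul h (by simp), Complex.log_neg_I, abs_of_pos h]
      ring
    rw [this, one_mul]
    congr 1
    ring
  · have h' : 0 < -Real.cos t := by
      rcases lt_or_gt_of_ne hc with h2 | h2
      · linarith
      · exact absurd h2 h
    have : Complex.log (-Complex.I * ((Real.cos t : ℝ) : ℂ)) = ((Real.log |Real.cos t| : ℝ) : ℂ) + (π / 2 * Complex.I) := by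
      have e : -Complex.I * ((Real.cos t : ℝ) : ℂ) = ((-Real.cos t : ℝ) : ℂ) * Complex.I := by
        rw [Complex.ofReal_neg]; ring
      rw [e, Complex.log_ofReal_mul h' (by simp), Complex.log_I, abs_of_neg (by linarith)]
    rw [this, ← Complex.exp_add]
    congr 1
    push_cast
    ring

theorem lam_lim (t : ℝ) : Tendsto (fun ε : ℝ => lam ε t) l0 (𝓝 ((Real.cos t : ℝ) : ℂ)) := by
  have : Continuous fun ε : ℝ => lam ε t := by unfold lam; fun_prop
  have h := (this.tendsto 0).comp l0_id
  simpa [lam, Function.comp_def] using h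

theorem psi_lim (p : Fin n → ℂ) {t : ℝ} (hc : Real.cos t ≠ 0) :
    Tendsto (fun ε => l2 (fun x => psi ε p t x - lens (th n t) ε t (gau (-1/2) (fun i => Complex.I * p i) 0) x)) l0 (𝓝 0) := by
  have hc' : ((Real.cos t : ℝ) : ℂ) ≠ 0 := by exact_mod_cast hc
  have hl := lam_lim t
  have key := gau_tendsto (n := n) (l := l0) (q := fun ε => gq ε t + Complex.I * ((Real.tan t / (2 * ε) : ℝ) : ℂ))
    (b := fun ε => gb ε p t) (c := fun ε => gc ε p t) (q0 := -1 / (2 * ((Real.cos t : ℝ) : ℂ) * ((Real.cos t : ℝ) : ℂ)))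
    (b0 := fun i => Complex.I * p i / ((Real.cos t : ℝ) : ℂ)) (c0 := c0 n t) ?_ ?_ ?_ ?_ ?_
  · refine key.congr' ?_
    filter_upwards [l0_mem] with ε he
    rw [← l2_uni (g := ch (Real.tan t / (2 * ε))) (ch_norm _)]
    congr 1
    ext x
    rw [mul_sub]
    congr 1
    · unfold ch psi gau
      rw [← Complex.exp_add]
      congr 1
      push_cast
      ring
    · unfold lens L
      rw [← exp_c0 n hc]
      unfold ch gau
      rw [← Complex.exp_add, ← Complex.exp_add, ← Complex.exp_add]
      congr 1
      rw [norm_smul, mul_pow, norm_inv, Real.norm_eq_abs, inv_pow, sq_abs]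
      have : (∑ j, Complex.I * p j / ((Real.cos t : ℝ) : ℂ) * ((x j : ℝ) : ℂ)) = ∑ j, Complex.I * p j * ((((Real.cos t)⁻¹ • x) j : ℝ) : ℂ) := by
        refine Finset.sum_congr rfl fun j _ => ?_
        simp
        ring
      rw [this]
      push_cast [-Complex.ofReal_sin, -Complex.ofReal_cos]
      have e2 : (-1 : ℂ) / (2 * ((Real.cos t : ℝ) : ℂ) * ((Real.cos t : ℝ) : ℂ)) = -1 / 2 * (((Real.cos t : ℝ) : ℂ) ^ 2)⁻¹ := by
        field_simp
      rw [e2]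
      ring
  · have : Tendsto (fun ε : ℝ => (-1 : ℂ) / (2 * lam ε t * ((Real.cos t : ℝ) : ℂ))) l0 (𝓝 (-1 / (2 * ((Real.cos t : ℝ) : ℂ) * ((Real.cos t : ℝ) : ℂ)))) :=
      tendsto_const_nhds.div ((hl.const_mul _).mul_const _) (mul_ne_zero (mul_ne_zero two_ne_zero hc') hc')
    refine this.congr' ?_
    filter_upwards [l0_mem] with ε he
    have h1 := lam_ne he.1 t
    have he' : (ε : ℂ) ≠ 0 := by exact_mod_cast he.1.ne'
    have hsc := sc_c t
    unfold gq
    rw [Real.tan_eq_sin_div_cos]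
    push_cast [-Complex.ofReal_sin, -Complex.ofReal_cos]
    have e1 : lam ε t = ((Real.cos t : ℝ) : ℂ) + Complex.I * ε * ((Real.sin t : ℝ) : ℂ) := rfl
    have e2 : lamd ε t = -((Real.sin t : ℝ) : ℂ) + Complex.I * ε * ((Real.cos t : ℝ) : ℂ) := rfl
    field_simp
    rw [e1, e2]
    linear_combination (-ε * (((Real.sin t : ℝ) : ℂ) ^ 2 + ((Real.cos t : ℝ) : ℂ) ^ 2)) * Complex.I_sq + ε * hsc
  · unfold gc c0
    have hs : -Complex.I * ((Real.cos t : ℝ) : ℂ) ∈ Complex.slitPlane := by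
      rw [Complex.mem_slitPlane_iff]
      right
      simpa [-Complex.ofReal_cos] using hc
    have h1 := ((hl.const_mul (-Complex.I)).clog hs).const_mul ((n : ℂ) / 2)
    have h2 : Tendsto (fun ε : ℝ => Complex.I * (ε : ℂ) / 2 * (∑ i, p i ^ 2) * (((Real.sin t : ℝ) : ℂ) / lam ε t)) l0
        (𝓝 (Complex.I * ((0 : ℝ) : ℂ) / 2 * (∑ i, p i ^ 2) * (((Real.sin t : ℝ) : ℂ) / ((Real.cos t : ℝ) : ℂ)))) := by
      refine Tendsto.mul ?_ (tendsto_const_nhds.div hl hc')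
      exact (((((Complex.continuous_ofReal.tendsto 0).comp l0_id).const_mul Complex.I).div_const 2).mul_const _)
    have h3 := (tendsto_const_nhds (x := -(Complex.I * n * π / 4)) (f := l0)).sub h1 |>.sub h2
    simpa using h3
  · intro i
    unfold gb
    exact tendsto_const_nhds.div hl hc'
  · filter_upwards [l0_mem] with ε he
    have := gq_re_le he.1 he.2 t
    rw [Complex.add_re, Complex.mul_re]
    simp only [Complex.I_re, Complex.I_im, Complex.ofReal_im, Complex.ofReal_re, zero_mul, mul_zero, sub_zero, add_zero]
    exact this
  · have e : (-1 : ℂ) / (2 * ((Real.cos t : ℝ) : ℂ) * ((Real.cos t : ℝ) : ℂ)) = ((-(1 / 2) * (Real.cos t ^ 2)⁻¹ : ℝ) : ℂ) := by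
      push_cast
      field_simp
    rw [e, Complex.ofReal_re]
    have h1 : 0 < Real.cos t ^ 2 := by positivity
    have h2 : 1 ≤ (Real.cos t ^ 2)⁻¹ := (one_le_inv₀ h1).2 (Real.cos_sq_le_one t)
    linarith

/-- families of free solutions with explicit limits -/
structure Fam (Ψ : ℝ → ℝ → Rn n → ℂ) (g : Rn n → ℂ) : Prop where
  test : ∀ ε, 0 < ε → ε ≤ 1 → Test ε (Ψ ε)
  isS : IsS g
  lim : ∀ t, Real.cos t ≠ 0 → Tendsto (fun ε => l2 (fun x => Ψ ε t x - lens (th n t) ε t g x)) l0 (𝓝 0)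

theorem Fam.add {Ψ Φ : ℝ → ℝ → Rn n → ℂ} {g h : Rn n → ℂ} (H : Fam Ψ g) (K : Fam Φ h) :
    Fam (fun ε t x => Ψ ε t x + Φ ε t x) (fun x => g x + h x) where
  test ε h1 h2 := (H.test ε h1 h2).add (K.test ε h1 h2)
  isS := H.isS.add K.isS
  lim t hc := by
    have := (H.lim t hc).add (K.lim t hc)
    rw [add_zero] at this
    refine squeeze_zero' (Eventually.of_forall fun ε => l2_nonneg _) ?_ this
    filter_upwards [l0_mem] with ε he
    have := l2_add (φ := fun x => Ψ ε t x - lens (th n t) ε t g x) (ψ := fun x => Φ ε t x - lens (th n t) ε t h x)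
      (((H.test ε he.1 he.2).isS t).sub (lens_isS _ ε hc H.isS)).memLp (((K.test ε he.1 he.2).isS t).sub (lens_isS _ ε hc K.isS)).memLp
    refine le_trans (le_of_eq ?_) this
    congr 1
    ext x
    unfold lens
    rw [L_add]
    ring

theorem Fam.cmul {Ψ : ℝ → ℝ → Rn n → ℂ} {g : Rn n → ℂ} (H : Fam Ψ g) (c : ℂ) :
    Fam (fun ε t x => c * Ψ ε t x) (fun x => c * g x) where
  test ε h1 h2 := (H.test ε h1 h2).cmul c
  isS := H.isS.cmul c
  lim t hc := by
    have := (H.lim t hc).const_mul ‖c‖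
    rw [mul_zero] at this
    refine this.congr fun ε => ?_
    rw [← l2_cmul]
    congr 1
    ext x
    unfold lens
    rw [L_cmul]
    ring

theorem fam_dense (hn : 0 < n) {φ : Rn n → ℂ} (hφ : IsS φ) {η : ℝ} (hη : 0 < η) :
    ∃ Ψ g, Fam Ψ g ∧ l2 (fun x => φ x - g x) < η := by
  have base : ∀ p : Fin n → ℂ, Fam (fun ε => psi ε p) (gau (-1/2) (fun i => Complex.I * p i) 0) := fun p =>
    ⟨fun ε h1 h2 => Test.psi hn h1 h2 p, gau_isS (by norm_num) _ _, fun t hc => psi_lim p hc⟩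
  obtain ⟨g, ⟨Ψ, h⟩, h2⟩ := gauss_dense (fun g : Rn n → ℂ => ∃ Ψ, Fam Ψ g) (-1/2) (by norm_num)
    ⟨_, by simpa using (base 0).cmul 0⟩
    (by rintro _ _ ⟨Ψ, h⟩ ⟨Ψ', h'⟩; exact ⟨_, h.add h'⟩)
    (by rintro c _ ⟨Ψ, h⟩; exact ⟨_, h.cmul c⟩)
    (by rintro _ ⟨Ψ, h⟩; exact h.isS.memLp)
    (fun p => ⟨_, base _⟩) hφ.memLp hη
  exact ⟨Ψ, g, h, h2⟩
end HW
end

noncomputable section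
namespace HW
variable {n : ℕ}

theorem nn_lens {V : Rn n → ℝ} (hV : V.HasTemperateGrowth) {a : ℝ → Rn n → ℂ} (h : PS V a) (S : ℝ) :
    ∃ C, 0 ≤ C ∧ ∀ (s : ℝ) (θ : ℂ) (ε t : ℝ), |s| ≤ S → ‖θ‖ = 1 → 0 < ε → Real.cos t ≠ 0 → |ε * Real.tan t| ≤ 1 →
      nn ε t (lens θ ε t (a s)) ≤ C := by
  choose C0 p0 h0 using fun k => (h.gop0 hV k).l2_bdd hV S
  choose C1 p1 h1 using fun k => (h.gop1 hV k).l2_bdd hV S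
  refine ⟨∑ k, (C0 k + C1 k), Finset.sum_nonneg fun k _ => add_nonneg (p0 k) (p1 k), fun s θ ε t hs hθ he hc ht => ?_⟩
  unfold nn
  refine Finset.sum_le_sum fun k _ => ?_
  have ha := h.isS hV s
  have s0 := gop0_isS k ha
  have s1 := (gop1_isS k ha).cmul ((ε * Real.tan t : ℝ) : ℂ)
  rw [gop_lens k θ he.ne' hc ha, lens_l2 hθ ε hc (s0.add s1)]
  refine (l2_add s0.memLp s1.memLp).trans (add_le_add (h0 k s hs) ?_)
  rw [l2_cmul, Complex.norm_real, Real.norm_eq_abs]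
  have := h1 k s hs
  have l := l2_nonneg (gop1 k (a s))
  nlinarith

theorem etan_le {ε t : ℝ} (he : 0 < ε) (hc : ε ≤ |Real.cos t|) : |ε * Real.tan t| ≤ 1 := by
  have hp : 0 < |Real.cos t| := lt_of_lt_of_le he hc
  rw [Real.tan_eq_sin_div_cos, abs_mul, abs_div, abs_of_pos he, ← mul_div_assoc, div_le_one hp]
  have := Real.abs_sin_le_one t
  nlinarith [abs_nonneg (Real.sin t)]

theorem Lam_abs {γ : ℝ} (h0 : 0 < γ) (h1 : γ < 1) {t : ℝ} (ht : t ∈ Set.Icc 0 π) : |Lam γ t| ≤ Lam γ π := by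
  have hp := Real.pi_pos
  have a := Lam_mono h0 h1 ⟨le_rfl, hp.le⟩ ht ht.1
  rw [Lam_zero] at a
  rw [abs_of_nonneg a]
  exact Lam_mono h0 h1 ht ⟨hp.le, le_rfl⟩ ht.2

theorem w_bd {γ : ℝ} (hn : 2 ≤ n) (h0 : 0 < γ) (h1 : γ < 1) {f : Rn n → ℂ} (hf : IsS f) :
    ∃ M, 0 ≤ M ∧ ∀ (θ : ℂ) (ε t : ℝ), ‖θ‖ = 1 → 0 < ε → t ∈ Set.Icc 0 π → ε ≤ |Real.cos t| →
      nn ε t (wf γ f θ ε t) ≤ M ∧ nn ε t (Rf γ f θ ε t) ≤ M * (ε / Real.cos t ^ 2) := by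
  have hγn : γ < n := by
    have : (2 : ℝ) ≤ n := by exact_mod_cast hn
    linarith
  have hV := har_temp (show 1 ≤ n by linarith) h0.le hγn hf
  obtain ⟨M1, p1, H1⟩ := nn_lens hV (aT_PS hf) (Lam γ π)
  obtain ⟨M2, p2, H2⟩ := nn_lens hV ((aT_PS hf).lap hV) (Lam γ π)
  refine ⟨M1 + M2, by positivity, fun θ ε t hθ he ht hc => ?_⟩
  have hc0 : Real.cos t ≠ 0 := abs_pos.1 (lt_of_lt_of_le he hc)
  have hL := Lam_abs h0 h1 ht
  have et := etan_le he hc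
  constructor
  · have := H1 _ θ ε t hL hθ he hc0 et
    unfold wf
    linarith
  · have h2 := H2 _ θ ε t hL hθ he hc0 et
    have e : Rf γ f θ ε t = fun x => ((ε / (2 * Real.cos t ^ 2) : ℝ) : ℂ) * lens θ ε t (fun y => lap (aT (hartree γ f) f (Lam γ t)) y) x := by
      unfold Rf lens
      exact L_cmul _ _ _ _ _
    rw [e, nn_cmul (lens_isS θ ε hc0 (aT_isS hV hf _).lap), Complex.norm_real, Real.norm_of_nonneg (by positivity)]
    have e2 : ε / (2 * Real.cos t ^ 2) = ε / Real.cos t ^ 2 / 2 := by field_simp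
    rw [e2]
    have q : 0 ≤ ε / Real.cos t ^ 2 := by positivity
    have h3 : 0 ≤ nn ε t (lens θ ε t (fun y => lap (aT (hartree γ f) f (Lam γ t)) y)) := nn_nonneg _ _ _
    nlinarith

theorem wt_le {γ κ t : ℝ} (h0 : 0 < γ) (hκ : 0 < κ) (h : κ ≤ |Real.cos t|) : wt γ t ≤ κ ^ (-γ) :=
  Real.rpow_le_rpow_of_nonpos hκ h (by linarith)

theorem region {γ : ℝ} (hn : 2 ≤ n) (h0 : 0 < γ) (h1 : γ < 1) {f : Rn n → ℂ} (hf : IsS f) :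
    ∃ C, 1 ≤ C ∧ ∀ κ, 0 < κ → ∃ D, 0 ≤ D ∧ ∀ (ε : ℝ) (u ud : ℝ → Rn n → ℂ) (θ : ℂ) (a b : ℝ), Glob γ ε u ud → ‖θ‖ = 1 →
      0 ≤ a → a ≤ b → b ≤ π → (∀ t ∈ Set.Icc a b, κ ≤ |Real.cos t|) → ε ≤ κ →
      C * (nn ε a (fun x => u a x - wf γ f θ ε a x) + D * ε) < 1 →
      ∀ t ∈ Set.Icc a b, nn ε t (fun x => u t x - wf γ f θ ε t x) ≤ C * (nn ε a (fun x => u a x - wf γ f θ ε a x) + D * ε) := by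
  obtain ⟨M, hM, HW⟩ := w_bd hn h0 h1 hf
  obtain ⟨C0, hC0, HT⟩ := T_diff_bd (n := n) hn h0 h1
  set N : ℝ := ((Fintype.card (Option (Bool × Fin n)) : ℕ) : ℝ) with hN
  have hN0 : 0 < N := by rw [hN]; exact_mod_cast Fintype.card_pos
  set k := N * (C0 * (2 * M + 1) ^ 2) with hk
  have hk0 : 0 < k := by positivity
  have hΛ : 0 ≤ Lam γ π := (abs_nonneg _).trans (Lam_abs h0 h1 ⟨Real.pi_pos.le, le_rfl⟩)
  refine ⟨Real.exp (k * Lam γ π), Real.one_le_exp (by positivity), fun κ hκ => ⟨N * (M / κ ^ 2) * π, by positivity, ?_⟩⟩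
  intro ε u ud θ a b G hθ ha hab hb hcos heκ hsm
  have he := G.he
  have hs : Set.Icc a b ⊆ Set.Icc 0 π := Set.Icc_subset_Icc ha hb
  have hS : ∀ t ∈ Set.Icc a b, t ∈ Set.Icc 0 π ∧ Real.cos t ≠ 0 := fun t ht =>
    ⟨hs ht, abs_pos.1 (lt_of_lt_of_le hκ (hcos t ht))⟩
  have wS := w_sol hS hθ he hn h0 h1 hf
  have uS := G.sol.mono (Set.subset_univ (Set.Icc a b))
  have rS := uS.sub wS
  set R : ℝ → ℝ := fun t => nn ε t (fun x => u t x - wf γ f θ ε t x) with hR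
  set F : ℝ → Rn n → ℂ := fun t x => T γ (u t) (u t) (u t) x - (T γ (wf γ f θ ε t) (wf γ f θ ε t) (wf γ f θ ε t) x + Rf γ f θ ε t x) with hF
  have Wb := fun t (ht : t ∈ Set.Icc a b) => HW θ ε t hθ he (hs ht) (heκ.trans (hcos t ht))
  have hγn : γ < n := by
    have : (2 : ℝ) ≤ n := by exact_mod_cast hn
    linarith
  have hV := har_temp (show 1 ≤ n by linarith) h0.le hγn hf
  -- pointwise bound for the forcing
  have nF : ∀ t ∈ Set.Icc a b, nn ε t (F t) ≤ C0 * wt γ t * R t * (nn ε t (u t) + M) ^ 2 + M / κ ^ 2 * ε := by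
    intro t ht
    have uI := uS.isS t ht
    have wI := wS.isS t ht
    have RI : IsS (Rf γ f θ ε t) := lens_isS θ ε (hS t ht).2 ((aT_isS hV hf _).lap.cmul _)
    have e : F t = fun x => (T γ (u t) (u t) (u t) x - T γ (wf γ f θ ε t) (wf γ f θ ε t) (wf γ f θ ε t) x) - Rf γ f θ ε t x := by
      ext x; simp only [hF]; ring
    rw [e]
    have T1 := T_isS (γ := γ) (by linarith) h0.le hγn uI uI uI
    have T2 := T_isS (γ := γ) (by linarith) h0.le hγn wI wI wI
    refine (nn_sub (T1.sub T2) RI ε t).trans (add_le_add ?_ ?_)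
    · refine (HT ε t (hS t ht).2 _ _ uI wI).trans ?_
      have q : 0 ≤ C0 * |Real.cos t| ^ (-γ) * nn ε t (fun x => u t x - wf γ f θ ε t x) :=
        mul_nonneg (by positivity) (nn_nonneg _ _ _)
      refine mul_le_mul_of_nonneg_left ?_ q
      have := (Wb t ht).1
      have u0 := nn_nonneg ε t (u t)
      have w0 := nn_nonneg ε t (wf γ f θ ε t)
      exact pow_le_pow_left₀ (by positivity) (by linarith) 2
    · refine (Wb t ht).2.trans ?_
      have c2 : κ ^ 2 ≤ Real.cos t ^ 2 := by
        rw [← sq_abs (Real.cos t)]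
        exact pow_le_pow_left₀ hκ.le (hcos t ht) 2
      have : ε / Real.cos t ^ 2 ≤ ε / κ ^ 2 := div_le_div_of_nonneg_left he.le (by positivity) c2
      calc M * (ε / Real.cos t ^ 2) ≤ M * (ε / κ ^ 2) := mul_le_mul_of_nonneg_left this hM
        _ = _ := by ring
  have Ru : ∀ t ∈ Set.Icc a b, nn ε t (u t) ≤ R t + M := by
    intro t ht
    have := nn_add (rS.isS t ht) (wS.isS t ht) ε t
    simp only [sub_add_cancel] at this
    linarith [(Wb t ht).1]
  have R0 : ∀ t, 0 ≤ R t := fun t => nn_nonneg _ _ _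
  -- crude bounds
  obtain ⟨Bu, hBu⟩ := G.bdd
  have Bu0 : 0 ≤ Bu := (nn_nonneg _ _ _).trans (hBu 0 ⟨le_rfl, Real.pi_pos.le⟩)
  have RB : ∀ t ∈ Set.Icc a b, R t ≤ Bu + M := fun t ht =>
    (nn_sub (uS.isS t ht) (wS.isS t ht) ε t).trans (add_le_add (hBu t (hs ht)) (Wb t ht).1)
  set L0 := C0 * κ ^ (-γ) * (Bu + M) * (Bu + M) ^ 2 + M / κ ^ 2 * ε with hL0
  have FB : ∀ t ∈ Set.Icc a b, nn ε t (F t) ≤ L0 := by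
    intro t ht
    refine (nF t ht).trans (add_le_add ?_ le_rfl)
    have w1 := wt_le h0 hκ (hcos t ht)
    have w0 := wt_nonneg γ t
    have u0 := nn_nonneg ε t (u t)
    have u1 := hBu t (hs ht)
    have s1 : (nn ε t (u t) + M) ^ 2 ≤ (Bu + M) ^ 2 := pow_le_pow_left₀ (by positivity) (by linarith) 2
    have s2 : C0 * wt γ t * R t ≤ C0 * κ ^ (-γ) * (Bu + M) :=
      mul_le_mul (mul_le_mul_of_nonneg_left w1 hC0.le) (RB t ht) (R0 t) (by positivity)
    exact mul_le_mul s2 s1 (by positivity) (by positivity)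
  have bz : ∀ t ∈ Set.Icc a b, l2 (fun x => u t x - wf γ f θ ε t x) ≤ max (Bu + M) L0 := fun t ht =>
    (l2_le_nn ε t _).trans ((RB t ht).trans (le_max_left _ _))
  have bF : ∀ t ∈ Set.Icc a b, l2 (F t) ≤ max (Bu + M) L0 := fun t ht =>
    (l2_le_nn ε t _).trans ((FB t ht).trans (le_max_right _ _))
  have Rc : ContinuousOn R (Set.Icc a b) := by
    have L0' : 0 ≤ L0 := by positivity
    have key : ∀ c d, c ∈ Set.Icc a b → d ∈ Set.Icc a b → c ≤ d → |R c - R d| ≤ N * L0 * (d - c) := by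
      intro c d hc hd hcd
      have sub : Set.Icc c d ⊆ Set.Icc a b := Set.Icc_subset_Icc hc.1 hd.2
      have := lemN (by linarith) he G.he1 (hs hc).1 hcd (hs hd).2 (rS.mono sub) (fun t ht => bz t (sub ht)) (fun t ht => bF t (sub ht))
        (K := fun _ => L0) (p := 0) (fun t ht _ => FB t (sub ht)) intervalIntegrable_const
      rw [intervalIntegral.integral_const, smul_eq_mul, ← hN] at this
      rw [abs_le]
      constructor
      · have := this.1; simp only [hR]; linarith
      · have := this.2; simp only [hR]; linarith
    have : LipschitzOnWith (Real.toNNReal (N * L0)) R (Set.Icc a b) := by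
      refine LipschitzOnWith.of_dist_le_mul fun c hc d hd => ?_
      rw [Real.dist_eq, Real.dist_eq, Real.coe_toNNReal _ (by positivity)]
      rcases le_total c d with h | h
      · rw [abs_sub_comm c d, abs_of_nonneg (sub_nonneg.2 h)]
        exact key c d hc hd h
      · rw [abs_sub_comm (R c), abs_of_nonneg (sub_nonneg.2 h)]
        exact key d c hd hc h
    exact this.continuousOn
  set A := R a + N * (M / κ ^ 2) * π * ε with hA
  have A0 : 0 ≤ A := by have := R0 a; have := Real.pi_pos; positivity
  set C := Real.exp (k * Lam γ π) with hC
  have C0' : 0 < C := Real.exp_pos _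
  have ma : a ∈ Set.Icc a b := ⟨le_rfl, hab⟩
  have main : ∀ A', A < A' → C * A' ≤ 1 → ∀ t ∈ Set.Icc a b, R t < A' * Real.exp (k * (Lam γ t - Lam γ a)) := by
    intro A' hA1 hA2
    set Z : ℝ → ℝ := fun t => A' * Real.exp (k * (Lam γ t - Lam γ a)) with hZ
    have A0' : 0 ≤ A' := A0.trans hA1.le
    have Zc : ContinuousOn Z (Set.Icc a b) := by
      have := (Lam_cont h0 h1).mono hs
      exact continuousOn_const.mul ((continuousOn_const.mul (this.sub continuousOn_const)).rexp)
    have Zd : ∀ t ∈ Set.Icc a b, HasDerivAt Z (k * wt γ t * Z t) t := by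
      intro t ht
      have := ((((Lam_deriv h0 h1 (hs ht) (hS t ht).2).sub_const (Lam γ a)).const_mul k).exp).const_mul A'
      refine this.congr_deriv ?_
      simp only [hZ]; ring
    have Z1 : ∀ t ∈ Set.Icc a b, Z t ≤ 1 := by
      intro t ht
      refine le_trans ?_ hA2
      rw [mul_comm C]
      refine mul_le_mul_of_nonneg_left (Real.exp_le_exp.2 (mul_le_mul_of_nonneg_left ?_ hk0.le)) A0'
      have q1 := Lam_mono h0 h1 (hs ht) ⟨Real.pi_pos.le, le_rfl⟩ (hs ht).2
      have q2 := Lam_mono h0 h1 ⟨le_rfl, Real.pi_pos.le⟩ (hs ma) ha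
      rw [Lam_zero] at q2
      linarith
    have b := boot (f := fun t => R t - Z t) (a := a) (b := b) (B := 0) (Rc.sub Zc) ?_ ?_
    · intro t ht
      have := b t ht
      linarith
    · have : Z a = A' := by simp [hZ]
      rw [this]
      have : R a ≤ A := by
        have := Real.pi_pos
        have : 0 ≤ N * (M / κ ^ 2) * π * ε := by positivity
        linarith
      linarith
    · intro t ht hle
      have sub : Set.Icc a t ⊆ Set.Icc a b := Set.Icc_subset_Icc le_rfl ht.2
      have Wc : ContinuousOn (fun s => k * wt γ s * Z s) (Set.Icc a t) :=
        (continuousOn_const.mul (fun s hs' => (wt_cont γ (hS s (sub hs')).2).continuousWithinAt)).mul (Zc.mono sub)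
      have Wi := Wc.intervalIntegrable_of_Icc ht.1 (μ := volume)
      have K := lemN (by linarith) he G.he1 ha ht.1 (ht.2.trans hb) (rS.mono sub) (fun s hs' => bz s (sub hs')) (fun s hs' => bF s (sub hs'))
        (K := fun s => N⁻¹ * (k * wt γ s * Z s) + M / κ ^ 2 * ε) (p := 0) (fun s hs' _ => ?_)
        ((Wi.const_mul _).add intervalIntegrable_const)
      · have K := K.1
        rw [intervalIntegral.integral_add (Wi.const_mul _) intervalIntegrable_const, intervalIntegral.integral_const_mul,
          intervalIntegral.integral_eq_sub_of_hasDerivAt (fun s hs' => Zd s (sub (by rwa [Set.uIcc_of_le ht.1] at hs'))) Wi,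
          intervalIntegral.integral_const, smul_eq_mul, ← hN] at K
        have Za : Z a = A' := by simp [hZ]
        have e : N * (N⁻¹ * (Z t - Z a) + (t - a) * (M / κ ^ 2 * ε)) = Z t - A' + N * (M / κ ^ 2) * (t - a) * ε := by
          rw [Za]; field_simp
        rw [e] at K
        have tp : t - a ≤ π := by linarith [ht.2]
        have : N * (M / κ ^ 2) * (t - a) * ε ≤ N * (M / κ ^ 2) * π * ε :=
          mul_le_mul_of_nonneg_right (mul_le_mul_of_nonneg_left tp (by positivity)) he.le
        show R t - Z t < 0
        have K' : R t ≤ R a + (Z t - A' + N * (M / κ ^ 2) * (t - a) * ε) := K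
        linarith
      · refine (nF s (sub hs')).trans (add_le_add ?_ le_rfl)
        have r1 := hle s hs'
        have r2 : R s ≤ Z s := by linarith
        have r3 := Z1 s (sub hs')
        have r4 := Ru s (sub hs')
        have u0 := nn_nonneg ε s (u s)
        have s1 : (nn ε s (u s) + M) ^ 2 ≤ (2 * M + 1) ^ 2 := pow_le_pow_left₀ (by positivity) (by linarith) 2
        have w0 := wt_nonneg γ s
        have s2 : C0 * wt γ s * R s ≤ C0 * wt γ s * Z s := mul_le_mul_of_nonneg_left r2 (by positivity)
        have z0 := (R0 s).trans r2
        refine (mul_le_mul s2 s1 (by positivity) (by positivity)).trans (le_of_eq ?_)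
        rw [hk]
        field_simp
  intro t ht
  show R t ≤ C * A
  by_contra hcon
  push Not at hcon
  have l1 : A < min (R t) 1 / C := by
    rw [lt_div_iff₀ C0', lt_min_iff]
    constructor
    · rw [mul_comm]; exact hcon
    · rw [mul_comm]; exact hsm
  have l2' : C * (min (R t) 1 / C) = min (R t) 1 := by field_simp
  have := main _ l1 (by rw [l2']; exact min_le_right _ _) t ht
  have h3 : min (R t) 1 / C * Real.exp (k * (Lam γ t - Lam γ a)) ≤ min (R t) 1 / C * C := by
    refine mul_le_mul_of_nonneg_left (Real.exp_le_exp.2 (mul_le_mul_of_nonneg_left ?_ hk0.le)) (A0.trans l1.le)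
    have q1 := Lam_mono h0 h1 (hs ht) ⟨Real.pi_pos.le, le_rfl⟩ (hs ht).2
    have q2 := Lam_mono h0 h1 ⟨le_rfl, Real.pi_pos.le⟩ (hs ma) ha
    rw [Lam_zero] at q2
    linarith
  rw [mul_comm _ C, l2'] at h3
  have := min_le_left (R t) 1
  linarith
end HW
end

noncomputable section
namespace HW
variable {n : ℕ}

theorem wf_zero (γ : ℝ) (f : Rn n → ℂ) (ε : ℝ) : wf γ f 1 ε 0 = f := by
  ext x
  simp [wf, lens, L, ch, aT, Es, Lam_zero]

/-- distance between an operator applied to the WKB solution and a lensed profile -/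
theorem gop_w_lens {V : Rn n → ℝ} (hV : V.HasTemperateGrowth) {f : Rn n → ℂ} (hf : IsS f) {g : Rn n → ℂ} (hg : IsS g)
    (k : Option (Bool × Fin n)) {θ : ℂ} (hθ : ‖θ‖ = 1) {ε t : ℝ} (he : 0 < ε) (hc : Real.cos t ≠ 0) (s s0 : ℝ) :
    l2 (fun x => gop k ε t (lens θ ε t (aT V f s)) x - lens θ ε t g x) ≤
      l2 (fun y => gop0 k (aT V f s) y - gop0 k (aT V f s0) y) + l2 (fun y => gop0 k (aT V f s0) y - g y)
        + ε * (|Real.tan t| * l2 (gop1 k (aT V f s))) := by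
  have ha := aT_isS hV hf s
  have ha0 := aT_isS hV hf s0
  have g0 := gop0_isS k ha
  have g00 := gop0_isS k ha0
  have g1 := (gop1_isS k ha).cmul ((ε * Real.tan t : ℝ) : ℂ)
  rw [gop_lens k θ he.ne' hc ha, ← lens_sub, lens_l2 hθ ε hc ((g0.add g1).sub hg)]
  have e : (fun y => gop0 k (aT V f s) y + ((ε * Real.tan t : ℝ) : ℂ) * gop1 k (aT V f s) y - g y)
      = fun y => (gop0 k (aT V f s) y - g y) + ((ε * Real.tan t : ℝ) : ℂ) * gop1 k (aT V f s) y := by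
    ext y; ring
  rw [e]
  refine (l2_add (g0.sub hg).memLp g1.memLp).trans (add_le_add (l2_tri g0.memLp g00.memLp hg.memLp) ?_)
  rw [l2_cmul, Complex.norm_real, Real.norm_eq_abs, abs_mul, abs_of_pos he, mul_assoc]

theorem cos_lb {t : ℝ} (h : t ∈ Set.Icc 0 π) (h' : t ≠ π / 2) : Real.cos t ≠ 0 := by
  have := cos_ge h.1 h.2
  have h2 : 0 < |t - π / 2| := abs_pos.2 (sub_ne_zero.2 h')
  have hp := Real.pi_pos
  have : 0 < |Real.cos t| := lt_of_lt_of_le (by positivity) this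
  exact abs_pos.1 this

theorem cos_lb' {t δ : ℝ} (h : t ∈ Set.Icc 0 π) (h' : δ ≤ |t - π / 2|) : 2 / π * δ ≤ |Real.cos t| := by
  have hp := Real.pi_pos
  exact (mul_le_mul_of_nonneg_left h' (by positivity)).trans (cos_ge h.1 h.2)

/-- crossing: a priori bound and smallness of the Duhamel term -/
theorem cross_bd {γ : ℝ} (hn : 2 ≤ n) (h0 : 0 < γ) (h1 : γ < 1) : ∃ C, 0 < C ∧ ∀ (M ε : ℝ) (u ud : ℝ → Rn n → ℂ) (a b : ℝ),
    Glob γ ε u ud → 1 ≤ M → 0 ≤ a → a ≤ b → b ≤ π → nn ε a (u a) ≤ M → C * M ^ 3 * (Lam γ b - Lam γ a) ≤ 1 / 2 →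
    ∀ (k : Option (Bool × Fin n)) (Ψ : ℝ → Rn n → ℂ), Test ε Ψ →
      l2 (fun x => gop k ε b (u b) x - Ψ b x) ≤ l2 (fun x => gop k ε a (u a) x - Ψ a x) + C * M ^ 3 * (Lam γ b - Lam γ a) := by
  obtain ⟨C, hC, H⟩ := T_bd (n := n) hn h0 h1
  set N : ℝ := ((Fintype.card (Option (Bool × Fin n)) : ℕ) : ℝ) with hN
  have hN0 : 1 ≤ N := by rw [hN]; exact_mod_cast Fintype.card_pos
  refine ⟨N * (C * 8), by positivity, fun M ε u ud a b G hM ha hab hb hMa hsm k Ψ hΨ => ?_⟩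
  have hs : Set.Icc a b ⊆ Set.Icc 0 π := Set.Icc_subset_Icc ha hb
  have ma : a ∈ Set.Icc a b := ⟨le_rfl, hab⟩
  have mb : b ∈ Set.Icc a b := ⟨hab, le_rfl⟩
  obtain ⟨Bu, hBu⟩ := G.bdd
  obtain ⟨C2, hC2, H2⟩ := T_bd_eps G.hn G.h0 G.h1 G.he G.he1
  have uI := fun t => G.sol.isS t trivial
  have bz : ∀ t ∈ Set.Icc a b, l2 (u t) ≤ max Bu (C2 * Bu ^ 3) := fun t ht =>
    ((l2_le_nn ε t _).trans (hBu t (hs ht))).trans (le_max_left _ _)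
  have bF : ∀ t ∈ Set.Icc a b, l2 (T γ (u t) (u t) (u t)) ≤ max Bu (C2 * Bu ^ 3) := by
    intro t ht
    refine ((l2_le_nn ε t _).trans ((H2 t _ _ _ (uI t) (uI t) (uI t)).trans ?_)).trans (le_max_right _ _)
    have := pow_le_pow_left₀ (nn_nonneg ε t (u t)) (hBu t (hs ht)) 3
    have := mul_le_mul_of_nonneg_left this hC2.le
    linarith [this]
  have iw := fun t (ht : t ∈ Set.Icc a b) => (wt_int h0 h1 (hs ma) (hs ht)).const_mul (C * (2 * M) ^ 3)
  have FK : ∀ t ∈ Set.Icc a b, nn ε t (u t) ≤ 2 * M → t ≠ π / 2 → nn ε t (T γ (u t) (u t) (u t)) ≤ C * (2 * M) ^ 3 * wt γ t := by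
    intro t ht hu hp
    have := H ε t true (cos_lb (hs ht) hp) _ _ _ (uI t) (uI t) (uI t)
    refine this.trans ?_
    show C * wt γ t * nn ε t (u t) * nn ε t (u t) * nn ε t (u t) ≤ _
    have q := pow_le_pow_left₀ (nn_nonneg ε t (u t)) hu 3
    have := mul_le_mul_of_nonneg_left q (mul_nonneg hC.le (wt_nonneg γ t))
    linarith [this]
  have int : ∀ t ∈ Set.Icc a b, ∫ s in a..t, C * (2 * M) ^ 3 * wt γ s = C * (2 * M) ^ 3 * (Lam γ t - Lam γ a) := by
    intro t ht
    rw [intervalIntegral.integral_const_mul, Lam_sub h0 h1 (hs ma) (hs ht)]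
  have bt := boot (f := fun t => nn ε t (u t)) (B := 2 * M) (G.nn_cont.mono hs) (by show nn ε a (u a) < 2 * M; linarith) (fun t ht hle => by
    have sub : Set.Icc a t ⊆ Set.Icc a b := Set.Icc_subset_Icc le_rfl ht.2
    have := (lemN (by linarith) G.he G.he1 ha ht.1 (ht.2.trans hb) (G.sol.mono (Set.subset_univ _)) (fun s hs' => bz s (sub hs'))
      (fun s hs' => bF s (sub hs')) (p := π / 2) (fun s hs' hp => FK s (sub hs') (hle s hs') hp) (iw t ht)).1
    rw [int t ht, ← hN] at this
    have m := Lam_mono h0 h1 (hs ht) (hs mb) ht.2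
    have : N * (C * (2 * M) ^ 3 * (Lam γ t - Lam γ a)) ≤ N * (C * 8) * M ^ 3 * (Lam γ b - Lam γ a) := by
      have e : N * (C * (2 * M) ^ 3 * (Lam γ t - Lam γ a)) = N * (C * 8) * M ^ 3 * (Lam γ t - Lam γ a) := by ring
      rw [e]
      exact mul_le_mul_of_nonneg_left (by linarith) (by positivity)
    show nn ε t (u t) < 2 * M
    linarith)
  have := (lemD (by linarith) G.he G.he1 ha hab hb (G.sol.mono (Set.subset_univ _)) bz bF k hΨ (p := π / 2)
    (fun s hs' hp => (l2_gop_le_nn k ε s _).trans (FK s hs' (bt s hs').le hp)) (iw b mb)).1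
  rw [int b mb] at this
  refine this.trans (add_le_add le_rfl ?_)
  have m := Lam_mono h0 h1 (hs ma) (hs mb) hab
  have e : C * (2 * M) ^ 3 * (Lam γ b - Lam γ a) = 1 * (C * 8 * M ^ 3 * (Lam γ b - Lam γ a)) := by ring
  have e2 : N * (C * 8) * M ^ 3 * (Lam γ b - Lam γ a) = N * (C * 8 * M ^ 3 * (Lam γ b - Lam γ a)) := by ring
  rw [e, e2]
  exact mul_le_mul_of_nonneg_right hN0 (mul_nonneg (by positivity) (by linarith))
end HW
end

noncomputable section
namespace HW
variable {n : ℕ}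

theorem gam_lt {γ : ℝ} (hn : 2 ≤ n) (h1 : γ < 1) : γ < n := by
  have : (2 : ℝ) ≤ n := by exact_mod_cast hn
  linarith

theorem wf_isS {γ : ℝ} (hn : 2 ≤ n) (h0 : 0 < γ) (h1 : γ < 1) {f : Rn n → ℂ} (hf : IsS f) (θ : ℂ) (ε : ℝ) {t : ℝ}
    (hc : Real.cos t ≠ 0) : IsS (wf γ f θ ε t) :=
  lens_isS θ ε hc (aT_isS (har_temp (by linarith) h0.le (gam_lt hn h1) hf) hf _)

/-- at a fixed time off the focus the WKB solution is close to the Gaussian family -/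
theorem near_ev {γ : ℝ} (hn : 2 ≤ n) (h0 : 0 < γ) (h1 : γ < 1) {f : Rn n → ℂ} (hf : IsS f)
    (k : Option (Bool × Fin n)) {Ψ : ℝ → ℝ → Rn n → ℂ} {g : Rn n → ℂ} (F : Fam Ψ g) {t s0 η : ℝ} (hη : 0 < η)
    (hc : Real.cos t ≠ 0)
    (hg : l2 (fun y => gop0 k (aT (hartree γ f) f s0) y - g y) < η)
    (ht : l2 (fun y => gop0 k (aT (hartree γ f) f (Lam γ t)) y - gop0 k (aT (hartree γ f) f s0) y) ≤ η) :
    ∀ᶠ ε in l0, l2 (fun x => gop k ε t (wf γ f (th n t) ε t) x - Ψ ε t x) ≤ 4 * η := by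
  have hV := har_temp (show 1 ≤ n by linarith) h0.le (gam_lt hn h1) hf
  have e1 : ∀ᶠ ε in l0, l2 (fun x => Ψ ε t x - lens (th n t) ε t g x) < η := (F.lim t hc).eventually_lt_const hη
  have e2 : ∀ᶠ ε in l0, ε * (|Real.tan t| * l2 (gop1 k (aT (hartree γ f) f (Lam γ t)))) < η := by
    have : Tendsto (fun ε : ℝ => ε * (|Real.tan t| * l2 (gop1 k (aT (hartree γ f) f (Lam γ t))))) l0 (𝓝 (0 * _)) :=
      l0_id.mul_const _
    rw [zero_mul] at this
    exact this.eventually_lt_const hη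
  filter_upwards [e1, e2, l0_mem] with ε k1 k2 k3
  have h3 := gop_w_lens hV hf F.isS k (th_norm n t) k3.1 hc (Lam γ t) s0
  have h4 := l2_tri ((wf_isS hn h0 h1 hf (th n t) ε hc).gop k ε t).memLp (lens_isS (th n t) ε hc F.isS).memLp
    ((F.test ε k3.1 k3.2).isS t).memLp
  rw [l2_comm (lens (th n t) ε t g)] at h4
  change l2 (fun x => gop k ε t (wf γ f (th n t) ε t) x - lens (th n t) ε t g x) ≤ _ at h3
  linarith

theorem crossing {γ : ℝ} (hn : 2 ≤ n) (h0 : 0 < γ) (h1 : γ < 1) {f : Rn n → ℂ} (hf : IsS f)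
    {u ud : ℝ → ℝ → Rn n → ℂ} (G : ∀ ε, 0 < ε → ε ≤ 1 → Glob γ ε (u ε) (ud ε)) (hi : ∀ ε, 0 < ε → ε ≤ 1 → u ε 0 = f)
    {η t1 : ℝ} (hη : 0 < η) (ht1 : π / 2 < t1) :
    ∃ δ, 0 < δ ∧ δ < π / 2 ∧ π / 2 + δ ≤ t1 ∧
      ∀ᶠ ε in l0, nn ε (π / 2 + δ) (fun x => u ε (π / 2 + δ) x - wf γ f (th n (π / 2 + δ)) ε (π / 2 + δ) x) ≤ η := by
  have hp := Real.pi_pos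
  have hV := har_temp (show 1 ≤ n by linarith) h0.le (gam_lt hn h1) hf
  obtain ⟨M, hM, HM⟩ := w_bd hn h0 h1 hf
  obtain ⟨C1, hC1, HR⟩ := region hn h0 h1 hf
  obtain ⟨C2, hC2, HC⟩ := cross_bd (n := n) hn h0 h1
  set N : ℝ := ((Fintype.card (Option (Bool × Fin n)) : ℕ) : ℝ) with hN
  have hN0 : 0 < N := by rw [hN]; exact_mod_cast Fintype.card_pos
  obtain ⟨η1, p1, q1, r1⟩ : ∃ η1 : ℝ, 0 < η1 ∧ η1 ≤ 1 / 2 ∧ N * (10 * η1) ≤ η := by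
    refine ⟨min (1 / 2) (η / (10 * N)), by positivity, min_le_left _ _, ?_⟩
    calc N * (10 * min (1 / 2) (η / (10 * N))) ≤ N * (10 * (η / (10 * N))) := by
          gcongr; exact min_le_right _ _
      _ = η := by field_simp
  set s0 := Lam γ (π / 2) with hs0
  have hF := fun k => fam_dense (by linarith) (gop0_isS k (aT_isS hV hf s0)) p1
  choose Ψ g F Hg using hF
  -- choice of δ
  have cL : ContinuousAt (Lam γ) (π / 2) := (Lam_cont h0 h1).continuousAt (Icc_mem_nhds (by linarith) (by linarith))
  have cp : Tendsto (fun δ : ℝ => Lam γ (π / 2 + δ)) (𝓝[>] 0) (𝓝 s0) := by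
    refine cL.tendsto.comp ?_
    have : Tendsto (fun δ : ℝ => π / 2 + δ) (𝓝 0) (𝓝 (π / 2 + 0)) := tendsto_const_nhds.add tendsto_id
    rw [add_zero] at this
    exact this.mono_left nhdsWithin_le_nhds
  have cm : Tendsto (fun δ : ℝ => Lam γ (π / 2 - δ)) (𝓝[>] 0) (𝓝 s0) := by
    refine cL.tendsto.comp ?_
    have : Tendsto (fun δ : ℝ => π / 2 - δ) (𝓝 0) (𝓝 (π / 2 - 0)) := tendsto_const_nhds.sub tendsto_id
    rw [sub_zero] at this
    exact this.mono_left nhdsWithin_le_nhds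
  have E1 : ∀ᶠ δ in 𝓝[>] (0 : ℝ), ∀ k : Option (Bool × Fin n),
      l2 (fun y => gop0 k (aT (hartree γ f) f (Lam γ (π / 2 + δ))) y - gop0 k (aT (hartree γ f) f s0) y) < η1 :=
    eventually_all.2 fun k => ((((aT_PS hf).gop0 hV k).l2_cont hV s0).comp cp).eventually_lt_const p1
  have E2 : ∀ᶠ δ in 𝓝[>] (0 : ℝ), ∀ k : Option (Bool × Fin n),
      l2 (fun y => gop0 k (aT (hartree γ f) f (Lam γ (π / 2 - δ))) y - gop0 k (aT (hartree γ f) f s0) y) < η1 :=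
    eventually_all.2 fun k => ((((aT_PS hf).gop0 hV k).l2_cont hV s0).comp cm).eventually_lt_const p1
  have E3 : ∀ᶠ δ in 𝓝[>] (0 : ℝ), C2 * (M + 1) ^ 3 * (Lam γ (π / 2 + δ) - Lam γ (π / 2 - δ)) < η1 := by
    have : Tendsto (fun δ : ℝ => C2 * (M + 1) ^ 3 * (Lam γ (π / 2 + δ) - Lam γ (π / 2 - δ))) (𝓝[>] 0)
        (𝓝 (C2 * (M + 1) ^ 3 * (s0 - s0))) := (cp.sub cm).const_mul _
    rw [sub_self, mul_zero] at this
    exact this.eventually_lt_const p1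
  have E4 : ∀ᶠ δ in 𝓝[>] (0 : ℝ), δ ∈ Set.Ioo 0 (min (π / 2) (t1 - π / 2)) :=
    Ioo_mem_nhdsGT (lt_min (by linarith) (by linarith))
  obtain ⟨δ, d1, d2, d3, d4⟩ := (E1.and (E2.and (E3.and E4))).exists
  have d5 : δ < π / 2 := d4.2.trans_le (min_le_left _ _)
  have d6 : δ < t1 - π / 2 := d4.2.trans_le (min_le_right _ _)
  have d0 : 0 < δ := d4.1
  refine ⟨δ, d0, d5, by linarith, ?_⟩
  set tp := π / 2 + δ with htp
  set tm := π / 2 - δ with htm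
  have mp : tp ∈ Set.Icc 0 π := ⟨by linarith, by linarith⟩
  have mm : tm ∈ Set.Icc 0 π := ⟨by linarith, by linarith⟩
  have cpn : Real.cos tp ≠ 0 := cos_lb mp (by rw [htp]; linarith)
  have cmn : Real.cos tm ≠ 0 := cos_lb mm (by rw [htm]; linarith)
  have thm : th n tm = 1 := by
    unfold th; rw [if_pos]; exact Real.cos_pos_of_mem_Ioo ⟨by linarith, by linarith⟩
  set κ := 2 / π * δ with hκ
  have hκ0 : 0 < κ := by positivity
  obtain ⟨D, hD, HRD⟩ := HR κ hκ0
  have F1 : ∀ᶠ ε in l0, ∀ k, l2 (fun x => gop k ε tp (wf γ f (th n tp) ε tp) x - Ψ k ε tp x) ≤ 4 * η1 :=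
    eventually_all.2 fun k => near_ev hn h0 h1 hf k (F k) p1 cpn (Hg k) (d1 k).le
  have F2 : ∀ᶠ ε in l0, ∀ k, l2 (fun x => gop k ε tm (wf γ f (th n tm) ε tm) x - Ψ k ε tm x) ≤ 4 * η1 :=
    eventually_all.2 fun k => near_ev hn h0 h1 hf k (F k) p1 cmn (Hg k) (d2 k).le
  have F3 : ∀ᶠ ε in l0, C1 * (0 + D * ε) < η1 := by
    have : Tendsto (fun ε : ℝ => C1 * (0 + D * ε)) l0 (𝓝 (C1 * (0 + D * 0))) :=
      ((l0_id.const_mul D).const_add 0).const_mul C1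
    simp only [mul_zero, add_zero] at this
    exact this.eventually_lt_const p1
  have F4 : ∀ᶠ ε in l0, ε < κ := l0_id.eventually_lt_const hκ0
  filter_upwards [F1, F2, F3, F4, l0_mem] with ε f1 f2 f3 f4 f5
  have Gε := G ε f5.1 f5.2
  have uS : ∀ t, IsS (u ε t) := fun t => Gε.sol.isS t trivial
  have z0 : nn ε 0 (fun x => u ε 0 x - wf γ f 1 ε 0 x) = 0 := by
    rw [wf_zero, hi ε f5.1 f5.2]
    have : nn ε 0 (fun x => f x - f x) = nn ε 0 (fun x => (0 : ℂ) * f x) := by simp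
    rw [this, nn_cmul hf]; simp
  have R := HRD ε (u ε) (ud ε) 1 0 tm Gε (by simp) le_rfl mm.1 mm.2 (fun t ht => ?_) f4.le (by rw [z0]; linarith) tm ⟨mm.1, le_rfl⟩
  swap
  · refine cos_lb' ⟨ht.1, ht.2.trans mm.2⟩ ?_
    rw [abs_sub_comm]
    exact le_trans (by linarith [ht.2]) (le_abs_self _)
  rw [z0] at R
  rw [thm] at f2
  have wSm := wf_isS hn h0 h1 hf 1 ε cmn
  have wSp := wf_isS hn h0 h1 hf (th n tp) ε cpn
  have um : nn ε tm (u ε tm) ≤ M + 1 := by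
    have a1 := nn_add ((uS tm).sub wSm) wSm ε tm
    have e : (fun x => u ε tm x - wf γ f 1 ε tm x + wf γ f 1 ε tm x) = u ε tm := by ext x; ring
    rw [e] at a1
    have cκ : κ ≤ |Real.cos tm| := cos_lb' mm (by rw [abs_sub_comm]; exact le_trans (by linarith) (le_abs_self _))
    have := (HM 1 ε tm (by simp) f5.1 mm (f4.le.trans cκ)).1
    linarith
  unfold nn
  calc ∑ k, l2 (gop k ε tp (fun x => u ε tp x - wf γ f (th n tp) ε tp x)) ≤ ∑ k : Option (Bool × Fin n), 10 * η1 := by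
        refine Finset.sum_le_sum fun k _ => ?_
        have T := (F k).test ε f5.1 f5.2
        have c1 := HC (M + 1) ε (u ε) (ud ε) tm tp Gε (by linarith) mm.1 (by linarith) mp.2 um (by linarith) k (Ψ k ε) T
        have c2 := l2_gop_le_nn k ε tm (fun x => u ε tm x - wf γ f 1 ε tm x)
        rw [gop_sub (uS tm).diff wSm.diff] at c2
        have c3 := l2_tri ((uS tm).gop k ε tm).memLp (wSm.gop k ε tm).memLp (T.isS tm).memLp
        have c4 := l2_tri ((uS tp).gop k ε tp).memLp (T.isS tp).memLp (wSp.gop k ε tp).memLp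
        rw [l2_comm (Ψ k ε tp)] at c4
        rw [gop_sub (uS tp).diff wSp.diff]
        have c5 := f1 k
        have c6 := f2 k
        linarith
    _ = N * (10 * η1) := by rw [Finset.sum_const, Finset.card_univ, nsmul_eq_mul]
    _ ≤ η := r1

theorem th_after {t : ℝ} (h : π / 2 < t) (h' : t ≤ π) :
    th n t = Complex.exp (-Complex.I * (n : ℂ) * ((π / 2 : ℝ) : ℂ)) := by
  unfold th
  rw [if_neg]
  exact not_lt.2 (Real.cos_nonpos_of_pi_div_two_le_of_le h.le (by linarith [Real.pi_pos]))

theorem final_asym {γ : ℝ} (hn : 2 ≤ n) (h0 : 0 < γ) (h1 : γ < 1) {f : Rn n → ℂ} (hf : IsS f)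
    {u ud : ℝ → ℝ → Rn n → ℂ} (G : ∀ ε, 0 < ε → ε ≤ 1 → Glob γ ε (u ε) (ud ε)) (hi : ∀ ε, 0 < ε → ε ≤ 1 → u ε 0 = f)
    {η t1 : ℝ} (hη : 0 < η) (ht1 : π / 2 < t1) (ht1' : t1 ≤ π) :
    ∀ᶠ ε in l0, ∀ τ ∈ Set.Icc t1 π,
      nn ε τ (fun x => u ε τ x - wf γ f (Complex.exp (-Complex.I * (n : ℂ) * ((π / 2 : ℝ) : ℂ))) ε τ x) ≤ η := by
  have hp := Real.pi_pos
  obtain ⟨C, hC, HR⟩ := region hn h0 h1 hf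
  have hC0 : 0 < C := by linarith
  obtain ⟨η', p, q, r⟩ : ∃ η' : ℝ, 0 < η' ∧ η' ≤ η ∧ η' < 1 :=
    ⟨min η (1 / 2), by positivity, min_le_left _ _, lt_of_le_of_lt (min_le_right _ _) (by norm_num)⟩
  obtain ⟨δ, d0, d1, d2, H⟩ := crossing hn h0 h1 hf G hi (η := η' / (2 * C)) (by positivity) ht1
  rw [th_after (n := n) (show π / 2 < π / 2 + δ by linarith) (by linarith)] at H
  have hκ0 : 0 < 2 / π * δ := by positivity
  obtain ⟨D, hD, HRD⟩ := HR _ hκ0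
  have F3 : ∀ᶠ ε in l0, C * (D * ε) < η' / 2 := by
    have : Tendsto (fun ε : ℝ => C * (D * ε)) l0 (𝓝 (C * (D * 0))) :=
      (l0_id.const_mul D).const_mul C
    simp only [mul_zero] at this
    exact this.eventually_lt_const (by positivity)
  have F4 : ∀ᶠ ε in l0, ε < 2 / π * δ := l0_id.eventually_lt_const hκ0
  filter_upwards [H, F3, F4, l0_mem] with ε k1 k3 k4 k5 τ hτ
  have e : C * (η' / (2 * C)) = η' / 2 := by field_simp
  have k2 := mul_le_mul_of_nonneg_left k1 hC0.le
  have R := HRD ε (u ε) (ud ε) (Complex.exp (-Complex.I * (n : ℂ) * ((π / 2 : ℝ) : ℂ))) (π / 2 + δ) π (G ε k5.1 k5.2) (by rw [Complex.norm_exp]; simp) (by linarith) (by linarith) le_rfl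
    (fun t ht => cos_lb' ⟨by linarith [ht.1], ht.2⟩ (le_trans (by linarith [ht.1]) (le_abs_self _))) k4.le (by rw [mul_add]; linarith)
    τ ⟨d2.trans hτ.1, hτ.2⟩
  rw [mul_add] at R
  linarith

end HW
end

noncomputable section
namespace HW
variable {n : ℕ}

theorem wkb_eq (γ : ℝ) (f : Rn n → ℂ) (ε τ : ℝ) :
    wkbProfileAfter n γ f ε τ = wf γ f (Complex.exp (-Complex.I * (n : ℂ) * ((π / 2 : ℝ) : ℂ))) ε τ := by
  ext x
  unfold wkbProfileAfter wf lens L ch aT Es gphase Lam wt hartree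
  rw [Complex.ofReal_add, mul_add, Complex.exp_add]
  have e : ‖x‖ ^ 2 * Real.tan τ / (2 * ε) = ‖x‖ ^ 2 * (Real.tan τ / (2 * ε)) := by ring
  rw [e]
  ring

theorem eLp_eq {φ : Rn n → ℂ} (h : IsS φ) : eLpNorm φ 2 volume = ENNReal.ofReal (l2 φ) := by
  unfold l2; rw [ENNReal.ofReal_toReal h.memLp.2.ne]

theorem eLp_vec {v : Rn n → EuclideanSpace ℂ (Fin n)} {φ : Rn n → ℂ} (b : Bool) (ε t : ℝ) (hφ : IsS φ)
    (hv : ∀ x j, v x j = gop (some (b, j)) ε t φ x) :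
    eLpNorm v 2 volume ≤ ENNReal.ofReal (nn ε t φ) := by
  have h1 : eLpNorm v 2 volume ≤ eLpNorm (fun x => ∑ j, ‖gop (some (b, j)) ε t φ x‖) 2 volume := by
    refine eLpNorm_mono fun x => ?_
    rw [Real.norm_of_nonneg (Finset.sum_nonneg fun _ _ => norm_nonneg _), EuclideanSpace.norm_eq]
    refine Real.sqrt_le_iff.2 ⟨Finset.sum_nonneg fun _ _ => norm_nonneg _, ?_⟩
    simp only [hv]
    exact Finset.sum_sq_le_sq_sum_of_nonneg fun _ _ => norm_nonneg _
  have h2 : eLpNorm (fun x => ∑ j, ‖gop (some (b, j)) ε t φ x‖) 2 volume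
      ≤ ∑ j, eLpNorm (gop (some (b, j)) ε t φ) 2 volume := by
    have e : (fun x => ∑ j, ‖gop (some (b, j)) ε t φ x‖) = ∑ j, fun x => ‖gop (some (b, j)) ε t φ x‖ := by
      ext x; simp
    rw [e]
    refine (eLpNorm_sum_le (fun j _ => (hφ.gop _ ε t).memLp.1.norm) (by norm_num)).trans (le_of_eq ?_)
    exact Finset.sum_congr rfl fun j _ => eLpNorm_norm _
  refine h1.trans (h2.trans ?_)
  have h3 : ∑ j, eLpNorm (gop (some (b, j)) ε t φ) 2 volume = ENNReal.ofReal (∑ j, l2 (gop (some (b, j)) ε t φ)) := by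
    rw [ENNReal.ofReal_sum_of_nonneg fun _ _ => l2_nonneg _]
    exact Finset.sum_congr rfl fun j _ => eLp_eq (hφ.gop _ ε t)
  rw [h3]
  refine ENNReal.ofReal_le_ofReal ?_
  unfold nn
  rw [Fintype.sum_option, Fintype.sum_prod_type]
  simp only [Fintype.sum_bool]
  have p0 := l2_nonneg (gop none ε t φ)
  have p1 : ∀ b, 0 ≤ ∑ j, l2 (gop (some (b, j)) ε t φ) := fun b => Finset.sum_nonneg fun _ _ => l2_nonneg _
  have := p1 true
  have := p1 false
  cases b <;> linarith

theorem eLp_J {φ : Rn n → ℂ} (ε t : ℝ) (hφ : IsS φ) : eLpNorm (JopE ε t φ) 2 volume ≤ ENNReal.ofReal (nn ε t φ) := by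
  refine eLp_vec true ε t hφ fun x j => ?_
  show Jop ε t φ x j = _
  unfold Jop gop Aop gA gB grad pd
  simp [-Complex.ofReal_sin, -Complex.ofReal_cos]
  ring

theorem eLp_H {φ : Rn n → ℂ} (ε t : ℝ) (hφ : IsS φ) : eLpNorm (HopE ε t φ) 2 volume ≤ ENNReal.ofReal (nn ε t φ) := by
  refine eLp_vec false ε t hφ fun x j => ?_
  show Hop ε t φ x j = _
  unfold Hop gop Aop gA gB grad pd
  simp [-Complex.ofReal_sin, -Complex.ofReal_cos]
  ring

theorem tendsto_sup {t1 : ℝ} {E : ℝ → ℝ → ℝ≥0∞} {r : ℝ → ℝ → ℝ}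
    (hE : ∀ᶠ ε in l0, ∀ τ ∈ Set.Icc t1 π, E ε τ ≤ ENNReal.ofReal (r ε τ))
    (hr : ∀ η : ℝ, 0 < η → ∀ᶠ ε in l0, ∀ τ ∈ Set.Icc t1 π, r ε τ ≤ η) :
    Tendsto (fun ε => ⨆ τ ∈ Set.Icc t1 π, E ε τ) l0 (𝓝 0) := by
  rw [ENNReal.tendsto_nhds_zero]
  intro e he
  obtain ⟨η, h1, h2⟩ : ∃ η : ℝ, 0 < η ∧ ENNReal.ofReal η ≤ e := by
    by_cases h : e = ⊤
    · exact ⟨1, one_pos, by rw [h]; exact le_top⟩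
    · exact ⟨e.toReal, ENNReal.toReal_pos he.ne' h, by rw [ENNReal.ofReal_toReal h]⟩
  filter_upwards [hE, hr η h1] with ε k1 k2
  exact iSup₂_le fun τ hτ => ((k1 τ hτ).trans (ENNReal.ofReal_le_ofReal (k2 τ hτ))).trans h2

theorem main9 (hn : 2 ≤ n) (γ : ℝ) (hγ0 : 0 < γ) (hγ1 : γ < 1)
    (f : SchwartzMap (Rn n) ℂ) (u : ℝ → ℝ → Rn n → ℂ)
    (hu : ∀ ε ∈ Set.Ioc (0 : ℝ) 1, IsSolutionH n 1 γ ε (⇑f) (u ε))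
    (t : ℝ) (ht0 : π / 2 < t) (ht : t ≤ π) :
    Tendsto (fun ε : ℝ => ⨆ τ ∈ Set.Icc t π,
        eLpNorm (fun x => u ε τ x - wkbProfileAfter n γ (⇑f) ε τ x) 2 volume)
      (𝓝[Set.Ioc (0 : ℝ) 1] 0) (𝓝 0)
    ∧ Tendsto (fun ε : ℝ => ⨆ τ ∈ Set.Icc t π,
        eLpNorm (JopE ε τ (fun x => u ε τ x - wkbProfileAfter n γ (⇑f) ε τ x)) 2 volume)
      (𝓝[Set.Ioc (0 : ℝ) 1] 0) (𝓝 0)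
    ∧ Tendsto (fun ε : ℝ => ⨆ τ ∈ Set.Icc t π,
        eLpNorm (HopE ε τ (fun x => u ε τ x - wkbProfileAfter n γ (⇑f) ε τ x)) 2 volume)
      (𝓝[Set.Ioc (0 : ℝ) 1] 0) (𝓝 0) := by
  have hf : IsS (⇑f) := ⟨f, rfl⟩
  have G : ∀ ε, 0 < ε → ε ≤ 1 → Glob γ ε (u ε) _ := fun ε h1 h2 => glob_of hn hγ0 hγ1 h1 h2 (hu ε ⟨h1, h2⟩)
  have hi : ∀ ε, 0 < ε → ε ≤ 1 → u ε 0 = f := fun ε h1 h2 => (hu ε ⟨h1, h2⟩).init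
  have key := fun (η : ℝ) (hη : 0 < η) => final_asym hn hγ0 hγ1 hf G hi hη ht0 ht
  simp only [← wkb_eq] at key
  have hS : ∀ ε, 0 < ε → ε ≤ 1 → ∀ τ ∈ Set.Icc t π, IsS (fun x => u ε τ x - wkbProfileAfter n γ (⇑f) ε τ x) := by
    intro ε h1 h2 τ hτ
    rw [wkb_eq]
    exact ((G ε h1 h2).sol.isS τ trivial).sub
      (wf_isS hn hγ0 hγ1 hf _ ε (cos_lb ⟨by linarith [hτ.1, Real.pi_pos], hτ.2⟩ (by linarith [hτ.1])))
  refine ⟨tendsto_sup ?_ key, tendsto_sup ?_ key, tendsto_sup ?_ key⟩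
  · filter_upwards [l0_mem] with ε h τ hτ
    rw [eLp_eq (hS ε h.1 h.2 τ hτ)]
    exact ENNReal.ofReal_le_ofReal (l2_le_nn ε τ _)
  · filter_upwards [l0_mem] with ε h τ hτ
    exact eLp_J ε τ (hS ε h.1 h.2 τ hτ)
  · filter_upwards [l0_mem] with ε h τ hτ
    exact eLp_H ε τ (hS ε h.1 h.2 τ hτ)

end HW
end

/-- nonlinear WKB asymptotics after the focus, in the case α = 1, 0 < γ < 1:
for π/2 < t ≤ π, sup_{t≤τ≤π} ‖A^ε(τ)(u^ε(τ) − wkbProfileAfter)‖_{L²} → 0 as ε → 0, where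
A^ε is any of Id, J^ε, H^ε. -/
theorem stmt9 (n : ℕ) (hn : 2 ≤ n) (γ : ℝ) (hγ0 : 0 < γ) (hγ1 : γ < 1)
    (f : SchwartzMap (Rn n) ℂ) (u : ℝ → ℝ → Rn n → ℂ)
    (hu : ∀ ε ∈ Set.Ioc (0 : ℝ) 1, IsSolutionH n 1 γ ε (⇑f) (u ε))
    (t : ℝ) (ht0 : π / 2 < t) (ht : t ≤ π) :
    Tendsto (fun ε : ℝ => ⨆ τ ∈ Set.Icc t π,
        eLpNorm (fun x => u ε τ x - wkbProfileAfter n γ (⇑f) ε τ x) 2 volume)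
      (𝓝[Set.Ioc (0 : ℝ) 1] 0) (𝓝 0)
    ∧ Tendsto (fun ε : ℝ => ⨆ τ ∈ Set.Icc t π,
        eLpNorm (JopE ε τ (fun x => u ε τ x - wkbProfileAfter n γ (⇑f) ε τ x)) 2 volume)
      (𝓝[Set.Ioc (0 : ℝ) 1] 0) (𝓝 0)
    ∧ Tendsto (fun ε : ℝ => ⨆ τ ∈ Set.Icc t π,
        eLpNorm (HopE ε τ (fun x => u ε τ x - wkbProfileAfter n γ (⇑f) ε τ x)) 2 volume)
      (𝓝[Set.Ioc (0 : ℝ) 1] 0) (𝓝 0) := by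
  exact HW.main9 hn γ hγ0 hγ1 f u hu t ht0 ht

end
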